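/- Assume S ⊆ {full, almost-full, bowtie}. Let G be a connected graph, O ⊆ V(G) with |O| ≤ 1, s a cutvertex of G, (X1,X2) a separation induced by s, G1 := G[X1] and G2 := G[X2]. Then G is O-geometric-S-restricted if and only if at least one of the following holds: (i) O ⊆ X1, G1 is O-geometric-S-restricted, and G2 is {s}-geometric-S-restricted; or (ii) O ⊆ X2, G1 is {s}-geometric-S-restricted, and G2 is O-geometric-S-restricted. -/

import Mathlib

open scoped unitInterval

namespace OnePlanarity

/-- The six crossing types of a crossing in a 1-planar drawing. -/
inductive CrossingType : Type
  | full | almostFull | bowtie | arrow | chair | timesCross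
  deriving DecidableEq

/-- The three crossing types in which the four endpoints of the crossing edges
lie on a common 4-cycle using the two crossing edges. -/
def goodTypes : Set CrossingType :=
  {CrossingType.full, CrossingType.almostFull, CrossingType.bowtie}

/-- The three "bad" crossing types. -/
def badTypes : Set CrossingType :=
  {CrossingType.arrow, CrossingType.chair, CrossingType.timesCross}

variable {V : Type*} {W : Type*}

/-- `HasCrossingType G a b c d t` says that, assuming the edges `ab` and `cd` of `G`
cross, the subgraph of `G` induced by `{a,b,c,d}` witnesses the crossing type `t`. -/
def HasCrossingType (G : SimpleGraph V) (a b c d : V) : CrossingType → Prop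
  | .full => G.Adj a c ∧ G.Adj a d ∧ G.Adj b c ∧ G.Adj b d
  | .almostFull =>
      (¬G.Adj a c ∧ G.Adj a d ∧ G.Adj b c ∧ G.Adj b d) ∨
      (G.Adj a c ∧ ¬G.Adj a d ∧ G.Adj b c ∧ G.Adj b d) ∨
      (G.Adj a c ∧ G.Adj a d ∧ ¬G.Adj b c ∧ G.Adj b d) ∨
      (G.Adj a c ∧ G.Adj a d ∧ G.Adj b c ∧ ¬G.Adj b d)
  | .bowtie =>
      (G.Adj a c ∧ G.Adj b d ∧ ¬G.Adj a d ∧ ¬G.Adj b c) ∨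
      (G.Adj a d ∧ G.Adj b c ∧ ¬G.Adj a c ∧ ¬G.Adj b d)
  | .arrow =>
      (G.Adj a c ∧ G.Adj a d ∧ ¬G.Adj b c ∧ ¬G.Adj b d) ∨
      (G.Adj b c ∧ G.Adj b d ∧ ¬G.Adj a c ∧ ¬G.Adj a d) ∨
      (G.Adj a c ∧ G.Adj b c ∧ ¬G.Adj a d ∧ ¬G.Adj b d) ∨
      (G.Adj a d ∧ G.Adj b d ∧ ¬G.Adj a c ∧ ¬G.Adj b c)
  | .chair =>
      (G.Adj a c ∧ ¬G.Adj a d ∧ ¬G.Adj b c ∧ ¬G.Adj b d) ∨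
      (¬G.Adj a c ∧ G.Adj a d ∧ ¬G.Adj b c ∧ ¬G.Adj b d) ∨
      (¬G.Adj a c ∧ ¬G.Adj a d ∧ G.Adj b c ∧ ¬G.Adj b d) ∨
      (¬G.Adj a c ∧ ¬G.Adj a d ∧ ¬G.Adj b c ∧ G.Adj b d)
  | .timesCross => ¬G.Adj a c ∧ ¬G.Adj a d ∧ ¬G.Adj b c ∧ ¬G.Adj b d

/-- `IsArc A x y` says that `A` is the image of a simple curve from `x` to `y`. -/
def IsArc (A : Set (ℝ × ℝ)) (x y : ℝ × ℝ) : Prop :=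
  ∃ f : I → ℝ × ℝ, Continuous f ∧ Function.Injective f ∧
    f 0 = x ∧ f 1 = y ∧ Set.range f = A

/-- A drawing of a graph `G` in the plane: vertices are mapped to distinct points,
every edge is mapped to a simple curve between the images of its endpoints avoiding the
images of all other vertices, and two edges intersect in finitely many points. -/
structure Drawing (G : SimpleGraph V) where
  pos : V → ℝ × ℝ
  pos_inj : Function.Injective pos
  arc : Sym2 V → Set (ℝ × ℝ)
  arc_curve : ∀ e ∈ G.edgeSet, ∀ u v : V, e = s(u, v) → IsArc (arc e) (pos u) (pos v)
  arc_avoid : ∀ e ∈ G.edgeSet, ∀ w : V, pos w ∈ arc e → w ∈ e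
  arc_finite_inter : ∀ e ∈ G.edgeSet, ∀ e' ∈ G.edgeSet, e ≠ e' →
    (arc e ∩ arc e').Finite

variable {G : SimpleGraph V}

/-- `D.Crosses e e' p` : the distinct edges `e` and `e'` of `G` cross at the point `p`
(an intersection point of their curves which is not the image of a vertex). -/
def Drawing.Crosses (D : Drawing G) (e e' : Sym2 V) (p : ℝ × ℝ) : Prop :=
  e ∈ G.edgeSet ∧ e' ∈ G.edgeSet ∧ e ≠ e' ∧
    p ∈ D.arc e ∧ p ∈ D.arc e' ∧ p ∉ Set.range D.pos

/-- A drawing is 1-planar if every edge is involved in at most one crossing and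
adjacent edges do not cross. -/
def Drawing.IsOnePlanar (D : Drawing G) : Prop :=
  (∀ e e₁ e₂ p q, D.Crosses e e₁ p → D.Crosses e e₂ q → e₁ = e₂ ∧ p = q) ∧
  (∀ e e' p, D.Crosses e e' p → ∀ v : V, v ∈ e → v ∉ e')

/-- A drawing is `S`-restricted if it is 1-planar and every crossing has a type in `S`. -/
def Drawing.IsSRestricted (D : Drawing G) (S : Set CrossingType) : Prop :=
  D.IsOnePlanar ∧
  ∀ a b c d : V, ∀ p : ℝ × ℝ, D.Crosses s(a, b) s(c, d) p →
    ∃ t ∈ S, HasCrossingType G a b c d t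

/-- A graph is 1-planar if it admits a 1-planar drawing. -/
def IsOnePlanarGraph (G : SimpleGraph V) : Prop :=
  ∃ D : Drawing G, D.IsOnePlanar

/-- A graph is `S`-restricted if it admits an `S`-restricted drawing. -/
def SRestricted (G : SimpleGraph V) (S : Set CrossingType) : Prop :=
  ∃ D : Drawing G, D.IsSRestricted S

/-- A planar graph: one admitting a crossing-free drawing. -/
def IsPlanarGraph (G : SimpleGraph V) : Prop :=
  ∃ D : Drawing G, ∀ e e' p, ¬ D.Crosses e e' p

/-- A drawing is geometric if every edge is drawn as a straight-line segment. -/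
def Drawing.IsGeometric (D : Drawing G) : Prop :=
  ∀ u v : V, G.Adj u v → D.arc s(u, v) = segment ℝ (D.pos u) (D.pos v)

/-- The point set of a drawing. -/
def Drawing.image (D : Drawing G) : Set (ℝ × ℝ) :=
  Set.range D.pos ∪ ⋃ e ∈ G.edgeSet, D.arc e

/-- The set of points of the outer (unbounded) face of a point set `A`. -/
def outerRegion (A : Set (ℝ × ℝ)) : Set (ℝ × ℝ) :=
  {x | x ∉ A ∧ ¬ Bornology.IsBounded (connectedComponentIn Aᶜ x)}

/-- `Inside γ x` : the point `x` is separated from the outer face by the closed curve `γ`. -/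
def Inside (γ : Set (ℝ × ℝ)) (x : ℝ × ℝ) : Prop :=
  x ∉ γ ∧ Bornology.IsBounded (connectedComponentIn γᶜ x)

/-- A vertex lies on (the boundary of) the outer face of a drawing. -/
def Drawing.OnOuterFace (D : Drawing G) (v : V) : Prop :=
  D.pos v ∈ closure (outerRegion D.image)

/-- Two vertices are cofacial: they lie on the boundary of a common face. -/
def Drawing.Cofacial (D : Drawing G) (u v : V) : Prop :=
  ∃ p : ℝ × ℝ, p ∉ D.image ∧
    D.pos u ∈ closure (connectedComponentIn D.imageᶜ p) ∧
    D.pos v ∈ closure (connectedComponentIn D.imageᶜ p)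

/-- A graph admits a geometric `S`-restricted drawing. -/
def GeoSRestricted (G : SimpleGraph V) (S : Set CrossingType) : Prop :=
  ∃ D : Drawing G, D.IsGeometric ∧ D.IsSRestricted S

/-- `OGeoSRestricted G S O` : the graph `G` admits a geometric `S`-restricted drawing
in which the vertex of `O` (if any) lies on the outer face. -/
def OGeoSRestricted (G : SimpleGraph V) (S : Set CrossingType) (O : Set V) : Prop :=
  ∃ D : Drawing G, D.IsGeometric ∧ D.IsSRestricted S ∧ ∀ v ∈ O, D.OnOuterFace v

/-- `k`-connectivity. -/
def KConnected (k : ℕ) (G : SimpleGraph V) : Prop :=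
  k < Nat.card V ∧ ∀ T : Set V, T.ncard < k → (G.induce Tᶜ).Connected

/-- A vertex has degree exactly two. -/
def DegTwo (G : SimpleGraph V) (w : V) : Prop :=
  ∃ a b : V, a ≠ b ∧ G.neighborSet w = {a, b}

/-- The simple graph obtained from `G` by suppressing the degree-2 vertices in `W`. -/
def suppress (G : SimpleGraph V) (Ws : Set V) : SimpleGraph {v : V // v ∉ Ws} :=
  SimpleGraph.fromRel (fun a b =>
    G.Adj a.1 b.1 ∨ ∃ w ∈ Ws, G.Adj w a.1 ∧ G.Adj w b.1)

/-- A graph is internally 3-connected if it is obtained from a 3-connected (multi)graph by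
subdividing a subset of its edges once each. -/
def InternallyThreeConnected (G : SimpleGraph V) : Prop :=
  ∃ Ws : Set V, (∀ w ∈ Ws, DegTwo G w) ∧ (∀ w ∈ Ws, ∀ u ∈ Ws, ¬ G.Adj w u) ∧
    KConnected 3 (suppress G Ws)

/-- `IsSeparation G T X₁ X₂` : `(X₁, X₂)` is a separation of `G` induced by the separator `T`. -/
def IsSeparation (G : SimpleGraph V) (T X₁ X₂ : Set V) : Prop :=
  X₁ ∪ X₂ = Set.univ ∧ X₁ ∩ X₂ = T ∧ (X₁ \ T).Nonempty ∧ (X₂ \ T).Nonempty ∧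
  ∀ u ∈ X₁ \ T, ∀ v ∈ X₂ \ T, ∀ p : G.Walk u v, ∃ w ∈ T, w ∈ p.support

end OnePlanarity
namespace OnePlanarity

variable {V : Type*}

/-- A block (2-connected component) of `G`: a maximal vertex set inducing a connected
subgraph without a cutvertex. -/
def IsBlock (G : SimpleGraph V) (B : Set V) : Prop :=
  B.Nonempty ∧ (G.induce B).Preconnected ∧
    (∀ v : V, (G.induce (B \ {v})).Preconnected) ∧
    ∀ B' : Set V, B ⊆ B' → B'.Nonempty → (G.induce B').Preconnected →
      (∀ v : V, (G.induce (B' \ {v})).Preconnected) → B = B'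

/-- The graph `G[X] + {s t, t s'}` obtained from the induced subgraph `G[X]` by adding a
new vertex `t` (the `Sum.inr` vertex) adjacent exactly to `s` and `s'`. -/
def augment (G : SimpleGraph V) (X : Set V) (s s' : V) : SimpleGraph (↥X ⊕ Unit) :=
  SimpleGraph.fromRel (fun a b =>
    (∃ u v : X, a = Sum.inl u ∧ b = Sum.inl v ∧ G.Adj u.1 v.1) ∨
    (∃ u : X, a = Sum.inl u ∧ ((u : V) = s ∨ (u : V) = s') ∧ b = Sum.inr ()))

/-- The copy of a set `O ⊆ V` inside the vertex set of `augment G X s s'`. -/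
def liftO (X O : Set V) : Set (↥X ⊕ Unit) :=
  {x | ∃ u : X, x = Sum.inl u ∧ (u : V) ∈ O}

end OnePlanarity
namespace OnePlanarity

section Steps
variable {N : Type*}

/-- Sweeps of a planar cell complex: `Steps l r F T` says that the path `l` can be moved across
the cells in `F`, one at a time, to become the path `r`, and that `T` collects the vertices of
all paths met. A cell is recorded as the cyclic list of its vertices, up its left side and down
its right side. -/
inductive Steps : List N → List N → Multiset (Cycle N) → Multiset N → Prop
  | refl (l : List N) : Steps l l 0 l
  | cons (x : List N) (a : N) (A B : List N) (b : N) (y r : List N) (F : Multiset (Cycle N))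
      (T : Multiset N) : Steps (x ++ a :: (B ++ b :: y)) r F T →
      Steps (x ++ a :: (A ++ b :: y)) r (((a :: (A ++ b :: B.reverse) : List N) : Cycle N) ::ₘ F)
        (A + T)

theorem Cycle.coe_append_comm (l₁ l₂ : List N) :
    ((l₁ ++ l₂ : List N) : Cycle N) = ((l₂ ++ l₁ : List N) : Cycle N) :=
  Cycle.coe_eq_coe.2 (List.isRotated_append)

namespace Steps

theorem single (x : List N) (a : N) (A B : List N) (b : N) (y : List N) :
    Steps (x ++ a :: (A ++ b :: y)) (x ++ a :: (B ++ b :: y))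
      {((a :: (A ++ b :: B.reverse) : List N) : Cycle N)}
      (A + (x ++ a :: (B ++ b :: y) : List N)) :=
  Steps.cons x a A B b y _ 0 _ (Steps.refl _)

theorem left_le {l r : List N} {F T} (h : Steps l r F T) : (l : Multiset N) ≤ T := by
  induction h with
  | refl l => exact le_rfl
  | cons x a A B b y r F T h ih =>
    have h1 : ((x ++ a :: (A ++ b :: y) : List N) : Multiset N) =
        A + (x ++ a :: b :: y : List N) := by
      simp only [← Multiset.coe_add, ← Multiset.cons_coe, Multiset.add_cons]
      rw [add_left_comm]
    rw [h1]
    gcongr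
    refine le_trans ?_ ih
    grind [Multiset.coe_le, List.Sublist.subperm]

theorem right_le {l r : List N} {F T} (h : Steps l r F T) : (r : Multiset N) ≤ T := by
  induction h with
  | refl l => exact le_rfl
  | cons x a A B b y r F T h ih => exact ih.trans (Multiset.le_add_left _ _)

theorem trans {l m r : List N} {F₁ F₂ T₁ T₂ T} (h₁ : Steps l m F₁ T₁) (h₂ : Steps m r F₂ T₂)
    (hT : T + (m : Multiset N) = T₁ + T₂) : Steps l r (F₁ + F₂) T := by
  induction h₁ generalizing T with
  | refl l => grind [add_comm, add_right_inj]
  | cons x a A B b y r' F T' h ih =>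
    have hle : (r' : Multiset N) ≤ T' + T₂ := h.right_le.trans (Multiset.le_add_right _ _)
    obtain ⟨T'', hT''⟩ := Multiset.le_iff_exists_add.1 hle
    have e : T = A + T'' := by
      have : T + (r' : Multiset N) = (A + T'') + r' := by grind
      exact add_right_cancel this
    rw [Multiset.cons_add, e]
    grind [Steps.cons]

theorem exists_trans {l m r : List N} {F₁ F₂ T₁ T₂} (h₁ : Steps l m F₁ T₁)
    (h₂ : Steps m r F₂ T₂) : ∃ T, T + (m : Multiset N) = T₁ + T₂ ∧ Steps l r (F₁ + F₂) T := by
  obtain ⟨T, hT⟩ := Multiset.le_iff_exists_add.1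
    (h₁.right_le.trans (Multiset.le_add_right _ T₂))
  exact ⟨T, by rw [hT, add_comm], h₁.trans h₂ (by rw [hT, add_comm])⟩

theorem congr_append {l r : List N} {F T} (h : Steps l r F T) (p q : List N) :
    Steps (p ++ (l ++ q)) (p ++ (r ++ q)) F (p + (T + q)) := by
  induction h with
  | refl l => simpa using Steps.refl (p ++ (l ++ q))
  | cons x a A B b y r F T h ih =>
    have h' := Steps.cons (p ++ x) a A B b (y ++ q) _ F _ (by simpa using ih)
    convert h' using 1
    · simp
    · grind

theorem rot180 {l r : List N} {F T} (h : Steps l r F T) : Steps r.reverse l.reverse F T := by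
  induction h with
  | refl l => simpa using Steps.refl l.reverse
  | cons x a A B b y r F T h ih =>
    have h1 := single y.reverse b B.reverse A.reverse a x.reverse
    have h2 : Steps (x ++ a :: (B ++ b :: y)).reverse (x ++ a :: (A ++ b :: y)).reverse
      {((a :: (A ++ b :: B.reverse) : List N) : Cycle N)}
      (B + (x ++ a :: (A ++ b :: y) : List N)) := by
      convert h1 using 1
      · simp
      · simp
      · congr 1
        have := Cycle.coe_append_comm (a :: A) (b :: B.reverse)
        simpa using this
      · rw [← Multiset.coe_reverse (x ++ _), ← Multiset.coe_reverse B]; simp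
    rw [← Multiset.singleton_add, add_comm]
    refine ih.trans h2 ?_
    rw [Multiset.coe_reverse]
    simp only [← Multiset.coe_add, ← Multiset.cons_coe, Multiset.add_cons]
    abel_nf

theorem mirror {l r : List N} {F T} (h : Steps l r F T) :
    Steps r l (F.map Cycle.reverse) T := by
  induction h with
  | refl l => simpa using Steps.refl l
  | cons x a A B b y r F T h ih =>
    have h1 := single x a B A b y
    rw [Multiset.map_cons, ← Multiset.singleton_add, add_comm]
    have e : (((a :: (A ++ b :: B.reverse) : List N) : Cycle N)).reverse =
        ((a :: (B ++ b :: A.reverse) : List N) : Cycle N) := by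
      rw [Cycle.reverse_coe]
      have := Cycle.coe_append_comm (B ++ b :: A.reverse) [a]
      simpa using this
    rw [e]
    refine ih.trans h1 ?_
    simp only [← Multiset.coe_add, ← Multiset.cons_coe, Multiset.add_cons]
    abel_nf

theorem mem_of_mem_left {l r : List N} {F T} (h : Steps l r F T) {c : N} (hc : c ∈ l) : c ∈ T :=
  Multiset.mem_of_le h.left_le (by simpa using hc)

theorem mem_of_mem_right {l r : List N} {F T} (h : Steps l r F T) {c : N} (hc : c ∈ r) : c ∈ T :=
  Multiset.mem_of_le h.right_le (by simpa using hc)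

theorem nodup_left {l r : List N} {F T} (h : Steps l r F T) (hT : T.Nodup) : l.Nodup := by
  simpa using Multiset.nodup_of_le h.left_le hT

theorem nodup_right {l r : List N} {F T} (h : Steps l r F T) (hT : T.Nodup) : r.Nodup := by
  simpa using Multiset.nodup_of_le h.right_le hT

theorem eq_of_faces_zero {l r : List N} {F T} (h : Steps l r F T) (hF : F = 0) :
    l = r ∧ T = l := by
  cases h with
  | refl => simp
  | cons => simp at hF

end Steps

theorem List.eq_of_append_cons {L L' U U' : List N} {c : N} (h : L ++ c :: U = L' ++ c :: U')
    (hn : (L ++ c :: U).Nodup) : L = L' ∧ U = U' := by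
  rcases List.append_eq_append_iff.1 h with ⟨m, h1, h2⟩ | ⟨m, h1, h2⟩ <;>
  · cases m with
    | nil => simp_all
    | cons d m => grind

theorem Steps.split {L U r : List N} {c : N} {F T} (h : Steps (L ++ c :: U) r F T)
    (hT : T.Nodup) (hc : c ∈ r) : ∃ L' U' F₁ F₂ T₁ T₂, r = L' ++ c :: U' ∧ F = F₁ + F₂ ∧
      T + {c} = T₁ + T₂ ∧ Steps (L ++ [c]) (L' ++ [c]) F₁ T₁ ∧ Steps (c :: U) (c :: U') F₂ T₂ := by
  generalize hl : L ++ c :: U = l at h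
  induction h generalizing L U with
  | refl l =>
    refine ⟨L, U, 0, 0, _, _, hl.symm, rfl, ?_, Steps.refl _, Steps.refl _⟩
    rw [← hl]
    simp only [← Multiset.coe_add, ← Multiset.cons_coe, ← Multiset.singleton_add]
    simp only [Multiset.coe_nil, add_zero]
    abel_nf
  | cons x a A B b y r F T h ih =>
    have hcA : c ∉ A := fun hA => by
      have := (Multiset.nodup_add.1 hT).2.2
      exact Multiset.disjoint_left.1 this (by simpa using hA) (h.mem_of_mem_right hc)
    have hT' := (Multiset.nodup_add.1 hT).2.1
    have key : (∃ m, x ++ [a] = L ++ c :: m ∧ U = m ++ (A ++ b :: y)) ∨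
        (∃ m, b :: y = m ++ c :: U ∧ L = x ++ a :: (A ++ m)) := by
      have e : (x ++ [a]) ++ (A ++ b :: y) = L ++ c :: U := by rw [hl]; simp
      rcases List.append_eq_append_iff.1 e with ⟨m, h1, h2⟩ | ⟨m, h1, h2⟩
      · right
        rcases List.append_eq_append_iff.1 h2 with ⟨m', h3, h4⟩ | ⟨m', h3, h4⟩
        · grind
        · cases m' with
          | nil => exact ⟨[], by simpa using h4.symm, by simp_all⟩
          | cons d m' => grind
      · cases m with
        | nil =>
          right
          cases A with
          | nil => exact ⟨[], by simpa using h2.symm, by simpa using h1.symm⟩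
          | cons d A => simp_all
        | cons d m => grind
    rcases key with ⟨m, h1, h2⟩ | ⟨m, h1, h2⟩
    · obtain ⟨L', U', F₁, F₂, T₁, T₂, e1, e2, e3, s1, s2⟩ :=
        ih (L := L) (U := m ++ (B ++ b :: y)) hT' hc (by grind)
      obtain ⟨w, m', hm⟩ : ∃ w m', c :: m = w ++ [m'] := ⟨_, _, (List.dropLast_append_getLast
        (by simp)).symm⟩
      have hm' : m' = a ∧ L ++ w = x := by grind [List.append_inj']
      obtain ⟨rfl, rfl⟩ := hm'
      refine ⟨L', U', F₁, ((m' :: (A ++ b :: B.reverse) : List N) : Cycle N) ::ₘ F₂, T₁,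
        (A : Multiset N) + T₂, e1, ?_, ?_, s1, ?_⟩
      rotate_left 2
      · grind [Steps.cons]
      · rw [e2]; simp
      · rw [add_assoc, e3]; abel
    · obtain ⟨L', U', F₁, F₂, T₁, T₂, e1, e2, e3, s1, s2⟩ :=
        ih (L := x ++ a :: (B ++ m)) (U := U) hT' hc (by rw [h1]; simp)
      obtain ⟨b', y', hm⟩ : ∃ b' y', m ++ [c] = b' :: y' := by
        cases m <;> simp
      have hb : b = b' ∧ y = y' ++ U := by
        have : b :: y = (m ++ [c]) ++ U := by rw [h1]; simp
        rw [hm] at this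
        simpa using this
      obtain ⟨rfl, rfl⟩ := hb
      refine ⟨L', U', ((a :: (A ++ b :: B.reverse) : List N) : Cycle N) ::ₘ F₁, F₂,
        (A : Multiset N) + T₁, T₂, e1, ?_, ?_, ?_, s2⟩
      rotate_left 2
      · grind [Steps.cons]
      · rw [e2]; simp
      · rw [add_assoc, e3]; abel

end Steps

section PathSum
variable {N : Type*}

/-- The sum of `S` over consecutive pairs of a list. -/
def psum (S : N → N → ℝ) : List N → ℝ
  | a :: b :: l => S a b + psum S (b :: l)
  | _ => 0

/-- The existence of a potential that dominates `S` around the cell `f`. -/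
def FaceOK (S : N → N → ℝ) (f : Cycle N) : Prop :=
  ∃ ψ : N → ℝ, f.Chain (fun u v => S u v < ψ v - ψ u)

theorem psum_append_cons (S : N → N → ℝ) (x : List N) (a : N) (y : List N) :
    psum S (x ++ a :: y) = psum S (x ++ [a]) + psum S (a :: y) := by
  induction x with
  | nil => simp [psum]
  | cons c x ih =>
    cases x with
    | nil => simp [psum]
    | cons d x => simp only [List.cons_append, psum] at *; rw [ih]; ring

theorem psum_reverse (S : N → N → ℝ) (hS : ∀ u v, S u v = - S v u) (l : List N) :
    psum S l.reverse = - psum S l := by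
  induction l with
  | nil => simp [psum]
  | cons a l ih =>
    cases l with
    | nil => simp [psum]
    | cons b l => grind [psum_append_cons, psum]

theorem psum_lt_of_isChain (S : N → N → ℝ) (ψ : N → ℝ) (a b : N) (m : List N)
    (h : List.IsChain (fun u v => S u v < ψ v - ψ u) (a :: (m ++ [b]))) :
    psum S (a :: (m ++ [b])) < ψ b - ψ a := by
  induction m generalizing a with
  | nil => simpa [psum] using h
  | cons c m ih => grind [psum]

theorem FaceOK.psum_lt {S : N → N → ℝ} (hS : ∀ u v, S u v = - S v u) {a b : N} {A B : List N}
    (h : FaceOK S ((a :: (A ++ b :: B.reverse) : List N) : Cycle N)) :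
    psum S (a :: (A ++ [b])) < psum S (a :: (B ++ [b])) := by
  obtain ⟨ψ, h⟩ := h
  rw [Cycle.chain_coe_cons] at h
  have e : a :: (A ++ b :: B.reverse ++ [a]) = (a :: A) ++ b :: (B.reverse ++ [a]) := by simp
  rw [e] at h
  have h1 : List.IsChain (fun u v => S u v < ψ v - ψ u) (a :: (A ++ [b])) :=
    h.prefix ⟨B.reverse ++ [a], by simp⟩
  have h2 := h.right_of_append
  have := psum_lt_of_isChain S ψ _ _ _ h1
  have h3 := psum_lt_of_isChain S ψ _ _ _ h2
  have h4 := psum_reverse S hS (a :: (B ++ [b]))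
  simp only [List.reverse_cons, List.reverse_append, List.reverse_nil, List.nil_append,
    List.cons_append] at h4
  linarith

theorem Steps.psum_le {S : N → N → ℝ} (hS : ∀ u v, S u v = - S v u) {l r : List N} {F T}
    (h : Steps l r F T) (hF : ∀ f ∈ F, FaceOK S f) :
    psum S l ≤ psum S r ∧ (F ≠ 0 → psum S l < psum S r) := by
  induction h with
  | refl => simp
  | cons x a A B b y r F T h ih =>
    have h1 := (hF _ (Multiset.mem_cons_self _ _)).psum_lt hS
    grind [psum_append_cons]

theorem Steps.faces_eq_zero {S : N → N → ℝ} (hS : ∀ u v, S u v = - S v u) {l : List N} {F T}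
    (h : Steps l l F T) (hF : ∀ f ∈ F, FaceOK S f) : F = 0 := by
  by_contra hne
  exact lt_irrefl _ ((h.psum_le hS hF).2 hne)

end PathSum

section Repole
variable {N : Type*} {S : N → N → ℝ}

theorem nodup_of_add_singleton {T T₁ T₂ : Multiset N} {c : N} (h : T + {c} = T₁ + T₂)
    (hT : T.Nodup) (h₁ : c ∈ T₁) (h₂ : c ∈ T₂) : T₁.Nodup ∧ T₂.Nodup := by
  classical
  rw [← Multiset.one_le_count_iff_mem] at h₁ h₂
  constructor <;> rw [Multiset.nodup_iff_count_le_one] <;> intro u <;>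
  · have h3 := Multiset.nodup_iff_count_le_one.1 hT u
    have := congrArg (Multiset.count u) h
    grind [Multiset.count_add, Multiset.count_singleton]

/-- The right end `τ` of a sweep can be replaced by the vertex `c` that precedes it finally. -/
def RepoleEnd (S : N → N → ℝ) (n : ℕ) : Prop :=
  ∀ (A A' : List N) (τ c : N) (F : Multiset (Cycle N)) (T : Multiset N), F.card < n →
    (∀ f ∈ F, FaceOK S f) → T.Nodup → c ∉ A → c ≠ τ →
    Steps (A ++ [τ]) (A' ++ [c, τ]) F T → Steps (A ++ [τ, c]) (A' ++ [c]) F T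

theorem RepoleEnd.start {n : ℕ} (hn : RepoleEnd S n) {X Y : List N} {b c : N}
    {F : Multiset (Cycle N)} {T : Multiset N} (hc : F.card < n) (hF : ∀ f ∈ F, FaceOK S f)
    (hT : T.Nodup) (hb : b ∉ Y) (hbc : b ≠ c) (h : Steps (c :: b :: X) (c :: Y) F T) :
    Steps (b :: X) (b :: c :: Y) F T := by
  have h' := h.rot180
  simp only [List.reverse_cons, List.append_assoc, List.cons_append, List.nil_append] at h'
  have := (hn Y.reverse X.reverse c b F T hc hF hT (by simpa using hb) hbc h').rot180
  simpa using this

theorem RepoleEnd.start_many {n : ℕ} (hn : RepoleEnd S n) {b : N}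
    {F : Multiset (Cycle N)} {T : Multiset N} (hc : F.card < n) (hF : ∀ f ∈ F, FaceOK S f)
    (hT : T.Nodup) {X : List N} (R : List N) {z : N} {Y : List N}
    (hd : ∀ w ∈ R, w ∉ z :: Y) (hbY : b ∉ z :: Y) (hnd : (R ++ [b]).Nodup)
    (h : Steps (z :: (R ++ b :: X)) (z :: Y) F T) :
    Steps (b :: X) (b :: (R.reverse ++ z :: Y)) F T := by
  induction R generalizing z Y with
  | nil => grind [hn.start]
  | cons w R ih =>
    have hw := hd w (by simp)
    simp only [List.mem_cons, not_or] at hw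
    simp only [List.cons_append, List.nodup_cons, List.mem_append, not_or] at hnd
    have h1 := hn.start hc hF hT hw.2 hw.1 h
    have := ih (z := w) (Y := z :: Y) ?_ ?_ hnd.2 h1
    · simpa using this
    · grind
    · grind

theorem repoleEnd_succ (hS : ∀ u v, S u v = - S v u) {n : ℕ} (ih : RepoleEnd S n) :
    RepoleEnd S (n + 1) := by
  intro A A' τ c F T hcard hF hT hcA hcτ h
  generalize hl : A ++ [τ] = l at h
  cases h with
  | refl =>
    have : c ∈ A ++ [τ] := by rw [hl]; simp
    simp [hcA, hcτ] at this
  | cons x a A₁ B b y r F T h =>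
    obtain ⟨y₀, hy⟩ : ∃ y₀, b :: y = y₀ ++ [τ] := by
      obtain ⟨w, τ', hw⟩ : ∃ w τ', b :: y = w ++ [τ'] :=
        ⟨_, _, (List.dropLast_append_getLast (by simp)).symm⟩
      have : A ++ [τ] = (x ++ a :: (A₁ ++ w)) ++ [τ'] := by rw [hl, hw]; simp
      grind [List.append_inj']
    have hA : A = x ++ a :: (A₁ ++ y₀) := by
      have : A ++ [τ] = (x ++ a :: (A₁ ++ y₀)) ++ [τ] := by rw [hl, hy]; simp
      exact (List.append_inj' this rfl).1
    have hTn := (Multiset.nodup_add.1 hT).2.1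
    have hcard' : F.card < n := by simpa using hcard
    have hF' : ∀ f ∈ F, FaceOK S f := fun f hf => hF f (Multiset.mem_cons_of_mem hf)
    by_cases hcB : c ∈ B
    · obtain ⟨R₁, R₂, rfl⟩ := List.append_of_mem hcB
      obtain ⟨L', U', F₁, F₂, T₁, T₂, e1, e2, e3, s1, s2⟩ :=
        Steps.split (L := x ++ a :: R₁) (U := R₂ ++ b :: y) (c := c) (by simpa using h) hTn
          (by simp)
      have hU := List.eq_of_append_cons (L := A') (U := [τ]) (c := c)
        (by simpa using e1) (by simpa using h.nodup_right hTn)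
      obtain ⟨rfl, rfl⟩ := hU
      have hnT : T₁.Nodup ∧ T₂.Nodup := nodup_of_add_singleton e3 hTn
        (s1.mem_of_mem_left (by simp)) (s2.mem_of_mem_left (by simp))
      have hF2 : ∀ f ∈ F₂, FaceOK S f := fun f hf => hF' f (by rw [e2]; simp [hf])
      have hc2 : F₂.card < n := by grind [Multiset.card_add]
      have hnd := s2.nodup_left hnT.2
      have upper : Steps (b :: (y ++ [c])) (b :: (R₂.reverse ++ [c])) F₂ T₂ := by
        have hz : ∃ z₀, R₂ ++ b :: y = z₀ ++ [τ] := ⟨R₂ ++ y₀, by rw [hy]; simp⟩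
        cases R₂ with
        | nil =>
          cases y with
          | nil =>
            have hbτ : b = τ := by grind
            subst hbτ
            have h0 := s2.faces_eq_zero hS hF2
            obtain ⟨-, hT2⟩ := s2.eq_of_faces_zero h0
            rw [h0, hT2]
            have hp : (([c, b] : List N) : Multiset N) = ([b, c] : List N) :=
              Multiset.coe_eq_coe.2 (List.Perm.swap b c [])
            grind [Steps.refl]
          | cons d y =>
            have hbτ : b ≠ τ := by
              rintro rfl
              have : b ∈ d :: y := by
                have : y₀ ≠ [] := by rintro rfl; simp at hy
                obtain ⟨p, q, rfl⟩ := List.exists_cons_of_ne_nil this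
                simp at hy; rw [hy.2]; simp
              simp at hnd this
              tauto
            have hbc : b ≠ c := by rintro rfl; simp at hnd
            have h1 := ih.start hc2 hF2 hnT.2 (by simpa using hbτ) hbc s2
            obtain ⟨p, q, rfl⟩ : ∃ p q, y₀ = p :: q := by
              refine List.exists_cons_of_ne_nil ?_
              rintro rfl; simp at hy
            simp only [List.cons_append, List.cons.injEq] at hy
            rw [hy.2] at h1 hnd ⊢
            have := ih (b :: q) [b] τ c F₂ T₂ hc2 hF2 hnT.2 (by grind) hcτ (by simpa using h1)
            simpa using this
        | cons w R₂ =>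
          have hwτ : w ≠ τ ∧ w ≠ c ∧ b ≠ c ∧ c ∉ R₂ ∧ c ∉ y₀ := by grind
          have h1 := ih.start hc2 hF2 hnT.2 (by simpa using hwτ.1) hwτ.2.1 s2
          rw [hy] at h1
          have h2 := ih (w :: (R₂ ++ y₀)) [w] τ c F₂ T₂ hc2 hF2 hnT.2 (by
            grind) hcτ (by simpa using h1)
          have h3 := ih.start_many (b := b) (X := y ++ [c]) hc2 hF2 hnT.2 R₂ (z := w) (Y := [c])
            (by grind)
            (by
              simp at hnd ⊢
              grind)
            (by grind)
            (by grind)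
          simpa using h3
      have hmid := Steps.cons x a (A₁ ++ b :: R₂.reverse) R₁ c [] (A' ++ [c]) F₁ T₁
        (by simpa using s1)
      have hup := upper.congr_append (x ++ a :: A₁) []
      simp only [List.append_nil, List.append_assoc, List.cons_append] at hup hmid
      have := hup.trans (F₂ := _) (m := x ++ a :: (A₁ ++ b :: (R₂.reverse ++ [c])))
        (T := (A₁ : Multiset N) + T) hmid ?_
      · grind [Multiset.add_cons, add_comm]
      · have := congrArg (· + ((x ++ a :: (A₁ ++ (A₁ ++ b :: R₂.reverse)) : List N) : Multiset N)) e3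
        simp only [← Multiset.coe_add, ← Multiset.cons_coe, Multiset.coe_nil, add_zero,
          ← Multiset.singleton_add] at this ⊢
        convert this using 1 <;> abel
    · have h1 := ih (x ++ a :: (B ++ y₀)) A' τ c F T hcard' hF' hTn (by
        grind) hcτ (by simpa [hy] using h)
      have hyc : y₀ ++ [τ, c] = b :: (y ++ [c]) := by grind
      grind [Steps.cons]

theorem repoleEnd (hS : ∀ u v, S u v = - S v u) (n : ℕ) : RepoleEnd S n := by
  induction n with
  | zero => intro A A' τ c F T h; simp at h
  | succ n ih => exact repoleEnd_succ hS ih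

end Repole

section Merge
variable {N : Type*} {S : N → N → ℝ}

theorem RepoleEnd.end_many {n : ℕ} (hn : RepoleEnd S n)
    {F : Multiset (Cycle N)} {T : Multiset N} (hc : F.card < n) (hF : ∀ f ∈ F, FaceOK S f)
    (hT : T.Nodup) (A' R A : List N) (τ : N) (hd : ∀ c ∈ R, c ∉ A ∧ c ≠ τ)
    (hR : R.Nodup) (h : Steps (A ++ [τ]) (A' ++ (R ++ [τ])) F T) {a : N} {t : List N}
    (hat : R ++ [τ] = a :: t) : Steps (A ++ τ :: R.reverse) (A' ++ [a]) F T := by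
  induction R using List.reverseRecOn generalizing A τ t with
  | nil =>
    simp at hat
    simpa [hat] using h
  | append_singleton R c ih =>
    obtain ⟨t', ht'⟩ : ∃ t', R ++ [c] = a :: t' := by
      cases R with
      | nil => simp_all
      | cons d R => simp_all
    have h1 := hn A (A' ++ R) τ c F T hc hF hT (hd c (by simp)).1 (hd c (by simp)).2
      (by simpa using h)
    have := ih (A ++ [τ]) c (by
      grind) (by simp [List.nodup_append] at hR; exact hR.1) (by simpa using h1) ht'
    simpa using this

theorem FaceOK.reverse (hS : ∀ u v, S u v = - S v u) {f : Cycle N} (h : FaceOK S f) :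
    FaceOK (fun u v => - S u v) f.reverse := by
  obtain ⟨ψ, h⟩ := h
  refine ⟨fun u => - ψ u, ?_⟩
  induction f using Cycle.induction_on with
  | nil => simp
  | cons a l _ =>
    rw [Cycle.chain_coe_cons] at h
    have e : ((a :: l : List N) : Cycle N).reverse = ((a :: l.reverse : List N) : Cycle N) := by
      grind [Cycle.reverse_coe, Cycle.coe_append_comm]
    rw [e, Cycle.chain_coe_cons]
    have h2 : a :: (l.reverse ++ [a]) = (a :: (l ++ [a])).reverse := by simp
    grind [List.isChain_reverse]

theorem Steps.order {l r L U : List N} {c d : N} {F T} (h : Steps l r F T) (hT : T.Nodup)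
    (hl : l = L ++ c :: U) (hd : d ∈ U) (hc : c ∈ r) {L' U' : List N} (hr : r = L' ++ d :: U') :
    c ∈ L' := by
  classical
  subst hl
  obtain ⟨L₁, U₁, F₁, F₂, T₁, T₂, e1, e2, e3, s1, s2⟩ := h.split hT hc
  have hdc : d ≠ c := by grind [h.nodup_left, List.nodup_append]
  have hdL : d ∉ L₁ := by
    intro hdL
    have h1 : 1 ≤ T₁.count d := Multiset.one_le_count_iff_mem.2 (s1.mem_of_mem_right (by simp [hdL]))
    have h2 : 1 ≤ T₂.count d := Multiset.one_le_count_iff_mem.2 (s2.mem_of_mem_left (by simp [hd]))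
    have h3 := congrArg (Multiset.count d) e3
    grind [Multiset.nodup_iff_count_le_one, Multiset.count_add, Multiset.count_singleton]
  have e := hr.symm.trans e1
  rcases List.append_eq_append_iff.1 e with ⟨m, h1, h2⟩ | ⟨m, h1, h2⟩
  · cases m with
    | nil => simp at h2; exact absurd h2.1 hdc
    | cons q m => grind
  · cases m with
    | nil => simp at h2; exact absurd h2.1.symm hdc
    | cons q m =>
      simp at h2
      rw [h1, h2.1]; simp

theorem Steps.split_edge (hS : ∀ u v, S u v = - S v u) {u v : N} {L U r : List N} {F T}
    (h : Steps (L ++ u :: v :: U) r F T) (hF : ∀ f ∈ F, FaceOK S f) (hT : T.Nodup)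
    {L' U' : List N} (hr : r = L' ++ u :: v :: U') :
    ∃ F₁ F₂ T₁ T₂, F = F₁ + F₂ ∧ T = T₁ + T₂ ∧ Steps (L ++ [u]) (L' ++ [u]) F₁ T₁ ∧
      Steps (v :: U) (v :: U') F₂ T₂ := by
  obtain ⟨L₁, U₁, F₁, F₂, T₁, T₂, e1, e2, e3, s1, s2⟩ := h.split hT (c := u) (by simp [hr])
  obtain ⟨rfl, rfl⟩ := List.eq_of_append_cons (hr.symm.trans e1)
    (hr ▸ h.nodup_right hT)
  have hn := nodup_of_add_singleton e3 hT (s1.mem_of_mem_left (by simp))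
    (s2.mem_of_mem_left (by simp))
  obtain ⟨L₂, U₂, F₃, F₄, T₃, T₄, e4, e5, e6, s3, s4⟩ :=
    Steps.split (L := [u]) (c := v) s2 hn.2 (by simp)
  have hn2 := s2.nodup_right hn.2
  obtain ⟨rfl, rfl⟩ := List.eq_of_append_cons (L := [u]) (U := U') (c := v) e4 hn2
  have hz := s3.faces_eq_zero hS (fun f hf => hF f (by rw [e2, e5]; simp [hf]))
  have hT3 := (s3.eq_of_faces_zero hz).2
  refine ⟨F₁, F₄, T₁, T₄, by rw [e2, e5, hz, zero_add], ?_, s1, s4⟩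
  have e7 : T + {u} + {v} = T₁ + T₄ + {u} + {v} := by
    rw [e3, add_assoc, e6, hT3]
    change T₁ + (({u} + {v} : Multiset N) + T₄) = _
    abel
  exact add_right_cancel (add_right_cancel e7)

theorem Steps.repole_lower (hS : ∀ u v, S u v = - S v u) {x₁ P₁ x₂ P₂ : List N} {u : N} {F T}
    (h : Steps (x₁ ++ (P₁ ++ [u])) (x₂ ++ (P₂ ++ [u])) F T) (hF : ∀ f ∈ F, FaceOK S f)
    (hT : T.Nodup) (hP : ∀ c ∈ P₁, c ∉ P₂) {a₁ a₂ : N} {t₁ t₂ : List N}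
    (h₁ : P₁ ++ [u] = a₁ :: t₁) (h₂ : P₂ ++ [u] = a₂ :: t₂) :
    ∃ X e Kl Kr Fb Fa Tb Ta, F = Fb + Fa ∧ Steps (x₁ ++ [a₁]) (X ++ e :: Kl) Fb Tb ∧
      Steps (X ++ e :: Kr) (x₂ ++ [a₂]) Fa Ta ∧ Tb + Ta = T + (X ++ [e] : List N) ∧
      Kr.reverse ++ e :: Kl = P₂ ++ u :: P₁.reverse := by
  have hnl := h.nodup_left hT
  have hnr := h.nodup_right hT
  by_cases hafter : ∀ c ∈ P₂, c ∉ x₁ ++ P₁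
  · have := (repoleEnd hS (F.card + 1)).end_many (by simp) hF hT x₂ P₂ (x₁ ++ P₁) u
      (fun c hc => ⟨hafter c hc, by
        grind⟩) (by simp [List.nodup_append] at hnr; tauto) (by simpa using h) h₂
    refine ⟨x₁, a₁, [], t₁ ++ P₂.reverse, 0, F, _, _, by simp, Steps.refl _, ?_, add_comm _ _, ?_⟩
    · grind
    · grind
  · have hbefore : ∀ d ∈ P₁, d ∉ x₂ ++ P₂ := by
      push Not at hafter
      obtain ⟨c, hc, hc1⟩ := hafter
      intro d hd hd1
      have hcx : c ∈ x₁ := by grind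
      have hdx : d ∈ x₂ := by grind
      obtain ⟨p, q, rfl⟩ := List.append_of_mem hcx
      obtain ⟨p', q', rfl⟩ := List.append_of_mem hdx
      have := h.order hT (L := p) (c := c) (U := q ++ (P₁ ++ [u])) (d := d) (by simp)
        (by simp [hd]) (by simp [hc]) (L' := p') (U' := q' ++ (P₂ ++ [u])) (by simp)
      simp [List.nodup_append] at hnr
      grind
    have hF' : ∀ f ∈ F.map Cycle.reverse, FaceOK (fun u v => - S u v) f := by
      intro f hf
      obtain ⟨g, hg, rfl⟩ := Multiset.mem_map.1 hf
      exact (hF g hg).reverse hS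
    have := (repoleEnd (S := fun u v => - S u v) (fun u v => by rw [hS u v])
      ((F.map Cycle.reverse).card + 1)).end_many (by simp) hF' hT x₁ P₁ (x₂ ++ P₂) u
      (fun c hc => ⟨hbefore c hc, by
        grind⟩) (by simp [List.nodup_append] at hnl; tauto) (by simpa using h.mirror) h₁
    have h4 := this.mirror
    rw [Multiset.map_map] at h4
    have e : Multiset.map (Cycle.reverse ∘ Cycle.reverse) F = F := by
      simp [Cycle.reverse_reverse]
    rw [e] at h4
    refine ⟨x₂, a₂, t₂ ++ P₁.reverse, [], F, 0, _, _, by simp, ?_, Steps.refl _, rfl, ?_⟩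
    · grind
    · grind

end Merge

section Merge2
variable {N : Type*} {S : N → N → ℝ}

theorem Steps.exists_flip {l r : List N} {F T} (h : Steps l r F T) {f : Cycle N} (hf : f ∈ F) :
    ∃ x a A B b y F₁ F₂ T₁ T₂, f = ((a :: (A ++ b :: B.reverse) : List N) : Cycle N) ∧
      F = F₁ + f ::ₘ F₂ ∧ Steps l (x ++ a :: (A ++ b :: y)) F₁ T₁ ∧
      Steps (x ++ a :: (B ++ b :: y)) r F₂ T₂ ∧ T + (x ++ a :: b :: y : List N) = T₁ + T₂ := by
  classical
  induction h with
  | refl => simp at hf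
  | cons x a A B b y r F T h ih =>
    by_cases he : f = ((a :: (A ++ b :: B.reverse) : List N) : Cycle N)
    · refine ⟨x, a, A, B, b, y, 0, F, _, T, he, by simp [he], Steps.refl _, h, ?_⟩
      ext c
      simp only [← Multiset.coe_add, ← Multiset.cons_coe, Multiset.count_add, Multiset.count_cons]
      omega
    · have hf' : f ∈ F := by grind
      obtain ⟨x', a', A', B', b', y', F₁, F₂, T₁, T₂, e1, e2, s1, s2, e3⟩ := ih hf'
      refine ⟨x', a', A', B', b', y', _, F₂, _, T₂, e1, ?_, Steps.cons x a A B b y _ _ _ s1, s2, ?_⟩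
      · rw [e2, Multiset.cons_add]
      · grind

theorem Steps.mem_of_mem_face {l r : List N} {F T} (h : Steps l r F T) {f : Cycle N} (hf : f ∈ F)
    {c : N} (hc : c ∈ f) : c ∈ T := by
  obtain ⟨x, a, A, B, b, y, F₁, F₂, T₁, T₂, rfl, e2, s1, s2, e3⟩ := h.exists_flip hf
  have h1 : c ∈ (x ++ a :: (A ++ b :: y)) ∨ c ∈ (x ++ a :: (B ++ b :: y)) := by
    simp at hc ⊢
    tauto
  classical
  by_contra hcT
  have h2 := congrArg (Multiset.count c) e3
  rw [Multiset.count_add, Multiset.count_add, Multiset.count_eq_zero_of_notMem hcT, zero_add] at h2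
  have hl := Multiset.count_le_of_le c s1.left_le
  have h5 := Multiset.count_le_of_le c s1.right_le
  have h6 := Multiset.count_le_of_le c s2.left_le
  simp only [← Multiset.coe_add, ← Multiset.cons_coe, Multiset.count_add,
      Multiset.count_cons] at h2 h5 h6
  have h7 : Multiset.count c (↑A : Multiset N) = 0 ∧ Multiset.count c (↑B : Multiset N) = 0 := by
    omega
  rw [Multiset.count_eq_zero, Multiset.count_eq_zero] at h7
  simp at h7
  have h8 : c ∈ x ++ a :: b :: y := by
    simp at h1 ⊢; tauto
  have h9 : 1 ≤ Multiset.count c ((x ++ a :: b :: y : List N) : Multiset N) :=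
    Multiset.one_le_count_iff_mem.2 (by simpa using h8)
  simp only [← Multiset.coe_add, ← Multiset.cons_coe, Multiset.count_add, Multiset.count_cons] at h9
  omega

theorem Steps.not_mem_face_of_edge (hS : ∀ u v, S u v = - S v u) {u v : N}
    {L U L' U' : List N} {F T}
    (h : Steps (L ++ u :: v :: U) (L' ++ u :: v :: U') F T) (hF : ∀ f ∈ F, FaceOK S f)
    (hT : T.Nodup) {f : Cycle N} (hf : f ∈ F) (hu : u ∈ f) (hv : v ∈ f) : False := by
  obtain ⟨F₁, F₂, T₁, T₂, rfl, rfl, s1, s2⟩ := h.split_edge hS hF hT rfl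
  have hd := (Multiset.nodup_add.1 hT).2.2
  rcases Multiset.mem_add.1 hf with h1 | h1
  · exact Multiset.disjoint_left.1 hd (s1.mem_of_mem_face h1 hv) (s2.mem_of_mem_left (by simp))
  · exact Multiset.disjoint_left.1 hd (s1.mem_of_mem_left (by simp)) (s2.mem_of_mem_face h1 hu)

theorem cycle_infix {c u v : N} {L φ : List N}
    (h : ((c :: L : List N) : Cycle N) = ((v :: u :: φ : List N) : Cycle N)) :
    ∃ P Q, c :: (L ++ [c]) = P ++ v :: u :: Q := by
  obtain ⟨n, hn, h⟩ := List.isRotated_iff_mod.1 (Cycle.coe_eq_coe.1 h)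
  rw [List.rotate_eq_drop_append_take hn] at h
  have h0 := List.take_append_drop n (c :: L)
  generalize List.take n (c :: L) = s at *
  generalize List.drop n (c :: L) = t at *
  match t, h with
  | [], h => grind
  | [w], h =>
    simp at h
    obtain ⟨rfl, rfl⟩ := h
    simp at h0
    refine ⟨u :: φ, [], ?_⟩
    rw [← List.cons_append, ← h0.2, h0.1]
    simp
  | w :: w' :: t, h =>
    simp at h
    obtain ⟨rfl, rfl, rfl⟩ := h
    refine ⟨s, t ++ [c], ?_⟩
    rw [← List.cons_append, ← h0]
    simp

theorem cycle_cons_inj {v : N} {l l' : List N}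
    (h : ((v :: l : List N) : Cycle N) = ((v :: l' : List N) : Cycle N)) (hn : (v :: l).Nodup) :
    l = l' := by
  obtain ⟨n, hn', h⟩ := List.isRotated_iff_mod.1 (Cycle.coe_eq_coe.1 h)
  rw [List.rotate_eq_drop_append_take hn'] at h
  have h0 := List.take_append_drop n (v :: l)
  generalize List.take n (v :: l) = s at *
  generalize List.drop n (v :: l) = t at *
  match s, t with
  | [], t => simp_all
  | s, [] => simp_all
  | a :: s, b :: t => grind

/-- The position of the arc `v → u` in the boundary of a cell. -/
theorem cell_edge {a b u v : N} {A B φ : List N} (hn : (a :: (A ++ b :: B.reverse)).Nodup)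
    (h : ((a :: (A ++ b :: B.reverse) : List N) : Cycle N) = ((v :: u :: φ : List N) : Cycle N)) :
    (∃ P Q, a :: (A ++ [b]) = P ++ v :: u :: Q ∧ φ = Q ++ (B.reverse ++ P)) ∨
    (∃ P Q, a :: (B ++ [b]) = P ++ u :: v :: Q ∧ φ = P.reverse ++ (A ++ Q.reverse)) := by
  obtain ⟨P, Q, e⟩ := cycle_infix h
  have e' : (a :: A) ++ b :: (B.reverse ++ [a]) = P ++ v :: u :: Q := by rw [← e]; simp
  have key : (∃ P Q, a :: (A ++ [b]) = P ++ v :: u :: Q) ∨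
      (∃ P Q, a :: (B ++ [b]) = P ++ u :: v :: Q) := by
    rcases List.append_eq_append_iff.1 e' with ⟨m, h1, h2⟩ | ⟨m, h1, h2⟩
    · right
      have : a :: (B ++ [b]) = (b :: (B.reverse ++ [a])).reverse := by simp
      rw [this, h2]
      exact ⟨Q.reverse, m.reverse, by simp⟩
    · match m, h2 with
      | [], h2 =>
        right
        have : a :: (B ++ [b]) = (b :: (B.reverse ++ [a])).reverse := by simp
        rw [this, show b :: (B.reverse ++ [a]) = v :: u :: Q from h2.symm]
        exact ⟨Q.reverse, [], by simp⟩
      | [w], h2 => grind []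
      | w :: w' :: m, h2 => grind
  have hn' : (v :: u :: φ).Nodup := (Cycle.coe_eq_coe.1 h).nodup_iff.1 hn
  rcases key with ⟨P, Q, e⟩ | ⟨P, Q, e⟩
  · refine Or.inl ⟨P, Q, e, ?_⟩
    have h2 : ((v :: u :: φ : List N) : Cycle N) = ((v :: u :: (Q ++ (B.reverse ++ P)) : List N) : Cycle N) := by
      grind [Cycle.coe_append_comm]
    have := cycle_cons_inj h2 hn'
    simpa using this
  · refine Or.inr ⟨P, Q, e, ?_⟩
    have h2 : ((v :: u :: φ : List N) : Cycle N) = ((v :: u :: (P.reverse ++ (A ++ Q.reverse)) : List N) : Cycle N) := by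
      rw [← h]
      have h3 : (a :: (A ++ b :: B.reverse) : List N) = [a] ++ (A ++ (B ++ [b]).reverse) := by simp
      rw [h3, Cycle.coe_append_comm]
      have h4 : A ++ (B ++ [b]).reverse ++ [a] = A ++ (a :: (B ++ [b])).reverse := by simp
      rw [h4, e]
      have h5 : A ++ (P ++ u :: v :: Q).reverse = (A ++ Q.reverse) ++ (v :: u :: P.reverse) := by simp
      rw [h5, Cycle.coe_append_comm]; simp
    have := cycle_cons_inj h2 hn'
    simpa using this

end Merge2

section Merge3
variable {N : Type*} {S : N → N → ℝ}

theorem Steps.merge_aux (hS : ∀ u v, S u v = - S v u)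
    {l r x₁ A₁ B₁ y₁ x₂ A₂ B₂ y₂ φ γ : List N} {a₁ b₁ a₂ b₂ u v : N}
    {F₁ Fm F₃ : Multiset (Cycle N)} {T₁ Tm T₃ T T' : Multiset N}
    (h₁ : Steps l (x₁ ++ a₁ :: (A₁ ++ b₁ :: y₁)) F₁ T₁)
    (hm : Steps (x₁ ++ a₁ :: (B₁ ++ b₁ :: y₁)) (x₂ ++ a₂ :: (A₂ ++ b₂ :: y₂)) Fm Tm)
    (h₃ : Steps (x₂ ++ a₂ :: (B₂ ++ b₂ :: y₂)) r F₃ T₃)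
    (hT₁ : T + (x₁ ++ a₁ :: b₁ :: y₁ : List N) = T₁ + T')
    (hT₂ : T' + (x₂ ++ a₂ :: b₂ :: y₂ : List N) = Tm + T₃)
    (hT : T.Nodup) (hF : ∀ f ∈ Fm, FaceOK S f)
    (hf : ((a₁ :: (A₁ ++ b₁ :: B₁.reverse) : List N) : Cycle N) = ((v :: u :: φ : List N) : Cycle N))
    (hg : ((a₂ :: (A₂ ++ b₂ :: B₂.reverse) : List N) : Cycle N) = ((u :: v :: γ : List N) : Cycle N))
    (hfok : FaceOK S (a₁ :: (A₁ ++ b₁ :: B₁.reverse) : List N))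
    (hgok : FaceOK S (a₂ :: (A₂ ++ b₂ :: B₂.reverse) : List N))
    (hφγ : ∀ c ∈ φ, c ∉ γ) :
    Steps l r (((u :: (φ ++ v :: γ) : List N) : Cycle N) ::ₘ (F₁ + Fm + F₃)) T := by
  classical
  have sg₁ := Steps.single x₁ a₁ A₁ B₁ b₁ y₁
  have sg₂ := Steps.single x₂ a₂ A₂ B₂ b₂ y₂
  have hcT : ∀ c, T.count c ≤ 1 := Multiset.nodup_iff_count_le_one.1 hT
  have hl₁ : ∀ c, _ := fun c => Multiset.count_le_of_le c h₁.right_le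
  have hlm : ∀ c, _ := fun c => Multiset.count_le_of_le c hm.left_le
  have hrm : ∀ c, _ := fun c => Multiset.count_le_of_le c hm.right_le
  have hl₃ : ∀ c, _ := fun c => Multiset.count_le_of_le c h₃.left_le
  have ec₁ : ∀ c, _ := fun c => congrArg (Multiset.count c) hT₁
  have ec₂ : ∀ c, _ := fun c => congrArg (Multiset.count c) hT₂
  simp only [← Multiset.coe_add, ← Multiset.cons_coe, Multiset.count_add, Multiset.count_cons]
    at hl₁ hlm hrm hl₃ ec₁ ec₂
  have hTm : Tm.Nodup := by grind [Multiset.nodup_iff_count_le_one]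
  have hn₁ : (a₁ :: (A₁ ++ b₁ :: B₁.reverse)).Nodup := by
    rw [← Multiset.coe_nodup, Multiset.nodup_iff_count_le_one]
    intro c
    have := hcT c; have := hl₁ c; have := hlm c; have := hrm c; have := hl₃ c
    have := ec₁ c; have := ec₂ c
    simp only [← Multiset.coe_add, ← Multiset.cons_coe, Multiset.count_add, Multiset.count_cons,
      Multiset.coe_reverse] at *
    omega
  have hn₂ : (a₂ :: (A₂ ++ b₂ :: B₂.reverse)).Nodup := by
    rw [← Multiset.coe_nodup, Multiset.nodup_iff_count_le_one]
    intro c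
    have := hcT c; have := hl₁ c; have := hlm c; have := hrm c; have := hl₃ c
    have := ec₁ c; have := ec₂ c
    simp only [← Multiset.coe_add, ← Multiset.cons_coe, Multiset.count_add, Multiset.count_cons,
      Multiset.coe_reverse] at *
    omega
  have hAB : ∀ c, (A₁ : Multiset N).count c + (Tm.count c + (B₂ : Multiset N).count c) ≤ 1 := by
    grind
  have sB : Steps (x₁ ++ a₁ :: (B₁ ++ b₁ :: y₁)) (x₂ ++ a₂ :: (B₂ ++ b₂ :: y₂)) _ (Tm + B₂) :=
    hm.trans sg₂ (by
      simp only [← Multiset.coe_add, ← Multiset.cons_coe]; ext c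
      grind [Multiset.count_add, Multiset.count_cons])
  have sA := Steps.cons x₁ a₁ A₁ B₁ b₁ y₁ _ _ _ hm
  have sAB := Steps.cons x₁ a₁ A₁ B₁ b₁ y₁ _ _ _ sB
  have nB : (Tm + (B₂ : Multiset N)).Nodup := by
    grind [Multiset.nodup_iff_count_le_one, Multiset.count_add]
  have nA : ((A₁ : Multiset N) + Tm).Nodup := by
    grind [Multiset.nodup_iff_count_le_one, Multiset.count_add]
  have nAB : ((A₁ : Multiset N) + (Tm + (B₂ : Multiset N))).Nodup := by
    grind [Multiset.nodup_iff_count_le_one, Multiset.count_add]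
  have path : ∀ (x : List N) (a : N) (A : List N) (b : N) (y P : List N) (w z : N) (Q : List N),
      a :: (A ++ [b]) = P ++ w :: z :: Q →
      x ++ a :: (A ++ b :: y) = (x ++ P) ++ w :: z :: (Q ++ y) := by grind
  rcases cell_edge hn₁ hf with ⟨P₁, Q₁, e₁, hφ⟩ | ⟨P₁, Q₁, e₁, hφ⟩ <;>
  rcases cell_edge hn₂ hg with ⟨P₂, Q₂, e₂, hγ⟩ | ⟨P₂, Q₂, e₂, hγ⟩
  · exfalso
    have := sA.order nA (path x₁ _ _ _ y₁ _ _ _ _ e₁) (d := u) (by simp)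
      (by rw [path x₂ _ _ _ y₂ _ _ _ _ e₂]; simp) (path x₂ _ _ _ y₂ _ _ _ _ e₂)
    have hn := sA.nodup_right nA
    rw [path x₂ _ _ _ y₂ _ _ _ _ e₂, List.nodup_append] at hn
    exact hn.2.2 _ this v (by simp) rfl
  · exfalso
    rw [path x₁ _ _ _ y₁ _ _ _ _ e₁, path x₂ _ _ _ y₂ _ _ _ _ e₂] at sAB
    refine sAB.not_mem_face_of_edge hS ?_ nAB (Multiset.mem_cons_self _ _)
      (by rw [hf]; simp) (by rw [hf]; simp)
    grind [Multiset.mem_singleton]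
  · obtain ⟨t₁, ht₁⟩ : ∃ t, P₁ ++ [u] = a₁ :: t := by cases P₁ <;> simp_all
    obtain ⟨t₂, ht₂⟩ : ∃ t, P₂ ++ [u] = a₂ :: t := by cases P₂ <;> simp_all
    obtain ⟨t₃, ht₃⟩ : ∃ t, Q₁.reverse ++ [v] = b₁ :: t := by
      have := congrArg List.reverse e₁
      simp at this
      cases hq : Q₁.reverse <;> simp_all
    obtain ⟨t₄, ht₄⟩ : ∃ t, Q₂.reverse ++ [v] = b₂ :: t := by
      have := congrArg List.reverse e₂
      simp at this
      cases hq : Q₂.reverse <;> simp_all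
    have hm' := hm
    rw [path x₁ _ _ _ y₁ _ _ _ _ e₁, path x₂ _ _ _ y₂ _ _ _ _ e₂] at hm'
    obtain ⟨Fl, Fu, Tl, Tu, rfl, rfl, sl, su⟩ := hm'.split_edge hS hF hTm rfl
    rw [Multiset.nodup_add] at hTm
    rw [List.append_assoc, List.append_assoc] at sl
    obtain ⟨X, e, Kl, Kr, Fb, Fa, Tb, Ta, rfl, s1, s2, eT, eK⟩ :=
      sl.repole_lower hS (fun f hf => hF f (by simp [hf])) hTm.1
        (fun c hc hc' => hφγ c (by simp [hφ, hc]) (by simp [hγ, hc'])) ht₁ ht₂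
    have su' := su.rot180
    have er : ∀ Q y : List N, (v :: (Q ++ y)).reverse = y.reverse ++ (Q.reverse ++ [v]) := by
      intro Q y; simp
    rw [er, er] at su'
    obtain ⟨X', e', Kl', Kr', Fb', Fa', Tb', Ta', rfl, s3, s4, eT', eK'⟩ :=
      su'.repole_lower hS (fun f hf => hF f (by simp at hf ⊢; tauto)) hTm.2.1
        (fun c hc hc' => hφγ c (by simp at hc'; simp [hφ, hc']) (by simp at hc; simp [hγ, hc]))
        ht₄ ht₃
    have s3' := s3.rot180
    have s4' := s4.rot180
    simp only [List.reverse_append, List.reverse_cons, List.reverse_nil, List.nil_append,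
      List.reverse_reverse, List.append_assoc, List.singleton_append] at s3' s4' eK'
    have k1 := s1.congr_append [] (A₁ ++ b₁ :: y₁)
    have k2 := s4'.congr_append (X ++ e :: (Kl ++ A₁)) []
    have k3 := Steps.single X e (Kl ++ (A₁ ++ Kr'.reverse)) (Kr ++ (B₂ ++ Kl'.reverse)) e' X'.reverse
    have k4 := s2.congr_append [] (B₂ ++ (Kl'.reverse ++ e' :: X'.reverse))
    have k5 := s3'.congr_append (x₂ ++ a₂ :: B₂) []
    simp only [List.nil_append, List.append_nil, List.append_assoc, List.cons_append]
      at k1 k2 k3 k4 k5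
    obtain ⟨R1, r1, j1⟩ := h₁.exists_trans k1
    obtain ⟨R2, r2, j2⟩ := j1.exists_trans k2
    obtain ⟨R3, r3, j3⟩ := j2.exists_trans k3
    obtain ⟨R4, r4, j4⟩ := j3.exists_trans k4
    obtain ⟨R5, r5, j5⟩ := j4.exists_trans k5
    obtain ⟨R6, r6, j6⟩ := j5.exists_trans h₃
    have eR : R6 = T := by
      have m1 := congrArg (fun L : List N => (L : Multiset N)) eK
      have m2 := congrArg (fun L : List N => (L : Multiset N)) eK'
      have m3 := congrArg (fun L : List N => (L : Multiset N)) e₁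
      have m4 := congrArg (fun L : List N => (L : Multiset N)) e₂
      clear hφ hγ hf hg eK eK' e₁ e₂ hlm hl₁ hl₃ hrm hcT ec₁ ec₂ hAB er path
      have toC : ∀ {A B : Multiset N}, A = B → ∀ c, A.count c = B.count c :=
        fun h c => congrArg _ h
      ext c
      have n1 := toC m1 c
      have n2 := toC m2 c
      have n3 := toC m3 c
      have n4 := toC m4 c
      have n5 := toC r1 c
      have n6 := toC r2 c
      have n7 := toC r3 c
      have n8 := toC r4 c
      have n9 := toC r5 c
      have n10 := toC r6 c
      have n11 := toC eT c
      have n12 := toC eT' c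
      have n13 := toC hT₁ c
      have n14 := toC hT₂ c
      clear r1 r2 r3 r4 r5 r6 eT eT' hT₁ hT₂ m1 m2 m3 m4
      simp only [← Multiset.coe_add, ← Multiset.cons_coe, Multiset.coe_reverse, Multiset.count_add,
        Multiset.count_cons, Multiset.coe_nil, Multiset.count_zero] at *
      omega
    rw [eR] at j6
    convert j6 using 1
    have hface : ((u :: (φ ++ v :: γ) : List N) : Cycle N) =
        ((e :: (Kl ++ (A₁ ++ Kr'.reverse) ++ e' :: (Kr ++ (B₂ ++ Kl'.reverse)).reverse) : List N) :
          Cycle N) := by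
      have h1 : e :: (Kl ++ (A₁ ++ Kr'.reverse) ++ e' :: (Kr ++ (B₂ ++ Kl'.reverse)).reverse) =
          (e :: Kl ++ A₁ ++ (Kr'.reverse ++ e' :: Kl') ++ B₂.reverse) ++ Kr.reverse := by simp
      have h2 : Kr.reverse ++ (e :: Kl ++ A₁ ++ (Kr'.reverse ++ e' :: Kl') ++ B₂.reverse) =
          (Kr.reverse ++ e :: Kl) ++ (A₁ ++ (Kr'.reverse ++ e' :: Kl') ++ B₂.reverse) := by simp
      rw [h1, Cycle.coe_append_comm, h2, eK, eK', hφ, hγ]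
      have h3 : u :: (P₁.reverse ++ (A₁ ++ Q₁.reverse) ++ v :: (Q₂ ++ (B₂.reverse ++ P₂))) =
          (u :: (P₁.reverse ++ (A₁ ++ Q₁.reverse) ++ v :: (Q₂ ++ B₂.reverse))) ++ P₂ := by simp
      rw [h3, Cycle.coe_append_comm]
      simp
    grind [Multiset.singleton_add]
  · exfalso
    have := sB.order nB (path x₁ _ _ _ y₁ _ _ _ _ e₁) (d := v) (by simp)
      (by rw [path x₂ _ _ _ y₂ _ _ _ _ e₂]; simp) (path x₂ _ _ _ y₂ _ _ _ _ e₂)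
    have hn := sB.nodup_right nB
    rw [path x₂ _ _ _ y₂ _ _ _ _ e₂, List.nodup_append] at hn
    exact hn.2.2 _ this u (by simp) rfl

/-- Two cells sharing exactly one edge can be replaced by their union. -/
theorem Steps.merge (hS : ∀ u v, S u v = - S v u) {l r φ γ : List N} {u v : N}
    {F : Multiset (Cycle N)} {T : Multiset N}
    (h : Steps l r (((v :: u :: φ : List N) : Cycle N) ::ₘ ((u :: v :: γ : List N) : Cycle N) ::ₘ F) T)
    (hT : T.Nodup)
    (hF : ∀ f ∈ ((v :: u :: φ : List N) : Cycle N) ::ₘ ((u :: v :: γ : List N) : Cycle N) ::ₘ F,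
      FaceOK S f)
    (hφγ : ∀ c ∈ φ, c ∉ γ) :
    Steps l r (((u :: (φ ++ v :: γ) : List N) : Cycle N) ::ₘ F) T := by
  classical
  obtain ⟨x, a, A, B, b, y, F₁, F₂, T₁, T₂, e1, e2, s1, s2, e3⟩ :=
    h.exists_flip (Multiset.mem_cons_self _ _)
  rw [Multiset.add_cons, Multiset.cons_inj_right] at e2
  have hok : ∀ f ∈ F₁ + F₂, FaceOK S f := by grind
  have hgm : ((u :: v :: γ : List N) : Cycle N) ∈ F₁ + F₂ := by rw [← e2]; simp
  have hfok := hF _ (Multiset.mem_cons_self _ _)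
  have hgok := hok _ hgm
  rcases Multiset.mem_add.1 hgm with hg | hg
  · obtain ⟨x', a', A', B', b', y', F₃, F₄, T₃, T₄, e4, e5, s3, s4, e6⟩ := s1.exists_flip hg
    obtain ⟨T', hT'⟩ : ∃ T', T' + (x ++ a :: b :: y : List N) = T₄ + T₂ := by
      obtain ⟨R, hR⟩ := Multiset.le_iff_exists_add.1 s2.left_le
      refine ⟨T₄ + (R + (B : Multiset N)), ?_⟩
      rw [hR]
      ext c
      simp only [← Multiset.coe_add, ← Multiset.cons_coe, Multiset.count_add, Multiset.count_cons]
      omega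
    rw [e4] at hgok e5
    rw [e1] at hfok
    have := s3.merge_aux hS s4 s2 (T' := T') (T := T) ?_ hT' hT ?_ e4.symm e1.symm hgok hfok
      (fun c hc hc' => hφγ c hc' hc)
    · have e7 : ((u :: (φ ++ v :: γ) : List N) : Cycle N) = ((v :: (γ ++ u :: φ) : List N) : Cycle N) := by
        grind [Cycle.coe_append_comm]
      rw [e7]
      simp_all
    · ext c
      have h1 := congrArg (Multiset.count c) e3
      have h2 := congrArg (Multiset.count c) e6
      have h3 := congrArg (Multiset.count c) hT'
      grind [Multiset.count_add]
    · grind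
  · obtain ⟨x', a', A', B', b', y', F₃, F₄, T₃, T₄, e4, e5, s3, s4, e6⟩ := s2.exists_flip hg
    rw [e4] at hgok e5
    rw [e1] at hfok
    have := s1.merge_aux hS s3 s4 e3 e6 hT ?_ e1.symm e4.symm hfok hgok hφγ
    · have e8 : F = F₁ + F₃ + F₄ := by
        rw [e4, e5, ← Multiset.singleton_add] at e2
        have : ({((a' :: (A' ++ b' :: B'.reverse) : List N) : Cycle N)} : Multiset _) + F =
            {((a' :: (A' ++ b' :: B'.reverse) : List N) : Cycle N)} + (F₁ + F₃ + F₄) := by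
          rw [e2]; simp only [← Multiset.singleton_add]; abel
        exact add_left_cancel this
      rw [e8]; exact this
    · grind

end Merge3

section Gordan

/-- **Gordan's theorem** for a finite family of linear functionals. -/
theorem gordan {E ι : Type*} [AddCommGroup E] [Module ℝ E] (s : Finset ι) (L : ι → E →ₗ[ℝ] ℝ) :
    (∃ X, ∀ i ∈ s, 0 < L i X) ∨
    ∃ w : ι → ℝ, (∀ i ∈ s, 0 ≤ w i) ∧ (∃ i ∈ s, 0 < w i) ∧ ∀ X, ∑ i ∈ s, w i * L i X = 0 := by
  classical
  by_contra hcon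
  push Not at hcon
  obtain ⟨h1, h2⟩ := hcon
  let M : E →ₗ[ℝ] (s → ℝ) := LinearMap.pi fun i => L i
  let C : Set (s → ℝ) := {z | ∀ i, 0 < z i}
  have hCo : IsOpen C := by
    have : C = ⋂ i, {z | 0 < z i} := by ext; simp [C]
    rw [this]
    exact isOpen_iInter_of_finite fun i => isOpen_lt continuous_const (continuous_apply i)
  have hCc : Convex ℝ C := by
    intro a ha b hb p q hp hq hpq i
    simp only [Pi.add_apply, Pi.smul_apply, smul_eq_mul]
    have := ha i; have := hb i
    rcases hp.eq_or_lt with rfl | hp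
    · simp_all
    · nlinarith
  have hdisj : Disjoint C (LinearMap.range M : Set (s → ℝ)) := by
    rw [Set.disjoint_left]
    rintro z hz ⟨X, rfl⟩
    obtain ⟨i, hi, h⟩ := h1 X
    exact absurd (hz ⟨i, hi⟩) (not_lt.2 h)
  obtain ⟨f, u, hfC, hfM⟩ := geometric_hahn_banach_open hCc hCo (LinearMap.range M).convex hdisj
  have hfM0 : ∀ X, f (M X) = 0 := by
    intro X
    by_contra hne
    have := hfM (M (((u - 1) / f (M X)) • X)) ⟨_, rfl⟩
    rw [map_smul, map_smul, smul_eq_mul, div_mul_cancel₀ _ hne] at this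
    linarith
  have hu : u ≤ 0 := by simpa [hfM0] using hfM (M 0) ⟨0, rfl⟩
  have hrep : ∀ z : s → ℝ, f z = ∑ i, z i * f (Pi.single i 1) := by
    intro z
    conv_lhs => rw [← Finset.univ_sum_single z]
    rw [map_sum]
    refine Finset.sum_congr rfl fun i _ => ?_
    have : (Pi.single i (z i) : s → ℝ) = z i • Pi.single i 1 := by
      rw [← Pi.single_smul]; simp
    rw [this, map_smul, smul_eq_mul]
  have hneg : ∀ i : s, f (Pi.single i 1) ≤ 0 := by
    intro i
    by_contra hpos
    push Not at hpos
    let c : ℝ := |f 1| / f (Pi.single i 1)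
    have hc : 0 ≤ c := div_nonneg (abs_nonneg _) hpos.le
    have hm : (1 + c • Pi.single i 1 : s → ℝ) ∈ C := by
      intro j
      simp only [Pi.add_apply, Pi.one_apply, Pi.smul_apply, smul_eq_mul]
      by_cases hj : j = i
      · subst hj; simp; linarith
      · simp [Pi.single_eq_of_ne hj]
    have := hfC _ hm
    rw [map_add, map_smul, smul_eq_mul, div_mul_cancel₀ _ hpos.ne'] at this
    have := neg_abs_le (f 1)
    linarith
  let w : ι → ℝ := fun i => if h : i ∈ s then - f (Pi.single ⟨i, h⟩ 1) else 0
  have hw : ∀ i : s, w i = - f (Pi.single i 1) := fun i => by simp [w]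
  have hsum : ∀ X, ∑ i ∈ s, w i * L i X = 0 := by
    intro X
    rw [← Finset.sum_coe_sort]
    have := hfM0 X
    rw [hrep] at this
    rw [← neg_eq_zero, ← Finset.sum_neg_distrib, ← this]
    refine Finset.sum_congr rfl fun i _ => ?_
    rw [hw]
    simp [M]; ring
  refine absurd hsum (not_forall.2 (h2 w (fun i hi => by grind) ?_))
  by_contra hall
  push Not at hall
  have h0 : ∀ i : s, f (Pi.single i 1) = 0 := fun i => by grind
  have : f 1 = 0 := by rw [hrep]; simp [h0]
  have := hfC 1 (fun i => by simp)
  linarith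

end Gordan

section Tent

/-- An unnormalised tent function of `u` supported on `[p, q]` with apex at `v`. -/
def tent (p v q u : ℝ) : ℝ := (q - v) * |u - p| + (v - p) * |u - q| - (q - p) * |u - v|

theorem tent_eq_zero_of_le {p v q u : ℝ} (h1 : p ≤ v) (h2 : v ≤ q) (h : u ≤ p) :
    tent p v q u = 0 := by
  unfold tent
  rw [abs_of_nonpos (by linarith), abs_of_nonpos (by linarith), abs_of_nonpos (by linarith)]
  ring

theorem tent_eq_zero_of_ge {p v q u : ℝ} (h1 : p ≤ v) (h2 : v ≤ q) (h : q ≤ u) :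
    tent p v q u = 0 := by
  unfold tent
  rw [abs_of_nonneg (by linarith), abs_of_nonneg (by linarith), abs_of_nonneg (by linarith)]
  ring

theorem tent_pos {p v q u : ℝ} (h1 : p < v) (h2 : v < q) (h3 : p < u) (h4 : u < q) :
    0 < tent p v q u := by
  unfold tent
  rw [abs_of_pos (by linarith), abs_of_neg (by linarith)]
  rcases le_total u v with h | h
  · rw [abs_of_nonpos (by linarith)]
    have := mul_pos (sub_pos.2 h2) (sub_pos.2 h3)
    nlinarith
  · rw [abs_of_nonneg (by linarith)]
    have := mul_pos (sub_pos.2 h1) (sub_pos.2 h4)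
    nlinarith

theorem tent_nonneg {p v q u : ℝ} (h1 : p ≤ v) (h2 : v ≤ q) : 0 ≤ tent p v q u := by
  rcases le_or_gt u p with h | h
  · rw [tent_eq_zero_of_le h1 h2 h]
  rcases le_or_gt q u with h' | h'
  · rw [tent_eq_zero_of_ge h1 h2 h']
  rcases h1.eq_or_lt with rfl | h1
  · unfold tent; simp
  rcases h2.eq_or_lt with rfl | h2
  · unfold tent; simp
  exact (tent_pos h1 h2 h h').le

variable {N : Type*}

/-- The functional measuring (up to a positive factor) the signed horizontal distance from `v`
to the segment `pq`, for points with prescribed heights `Y`. -/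
def lever (Y : N → ℝ) (v p q : N) : (N → ℝ) →ₗ[ℝ] ℝ :=
  (Y q - Y v) • LinearMap.proj p + (Y v - Y p) • LinearMap.proj q - (Y q - Y p) • LinearMap.proj v

theorem lever_apply (Y : N → ℝ) (v p q : N) (X : N → ℝ) :
    lever Y v p q X = (Y q - Y v) * X p + (Y v - Y p) * X q - (Y q - Y p) * X v := rfl

theorem lever_abs (Y : N → ℝ) (v p q : N) (y : ℝ) :
    lever Y v p q (fun w => |y - Y w|) = tent (Y p) (Y v) (Y q) y := rfl

end Tent

section Sweep
variable {N : Type*}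

/-- A sequence of paths, each obtained from the preceding one by flipping an arc `A t` with
ends `a t`, `b t` to an arc `B t`. -/
structure Sweep (l r : List N) (F : Multiset (Cycle N)) (T : Multiset N) where
  n : ℕ
  P : ℕ → List N
  x : ℕ → List N
  a : ℕ → N
  A : ℕ → List N
  B : ℕ → List N
  b : ℕ → N
  y : ℕ → List N
  start : P 0 = l
  final : P n = r
  left : ∀ t < n, P t = x t ++ a t :: (A t ++ b t :: y t)
  right : ∀ t < n, P (t + 1) = x t ++ a t :: (B t ++ b t :: y t)
  nodup : ∀ t ≤ n, (P t).Nodup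
  conv : ∀ i j k, i ≤ j → j ≤ k → k ≤ n → ∀ w, w ∈ P i → w ∈ P k → w ∈ P j
  dead : ∀ t < n, ∀ v ∈ A t, v ∉ P (t + 1)
  fresh : ∀ t < n, ∀ v ∈ B t, v ∉ P t
  face_mem : ∀ t < n, (↑(a t :: (A t ++ b t :: (B t).reverse)) : Cycle N) ∈ F
  face_surj : ∀ f ∈ F, ∃ t < n, f = ↑(a t :: (A t ++ b t :: (B t).reverse))
  mem_total : ∀ t ≤ n, ∀ w ∈ P t, w ∈ T
  total_mem : ∀ w ∈ T, ∃ t ≤ n, w ∈ P t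

theorem Steps.nonempty_sweep [Inhabited N] {l r : List N} {F : Multiset (Cycle N)} {T : Multiset N}
    (h : Steps l r F T) (hT : T.Nodup) : Nonempty (Sweep l r F T) := by
  classical
  induction h with
  | refl l =>
    have hl : l.Nodup := by simpa using hT
    refine ⟨{ n := 0, P := fun _ => l, x := fun _ => [], A := fun _ => [], B := fun _ => [],
              y := fun _ => [], a := fun _ => default, b := fun _ => default, start := rfl, final := rfl,
              left := by simp, right := by simp, nodup := fun _ _ => hl,
              conv := fun _ _ _ _ _ _ _ h _ => h,
              dead := by simp, fresh := by simp, face_mem := ?_, face_surj := ?_,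
              mem_total := fun _ _ w hw => by simpa using hw,
              total_mem := fun w hw => ⟨0, le_rfl, by simpa using hw⟩ }⟩
    · simp
    · simp
  | cons x a A B b y r F T h ih =>
    obtain ⟨s⟩ := ih (Multiset.nodup_add.1 hT).2.1
    have hdis : ∀ v ∈ A, v ∉ T := fun v hv hv' =>
      (Multiset.disjoint_left.1 (Multiset.nodup_add.1 hT).2.2 (by simpa using hv)) hv'
    have hP0 := s.start
    have hnd0 := s.nodup 0 (Nat.zero_le _)
    rw [hP0] at hnd0
    have hmem0 : ∀ w ∈ x ++ a :: (B ++ b :: y), w ∈ T := fun w hw =>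
      s.mem_total 0 (Nat.zero_le _) w (by rw [hP0]; exact hw)
    have hBA : ∀ v ∈ B, v ∉ A := fun v hv hv' => hdis v hv' (hmem0 v (by simp [hv]))
    have hnd : (x ++ a :: (A ++ b :: y)).Nodup :=
      (Steps.cons x a A B b y r F T h).nodup_left hT
    refine ⟨{ n := s.n + 1, P := fun t => t.casesOn (x ++ a :: (A ++ b :: y)) s.P,
              x := fun t => t.casesOn x s.x, a := fun t => t.casesOn a s.a,
              A := fun t => t.casesOn A s.A, B := fun t => t.casesOn B s.B,
              b := fun t => t.casesOn b s.b, y := fun t => t.casesOn y s.y,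
              start := rfl, final := s.final, left := ?_, right := ?_, nodup := ?_,
              conv := ?_, dead := ?_, fresh := ?_, face_mem := ?_, face_surj := ?_,
              mem_total := ?_, total_mem := ?_ }⟩
    · rintro (_ | t) ht
      · rfl
      · exact s.left t (by omega)
    · rintro (_ | t) ht
      · exact hP0
      · exact s.right t (by omega)
    · rintro (_ | t) ht
      · exact hnd
      · exact s.nodup t (by omega)
    · rintro (_ | i) (_ | j) (_ | k) hij hjk hk w hi hk'
      · exact hi
      · exact hi
      · omega
      · have hw : w ∈ T := s.mem_total k (by omega) w hk'
        refine s.conv 0 j k (by omega) (by omega) (by omega) w ?_ hk'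
        rw [hP0]
        have : w ∉ A := fun h => hdis w h hw
        replace hi : w ∈ x ++ a :: (A ++ b :: y) := hi
        simp only [List.mem_append, List.mem_cons] at hi ⊢
        tauto
      · omega
      · omega
      · omega
      · exact s.conv i j k (by omega) (by omega) (by omega) w hi hk'
    · rintro (_ | t) ht v hv
      · exact fun h => hdis v hv (s.mem_total 0 (by omega) v h)
      · exact s.dead t (by omega) v hv
    · rintro (_ | t) ht v hv
      · intro h
        have h1 := hBA v hv
        have h2 : v ∈ B := hv
        replace h : v ∈ x ++ a :: (A ++ b :: y) := h
        clear hv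
        simp only [List.nodup_append, List.nodup_cons, List.mem_append, List.mem_cons] at hnd0 h
        grind
      · exact s.fresh t (by omega) v hv
    · rintro (_ | t) ht
      · simp
      · exact Multiset.mem_cons_of_mem (s.face_mem t (by omega))
    · intro f hf
      rcases Multiset.mem_cons.1 hf with rfl | hf
      · exact ⟨0, by omega, rfl⟩
      · obtain ⟨t, ht, h⟩ := s.face_surj f hf
        exact ⟨t + 1, by omega, h⟩
    · rintro (_ | t) ht w hw
      · aesop
      · have := s.mem_total t (by omega) w hw
        simp [this]
    · intro w hw
      rcases Multiset.mem_add.1 hw with hw | hw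
      · exact ⟨0, by omega, by simp_all⟩
      · obtain ⟨t, ht, h⟩ := s.total_mem w hw
        exact ⟨t + 1, by omega, h⟩

theorem injOn_of_pairwise_lt {Y : N → ℝ} {l : List N} (h : l.Pairwise (fun u v => Y u < Y v))
    {u v : N} (hu : u ∈ l) (hv : v ∈ l) (huv : Y u = Y v) : u = v := by
  induction l with
  | nil => simp at hu
  | cons w l ih =>
    rw [List.pairwise_cons] at h
    rcases List.mem_cons.1 hu with hu | hu <;> rcases List.mem_cons.1 hv with hv | hv
    · rw [hu, hv]
    · grind
    · grind
    · exact ih h.2 hu hv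

theorem exists_increasing (B : List N) (hB : B.Nodup) {lo hi : ℝ} (h : lo < hi) {U : Set ℝ}
    (hU : U.Finite) :
    ∃ g : N → ℝ, B.Pairwise (fun u v => g u < g v) ∧ ∀ v ∈ B, lo < g v ∧ g v < hi ∧ g v ∉ U := by
  classical
  induction B generalizing lo with
  | nil => exact ⟨fun _ => 0, by simp⟩
  | cons v B ih =>
    obtain ⟨z, ⟨hz1, hz2⟩, hz⟩ := (Set.Ioo_infinite h).exists_notMem_finite hU
    rw [List.nodup_cons] at hB
    obtain ⟨g, hg1, hg2⟩ := ih hB.2 hz2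
    have hne : ∀ w ∈ B, w ≠ v := fun w hw h => hB.1 (h ▸ hw)
    have hup : ∀ w ∈ B, Function.update g v z w = g w := fun w hw =>
      Function.update_of_ne (hne w hw) _ _
    refine ⟨Function.update g v z, ?_, ?_⟩
    · rw [List.pairwise_cons]
      refine ⟨fun w hw => ?_, ?_⟩
      · grind
      · refine hg1.imp_of_mem fun hu hw hlt => ?_
        rw [hup _ hu, hup _ hw]; exact hlt
    · grind

theorem Sweep.exists_heights {l r : List N} {F : Multiset (Cycle N)} {T : Multiset N}
    (s : Sweep l r F T) :
    ∃ Y : N → ℝ, (∀ t ≤ s.n, (s.P t).Pairwise (fun u v => Y u < Y v)) ∧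
      ∀ u ∈ T, ∀ v ∈ T, Y u = Y v → u = v := by
  classical
  have key : ∀ k ≤ s.n, ∃ Y : N → ℝ, (∀ t ≤ k, (s.P t).Pairwise (fun u v => Y u < Y v)) ∧
      ∀ i ≤ k, ∀ j ≤ k, ∀ u ∈ s.P i, ∀ v ∈ s.P j, Y u = Y v → u = v := by
    intro k
    induction k with
    | zero =>
      intro _
      obtain ⟨g, hg, -⟩ := exists_increasing (s.P 0) (s.nodup 0 (by omega)) zero_lt_one
        (Set.finite_empty)
      refine ⟨g, fun t ht => by rwa [Nat.le_zero.1 ht], fun i hi j hj u hu v hv huv => ?_⟩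
      rw [Nat.le_zero.1 hi] at hu
      rw [Nat.le_zero.1 hj] at hv
      exact injOn_of_pairwise_lt hg hu hv huv
    | succ k ih =>
      intro hk
      obtain ⟨Y, hY1, hY2⟩ := ih (by omega)
      have hl := s.left k (by omega)
      have hr := s.right k (by omega)
      have hp := hY1 k le_rfl
      have hab : Y (s.a k) < Y (s.b k) := by grind
      let U : Set ℝ := Y '' {w | ∃ i ≤ k, w ∈ s.P i}
      have hU : U.Finite := by
        refine Set.Finite.image _ ?_
        refine (Multiset.finite_toSet T).subset ?_
        rintro w ⟨i, hi, hw⟩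
        exact s.mem_total i (by omega) w hw
      have hnd := s.nodup (k + 1) hk
      obtain ⟨g, hg1, hg2⟩ := exists_increasing (s.B k) (by grind) hab hU
      let Y' : N → ℝ := fun w => if w ∈ s.B k then g w else Y w
      have hB : ∀ w ∈ s.B k, Y' w = g w := fun w hw => if_pos hw
      have hnB : ∀ w, w ∉ s.B k → Y' w = Y w := fun w hw => if_neg hw
      have hold : ∀ i ≤ k, ∀ w ∈ s.P i, Y' w = Y w := fun i hi w hw => hnB w fun hwB =>
        s.fresh k (by omega) w hwB (s.conv i k (k + 1) hi (by omega) hk w hw (by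
          rw [hr]; simp [hwB]))
      have hmem : ∀ w ∈ s.P (k + 1), w ∈ s.B k ∨ w ∈ s.P k := by grind
      have hcases : ∀ i ≤ k + 1, ∀ w ∈ s.P i, (w ∈ s.B k) ∨ (w ∉ s.B k ∧ ∃ j ≤ k, w ∈ s.P j) := by
        grind
      have hginj : ∀ u ∈ s.B k, ∀ v ∈ s.B k, g u = g v → u = v :=
        fun u hu v hv huv => injOn_of_pairwise_lt hg1 hu hv huv
      refine ⟨Y', ?_, ?_⟩
      · intro t ht
        rcases Nat.lt_or_ge t (k + 1) with h' | h'
        · refine (hY1 t (by omega)).imp_of_mem fun hu hv h => ?_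
          rw [hold t (by omega) _ hu, hold t (by omega) _ hv]
          exact h
        · obtain rfl : t = k + 1 := by omega
          have e : ∀ w ∈ s.P k, Y' w = Y w := hold k le_rfl
          rw [hl] at hp e
          rw [hr]
          simp only [List.pairwise_append, List.pairwise_cons, List.mem_append,
              List.mem_cons] at hp e ⊢
          have ea : Y' (s.a k) = Y (s.a k) := e _ (by simp)
          have eb : Y' (s.b k) = Y (s.b k) := e _ (by simp)
          have ex : ∀ w ∈ s.x k, Y' w = Y w := fun w hw => e _ (by simp [hw])
          have ey : ∀ w ∈ s.y k, Y' w = Y w := fun w hw => e _ (by simp [hw])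
          obtain ⟨p1, ⟨p2, -, ⟨p3, p4⟩, p5⟩, p6⟩ := hp
          refine ⟨p1.imp_of_mem fun hu hv h => by rw [ex _ hu, ex _ hv]; exact h,
            ⟨?_, hg1.imp_of_mem fun hu hv h => by rw [hB _ hu, hB _ hv]; exact h,
              ⟨fun w hw => by rw [eb, ey w hw]; exact p3 w hw,
               p4.imp_of_mem fun hu hv h => by rw [ey _ hu, ey _ hv]; exact h⟩, ?_⟩, ?_⟩
          · grind
          · grind
          · grind
      · intro i hi j hj u hu v hv huv
        rcases hcases i hi u hu with h1 | ⟨h1, i', hi', hu'⟩ <;>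
          rcases hcases j hj v hv with h2 | ⟨h2, j', hj', hv'⟩
        · grind
        · grind
        · grind
        · grind
  obtain ⟨Y, h1, h2⟩ := key s.n le_rfl
  refine ⟨Y, h1, fun u hu v hv huv => ?_⟩
  obtain ⟨i, hi, hi'⟩ := s.total_mem u hu
  obtain ⟨j, hj, hj'⟩ := s.total_mem v hv
  exact h2 i hi j hj u hi' v hj' huv
end Sweep

section Chord
variable {N : Type*}

/-- A cell `f` carries a potential compatible with the values `base` prescribed on its chords;
there is at most one chord up to reversal, or there are two chords with alternating ends. -/
def ChordOK (S base : N → N → ℝ) (ch : N → N → Prop) (f : Cycle N) : Prop :=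
  ∃ ψ : N → ℝ, f.Chain (fun u v => S u v < ψ v - ψ u) ∧
    (∀ p q, ch p q → p ∈ f ∧ q ∈ f ∧ base p q = ψ q - ψ p) ∧
    ((∃ c e, ∀ p q, ch p q → (p = c ∧ q = e) ∨ (p = e ∧ q = c)) ∨
      ∃ c d e g, ∃ l : List N, f = ↑l ∧ List.Sublist [c, d, e, g] l ∧
        (∀ p q, ch p q → (p = c ∧ q = e) ∨ (p = e ∧ q = c) ∨ (p = d ∧ q = g) ∨ (p = g ∧ q = d)) ∧
        ψ g - ψ c ≤ base c g ∧ ψ c - ψ d ≤ base d c ∧ ψ d - ψ e ≤ base e d ∧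
        ψ e - ψ g ≤ base g e)

theorem ChordOK.faceOK {S base : N → N → ℝ} {ch : N → N → Prop} {f : Cycle N}
    (h : ChordOK S base ch f) : FaceOK S f := ⟨_, h.choose_spec.1⟩

theorem exists_split_of_lt {Y : N → ℝ} {Z : List N} (hZ : Z.Pairwise fun u v => Y u < Y v)
    {p q : N} (hp : p ∈ Z) (hq : q ∈ Z) (hpq : Y p < Y q) : ∃ L M R, Z = L ++ p :: (M ++ q :: R) := by
  obtain ⟨L, R, rfl⟩ := List.append_of_mem hp
  rcases List.mem_append.1 hq with h | h
  · grind
  · rcases List.mem_cons.1 h with rfl | h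
    · grind
    · obtain ⟨M, R', rfl⟩ := List.append_of_mem h
      exact ⟨L, M, R', rfl⟩

theorem order_four {Y : N → ℝ} {Z B l : List N} {c d e g : N}
    (hZ : Z.Pairwise fun u v => Y u < Y v) (hn : (Z ++ B).Nodup)
    (hl : ((l : List N) : Cycle N) = ((Z ++ B : List N) : Cycle N))
    (hs : List.Sublist [c, d, e, g] l) (hc : c ∈ Z) (hd : d ∈ Z) (he : e ∈ Z) (hg : g ∈ Z) :
    (Y c < Y d ∧ Y d < Y e ∧ Y e < Y g) ∨ (Y d < Y e ∧ Y e < Y g ∧ Y g < Y c) ∨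
    (Y e < Y g ∧ Y g < Y c ∧ Y c < Y d) ∨ (Y g < Y c ∧ Y c < Y d ∧ Y d < Y e) := by
  obtain ⟨n, hn', h⟩ := List.isRotated_iff_mod.1 (Cycle.coe_eq_coe.1 hl)
  rw [List.rotate_eq_drop_append_take hn'] at h
  have h0 := List.take_append_drop n l
  generalize List.take n l = u at *
  generalize List.drop n l = v at *
  subst h0
  obtain ⟨s₁, s₂, h12, h1, h2⟩ := List.sublist_append_iff.1 hs
  have h21 : List.Sublist (s₂ ++ s₁) (Z ++ B) := h ▸ h2.append h1
  have hall : ∀ w ∈ s₂ ++ s₁, w ∈ Z := by grind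
  obtain ⟨t₁, t₂, h12', h1', h2'⟩ := List.sublist_append_iff.1 h21
  have ht : t₂ = [] := by
    rw [List.eq_nil_iff_forall_not_mem]
    intro w hw
    have h3 : w ∈ Z := hall w (by rw [h12']; simp [hw])
    exact (List.nodup_append.1 hn).2.2 w h3 w (h2'.subset hw) rfl
  subst ht
  rw [List.append_nil] at h12'
  have hp := hZ.sublist (h12' ▸ h1')
  rcases s₁ with _ | ⟨_, _ | ⟨_, _ | ⟨_, _ | ⟨_, s₁⟩⟩⟩⟩ <;>
    simp only [List.nil_append, List.cons_append, List.cons.injEq] at h12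
  · grind
  · grind
  · grind
  · grind
  · aesop

set_option maxHeartbeats 400000 in
/-- If rods joining vertices of an arc `a :: (A ++ [b])` of a cell are the chords of the cell or the
opposite arc, then their union spans a segment of the arc whose sum is less than the base. -/
theorem ChordOK.exists_span {S base : N → N → ℝ} {ch : N → N → Prop} {Y : N → ℝ} {a b : N}
    {A B : List N} (hS : ∀ u v, S u v = - S v u)
    (h : ChordOK S base ch ((a :: (A ++ b :: B) : List N) : Cycle N))
    (hn : (a :: (A ++ b :: B)).Nodup)
    (hY : (a :: (A ++ [b])).Pairwise fun u v => Y u < Y v) (hb : B = [] → base a b = S a b)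
    (R : N → N → Prop) (hR : ∀ p q, R p q → Y p < Y q ∧ p ∈ a :: (A ++ [b]) ∧ q ∈ a :: (A ++ [b]) ∧
      ((p = a ∧ q = b ∧ B = []) ∨ ch p q)) (hne : ∃ p q, R p q) :
    ∃ α β L M L', a :: (A ++ [b]) = L ++ α :: (M ++ β :: L') ∧
      psum S (α :: (M ++ [β])) < base α β ∧
      ∀ y, (∃ p q, R p q ∧ Y p < y ∧ y < Y q) ↔ (Y α < y ∧ y < Y β) := by
  obtain ⟨ψ, hψ, hch, hor⟩ := h
  rw [Cycle.chain_coe_cons] at hψ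
  have e : a :: (A ++ b :: B ++ [a]) = (a :: (A ++ [b])) ++ (B ++ [a]) := by simp
  have e' : a :: (A ++ b :: B ++ [a]) = (a :: A) ++ (b :: (B ++ [a])) := by simp
  have hψ2 := (e' ▸ hψ).right_of_append
  rw [e] at hψ
  have hψ1 := hψ.left_of_append
  have hrange : ∀ p ∈ a :: (A ++ [b]), Y a ≤ Y p ∧ Y p ≤ Y b := by
    have := hY
    simp only [List.pairwise_append, List.pairwise_cons, List.mem_append] at this
    intro p hp
    simp only [List.mem_cons, List.mem_append, List.not_mem_nil, or_false] at hp
    have hab := this.1 b (by simp)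
    rcases hp with rfl | hp | rfl
    · exact ⟨le_rfl, hab.le⟩
    · grind
    · exact ⟨hab.le, le_rfl⟩
  have hdec : ∀ p q, p ∈ a :: (A ++ [b]) → q ∈ a :: (A ++ [b]) → Y p < Y q → ∃ L M L',
      a :: (A ++ [b]) = L ++ p :: (M ++ q :: L') ∧ psum S (p :: (M ++ [q])) < ψ q - ψ p := by
    intro p q hp hq hpq
    obtain ⟨L, M, L', hd⟩ := exists_split_of_lt hY hp hq hpq
    refine ⟨L, M, L', hd, psum_lt_of_isChain S ψ _ _ _ ?_⟩
    rw [hd] at hψ1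
    exact hψ1.infix ⟨L, L', by simp⟩
  by_cases hab : R a b ∧ B = []
  · obtain ⟨hab, rfl⟩ := hab
    refine ⟨a, b, [], A, [], by simp, ?_, fun y => ⟨?_, fun hy => ⟨a, b, hab, hy⟩⟩⟩
    · have h1 := psum_lt_of_isChain S ψ _ _ _ hψ1
      have h2 : S b a < ψ a - ψ b := by simpa using hψ2
      rw [hb rfl, hS a b]
      linarith
    · grind
  have hRch : ∀ p q, R p q → ch p q := by grind
  have single : ∀ p q, R p q → (∀ p' q', R p' q' → p' = p ∧ q' = q) →
      ∃ α β L M L', a :: (A ++ [b]) = L ++ α :: (M ++ β :: L') ∧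
      psum S (α :: (M ++ [β])) < base α β ∧
      ∀ y, (∃ p q, R p q ∧ Y p < y ∧ y < Y q) ↔ (Y α < y ∧ y < Y β) := by
    intro p q hpq hu
    obtain ⟨h1, h2, h3, -⟩ := hR p q hpq
    obtain ⟨L, M, L', h4, h5⟩ := hdec p q h2 h3 h1
    refine ⟨p, q, L, M, L', h4, by rw [(hch p q (hRch p q hpq)).2.2]; exact h5, fun y =>
      ⟨?_, fun h => ⟨p, q, hpq, h⟩⟩⟩
    rintro ⟨p', q', h', hy⟩
    obtain ⟨rfl, rfl⟩ := hu p' q' h'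
    exact hy
  obtain ⟨p, q, hpq⟩ := hne
  have hasym : ∀ p q, R p q → ¬ R q p := fun p q h h' => (hR p q h).1.not_gt (hR q p h').1
  rcases hor with ⟨c, e, hce⟩ | ⟨c, d, e, g, l, hl, hsub, hcdeg, i1, i2, i3, i4⟩
  · refine single p q hpq fun p' q' h' => ?_
    rcases hce p q (hRch p q hpq) with ⟨rfl, rfl⟩ | ⟨rfl, rfl⟩ <;>
      rcases hce p' q' (hRch p' q' h') with ⟨rfl, rfl⟩ | ⟨rfl, rfl⟩
    · exact ⟨rfl, rfl⟩
    · grind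
    · grind
    · exact ⟨rfl, rfl⟩
  · by_cases h1 : R c e ∨ R e c
    swap
    · push Not at h1
      have h2 : ∀ p q, R p q → (p = d ∧ q = g) ∨ (p = g ∧ q = d) := by
        intro p q h
        rcases hcdeg p q (hRch p q h) with ⟨rfl, rfl⟩ | ⟨rfl, rfl⟩ | h' | h'
        · exact absurd h h1.1
        · exact absurd h h1.2
        · exact Or.inl h'
        · exact Or.inr h'
      refine single p q hpq fun p' q' h' => ?_
      rcases h2 p q hpq with ⟨rfl, rfl⟩ | ⟨rfl, rfl⟩ <;> rcases h2 p' q' h' with ⟨rfl, rfl⟩ | ⟨rfl,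
          rfl⟩
      · exact ⟨rfl, rfl⟩
      · exact absurd h' (hasym _ _ hpq)
      · exact absurd h' (hasym _ _ hpq)
      · exact ⟨rfl, rfl⟩
    by_cases h1' : R d g ∨ R g d
    swap
    · push Not at h1'
      have h2 : ∀ p q, R p q → (p = c ∧ q = e) ∨ (p = e ∧ q = c) := by
        intro p q h
        rcases hcdeg p q (hRch p q h) with h' | h' | ⟨rfl, rfl⟩ | ⟨rfl, rfl⟩
        · exact Or.inl h'
        · exact Or.inr h'
        · exact absurd h h1'.1
        · exact absurd h h1'.2
      refine single p q hpq fun p' q' h' => ?_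
      rcases h2 p q hpq with ⟨rfl, rfl⟩ | ⟨rfl, rfl⟩ <;> rcases h2 p' q' h' with ⟨rfl, rfl⟩ | ⟨rfl,
          rfl⟩
      · exact ⟨rfl, rfl⟩
      · exact absurd h' (hasym _ _ hpq)
      · exact absurd h' (hasym _ _ hpq)
      · exact ⟨rfl, rfl⟩
    have hce : c ∈ a :: (A ++ [b]) ∧ e ∈ a :: (A ++ [b]) := by
      rcases h1 with h | h
      · exact ⟨(hR _ _ h).2.1, (hR _ _ h).2.2.1⟩
      · exact ⟨(hR _ _ h).2.2.1, (hR _ _ h).2.1⟩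
    have hdg : d ∈ a :: (A ++ [b]) ∧ g ∈ a :: (A ++ [b]) := by
      rcases h1' with h | h
      · exact ⟨(hR _ _ h).2.1, (hR _ _ h).2.2.1⟩
      · exact ⟨(hR _ _ h).2.2.1, (hR _ _ h).2.1⟩
    have double : ∀ w₁ w₂ w₃ w₄, w₁ ∈ a :: (A ++ [b]) → w₄ ∈ a :: (A ++ [b]) →
        Y w₁ < Y w₂ → Y w₂ < Y w₃ → Y w₃ < Y w₄ →
        (R w₁ w₃ ∨ R w₃ w₁) → (R w₂ w₄ ∨ R w₄ w₂) → ψ w₄ - ψ w₁ ≤ base w₁ w₄ →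
        (∀ p q, R p q → (p = w₁ ∧ q = w₃) ∨ (p = w₃ ∧ q = w₁) ∨ (p = w₂ ∧ q = w₄) ∨ (p = w₄ ∧ q = w₂)) →
        ∃ α β L M L', a :: (A ++ [b]) = L ++ α :: (M ++ β :: L') ∧
        psum S (α :: (M ++ [β])) < base α β ∧
        ∀ y, (∃ p q, R p q ∧ Y p < y ∧ y < Y q) ↔ (Y α < y ∧ y < Y β) := by
      intro w₁ w₂ w₃ w₄ m1 m4 l1 l2 l3 r1 r2 hb hall
      replace r1 : R w₁ w₃ := r1.resolve_right fun h => by linarith [(hR _ _ h).1]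
      replace r2 : R w₂ w₄ := r2.resolve_right fun h => by linarith [(hR _ _ h).1]
      obtain ⟨L, M, L', h4, h5⟩ := hdec w₁ w₄ m1 m4 (by linarith)
      refine ⟨w₁, w₄, L, M, L', h4, h5.trans_le hb, fun y => ⟨?_, fun ⟨y1, y2⟩ => ?_⟩⟩
      · rintro ⟨p, q, hpq, y1, y2⟩
        have := (hR p q hpq).1
        rcases hall p q hpq with ⟨rfl, rfl⟩ | ⟨rfl, rfl⟩ | ⟨rfl, rfl⟩ | ⟨rfl, rfl⟩ <;>
          constructor <;> linarith
      · rcases lt_or_ge y (Y w₃) with h | h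
        · exact ⟨_, _, r1, y1, h⟩
        · exact ⟨_, _, r2, by linarith, y2⟩
    have hall := fun p q h => hcdeg p q (hRch p q h)
    rcases order_four hY (B := B) (l := l) (by simpa using hn) (by rw [← hl]; simp) hsub
      hce.1 hdg.1 hce.2 hdg.2 with ⟨l1, l2, l3⟩ | ⟨l1, l2, l3⟩ | ⟨l1, l2, l3⟩ | ⟨l1, l2, l3⟩
    · exact double c d e g hce.1 hdg.2 l1 l2 l3 h1 h1' i1 hall
    · exact double d e g c hdg.1 hce.1 l1 l2 l3 h1' h1.symm i2
        fun p q h => by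
          rcases hall p q h with h' | h' | h' | h'
          exacts [Or.inr (Or.inr (Or.inr h')), Or.inr (Or.inr (Or.inl h')), Or.inl h',
              Or.inr (Or.inl h')]
    · exact double e g c d hce.2 hdg.1 l1 l2 l3 h1.symm h1'.symm i3
        fun p q h => by
          rcases hall p q h with h' | h' | h' | h'
          exacts [Or.inr (Or.inl h'), Or.inl h', Or.inr (Or.inr (Or.inr h')),
              Or.inr (Or.inr (Or.inl h'))]
    · exact double g c d e hdg.2 hce.2 l1 l2 l3 h1'.symm h1 i4
        fun p q h => by
          rcases hall p q h with h' | h' | h' | h'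
          exacts [Or.inr (Or.inr (Or.inl h')), Or.inr (Or.inr (Or.inr h')), Or.inr (Or.inl h'),
              Or.inl h']

end Chord

section Flip
variable {N : Type*}

/-- The function of the height obtained by testing `C` against minus the distance functions. -/
def pot (Y : N → ℝ) (C : (N → ℝ) →ₗ[ℝ] ℝ) (y : ℝ) : ℝ := - C fun w => |y - Y w|

/-- A weighted sum of levers. -/
def leverSum (Y : N → ℝ) (K : Finset (N × N × N)) (w : N × N × N → ℝ) : (N → ℝ) →ₗ[ℝ] ℝ :=
  ∑ j ∈ K, w j • lever Y j.1 j.2.1 j.2.2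

/-- A weighted sum of tents. -/
def tentSum (Y : N → ℝ) (K : Finset (N × N × N)) (w : N × N × N → ℝ) (y : ℝ) : ℝ :=
  ∑ j ∈ K, w j * tent (Y j.2.1) (Y j.1) (Y j.2.2) y

theorem leverSum_apply (Y : N → ℝ) (K : Finset (N × N × N)) (w : N × N × N → ℝ) (X : N → ℝ) :
    leverSum Y K w X = ∑ j ∈ K, w j * ((Y j.2.2 - Y j.1) * X j.2.1 + (Y j.1 - Y j.2.1) * X j.2.2
      - (Y j.2.2 - Y j.2.1) * X j.1) := by
  simp [leverSum, lever_apply]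

theorem leverSum_abs (Y : N → ℝ) (K : Finset (N × N × N)) (w : N × N × N → ℝ) (y : ℝ) :
    leverSum Y K w (fun v => |y - Y v|) = tentSum Y K w y := by
  simp [leverSum, tentSum, lever_abs]

/-- A flip of an arc `A` to an arc `B`, together with the change of a functional. -/
structure Flip (Y : N → ℝ) (x : List N) (a : N) (A B : List N) (b : N) (y : List N)
    (C C' : (N → ℝ) →ₗ[ℝ] ℝ) (KA KB : Finset (N × N × N)) (lam mu : N × N × N → ℝ) : Prop where
  sortL : (x ++ a :: (A ++ b :: y)).Pairwise fun u v => Y u < Y v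
  sortR : (x ++ a :: (B ++ b :: y)).Pairwise fun u v => Y u < Y v
  dead : ∀ v ∈ A, v ∉ x ++ a :: (B ++ b :: y)
  fresh : ∀ v ∈ B, v ∉ x ++ a :: (A ++ b :: y)
  suppL : ∀ X : N → ℝ, (∀ w ∈ x ++ a :: (A ++ b :: y), X w = 0) → C X = 0
  suppR : ∀ X : N → ℝ, (∀ w ∈ x ++ a :: (B ++ b :: y), X w = 0) → C' X = 0
  step : ∀ X, C X + leverSum Y KA lam X = C' X + leverSum Y KB mu X
  memA : ∀ j ∈ KA, j.1 ∈ A ∧ Y j.2.1 < Y j.1 ∧ Y j.1 < Y j.2.2 ∧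
    j.2.1 ∈ a :: (A ++ b :: B) ∧ j.2.2 ∈ a :: (A ++ b :: B)
  memB : ∀ j ∈ KB, j.1 ∈ B ∧ Y j.2.1 < Y j.1 ∧ Y j.1 < Y j.2.2 ∧
    j.2.1 ∈ a :: (A ++ b :: B) ∧ j.2.2 ∈ a :: (A ++ b :: B)
  lam0 : ∀ j ∈ KA, 0 ≤ lam j
  mu0 : ∀ j ∈ KB, 0 ≤ mu j

namespace Flip
variable {Y : N → ℝ} {x : List N} {a : N} {A B : List N} {b : N} {y : List N}
    {C C' : (N → ℝ) →ₗ[ℝ] ℝ} {KA KB : Finset (N × N × N)} {lam mu : N × N × N → ℝ}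

theorem symm (h : Flip Y x a A B b y C C' KA KB lam mu) :
    Flip Y x a B A b y C' C KB KA mu lam where
  sortL := h.sortR
  sortR := h.sortL
  dead := h.fresh
  fresh := h.dead
  suppL := h.suppR
  suppR := h.suppL
  step := fun X => (h.step X).symm
  memA := fun j hj => by
    have := h.memB j hj
    simp only [List.mem_cons, List.mem_append] at this ⊢
    tauto
  memB := fun j hj => by
    have := h.memA j hj
    simp only [List.mem_cons, List.mem_append] at this ⊢
    tauto
  lam0 := h.mu0
  mu0 := h.lam0

theorem lt (h : Flip Y x a A B b y C C' KA KB lam mu) : Y a < Y b := by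
  have := h.sortL
  simp only [List.pairwise_append, List.pairwise_cons, List.mem_append, List.mem_cons] at this
  exact this.2.1.1 b (by simp)

theorem range_left (h : Flip Y x a A B b y C C' KA KB lam mu) {v : N} (hv : v ∈ A) :
    Y a < Y v ∧ Y v < Y b := by
  have := h.sortL
  simp only [List.pairwise_append, List.pairwise_cons, List.mem_append, List.mem_cons] at this
  exact ⟨this.2.1.1 v (by simp [hv]), this.2.1.2.2.2 v hv b (by simp)⟩

theorem range (h : Flip Y x a A B b y C C' KA KB lam mu) {v : N} (hv : v ∈ a :: (A ++ b :: B)) :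
    Y a ≤ Y v ∧ Y v ≤ Y b := by
  have hab := h.lt
  simp only [List.mem_cons, List.mem_append] at hv
  rcases hv with rfl | hv | rfl | hv
  · exact ⟨le_rfl, hab.le⟩
  · exact ⟨(h.range_left hv).1.le, (h.range_left hv).2.le⟩
  · exact ⟨hab.le, le_rfl⟩
  · exact ⟨(h.symm.range_left hv).1.le, (h.symm.range_left hv).2.le⟩

theorem range_lower (h : Flip Y x a A B b y C C' KA KB lam mu) {v : N} (hv : v ∈ x) :
    Y v < Y a := by
  have := h.sortL
  simp only [List.pairwise_append, List.pairwise_cons, List.mem_append, List.mem_cons] at this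
  exact this.2.2 v hv a (by simp)

theorem range_upper (h : Flip Y x a A B b y C C' KA KB lam mu) {v : N} (hv : v ∈ y) :
    Y b < Y v := by
  have := h.sortL
  simp only [List.pairwise_append, List.pairwise_cons, List.mem_append, List.mem_cons] at this
  exact this.2.1.2.2.1.1 v hv

theorem eval_eq (h : Flip Y x a A B b y C C' KA KB lam mu) {X : N → ℝ}
    (hX : ∀ w, ¬ (Y a < Y w ∧ Y w < Y b) → X w = 0) :
    ∃ XA XB : N → ℝ, (∀ w ∈ A, XA w = X w) ∧ (∀ w ∉ A, XA w = 0) ∧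
      (∀ w ∈ B, XB w = X w) ∧ (∀ w ∉ B, XB w = 0) ∧
      C X + leverSum Y KA lam X =
        ∑ j ∈ KA, lam j * ((Y j.2.2 - Y j.1) * XB j.2.1 + (Y j.1 - Y j.2.1) * XB j.2.2) +
        ∑ j ∈ KB, mu j * ((Y j.2.2 - Y j.1) * XA j.2.1 + (Y j.1 - Y j.2.1) * XA j.2.2) := by
  classical
  let XA : N → ℝ := fun w => if w ∈ A then X w else 0
  let XB : N → ℝ := fun w => if w ∈ B then X w else 0
  have hA1 : ∀ w ∈ A, XA w = X w := fun w hw => if_pos hw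
  have hA0 : ∀ w ∉ A, XA w = 0 := fun w hw => if_neg hw
  have hB1 : ∀ w ∈ B, XB w = X w := fun w hw => if_pos hw
  have hB0 : ∀ w ∉ B, XB w = 0 := fun w hw => if_neg hw
  have hAB : ∀ w ∈ A, w ∉ B := fun w hw hw' => h.dead w hw (by simp [hw'])
  have hBA : ∀ w ∈ B, w ∉ A := fun w hw hw' => hAB w hw' hw
  refine ⟨XA, XB, hA1, hA0, hB1, hB0, ?_⟩
  let Xr : N → ℝ := X - XA - XB
  have hXr : ∀ w, w ∈ a :: (A ++ b :: B) ∨ w ∈ x ∨ w ∈ y → Xr w = 0 := by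
    intro w hw
    have e : Xr w = X w - XA w - XB w := rfl
    by_cases h1 : w ∈ A
    · grind
    by_cases h2 : w ∈ B
    · grind
    rw [e, hA0 w h1, hB0 w h2, hX w, sub_zero, sub_zero]
    simp only [List.mem_cons, List.mem_append, h1, h2, false_or, or_false] at hw
    rintro ⟨l1, l2⟩
    rcases hw with (rfl | rfl) | hw | hw
    · exact lt_irrefl _ l1
    · exact lt_irrefl _ l2
    · exact (h.range_lower hw).not_gt l1
    · exact (h.range_upper hw).not_gt l2
  have e : X = Xr + XA + XB := by grind
  have e1 : C Xr = 0 := h.suppL _ fun w hw => hXr w (by grind)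
  have e2 : leverSum Y KA lam Xr = 0 := by
    rw [leverSum_apply]
    refine Finset.sum_eq_zero fun j hj => ?_
    obtain ⟨m1, -, -, m2, m3⟩ := h.memA j hj
    rw [hXr j.1 (Or.inl (by simp [m1])), hXr _ (Or.inl m2), hXr _ (Or.inl m3)]
    ring
  have e3 : C' XA = 0 := h.suppR _ fun w hw => hA0 w fun hw' => h.dead w hw' hw
  have e4 : C XB = 0 := h.suppL _ fun w hw => hB0 w fun hw' => h.fresh w hw' hw
  have e5 := h.step XA
  have e6 : leverSum Y KB mu XA =
      ∑ j ∈ KB, mu j * ((Y j.2.2 - Y j.1) * XA j.2.1 + (Y j.1 - Y j.2.1) * XA j.2.2) := by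
    rw [leverSum_apply]
    refine Finset.sum_congr rfl fun j hj => ?_
    rw [hA0 j.1 (hBA _ (h.memB j hj).1)]
    ring
  have e7 : leverSum Y KA lam XB =
      ∑ j ∈ KA, lam j * ((Y j.2.2 - Y j.1) * XB j.2.1 + (Y j.1 - Y j.2.1) * XB j.2.2) := by
    rw [leverSum_apply]
    refine Finset.sum_congr rfl fun j hj => ?_
    rw [hB0 j.1 (hAB _ (h.memA j hj).1)]
    ring
  rw [← e7, ← e6]
  conv_lhs => rw [e]
  simp only [map_add]
  linarith

theorem eval_nonneg (h : Flip Y x a A B b y C C' KA KB lam mu) {X : N → ℝ} (h0 : ∀ w, 0 ≤ X w)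
    (hX : ∀ w, ¬ (Y a < Y w ∧ Y w < Y b) → X w = 0) : 0 ≤ C X + leverSum Y KA lam X := by
  obtain ⟨XA, XB, hA1, hA0, hB1, hB0, e⟩ := h.eval_eq hX
  have hA : ∀ w, 0 ≤ XA w := fun w => by
    by_cases hw : w ∈ A
    · rw [hA1 w hw]; exact h0 w
    · rw [hA0 w hw]
  have hB : ∀ w, 0 ≤ XB w := fun w => by
    by_cases hw : w ∈ B
    · rw [hB1 w hw]; exact h0 w
    · rw [hB0 w hw]
  rw [e]
  refine add_nonneg (Finset.sum_nonneg fun j hj => ?_) (Finset.sum_nonneg fun j hj => ?_)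
  · obtain ⟨-, l1, l2, -⟩ := h.memA j hj
    exact mul_nonneg (h.lam0 j hj) (add_nonneg (mul_nonneg (by linarith) (hB _))
      (mul_nonneg (by linarith) (hB _)))
  · obtain ⟨-, l1, l2, -⟩ := h.memB j hj
    exact mul_nonneg (h.mu0 j hj) (add_nonneg (mul_nonneg (by linarith) (hA _))
      (mul_nonneg (by linarith) (hA _)))

theorem eval_pos (h : Flip Y x a A B b y C C' KA KB lam mu) {X : N → ℝ} (h0 : ∀ w, 0 ≤ X w)
    (hX : ∀ w, ¬ (Y a < Y w ∧ Y w < Y b) → X w = 0) {j : N × N × N} (hj : j ∈ KA)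
    (hl : 0 < lam j) {p : N} (hp : p = j.2.1 ∨ p = j.2.2) (hpB : p ∈ B) (hXp : 0 < X p) :
    0 < C X + leverSum Y KA lam X := by
  obtain ⟨XA, XB, hA1, hA0, hB1, hB0, e⟩ := h.eval_eq hX
  have hA : ∀ w, 0 ≤ XA w := fun w => by
    by_cases hw : w ∈ A
    · rw [hA1 w hw]; exact h0 w
    · rw [hA0 w hw]
  have hB : ∀ w, 0 ≤ XB w := fun w => by
    by_cases hw : w ∈ B
    · rw [hB1 w hw]; exact h0 w
    · rw [hB0 w hw]
  rw [e]
  refine add_pos_of_pos_of_nonneg (Finset.sum_pos' (fun j hj => ?_) ⟨j, hj, ?_⟩)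
    (Finset.sum_nonneg fun j hj => ?_)
  · obtain ⟨-, l1, l2, -⟩ := h.memA j hj
    exact mul_nonneg (h.lam0 j hj) (add_nonneg (mul_nonneg (by linarith) (hB _))
      (mul_nonneg (by linarith) (hB _)))
  · obtain ⟨-, l1, l2, -⟩ := h.memA j hj
    refine mul_pos hl ?_
    have hp' : 0 < XB p := by rw [hB1 p hpB]; exact hXp
    rcases hp with rfl | rfl
    · exact add_pos_of_pos_of_nonneg (mul_pos (by linarith) hp') (mul_nonneg (by linarith) (hB _))
    · exact add_pos_of_nonneg_of_pos (mul_nonneg (by linarith) (hB _)) (mul_pos (by linarith) hp')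
  · obtain ⟨-, l1, l2, -⟩ := h.memB j hj
    exact mul_nonneg (h.mu0 j hj) (add_nonneg (mul_nonneg (by linarith) (hA _))
      (mul_nonneg (by linarith) (hA _)))

/-- The potential between the two stages of a flip. -/
theorem mid_eq (h : Flip Y x a A B b y C C' KA KB lam mu) (z : ℝ) :
    pot Y C z - tentSum Y KA lam z = pot Y C' z - tentSum Y KB mu z := by
  have := h.step fun w => |z - Y w|
  rw [leverSum_abs, leverSum_abs] at this
  unfold pot
  linarith

theorem eval_tent (Y : N → ℝ) (C : (N → ℝ) →ₗ[ℝ] ℝ) (KA : Finset (N × N × N))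
    (lam : N × N × N → ℝ) (y1 z y2 : ℝ) :
    C (fun w => tent y1 z y2 (Y w)) + leverSum Y KA lam (fun w => tent y1 z y2 (Y w)) =
      (y2 - y1) * (pot Y C z - tentSum Y KA lam z) - (y2 - z) * (pot Y C y1 - tentSum Y KA lam y1)
        - (z - y1) * (pot Y C y2 - tentSum Y KA lam y2) := by
  have e : (fun w => tent y1 z y2 (Y w)) = (y2 - z) • (fun w => |y1 - Y w|) +
      (z - y1) • (fun w => |y2 - Y w|) - (y2 - y1) • (fun w => |z - Y w|) := by
    ext w
    simp [tent, abs_sub_comm (Y w)]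
  rw [e]
  simp only [map_add, map_sub, map_smul, leverSum_abs, smul_eq_mul]
  unfold pot
  ring

theorem concave (h : Flip Y x a A B b y C C' KA KB lam mu) {y1 z y2 : ℝ} (h1 : Y a ≤ y1)
    (h2 : y1 ≤ z) (h3 : z ≤ y2) (h4 : y2 ≤ Y b) :
    (y2 - z) * (pot Y C y1 - tentSum Y KA lam y1) + (z - y1) * (pot Y C y2 - tentSum Y KA lam y2)
      ≤ (y2 - y1) * (pot Y C z - tentSum Y KA lam z) := by
  have := h.eval_nonneg (X := fun w => tent y1 z y2 (Y w)) (fun w => tent_nonneg h2 h3) (by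
    intro w hw
    rw [not_and_or, not_lt, not_lt] at hw
    rcases hw with hw | hw
    · exact tent_eq_zero_of_le h2 h3 (hw.trans h1)
    · exact tent_eq_zero_of_ge h2 h3 (h4.trans hw))
  rw [eval_tent] at this
  linarith

theorem strictConcave (h : Flip Y x a A B b y C C' KA KB lam mu) {j : N × N × N} (hj : j ∈ KA)
    (hl : 0 < lam j) {p : N} (hp : p = j.2.1 ∨ p = j.2.2) (hpB : p ∈ B) :
    (Y b - Y p) * (pot Y C (Y a) - tentSum Y KA lam (Y a)) +
      (Y p - Y a) * (pot Y C (Y b) - tentSum Y KA lam (Y b))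
      < (Y b - Y a) * (pot Y C (Y p) - tentSum Y KA lam (Y p)) := by
  obtain ⟨h2, h3⟩ := h.symm.range_left hpB
  have := h.eval_pos (X := fun w => tent (Y a) (Y p) (Y b) (Y w))
    (fun w => tent_nonneg h2.le h3.le) (by
    intro w hw
    rw [not_and_or, not_lt, not_lt] at hw
    rcases hw with hw | hw
    · exact tent_eq_zero_of_le h2.le h3.le hw
    · exact tent_eq_zero_of_ge h2.le h3.le hw) hj hl hp hpB (tent_pos h2 h3 h2 h3)
  rw [eval_tent] at this
  linarith

theorem tentSum_nonneg (h : Flip Y x a A B b y C C' KA KB lam mu) (z : ℝ) :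
    0 ≤ tentSum Y KA lam z :=
  Finset.sum_nonneg fun j hj => mul_nonneg (h.lam0 j hj)
    (tent_nonneg (h.memA j hj).2.1.le (h.memA j hj).2.2.1.le)

theorem tentSum_pos_iff (h : Flip Y x a A B b y C C' KA KB lam mu) (z : ℝ) :
    0 < tentSum Y KA lam z ↔ ∃ j ∈ KA, 0 < lam j ∧ Y j.2.1 < z ∧ z < Y j.2.2 := by
  have hterm : ∀ j ∈ KA, 0 ≤ lam j * tent (Y j.2.1) (Y j.1) (Y j.2.2) z := fun j hj =>
    mul_nonneg (h.lam0 j hj) (tent_nonneg (h.memA j hj).2.1.le (h.memA j hj).2.2.1.le)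
  constructor
  · intro hpos
    by_contra hcon
    push Not at hcon
    refine hpos.ne' (Finset.sum_eq_zero fun j hj => ?_)
    obtain ⟨-, l1, l2, -⟩ := h.memA j hj
    rcases (h.lam0 j hj).eq_or_lt with h0 | h0
    · rw [← h0, zero_mul]
    rcases lt_or_ge (Y j.2.1) z with h1 | h1
    · rw [tent_eq_zero_of_ge l1.le l2.le (hcon j hj h0 h1), mul_zero]
    · rw [tent_eq_zero_of_le l1.le l2.le h1, mul_zero]
  · rintro ⟨j, hj, hl, h1, h2⟩
    obtain ⟨-, l1, l2, -⟩ := h.memA j hj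
    exact Finset.sum_pos' hterm ⟨j, hj, mul_pos hl (tent_pos l1 l2 h1 h2)⟩

theorem tentSum_eq_zero (h : Flip Y x a A B b y C C' KA KB lam mu) {z : ℝ}
    (hz : z ≤ Y a ∨ Y b ≤ z) : tentSum Y KA lam z = 0 := by
  refine (h.tentSum_nonneg z).antisymm' (not_lt.1 fun hpos => ?_)
  obtain ⟨j, hj, -, l1, l2⟩ := (h.tentSum_pos_iff z).1 hpos
  obtain ⟨-, -, -, m1, m2⟩ := h.memA j hj
  have := (h.range m1).1
  have := (h.range m2).2
  rcases hz with hz | hz <;> linarith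

theorem pot_eq (h : Flip Y x a A B b y C C' KA KB lam mu) {z : ℝ}
    (hz : z ≤ Y a ∨ Y b ≤ z) : pot Y C' z = pot Y C z := by
  have := h.mid_eq z
  rw [h.tentSum_eq_zero hz, h.symm.tentSum_eq_zero hz] at this
  linarith

theorem mid_nonneg (h : Flip Y x a A B b y C C' KA KB lam mu) (hC : ∀ z, 0 ≤ pot Y C z) (z : ℝ)
    (h1 : Y a ≤ z) (h2 : z ≤ Y b) : 0 ≤ pot Y C z - tentSum Y KA lam z := by
  have := h.concave le_rfl h1 h2 le_rfl
  rw [h.tentSum_eq_zero (Or.inl le_rfl), h.tentSum_eq_zero (Or.inr le_rfl), sub_zero, sub_zero]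
    at this
  have l := h.lt
  have h3 := mul_nonneg (sub_nonneg.2 h2) (hC (Y a))
  have h4 := mul_nonneg (sub_nonneg.2 h1) (hC (Y b))
  exact nonneg_of_mul_nonneg_right (by linarith) (sub_pos.2 l)

theorem pot_nonneg (h : Flip Y x a A B b y C C' KA KB lam mu) (hC : ∀ z, 0 ≤ pot Y C z) (z : ℝ) :
    0 ≤ pot Y C' z := by
  by_cases hz : z ≤ Y a ∨ Y b ≤ z
  · rw [h.pot_eq hz]; exact hC z
  · push Not at hz
    have h1 := h.mid_nonneg hC z hz.1.le hz.2.le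
    have h2 := h.mid_eq z
    have h3 := h.symm.tentSum_nonneg z
    linarith

theorem mid_dichotomy (h : Flip Y x a A B b y C C' KA KB lam mu) (hC : ∀ z, 0 ≤ pot Y C z) :
    (∀ z, Y a < z → z < Y b → 0 < pot Y C z - tentSum Y KA lam z) ∨
    (∀ z, Y a ≤ z → z ≤ Y b → pot Y C z - tentSum Y KA lam z = 0) := by
  by_contra! hcon
  obtain ⟨⟨z0, h1, h2, h3⟩, z, h4, h5, h6⟩ := hcon
  have h7 := h.mid_nonneg hC
  have h8 := h7 z0 h1.le h2.le
  have h9 := h7 z h4 h5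
  have ha := h7 (Y a) le_rfl h.lt.le
  have hb := h7 (Y b) h.lt.le le_rfl
  have h0 : pot Y C z0 - tentSum Y KA lam z0 = 0 := le_antisymm h3 h8
  have hz : 0 < pot Y C z - tentSum Y KA lam z := lt_of_le_of_ne h9 (Ne.symm h6)
  rcases lt_trichotomy z z0 with l | l | l
  · have := h.concave h4 l.le h2.le le_rfl
    rw [h0] at this
    have := mul_pos (sub_pos.2 h2) hz
    have := mul_nonneg (sub_nonneg.2 l.le) hb
    linarith
  · rw [l] at hz; linarith
  · have := h.concave le_rfl h1.le l.le h5
    rw [h0] at this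
    have := mul_pos (sub_pos.2 h1) hz
    have := mul_nonneg (sub_nonneg.2 l.le) ha
    linarith

end Flip
end Flip

section Block
variable {N : Type*}

/-- On every segment of the path between consecutive zeros of the potential, the path sum exceeds
the base. -/
def BlockOK (S base : N → N → ℝ) (Y : N → ℝ) (C : (N → ℝ) →ₗ[ℝ] ℝ) (P : List N) : Prop :=
  ∀ L α M β R, P = L ++ α :: (M ++ β :: R) → pot Y C (Y α) = 0 → pot Y C (Y β) = 0 →
    (∀ z, Y α < z → z < Y β → 0 < pot Y C z) → base α β < psum S (α :: (M ++ [β]))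

/-- The pairs that vertices on the other side of the cell must avoid. -/
def IsRod (ch : N → N → Prop) (P : List N) (p q : N) : Prop := [p, q] <:+: P ∨ ch p q

theorem infix_pair_ends {a b p q : N} {B : List N} (h : [p, q] <:+: a :: (B ++ [b]))
    (hp : p ∉ B) (hq : q ∉ B) : p = a ∧ q = b ∧ B = [] := by
  obtain ⟨L, R, h⟩ := h
  rcases B with _ | ⟨c, B⟩
  · rcases L with _ | ⟨_, L⟩
    · simp at h; exact ⟨h.1, h.2.1, rfl⟩
    · have := congrArg List.length h; simp at this; omega
  · exfalso
    rcases L with _ | ⟨d, L⟩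
    · grind
    · simp only [List.cons_append, List.append_assoc, List.cons.injEq, List.nil_append] at h
      have h2 : L ++ p :: q :: R = (c :: B) ++ [b] := by simpa using h.2
      have : p ∈ c :: B := by
        rcases R.eq_nil_or_concat with rfl | ⟨R', e, rfl⟩
        · have h3 : (L ++ [p]) ++ [q] = (c :: B) ++ [b] := by simpa using h2
          rw [← (List.append_inj' h3 rfl).1]; simp
        · grind [List.append_inj']
      exact hp this

/-- The compatibility data of a single flip. -/
structure FlipOK (S base : N → N → ℝ) (ch : N → N → Prop) (a : N) (A B : List N) (b : N) : Prop where
  anti : ∀ u v, S u v = - S v u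
  base_anti : ∀ u v, base u v = - base v u
  ch_symm : ∀ p q, ch p q → ch q p
  chord : ChordOK S base ch ((a :: (A ++ b :: B.reverse) : List N) : Cycle N)
  edgeL : A = [] → base a b = S a b
  edgeR : B = [] → base a b = S a b

namespace Flip
variable {S base : N → N → ℝ} {ch : N → N → Prop}
variable {Y : N → ℝ} {x : List N} {a : N} {A B : List N} {b : N} {y : List N}
    {C C' : (N → ℝ) →ₗ[ℝ] ℝ} {KA KB : Finset (N × N × N)} {lam mu : N × N × N → ℝ}

theorem sort_left (h : Flip Y x a A B b y C C' KA KB lam mu) :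
    (a :: (A ++ [b])).Pairwise fun u v => Y u < Y v :=
  h.sortL.sublist (List.IsInfix.sublist ⟨x, y, by simp⟩)

theorem nodup_face (h : Flip Y x a A B b y C C' KA KB lam mu) : (a :: (A ++ b :: B.reverse)).Nodup := by
  have hp : ∀ {l : List N}, l.Pairwise (fun u v => Y u < Y v) → l.Nodup := fun h =>
    h.imp fun h e => by rw [e] at h; exact lt_irrefl _ h
  have h1 := hp h.sort_left
  have h2 := hp h.symm.sort_left
  have h3 : ∀ v ∈ A, v ∉ B := fun v hv hv' => h.dead v hv (by simp [hv'])
  grind [List.nodup_reverse]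

theorem span_left (h : Flip Y x a A B b y C C' KA KB lam mu) (ok : FlipOK S base ch a A B b)
    (R : N → N → Prop) (hR : ∀ p q, R p q → Y p < Y q ∧ p ∈ a :: (A ++ [b]) ∧ q ∈ a :: (A ++ [b]) ∧
      ((p = a ∧ q = b ∧ B = []) ∨ ch p q)) (hne : ∃ p q, R p q) :
    ∃ α β L M L', a :: (A ++ [b]) = L ++ α :: (M ++ β :: L') ∧
      psum S (α :: (M ++ [β])) < base α β ∧
      ∀ y, (∃ p q, R p q ∧ Y p < y ∧ y < Y q) ↔ (Y α < y ∧ y < Y β) :=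
  ok.chord.exists_span ok.anti h.nodup_face h.sort_left (fun e => ok.edgeR (by simpa using e)) R
    (fun p q hpq => by simpa using hR p q hpq) hne

theorem span_right (h : Flip Y x a A B b y C C' KA KB lam mu) (ok : FlipOK S base ch a A B b)
    (R : N → N → Prop) (hR : ∀ p q, R p q → Y p < Y q ∧ p ∈ a :: (B ++ [b]) ∧ q ∈ a :: (B ++ [b]) ∧
      ((p = a ∧ q = b ∧ A = []) ∨ ch p q)) (hne : ∃ p q, R p q) :
    ∃ α β L M L', a :: (B ++ [b]) = L ++ α :: (M ++ β :: L') ∧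
      base α β < psum S (α :: (M ++ [β])) ∧
      ∀ y, (∃ p q, R p q ∧ Y p < y ∧ y < Y q) ↔ (Y α < y ∧ y < Y β) := by
  have hc := ok.chord
  have ecyc : ((a :: (A ++ b :: B.reverse) : List N) : Cycle N) = (b :: (B.reverse ++ a :: A) : List N) :=
    Cycle.coe_append_comm (a :: A) (b :: B.reverse)
  rw [ecyc] at hc
  have hn : (b :: (B.reverse ++ a :: A)).Nodup := by grind [h.nodup_face]
  have erev : b :: (B.reverse ++ [a]) = (a :: (B ++ [b])).reverse := by simp
  obtain ⟨β, α, L, M, L', e1, e2, e3⟩ := hc.exists_span (Y := fun v => - Y v) ok.anti hn (by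
      rw [erev, List.pairwise_reverse]
      simpa using h.symm.sort_left) (fun e => by
      rw [ok.base_anti, ok.edgeL e, ← ok.anti]) (fun p q => R q p) (by
      intro p q hpq
      obtain ⟨h1, h2, h3, h4⟩ := hR q p hpq
      refine ⟨by simpa using h1, by rw [erev, List.mem_reverse]; exact h3,
        by rw [erev, List.mem_reverse]; exact h2, ?_⟩
      rcases h4 with ⟨h4, h5, h6⟩ | h4
      · exact Or.inl ⟨h5, h4, h6⟩
      · exact Or.inr (ok.ch_symm _ _ h4))
    (by obtain ⟨p, q, h⟩ := hne; exact ⟨q, p, h⟩)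
  rw [erev] at e1
  refine ⟨α, β, L'.reverse, M.reverse, L.reverse, ?_, ?_, fun z => ?_⟩
  · rw [← List.reverse_inj, e1]; simp
  · have := psum_reverse S ok.anti (β :: (M ++ [α]))
    have e : (β :: (M ++ [α])).reverse = α :: (M.reverse ++ [β]) := by simp
    rw [e] at this
    rw [ok.base_anti] at e2
    linarith
  · have := e3 (-z)
    simp only [neg_lt_neg_iff] at this
    constructor
    · rintro ⟨p, q, h1, h2, h3⟩
      exact (this.1 ⟨q, p, h1, h3, h2⟩).symm
    · grind

theorem mem_of_rod (h : Flip Y x a A B b y C C' KA KB lam mu)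
    (hmid : ∀ z, Y a ≤ z → z ≤ Y b → pot Y C z - tentSum Y KA lam z = 0)
    {j : N × N × N} (hj : j ∈ KA) (hl : 0 < lam j) {p : N} (hp : p = j.2.1 ∨ p = j.2.2) : p ∉ B := by
  intro hpB
  have := h.strictConcave hj hl hp hpB
  obtain ⟨h1, h2⟩ := h.symm.range_left hpB
  rw [hmid _ le_rfl h.lt.le, hmid _ h.lt.le le_rfl, hmid _ h1.le h2.le] at this
  linarith

theorem rod_spec (h : Flip Y x a A B b y C C' KA KB lam mu)
    (hrod : ∀ j ∈ KA, IsRod ch (a :: (B ++ [b])) j.2.1 j.2.2)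
    (hmid : ∀ z, Y a ≤ z → z ≤ Y b → pot Y C z - tentSum Y KA lam z = 0)
    {j : N × N × N} (hj : j ∈ KA) (hl : 0 < lam j) :
    Y j.2.1 < Y j.2.2 ∧ j.2.1 ∈ a :: (A ++ [b]) ∧ j.2.2 ∈ a :: (A ++ [b]) ∧
      ((j.2.1 = a ∧ j.2.2 = b ∧ B = []) ∨ ch j.2.1 j.2.2) := by
  obtain ⟨m0, l1, l2, m1, m2⟩ := h.memA j hj
  have n1 := h.mem_of_rod hmid hj hl (Or.inl rfl)
  have n2 := h.mem_of_rod hmid hj hl (Or.inr rfl)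
  refine ⟨l1.trans l2, ?_, ?_, ?_⟩
  · grind
  · grind
  · rcases hrod j hj with hr | hr
    · grind [infix_pair_ends]
    · exact Or.inr hr

theorem lam_eq_zero (h : Flip Y x a A B b y C C' KA KB lam mu) (ok : FlipOK S base ch a A B b)
    (hrod : ∀ j ∈ KA, IsRod ch (a :: (B ++ [b])) j.2.1 j.2.2)
    (hblock : BlockOK S base Y C (x ++ a :: (A ++ b :: y)))
    (hmid : ∀ z, Y a ≤ z → z ≤ Y b → pot Y C z - tentSum Y KA lam z = 0) :
    ∀ j ∈ KA, lam j = 0 := by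
  intro j hj
  by_contra hne
  have hl : 0 < lam j := lt_of_le_of_ne (h.lam0 j hj) (Ne.symm hne)
  obtain ⟨α, β, L, M, L', e1, e2, e3⟩ := h.span_left ok
    (fun p q => ∃ j ∈ KA, 0 < lam j ∧ p = j.2.1 ∧ q = j.2.2) (by
      rintro p q ⟨j, hj, hl, rfl, rfl⟩
      exact h.rod_spec hrod hmid hj hl) ⟨_, _, j, hj, hl, rfl, rfl⟩
  have e3' : ∀ z, 0 < tentSum Y KA lam z ↔ Y α < z ∧ z < Y β := by grind [h.tentSum_pos_iff]
  have hα : α ∈ a :: (A ++ [b]) := by rw [e1]; simp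
  have hβ : β ∈ a :: (A ++ [b]) := by rw [e1]; simp
  have hr : ∀ v ∈ a :: (A ++ [b]), Y a ≤ Y v ∧ Y v ≤ Y b := fun v hv => h.range (by grind)
  have hz : ∀ v ∈ a :: (A ++ [b]), ¬ (Y α < Y v ∧ Y v < Y β) → pot Y C (Y v) = 0 := by
    intro v hv hn
    have h1 := hmid (Y v) (hr v hv).1 (hr v hv).2
    have h2 := h.tentSum_nonneg (Y v)
    have h3 := mt (e3' (Y v)).1 hn
    linarith
  have := hblock (x ++ L) α M β (L' ++ y) (by
    have : x ++ a :: (A ++ b :: y) = x ++ (a :: (A ++ [b])) ++ y := by simp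
    rw [this, e1]; simp) (hz α hα fun h => lt_irrefl _ h.1) (hz β hβ fun h => lt_irrefl _ h.2)
    fun z h1 h2 => by
      have h3 := hmid z ((hr α hα).1.trans h1.le) (h2.le.trans (hr β hβ).2)
      have h4 := (e3' z).2 ⟨h1, h2⟩
      linarith
  linarith

theorem sort_nodup {l : List N} (h : l.Pairwise fun u v => Y u < Y v) : l.Nodup :=
  h.imp fun h e => by rw [e] at h; exact lt_irrefl _ h

theorem block_mid (h : Flip Y x a A B b y C C' KA KB lam mu) (ok : FlipOK S base ch a A B b)
    (hrod : ∀ j ∈ KB, IsRod ch (a :: (A ++ [b])) j.2.1 j.2.2)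
    (hmid : ∀ z, Y a ≤ z → z ≤ Y b → pot Y C z - tentSum Y KA lam z = 0)
    {L M R : List N} {α β : N} (e : x ++ a :: (B ++ b :: y) = L ++ α :: (M ++ β :: R))
    (hα : Y a ≤ Y α) (hβ : Y β ≤ Y b) (zα : pot Y C' (Y α) = 0) (zβ : pot Y C' (Y β) = 0)
    (hpos : ∀ z, Y α < z → z < Y β → 0 < pot Y C' z) : base α β < psum S (α :: (M ++ [β])) := by
  have hmid' : ∀ z, Y a ≤ z → z ≤ Y b → pot Y C' z - tentSum Y KB mu z = 0 := fun z h1 h2 => by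
    rw [← h.mid_eq]; exact hmid z h1 h2
  have hlt : Y α < Y β := by grind [h.sortR]
  have t : ∀ z, Y a ≤ z → z ≤ Y b → tentSum Y KB mu z = pot Y C' z := fun z h1 h2 => by
    linarith [hmid' z h1 h2]
  have tα : ¬ 0 < tentSum Y KB mu (Y α) := by rw [t _ hα (by linarith), zα]; exact lt_irrefl _
  have tβ : ¬ 0 < tentSum Y KB mu (Y β) := by rw [t _ (by linarith) hβ, zβ]; exact lt_irrefl _
  let R0 : N → N → Prop := fun p q => ∃ j ∈ KB, 0 < mu j ∧ p = j.2.1 ∧ q = j.2.2 ∧ Y α ≤ Y p ∧ Y q ≤ Y β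
  have hcov : ∀ z, Y α < z → z < Y β → ∃ p q, R0 p q ∧ Y p < z ∧ z < Y q := by
    grind [h.symm.tentSum_pos_iff]
  obtain ⟨α', β', L', M', R', e1, e2, e3⟩ := h.span_right ok R0 (by
    rintro p q ⟨j, hj, hl, rfl, rfl, -⟩
    exact h.symm.rod_spec hrod hmid' hj hl)
    (by
      obtain ⟨p, q, hpq, -⟩ := hcov ((Y α + Y β) / 2) (by linarith) (by linarith)
      exact ⟨p, q, hpq⟩)
  have hlt' : Y α' < Y β' := by
    have := e1 ▸ h.symm.sort_left
    simp only [List.pairwise_append, List.pairwise_cons] at this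
    exact this.2.1.1 β' (by simp)
  have e3' : ∀ z, (Y α < z ∧ z < Y β) ↔ (Y α' < z ∧ z < Y β') := by
    intro z
    rw [← e3]
    constructor
    · rintro ⟨h1, h2⟩; exact hcov z h1 h2
    · rintro ⟨p, q, ⟨j, hj, hl, rfl, rfl, h3, h4⟩, h1, h2⟩
      exact ⟨by linarith, by linarith⟩
  have hIoo : Set.Ioo (Y α) (Y β) = Set.Ioo (Y α') (Y β') := Set.ext e3'
  have hEα : Y α = Y α' := by
    have := congrArg sInf hIoo; rwa [csInf_Ioo hlt, csInf_Ioo hlt'] at this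
  have hEβ : Y β = Y β' := by
    have := congrArg sSup hIoo; rwa [csSup_Ioo hlt, csSup_Ioo hlt'] at this
  have e4 : x ++ a :: (B ++ b :: y) = (x ++ L') ++ α' :: (M' ++ β' :: (R' ++ y)) := by
    have : x ++ a :: (B ++ b :: y) = x ++ (a :: (B ++ [b])) ++ y := by simp
    rw [this, e1]; simp
  have hαα : α = α' := injOn_of_pairwise_lt h.sortR (by rw [e]; simp) (by rw [e4]; simp) hEα
  have hββ : β = β' := injOn_of_pairwise_lt h.sortR (by rw [e]; simp) (by rw [e4]; simp) hEβ
  subst hαα hββ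
  have hnd := sort_nodup h.sortR
  have h5 := (List.eq_of_append_cons (e.symm.trans e4) (e ▸ hnd)).2
  have hnd2 : (M ++ β :: R).Nodup := by
    have := e ▸ hnd
    simp only [List.nodup_append, List.nodup_cons] at this ⊢
    exact this.2.1.2
  have h6 := (List.eq_of_append_cons h5 hnd2).1
  rw [h6]; exact e2

theorem block_step (h : Flip Y x a A B b y C C' KA KB lam mu) (ok : FlipOK S base ch a A B b)
    (hrodA : ∀ j ∈ KA, IsRod ch (a :: (B ++ [b])) j.2.1 j.2.2)
    (hrodB : ∀ j ∈ KB, IsRod ch (a :: (A ++ [b])) j.2.1 j.2.2)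
    (hC : ∀ z, 0 ≤ pot Y C z)
    (hblock : BlockOK S base Y C (x ++ a :: (A ++ b :: y))) :
    BlockOK S base Y C' (x ++ a :: (B ++ b :: y)) := by
  intro L α M β R e zα zβ hpos
  have hnd := sort_nodup h.sortR
  have hsort := e ▸ h.sortR
  have hlt : Y α < Y β := by grind
  have hsplit := hsort
  simp only [List.pairwise_append, List.pairwise_cons, List.mem_append, List.mem_cons] at hsplit
  have ha : a ∈ L ++ α :: (M ++ β :: R) := by rw [← e]; simp
  have hb : b ∈ L ++ α :: (M ++ β :: R) := by rw [← e]; simp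
  simp only [List.mem_append, List.mem_cons] at ha hb
  -- below the flip
  by_cases c1 : Y β ≤ Y a
  · have : a = β ∨ a ∈ R := by grind
    have key : ∃ R', x ++ a :: (A ++ b :: y) = L ++ α :: (M ++ β :: R') := by
      rcases this with rfl | ha
      · grind [List.eq_of_append_cons]
      · obtain ⟨R1, R2, rfl⟩ := List.append_of_mem ha
        have e' : x ++ a :: (B ++ b :: y) = (L ++ α :: (M ++ β :: R1)) ++ a :: R2 := by simpa using e
        obtain ⟨h1, h2⟩ := List.eq_of_append_cons e' hnd
        exact ⟨R1 ++ a :: (A ++ b :: y), by rw [h1]; simp⟩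
    obtain ⟨R', key⟩ := key
    refine hblock L α M β R' key ?_ ?_ fun z h1 h2 => ?_
    · grind [h.pot_eq]
    · grind [h.pot_eq]
    · grind [h.pot_eq]
  -- above the flip
  by_cases c2 : Y b ≤ Y α
  · have : b = α ∨ b ∈ L := by grind
    have key : ∃ L', x ++ a :: (A ++ b :: y) = L' ++ α :: (M ++ β :: R) := by
      have hnd' : ((x ++ a :: B) ++ b :: y).Nodup := by simpa using hnd
      rcases this with rfl | hb
      · grind [List.eq_of_append_cons]
      · obtain ⟨L1, L2, rfl⟩ := List.append_of_mem hb
        have e' : (x ++ a :: B) ++ b :: y = L1 ++ b :: (L2 ++ α :: (M ++ β :: R)) := by simpa using e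
        obtain ⟨h1, h2⟩ := List.eq_of_append_cons e' hnd'
        exact ⟨x ++ a :: (A ++ b :: L2), by rw [h2]; simp⟩
    obtain ⟨L', key⟩ := key
    refine hblock L' α M β R key ?_ ?_ fun z h1 h2 => ?_
    · grind [h.pot_eq]
    · grind [h.pot_eq]
    · grind [h.pot_eq]
  push Not at c1 c2
  rcases h.mid_dichotomy hC with hmid | hmid
  · -- positive in the middle
    have hpos' : ∀ z, Y a < z → z < Y b → 0 < pot Y C' z := fun z h1 h2 => by
      have := h.mid_eq z
      have := hmid z h1 h2
      have := h.symm.tentSum_nonneg z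
      linarith
    have hα : Y α ≤ Y a := by grind
    have hβ : Y b ≤ Y β := by grind
    have ha' : a = α ∨ a ∈ M := by grind
    have hb' : b = β ∨ b ∈ M := by grind
    have key : ∃ p q, α :: (M ++ [β]) = p ++ a :: (B ++ b :: q) ∧ ∃ M',
        α :: (M' ++ [β]) = p ++ a :: (A ++ b :: q) := by
      have hab := h.lt
      have hnM : (α :: (M ++ [β])).Nodup := sort_nodup (hsort.sublist
        (List.IsInfix.sublist ⟨L, R, by simp⟩))
      have hins : ∀ u v : List N, M ++ [β] = u ++ b :: v → ∃ q', b :: v = q' ++ [β] := by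
        intro u v huv
        rcases v.eq_nil_or_concat with rfl | ⟨v', c, rfl⟩
        · simp_all
        · have : M ++ [β] = (u ++ b :: v') ++ [c] := by simpa using huv
          have := (List.append_inj' this rfl).2
          grind
      have hsp : ∃ p q, α :: (M ++ [β]) = p ++ a :: (B ++ b :: q) := by
        have m1 : a ∈ α :: (M ++ [β]) := by rcases ha' with h | h <;> simp [h]
        have m2 : b ∈ α :: (M ++ [β]) := by rcases hb' with h | h <;> simp [h]
        obtain ⟨p, m, q, hpq⟩ := exists_split_of_lt (hsort.sublist
          (List.IsInfix.sublist ⟨L, R, by simp⟩)) m1 m2 hab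
        refine ⟨p, q, ?_⟩
        have e5 : x ++ a :: (B ++ b :: y) = (L ++ p) ++ a :: (m ++ b :: (q ++ R)) := by
          have : L ++ α :: (M ++ β :: R) = L ++ (α :: (M ++ [β])) ++ R := by simp
          rw [e, this, hpq]; simp
        grind [List.eq_of_append_cons]
      obtain ⟨p, q, hpq⟩ := hsp
      refine ⟨p, q, hpq, ?_⟩
      rcases p with _ | ⟨c, p⟩
      · simp only [List.nil_append, List.cons.injEq] at hpq
        obtain ⟨rfl, hpq⟩ := hpq
        obtain ⟨q', hq'⟩ := hins B q hpq
        exact ⟨A ++ q', by simp [hq']⟩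
      · simp only [List.cons_append, List.cons.injEq] at hpq
        obtain ⟨rfl, hpq⟩ := hpq
        obtain ⟨q', hq'⟩ := hins (p ++ a :: B) q (by simpa using hpq)
        exact ⟨p ++ a :: (A ++ q'), by simp [hq']⟩
    obtain ⟨p, q, e1, M', e2⟩ := key
    have e3 : x ++ a :: (A ++ b :: y) = L ++ α :: (M' ++ β :: R) := by
      have e4 : x ++ a :: (B ++ b :: y) = (L ++ p) ++ a :: (B ++ b :: (q ++ R)) := by
        have : L ++ α :: (M ++ β :: R) = L ++ (α :: (M ++ [β])) ++ R := by simp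
        rw [e, this, e1]; simp
      obtain ⟨h1, h2⟩ := List.eq_of_append_cons e4 hnd
      have h3 : y = q ++ R := by simpa using h2
      have : L ++ α :: (M' ++ β :: R) = L ++ (α :: (M' ++ [β])) ++ R := by simp
      rw [this, e2, h1, h3]; simp
    have := hblock L α M' β R e3 (by rw [← h.pot_eq (Or.inl hα)]; exact zα)
      (by rw [← h.pot_eq (Or.inr hβ)]; exact zβ) (fun z h1 h2 => by
        by_cases hz : z ≤ Y a ∨ Y b ≤ z
        · grind [h.pot_eq]
        · push Not at hz
          have h3 := hmid z hz.1 hz.2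
          have h4 := h.tentSum_nonneg z
          linarith)
    refine this.trans ?_
    have hlt := ok.chord.faceOK.psum_lt ok.anti
    grind [psum_append_cons]
  · -- zero in the middle
    have hl := h.lam_eq_zero ok hrodA hblock hmid
    have hza : pot Y C' (Y a) = 0 := by
      have h1 := hmid (Y a) le_rfl h.lt.le
      grind [h.mid_eq, h.symm.tentSum_eq_zero]
    have hzb : pot Y C' (Y b) = 0 := by
      have h1 := hmid (Y b) h.lt.le le_rfl
      grind [h.mid_eq, h.symm.tentSum_eq_zero]
    have hα : Y a ≤ Y α := by grind
    have hβ : Y β ≤ Y b := by grind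
    exact h.block_mid ok hrodB hmid e hα hβ zα zβ hpos

theorem weights_eq_zero (h : Flip Y x a A B b y C C' KA KB lam mu) (ok : FlipOK S base ch a A B b)
    (hrodA : ∀ j ∈ KA, IsRod ch (a :: (B ++ [b])) j.2.1 j.2.2)
    (hC : ∀ z, 0 ≤ pot Y C z)
    (hblock : BlockOK S base Y C (x ++ a :: (A ++ b :: y))) (h0 : ∀ z, pot Y C' z = 0) :
    (∀ z, pot Y C z = 0) ∧ (∀ j ∈ KA, lam j = 0) ∧ ∀ j ∈ KB, mu j = 0 := by
  have hmid : ∀ z, Y a ≤ z → z ≤ Y b → pot Y C z - tentSum Y KA lam z = 0 := by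
    refine (h.mid_dichotomy hC).resolve_left fun hm => ?_
    have h1 := hm ((Y a + Y b) / 2) (by linarith [h.lt]) (by linarith [h.lt])
    rw [h.mid_eq, h0] at h1
    linarith [h.symm.tentSum_nonneg ((Y a + Y b) / 2)]
  have hl := h.lam_eq_zero ok hrodA hblock hmid
  refine ⟨fun z => ?_, hl, fun j hj => ?_⟩
  · by_cases hz : z ≤ Y a ∨ Y b ≤ z
    · rw [← h.pot_eq hz]; exact h0 z
    · grind [tentSum, Finset.sum_eq_zero]
  · by_contra hne
    have hmu : 0 < mu j := lt_of_le_of_ne (h.mu0 j hj) (Ne.symm hne)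
    obtain ⟨m0, l1, l2, m1, m2⟩ := h.memB j hj
    have h1 := (h.symm.tentSum_pos_iff (Y j.1)).2 ⟨j, hj, hmu, l1, l2⟩
    have h2 := h.symm.range_left m0
    have h3 := hmid (Y j.1) h2.1.le h2.2.le
    rw [h.mid_eq, h0] at h3
    linarith

end Flip
end Block

section Positions
variable {N : Type*} {l r : List N} {F : Multiset (Cycle N)} {T : Multiset N}

theorem ChordOK.mem {S base : N → N → ℝ} {ch : N → N → Prop} {f : Cycle N}
    (h : ChordOK S base ch f) {p q : N} (hp : ch p q) : p ∈ f ∧ q ∈ f := by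
  obtain ⟨ψ, -, h, -⟩ := h
  exact ⟨(h p q hp).1, (h p q hp).2.1⟩

/-- The functionals accumulated by the first `t` flips are supported on the `t`-th path. -/
theorem Sweep.partial_support (s : Sweep l r F T) (D : ℕ → (N → ℝ) →ₗ[ℝ] ℝ)
    (hD : ∀ t < s.n, ∀ X : N → ℝ,
      (∀ w, w ∈ s.P t ∨ w ∈ s.P (t + 1) → X w = 0) → D t X = 0)
    (h0 : ∀ X, ∑ t ∈ Finset.range s.n, D t X = 0) {t : ℕ} (ht : t ≤ s.n) (X : N → ℝ)
    (hX : ∀ w ∈ s.P t, X w = 0) : ∑ i ∈ Finset.range t, D i X = 0 := by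
  classical
  let X' : N → ℝ := fun w => if ∃ i ≤ t, w ∈ s.P i then X w else 0
  have h1 : ∑ i ∈ Finset.range t, D i X = ∑ i ∈ Finset.range t, D i X' := by
    refine Finset.sum_congr rfl fun i hi => ?_
    rw [Finset.mem_range] at hi
    rw [← sub_eq_zero, ← map_sub]
    refine hD i (by omega) _ fun w hw => ?_
    have : ∃ i ≤ t, w ∈ s.P i := by grind
    simp [X', this]
  have h2 : ∀ i ∈ Finset.range s.n, i ∉ Finset.range t → D i X' = 0 := by
    intro i hi hi'
    rw [Finset.mem_range] at hi hi'
    refine hD i hi _ fun w hw => ?_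
    simp only [X']
    split_ifs with h
    · obtain ⟨k, hk, hwk⟩ := h
      refine hX w ?_
      rcases hw with hw | hw
      · grind [s.conv]
      · exact s.conv k t (i + 1) hk (by omega) (by omega) w hwk hw
    · rfl
  rw [h1, Finset.sum_subset (Finset.range_subset_range.2 ht) h2, h0]

theorem Sweep.exists_positions (s : Sweep l r F T) {Y : N → ℝ}
    (hY : ∀ t ≤ s.n, (s.P t).Pairwise fun u v => Y u < Y v)
    {S base : N → N → ℝ} {ch : ℕ → N → N → Prop}
    (ok : ∀ t < s.n, FlipOK S base (ch t) (s.a t) (s.A t) (s.B t) (s.b t)) :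
    ∃ X : N → ℝ, ∀ t < s.n,
      (∀ v ∈ s.A t, ∀ p q, IsRod (ch t) (s.a t :: (s.B t ++ [s.b t])) p q → Y p < Y v → Y v < Y q →
        0 < lever Y v p q X) ∧
      (∀ v ∈ s.B t, ∀ p q, IsRod (ch t) (s.a t :: (s.A t ++ [s.b t])) p q → Y p < Y v → Y v < Y q →
        lever Y v p q X < 0) := by
  classical
  let W : ℕ → Finset N := fun t => (s.a t :: (s.A t ++ s.b t :: s.B t)).toFinset
  let KA : ℕ → Finset (N × N × N) := fun t => (W t ×ˢ W t ×ˢ W t).filter fun j =>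
    j.1 ∈ s.A t ∧ IsRod (ch t) (s.a t :: (s.B t ++ [s.b t])) j.2.1 j.2.2 ∧
      Y j.2.1 < Y j.1 ∧ Y j.1 < Y j.2.2
  let KB : ℕ → Finset (N × N × N) := fun t => (W t ×ˢ W t ×ˢ W t).filter fun j =>
    j.1 ∈ s.B t ∧ IsRod (ch t) (s.a t :: (s.A t ++ [s.b t])) j.2.1 j.2.2 ∧
      Y j.2.1 < Y j.1 ∧ Y j.1 < Y j.2.2
  have memW : ∀ t v, v ∈ W t ↔ v ∈ s.a t :: (s.A t ++ s.b t :: s.B t) := fun t v => by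
    simp only [W, List.mem_toFinset]
  have chW : ∀ t < s.n, ∀ p q, ch t p q → p ∈ W t ∧ q ∈ W t := by
    intro t ht p q h
    have := (ok t ht).chord.mem h
    simpa [memW] using this
  have rodW : ∀ t < s.n, ∀ D, D = s.A t ∨ D = s.B t → ∀ p q,
      IsRod (ch t) (s.a t :: (D ++ [s.b t])) p q → p ∈ W t ∧ q ∈ W t := by
    rintro t ht D hD p q (h | h)
    · grind [List.mem_cons_self]
    · exact chW t ht p q h
  let ι := (_ : ℕ) × ((N × N × N) ⊕ (N × N × N))
  let K : Finset ι := (Finset.range s.n).sigma fun t => (KA t).disjSum (KB t)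
  let L : ι → (N → ℝ) →ₗ[ℝ] ℝ := fun i =>
    i.2.elim (fun j => lever Y j.1 j.2.1 j.2.2) fun j => - lever Y j.1 j.2.1 j.2.2
  rcases gordan K L with ⟨X, hX⟩ | ⟨w, w0, ⟨i₀, hi₀, hw₀⟩, hw⟩
  · refine ⟨X, fun t ht => ⟨fun v hv p q hr h1 h2 => ?_, fun v hv p q hr h1 h2 => ?_⟩⟩
    · have := hX ⟨t, Sum.inl (v, p, q)⟩ (by
        have := rodW t ht _ (Or.inr rfl) p q hr
        refine Finset.mem_sigma.2 ⟨Finset.mem_range.2 ht, Finset.inl_mem_disjSum.2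
          (Finset.mem_filter.2 ⟨?_, hv, hr, h1, h2⟩)⟩
        grind)
      simpa [L] using this
    · have := hX ⟨t, Sum.inr (v, p, q)⟩ (by
        have := rodW t ht _ (Or.inl rfl) p q hr
        refine Finset.mem_sigma.2 ⟨Finset.mem_range.2 ht, Finset.inr_mem_disjSum.2
          (Finset.mem_filter.2 ⟨?_, hv, hr, h1, h2⟩)⟩
        grind)
      simpa [L] using this
  exfalso
  let lam : ℕ → N × N × N → ℝ := fun t j => w ⟨t, Sum.inl j⟩
  let mu : ℕ → N × N × N → ℝ := fun t j => w ⟨t, Sum.inr j⟩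
  let D : ℕ → (N → ℝ) →ₗ[ℝ] ℝ := fun t => leverSum Y (KA t) (lam t) - leverSum Y (KB t) (mu t)
  let C : ℕ → (N → ℝ) →ₗ[ℝ] ℝ := fun t => ∑ i ∈ Finset.range t, D i
  have Csucc : ∀ t, C (t + 1) = C t + D t := fun t => Finset.sum_range_succ _ _
  have memAB : ∀ t < s.n, ∀ v ∈ W t, v ∈ s.P t ∨ v ∈ s.P (t + 1) := by grind [s.left, s.right]
  have hD : ∀ t < s.n, ∀ X : N → ℝ,
      (∀ w, w ∈ s.P t ∨ w ∈ s.P (t + 1) → X w = 0) → D t X = 0 := by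
    intro t ht X hX
    simp only [D, LinearMap.sub_apply, leverSum_apply]
    have hz : ∀ v ∈ W t, X v = 0 := fun v hv => hX v (memAB t ht v hv)
    rw [Finset.sum_eq_zero, Finset.sum_eq_zero, sub_zero]
    all_goals
      intro j hj
      simp only [KA, KB, Finset.mem_filter, Finset.mem_product] at hj
      rw [hz _ hj.1.1, hz _ hj.1.2.1, hz _ hj.1.2.2]
      ring
  have h0 : ∀ X, ∑ t ∈ Finset.range s.n, D t X = 0 := by
    intro X
    rw [← hw X, Finset.sum_sigma]
    refine Finset.sum_congr rfl fun t _ => ?_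
    rw [Finset.sum_disjSum]
    simp [D, L, leverSum, lam, mu, sub_eq_add_neg]
  have supp : ∀ t ≤ s.n, ∀ X : N → ℝ, (∀ w ∈ s.P t, X w = 0) → C t X = 0 := by
    intro t ht X hX
    simpa [C] using s.partial_support D hD h0 ht X hX
  have flip : ∀ t < s.n, Flip Y (s.x t) (s.a t) (s.A t) (s.B t) (s.b t) (s.y t) (C t) (C (t + 1))
      (KA t) (KB t) (lam t) (mu t) := by
    intro t ht
    refine ⟨by rw [← s.left t ht]; exact hY t ht.le, by rw [← s.right t ht]; exact hY (t + 1) ht,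
      by rw [← s.right t ht]; exact s.dead t ht, by rw [← s.left t ht]; exact s.fresh t ht,
      by rw [← s.left t ht]; exact supp t ht.le, by rw [← s.right t ht]; exact supp (t + 1) ht,
      fun X => ?_, fun j hj => ?_, fun j hj => ?_, fun j hj => ?_, fun j hj => ?_⟩
    · grind [LinearMap.add_apply, LinearMap.sub_apply]
    · grind
    · grind
    · exact w0 ⟨t, Sum.inl j⟩ (Finset.mem_sigma.2 ⟨Finset.mem_range.2 ht,
        Finset.inl_mem_disjSum.2 hj⟩)
    · exact w0 ⟨t, Sum.inr j⟩ (Finset.mem_sigma.2 ⟨Finset.mem_range.2 ht,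
        Finset.inr_mem_disjSum.2 hj⟩)
  have rodA : ∀ t < s.n, ∀ j ∈ KA t, IsRod (ch t) (s.a t :: (s.B t ++ [s.b t])) j.2.1 j.2.2 :=
    fun t _ j hj => (Finset.mem_filter.1 hj).2.2.1
  have rodB : ∀ t < s.n, ∀ j ∈ KB t, IsRod (ch t) (s.a t :: (s.A t ++ [s.b t])) j.2.1 j.2.2 :=
    fun t _ j hj => (Finset.mem_filter.1 hj).2.2.1
  have up : ∀ t ≤ s.n, (∀ z, 0 ≤ pot Y (C t) z) ∧ BlockOK S base Y (C t) (s.P t) := by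
    intro t
    induction t with
    | zero =>
      intro _
      have hz : ∀ z, pot Y (C 0) z = 0 := fun z => by simp [C, pot]
      refine ⟨fun z => (hz z).ge, ?_⟩
      intro L α M β R e _ _ hpos
      have hlt : Y α < Y β := by grind []
      have := hpos ((Y α + Y β) / 2) (by linarith) (by linarith)
      rw [hz] at this
      exact absurd this (lt_irrefl 0)
    | succ t ih =>
      intro ht
      obtain ⟨i1, i2⟩ := ih (by omega)
      rw [s.left t ht] at i2
      refine ⟨(flip t ht).pot_nonneg i1, ?_⟩
      rw [s.right t ht]
      exact (flip t ht).block_step (ok t ht) (rodA t ht) (rodB t ht) i1 i2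
  have down : ∀ k ≤ s.n, ∀ z, pot Y (C (s.n - k)) z = 0 := by
    intro k
    induction k with
    | zero =>
      intro _ z
      have := h0 fun w => |z - Y w|
      simp [pot, C, this]
    | succ k ih =>
      intro hk
      have ht : s.n - (k + 1) < s.n := by omega
      have e : s.n - (k + 1) + 1 = s.n - k := by omega
      obtain ⟨i1, i2⟩ := up _ ht.le
      rw [s.left _ ht] at i2
      refine ((flip _ ht).weights_eq_zero (ok _ ht) (rodA _ ht) i1 i2 ?_).1
      rw [e]
      exact ih (by omega)
  obtain ⟨t, j⟩ := i₀
  obtain ⟨ht, hj⟩ := Finset.mem_sigma.1 hi₀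
  replace ht : t < s.n := Finset.mem_range.1 ht
  obtain ⟨i1, i2⟩ := up _ ht.le
  rw [s.left _ ht] at i2
  have e : s.n - (s.n - (t + 1)) = t + 1 := by omega
  obtain ⟨-, k1, k2⟩ := (flip _ ht).weights_eq_zero (ok _ ht) (rodA _ ht) i1 i2 (by
    rw [← e]; exact down _ (by omega))
  rcases j with j | j
  · grind [Finset.inl_mem_disjSum]
  · grind [Finset.inr_mem_disjSum]

end Positions

section Lin
variable {N : Type*}

/-- The abscissa, at height `y`, of the line through the points placed for `p` and `q`. -/
noncomputable def lin (X Y : N → ℝ) (p q : N) (y : ℝ) : ℝ :=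
  ((Y q - y) * X p + (y - Y p) * X q) / (Y q - Y p)

variable {X Y : N → ℝ}

theorem lin_left {p q : N} (h : Y p < Y q) : lin X Y p q (Y p) = X p := by grind [lin]

theorem lin_right {p q : N} (h : Y p < Y q) : lin X Y p q (Y q) = X q := by grind [lin]

theorem lin_affine (p q : N) (z1 y z2 : ℝ) :
    (z2 - z1) * lin X Y p q y = (z2 - y) * lin X Y p q z1 + (y - z1) * lin X Y p q z2 := by
  unfold lin; ring

theorem lin_neg (p q : N) (y : ℝ) : lin (-X) Y p q y = - lin X Y p q y := by
  simp only [lin, Pi.neg_apply]; ring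

theorem lever_pos_iff {p q v : N} (h : Y p < Y q) :
    0 < lever Y v p q X ↔ X v < lin X Y p q (Y v) := by
  rw [lever_apply, lin, lt_div_iff₀ (by linarith)]
  constructor <;> intro h <;> linarith

theorem lever_neg_iff {p q v : N} (h : Y p < Y q) :
    lever Y v p q X < 0 ↔ lin X Y p q (Y v) < X v := by
  rw [lever_apply, lin, div_lt_iff₀ (by linarith)]
  constructor <;> intro h <;> linarith

theorem infix_pair_iff {l : List N} {p q : N} :
    [p, q] <:+: l ↔ ∃ s t, l = s ++ p :: q :: t := by
  constructor
  · rintro ⟨s, t, h⟩; exact ⟨s, t, by simp [← h]⟩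
  · rintro ⟨s, t, h⟩; exact ⟨s, t, by simp [h]⟩

theorem infix_pair_append {L R : List N} {c p q : N} (h : [p, q] <:+: L ++ c :: R) :
    [p, q] <:+: L ++ [c] ∨ [p, q] <:+: c :: R := by
  obtain ⟨s, t, h⟩ := infix_pair_iff.1 h
  rcases List.append_eq_append_iff.1 h with ⟨m, h1, h2⟩ | ⟨m, h1, h2⟩
  · grind [infix_pair_iff]
  · cases m with
    | nil => exact Or.inr (infix_pair_iff.2 ⟨[], t, by simpa using h2.symm⟩)
    | cons p' m =>
      simp only [List.cons_append, List.cons.injEq] at h2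
      obtain ⟨rfl, h2⟩ := h2
      cases m with
      | nil => grind [infix_pair_iff]
      | cons q' m => grind [infix_pair_iff]

theorem lt_of_infix {l : List N} (hl : l.Pairwise fun u v => Y u < Y v) {p q : N}
    (h : [p, q] <:+: l) : Y p < Y q := by
  have := hl.sublist h.sublist
  simpa using this

theorem between_of_infix {l : List N} (hl : l.Pairwise fun u v => Y u < Y v) {p q v : N}
    (h : [p, q] <:+: l) (hv : v ∈ l) (h1 : Y p ≤ Y v) (h2 : Y v ≤ Y q) : v = p ∨ v = q := by
  obtain ⟨s, t, rfl⟩ := infix_pair_iff.1 h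
  simp only [List.pairwise_append, List.pairwise_cons, List.mem_cons] at hl
  simp only [List.mem_append, List.mem_cons] at hv
  rcases hv with hv | hv | hv | hv
  · grind
  · exact Or.inl hv
  · exact Or.inr hv
  · have := hl.2.1.2.1 v hv; linarith

theorem mem_of_infix_left {l : List N} {p q : N} (h : [p, q] <:+: l) : p ∈ l := h.subset (by simp)
theorem mem_of_infix_right {l : List N} {p q : N} (h : [p, q] <:+: l) : q ∈ l := h.subset (by simp)

/-- The point `(x, y)` lies on the polygonal path along `P`. -/
def OnPath (X Y : N → ℝ) (P : List N) (x y : ℝ) : Prop :=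
  ∃ p q, [p, q] <:+: P ∧ Y p ≤ y ∧ y ≤ Y q ∧ x = lin X Y p q y

theorem OnPath.mono {P Q : List N} (h : P <:+: Q) {x y : ℝ} (hx : OnPath X Y P x y) :
    OnPath X Y Q x y := by
  obtain ⟨p, q, h1, h2⟩ := hx
  exact ⟨p, q, h1.trans h, h2⟩

theorem OnPath.unique_aux {P : List N} (hP : P.Pairwise fun u v => Y u < Y v) {p q p' q' : N}
    {y : ℝ} (h : [p, q] <:+: P) (h' : [p', q'] <:+: P) (h2 : y ≤ Y q)
    (h1' : Y p' ≤ y) (h2' : y ≤ Y q') (hlt : Y p ≤ Y p') :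
    lin X Y p q y = lin X Y p' q' y := by
  have k := lt_of_infix hP h
  have k' := lt_of_infix hP h'
  rcases between_of_infix hP h (mem_of_infix_left h') hlt (by linarith) with rfl | rfl
  · rcases le_total (Y q) (Y q') with hq | hq
    · rcases between_of_infix hP h' (mem_of_infix_right h) k.le hq with e | rfl
      · grind
      · rfl
    · rcases between_of_infix hP h (mem_of_infix_right h') k'.le hq with e | rfl
      · grind
      · rfl
  · grind [lin_right, lin_left]

theorem OnPath.unique {P : List N} (hP : P.Pairwise fun u v => Y u < Y v) {x x' y : ℝ}
    (h : OnPath X Y P x y) (h' : OnPath X Y P x' y) : x = x' := by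
  obtain ⟨p, q, h1, h2, h3, rfl⟩ := h
  obtain ⟨p', q', h1', h2', h3', rfl⟩ := h'
  rcases le_total (Y p) (Y p') with hl | hl
  · grind [unique_aux]
  · grind [unique_aux]

theorem OnPath.exists_pair (a : N) (A : List N) (b : N) {y : ℝ} (h1 : Y a ≤ y) (h2 : y ≤ Y b) :
    ∃ p q, [p, q] <:+: a :: (A ++ [b]) ∧ Y p ≤ y ∧ y ≤ Y q := by
  induction A generalizing a with
  | nil => exact ⟨a, b, List.infix_rfl, h1, h2⟩
  | cons c A ih =>
    rcases le_total y (Y c) with h | h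
    · exact ⟨a, c, infix_pair_iff.2 ⟨[], A ++ [b], by simp⟩, h1, h⟩
    · grind [List.infix_cons]

theorem OnPath.exists_of_le (a : N) (A : List N) (b : N) {y : ℝ} (h1 : Y a ≤ y) (h2 : y ≤ Y b) :
    ∃ x, OnPath X Y (a :: (A ++ [b])) x y := by
  obtain ⟨p, q, h⟩ := exists_pair a A b h1 h2
  exact ⟨_, p, q, h.1, h.2.1, h.2.2, rfl⟩

theorem OnPath.of_mem {P : List N} (hP : P.Pairwise fun u v => Y u < Y v) {v : N} (hv : v ∈ P)
    (h : 2 ≤ P.length) : OnPath X Y P (X v) (Y v) := by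
  obtain ⟨s, t, rfl⟩ := List.append_of_mem hv
  cases t with
  | cons c t =>
    have i : [v, c] <:+: s ++ v :: c :: t := infix_pair_iff.2 ⟨s, t, rfl⟩
    have := lt_of_infix hP i
    exact ⟨v, c, i, le_rfl, this.le, (lin_left this).symm⟩
  | nil =>
    rcases List.eq_nil_or_concat s with rfl | ⟨s, c, rfl⟩
    · simp at h
    · have i : [c, v] <:+: s.concat c ++ [v] := infix_pair_iff.2 ⟨s, [], by simp⟩
      have := lt_of_infix hP i
      exact ⟨c, v, i, this.le, le_rfl, (lin_right this).symm⟩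

end Lin

section FlipPos
variable {N : Type*}

/-- Positions that satisfy the contact conditions of a single flip. -/
structure FlipPos (X Y : N → ℝ) (ch : N → N → Prop) (a : N) (A B : List N) (b : N) : Prop where
  sortA : (a :: (A ++ [b])).Pairwise fun u v => Y u < Y v
  sortB : (a :: (B ++ [b])).Pairwise fun u v => Y u < Y v
  disj : ∀ u ∈ A, ∀ v ∈ B, Y u ≠ Y v
  ch_mem : ∀ p q, ch p q → p ∈ a :: (A ++ b :: B) ∧ q ∈ a :: (A ++ b :: B)
  left : ∀ v ∈ A, ∀ p q, IsRod ch (a :: (B ++ [b])) p q → Y p < Y v → Y v < Y q →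
    X v < lin X Y p q (Y v)
  right : ∀ v ∈ B, ∀ p q, IsRod ch (a :: (A ++ [b])) p q → Y p < Y v → Y v < Y q →
    lin X Y p q (Y v) < X v

namespace FlipPos
variable {X Y : N → ℝ} {ch : N → N → Prop} {a : N} {A B : List N} {b : N}

theorem symm (h : FlipPos X Y ch a A B b) : FlipPos (-X) Y ch a B A b where
  sortA := h.sortB
  sortB := h.sortA
  disj := fun u hu v hv => (h.disj v hv u hu).symm
  ch_mem := fun p q hpq => by
    have := h.ch_mem p q hpq
    grind
  left := fun v hv p q hr h1 h2 => by grind [lin_neg, Pi.neg_apply, neg_lt_neg_iff, h.right]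
  right := fun v hv p q hr h1 h2 => by grind [lin_neg, Pi.neg_apply, neg_lt_neg_iff, h.left]

theorem rangeA (h : FlipPos X Y ch a A B b) {v : N} (hv : v ∈ A) : Y a < Y v ∧ Y v < Y b := by
  grind [h.sortA, List.pairwise_cons]

theorem lt (h : FlipPos X Y ch a A B b) : Y a < Y b := by grind [h.sortA]

theorem range (h : FlipPos X Y ch a A B b) {v : N} (hv : v ∈ a :: (A ++ b :: B)) :
    Y a ≤ Y v ∧ Y v ≤ Y b := by
  simp only [List.mem_cons, List.mem_append] at hv
  have := h.lt
  rcases hv with rfl | hv | rfl | hv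
  · exact ⟨le_rfl, this.le⟩
  · exact ⟨(h.rangeA hv).1.le, (h.rangeA hv).2.le⟩
  · exact ⟨this.le, le_rfl⟩
  · exact ⟨(h.symm.rangeA hv).1.le, (h.symm.rangeA hv).2.le⟩

theorem rod_mem (h : FlipPos X Y ch a A B b) {p q : N} (hr : IsRod ch (a :: (B ++ [b])) p q) :
    p ∈ a :: (A ++ b :: B) ∧ q ∈ a :: (A ++ b :: B) := by
  rcases hr with hr | hr
  · have h1 := mem_of_infix_left hr
    have h2 := mem_of_infix_right hr
    grind
  · exact h.ch_mem _ _ hr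

/-- A vertex of the cell is not on the left of the left path. -/
theorem end_le (h : FlipPos X Y ch a A B b) {p p1 q1 : N} (hp : p ∈ a :: (A ++ b :: B))
    (hi : [p1, q1] <:+: a :: (A ++ [b])) (h1 : Y p1 ≤ Y p) (h2 : Y p ≤ Y q1) :
    lin X Y p1 q1 (Y p) ≤ X p ∧ (p = p1 ∨ p = q1 ∨ lin X Y p1 q1 (Y p) < X p) := by
  have hlt := lt_of_infix h.sortA hi
  by_cases hpA : p ∈ a :: (A ++ [b])
  · rcases between_of_infix h.sortA hi hpA h1 h2 with rfl | rfl
    · grind [lin_left]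
    · grind [lin_right]
  · have hpB : p ∈ B := by grind
    have hr := h.symm.rangeA hpB
    have ne : ∀ u ∈ a :: (A ++ [b]), Y u ≠ Y p := by grind [h.disj]
    have := h.right p hpB p1 q1 (Or.inl hi) (lt_of_le_of_ne h1 (ne _ (mem_of_infix_left hi)))
      (lt_of_le_of_ne h2 (ne _ (mem_of_infix_right hi)).symm)
    exact ⟨this.le, Or.inr (Or.inr this)⟩

theorem mem_of_interior (_h : FlipPos X Y ch a A B b) {v : N} (hv : v ∈ a :: (A ++ [b]))
    (h1 : Y a < Y v) (h2 : Y v < Y b) : v ∈ A := by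
  simp only [List.mem_cons, List.mem_append, List.not_mem_nil, or_false] at hv
  rcases hv with rfl | m | rfl
  · exact absurd h1 (lt_irrefl _)
  · exact m
  · exact absurd h2 (lt_irrefl _)

theorem mem_left (_h : FlipPos X Y ch a A B b) {v : N} (hv : v ∈ a :: (A ++ [b])) :
    v ∈ a :: (A ++ b :: B) := by
  simp only [List.mem_cons, List.mem_append, List.not_mem_nil, or_false] at hv ⊢
  tauto

theorem lt_lin (h : FlipPos X Y ch a A B b) {p q p1 q1 : N} {y : ℝ}
    (hr : IsRod ch (a :: (B ++ [b])) p q) (hy1 : Y p < y) (hy2 : y < Y q)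
    (hi : [p1, q1] <:+: a :: (A ++ [b])) (h1 : Y p1 ≤ y) (h2 : y ≤ Y q1) :
    lin X Y p1 q1 y ≤ lin X Y p q y ∧ (¬ [p, q] <:+: a :: (A ++ [b]) →
      lin X Y p1 q1 y < lin X Y p q y) := by
  have hpq : Y p < Y q := hy1.trans hy2
  have hlt := lt_of_infix h.sortA hi
  obtain ⟨mp, mq⟩ := h.rod_mem hr
  have rp := h.range mp
  have rq := h.range mq
  have rp1 := h.range (h.mem_left (mem_of_infix_left hi))
  have rq1 := h.range (h.mem_left (mem_of_infix_right hi))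
  obtain ⟨z1, k1, k2, k3⟩ : ∃ z1, z1 ≤ y ∧ lin X Y p1 q1 z1 ≤ lin X Y p q z1 ∧
      ((p = p1 ∧ z1 < y) ∨ lin X Y p1 q1 z1 < lin X Y p q z1) := by
    rcases lt_or_ge (Y p) (Y p1) with hc | hc
    · grind [h.mem_of_interior, mem_of_infix_left, h.left, lin_left]
    · grind [h.end_le, lin_left]
  obtain ⟨z2, l1, l2, l3⟩ : ∃ z2, y ≤ z2 ∧ lin X Y p1 q1 z2 ≤ lin X Y p q z2 ∧
      ((q = q1 ∧ y < z2) ∨ lin X Y p1 q1 z2 < lin X Y p q z2) := by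
    rcases lt_or_ge (Y q1) (Y q) with hc | hc
    · grind [h.mem_of_interior, mem_of_infix_right, h.left, lin_right]
    · grind [h.end_le, lin_right]
  have a1 := lin_affine (X := X) (Y := Y) p q z1 y z2
  have a2 := lin_affine (X := X) (Y := Y) p1 q1 z1 y z2
  rcases (k1.trans l1).eq_or_lt with e | e
  · grind
  · refine ⟨?_, fun hn => ?_⟩
    · have : (z2 - z1) * lin X Y p1 q1 y ≤ (z2 - z1) * lin X Y p q y := by
        grind [add_le_add, mul_le_mul_of_nonneg_left]
      exact le_of_mul_le_mul_left this (by linarith)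
    · have : (z2 - z1) * lin X Y p1 q1 y < (z2 - z1) * lin X Y p q y := by
        grind [add_lt_add_of_le_of_lt, mul_lt_mul_of_pos_left, add_lt_add_of_lt_of_le]
      exact lt_of_mul_lt_mul_left this (by linarith)

theorem le_lin (h : FlipPos X Y ch a A B b) {p q p1 q1 : N} {y : ℝ}
    (hr : IsRod ch (a :: (B ++ [b])) p q) (hpq : Y p < Y q) (hy1 : Y p ≤ y) (hy2 : y ≤ Y q)
    (hi : [p1, q1] <:+: a :: (A ++ [b])) (h1 : Y p1 ≤ y) (h2 : y ≤ Y q1) :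
    lin X Y p1 q1 y ≤ lin X Y p q y := by
  obtain ⟨mp, mq⟩ := h.rod_mem hr
  rcases hy1.eq_or_lt with rfl | hy1
  · grind [lin_left, h.end_le]
  rcases hy2.eq_or_lt with rfl | hy2
  · grind [lin_right, h.end_le]
  exact (h.lt_lin hr hy1 hy2 hi h1 h2).1

theorem path_le (h : FlipPos X Y ch a A B b) {x x' y : ℝ} (h1 : OnPath X Y (a :: (A ++ [b])) x y)
    (h2 : OnPath X Y (a :: (B ++ [b])) x' y) : x ≤ x' := by
  obtain ⟨p, q, i, k1, k2, rfl⟩ := h1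
  obtain ⟨p', q', i', k1', k2', rfl⟩ := h2
  exact h.le_lin (Or.inl i') (lt_of_infix h.sortB i') k1' k2' i k1 k2

theorem left_lt_chord (h : FlipPos X Y ch a A B b) {p q : N} (hc : ch p q)
    (hn : ¬ [p, q] <:+: a :: (A ++ [b])) {x y : ℝ} (h1 : OnPath X Y (a :: (A ++ [b])) x y)
    (hy1 : Y p < y) (hy2 : y < Y q) : x < lin X Y p q y := by
  obtain ⟨p', q', i, k1, k2, rfl⟩ := h1
  exact (h.lt_lin (Or.inr hc) hy1 hy2 i k1 k2).2 hn

theorem chord_lt_right (h : FlipPos X Y ch a A B b) {p q : N} (hc : ch p q)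
    (hn : ¬ [p, q] <:+: a :: (B ++ [b])) {x y : ℝ} (h1 : OnPath X Y (a :: (B ++ [b])) x y)
    (hy1 : Y p < y) (hy2 : y < Y q) : lin X Y p q y < x := by
  obtain ⟨p', q', i, k1, k2, rfl⟩ := h1
  have := (h.symm.lt_lin (Or.inr hc) hy1 hy2 i k1 k2).2 hn
  rwa [lin_neg, lin_neg, neg_lt_neg_iff] at this

theorem dead_lt (h : FlipPos X Y ch a A B b) {v : N} (hv : v ∈ A)
    {x : ℝ} (h1 : OnPath X Y (a :: (B ++ [b])) x (Y v)) : X v < x := by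
  obtain ⟨p, q, i, k1, k2, rfl⟩ := h1
  have hr := h.rangeA hv
  have ne : ∀ u ∈ a :: (B ++ [b]), Y u ≠ Y v := by grind [h.disj]
  exact h.left v hv p q (Or.inl i) (lt_of_le_of_ne k1 (ne _ (mem_of_infix_left i)))
    (lt_of_le_of_ne k2 (ne _ (mem_of_infix_right i)).symm)

end FlipPos
end FlipPos

section Stretch
variable {N : Type*} {l r : List N} {F : Multiset (Cycle N)} {T : Multiset N}

theorem exists_middle {P : List N} {u w : N} (h1 : P.head? = some u) (h2 : P.getLast? = some w)
    (h : u ≠ w) : ∃ M, P = u :: (M ++ [w]) := by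
  cases P with
  | nil => simp at h1
  | cons v P =>
    simp only [List.head?_cons, Option.some.injEq] at h1
    subst h1
    rcases List.eq_nil_or_concat P with rfl | ⟨M, c, rfl⟩
    · simp at h2; exact absurd h2 h
    · grind

theorem Sweep.path_form (s : Sweep l r F T) {u w : N} {M : List N} (h : l = u :: (M ++ [w]))
    (t : ℕ) (ht : t ≤ s.n) : ∃ M', s.P t = u :: (M' ++ [w]) := by
  have key : (s.P t).head? = some u ∧ (s.P t).getLast? = some w := by
    induction t with
    | zero => rw [s.start, h]; simp [List.getLast?_cons]
    | succ t ih => grind [s.left, s.right]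
  refine exists_middle key.1 key.2 ?_
  have := s.nodup 0 (Nat.zero_le _)
  rw [s.start, h] at this
  simp only [List.nodup_cons, List.mem_append, List.mem_singleton, not_or] at this
  exact this.1.2

/-- The face closed by the `t`-th flip. -/
def Sweep.face (s : Sweep l r F T) (t : ℕ) : Cycle N :=
  ↑(s.a t :: (s.A t ++ s.b t :: (s.B t).reverse))

theorem flipOK_of_face {S base : N → N → ℝ} {ch : N → N → Prop} {a : N} {A B : List N} {b : N}
    (hS : ∀ u v, S u v = - S v u) (hb : ∀ u v, base u v = - base v u)
    (hs : ∀ p q, ch p q → ch q p)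
    (hc : ChordOK S base ch ((a :: (A ++ b :: B.reverse) : List N) : Cycle N))
    (he : ((a :: (A ++ b :: B.reverse) : List N) : Cycle N).Chain fun u v => base u v = S u v) :
    FlipOK S base ch a A B b := by
  refine ⟨hS, hb, hs, hc, ?_, ?_⟩
  · grind [Cycle.chain_coe_cons]
  · grind [Cycle.coe_append_comm, Cycle.chain_coe_cons]

theorem not_infix_of_chord {S base : N → N → ℝ} {ch : N → N → Prop} {a : N} {A B : List N} {b : N}
    (hs : ∀ p q, ch p q → ch q p)
    (hc : ChordOK S base ch ((a :: (A ++ b :: B.reverse) : List N) : Cycle N))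
    (he : ((a :: (A ++ b :: B.reverse) : List N) : Cycle N).Chain fun u v => base u v = S u v)
    {p q : N} (h : ch p q) : ¬ [p, q] <:+: a :: (A ++ [b]) ∧ ¬ [p, q] <:+: a :: (B ++ [b]) := by
  obtain ⟨ψ, h1, h2, -⟩ := hc
  have key : ∀ p q, ch p q → ¬ [p, q] <:+: a :: (A ++ b :: (B.reverse ++ [a])) := by
    intro p q h hi
    rw [Cycle.chain_coe_cons] at h1 he
    have e : a :: (A ++ b :: B.reverse ++ [a]) = a :: (A ++ b :: (B.reverse ++ [a])) := by simp
    rw [e] at h1 he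
    have k1 := h1.infix hi
    have k2 := he.infix hi
    grind
  refine ⟨fun hi => key p q h (hi.trans ?_), fun hi => key q p (hs _ _ h) ?_⟩
  · grind
  · rw [← List.reverse_infix] at hi
    grind

/-- The stretching theorem: the chords of the faces of a sweep can be drawn as straight segments
inside disjoint strips between the successive paths. -/
theorem Sweep.exists_placement (s : Sweep l r F T) {S base : N → N → ℝ}
    {Ch : Cycle N → N → N → Prop} (hS : ∀ u v, S u v = - S v u)
    (hb : ∀ u v, base u v = - base v u) (hs : ∀ f p q, Ch f p q → Ch f q p)
    (hF : ∀ f ∈ F, ChordOK S base (Ch f) f ∧ f.Chain fun u v => base u v = S u v)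
    {u w : N} {M : List N} (hl : l = u :: (M ++ [w])) :
    ∃ X Y : N → ℝ, (∀ u ∈ T, ∀ v ∈ T, Y u = Y v → u = v) ∧
      (∀ t ≤ s.n, (s.P t).Pairwise fun u v => Y u < Y v) ∧
      (∀ t ≤ s.n, ∀ v ∈ s.P t, OnPath X Y (s.P t) (X v) (Y v)) ∧
      (∀ t ≤ s.n, ∀ y, Y u ≤ y → y ≤ Y w → ∃ x, OnPath X Y (s.P t) x y) ∧
      (∀ t t', t ≤ t' → t' ≤ s.n → ∀ x x' y, OnPath X Y (s.P t) x y → OnPath X Y (s.P t') x' y →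
        x ≤ x') ∧
      (∀ t < s.n, ∀ p q, Ch (s.face t) p q → ∀ x y, Y p < y → y < Y q →
        (OnPath X Y (s.P t) x y → x < lin X Y p q y) ∧
        (OnPath X Y (s.P (t + 1)) x y → lin X Y p q y < x)) ∧
      (∀ t < s.n, ∀ v ∈ s.A t, ∀ x, OnPath X Y (s.P (t + 1)) x (Y v) → X v < x) := by
  obtain ⟨Y, hY, hinj⟩ := s.exists_heights
  have ok : ∀ t < s.n, FlipOK S base (Ch (s.face t)) (s.a t) (s.A t) (s.B t) (s.b t) := fun t ht =>
    flipOK_of_face hS hb (hs _) (hF _ (s.face_mem t ht)).1 (hF _ (s.face_mem t ht)).2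
  obtain ⟨X, hX⟩ := s.exists_positions hY (ch := fun t => Ch (s.face t)) ok
  have hlen : ∀ t ≤ s.n, 2 ≤ (s.P t).length := by grind [s.path_form]
  have iA : ∀ t < s.n, s.a t :: (s.A t ++ [s.b t]) <:+: s.P t := fun t ht =>
    ⟨s.x t, s.y t, by rw [s.left t ht]; simp⟩
  have iB : ∀ t < s.n, s.a t :: (s.B t ++ [s.b t]) <:+: s.P (t + 1) := fun t ht =>
    ⟨s.x t, s.y t, by rw [s.right t ht]; simp⟩
  have fp : ∀ t < s.n, FlipPos X Y (Ch (s.face t)) (s.a t) (s.A t) (s.B t) (s.b t) := by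
    intro t ht
    have sA := (hY t ht.le).sublist (iA t ht).sublist
    have sB := (hY (t + 1) ht).sublist (iB t ht).sublist
    refine ⟨sA, sB, ?_, ?_, ?_, ?_⟩
    · intro c hc v hv e
      have m1 : c ∈ s.P t := (iA t ht).subset (by simp [hc])
      have m2 : v ∈ s.P (t + 1) := (iB t ht).subset (by simp [hv])
      grind [s.mem_total, s.fresh]
    · intro p q h
      have := (ok t ht).chord.mem h
      simpa using this
    · grind [lever_pos_iff]
    · grind [lever_neg_iff]
  have midA : ∀ t < s.n, ∀ x y, Y (s.a t) ≤ y → y ≤ Y (s.b t) → OnPath X Y (s.P t) x y →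
      OnPath X Y (s.a t :: (s.A t ++ [s.b t])) x y := by
    intro t ht x y h1 h2 h
    obtain ⟨x', h'⟩ := OnPath.exists_of_le (X := X) (s.a t) (s.A t) (s.b t) h1 h2
    rw [h.unique (hY t ht.le) (h'.mono (iA t ht))]
    exact h'
  have midB : ∀ t < s.n, ∀ x y, Y (s.a t) ≤ y → y ≤ Y (s.b t) → OnPath X Y (s.P (t + 1)) x y →
      OnPath X Y (s.a t :: (s.B t ++ [s.b t])) x y := by
    intro t ht x y h1 h2 h
    obtain ⟨x', h'⟩ := OnPath.exists_of_le (X := X) (s.a t) (s.B t) (s.b t) h1 h2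
    rw [h.unique (hY (t + 1) ht) (h'.mono (iB t ht))]
    exact h'
  have ex : ∀ t ≤ s.n, ∀ y, Y u ≤ y → y ≤ Y w → ∃ x, OnPath X Y (s.P t) x y := by
    intro t ht y h1 h2
    obtain ⟨M', e⟩ := s.path_form hl t ht
    rw [e]
    exact OnPath.exists_of_le u M' w h1 h2
  have rg : ∀ t ≤ s.n, ∀ x y, OnPath X Y (s.P t) x y → Y u ≤ y ∧ y ≤ Y w := by
    intro t ht x y h
    have hsort := hY t ht
    obtain ⟨M', e⟩ := s.path_form hl t ht
    rw [e] at h hsort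
    obtain ⟨p, q, i, h1, h2, -⟩ := h
    grind [mem_of_infix_left, mem_of_infix_right, List.pairwise_cons]
  have step : ∀ t < s.n, ∀ x x' y, OnPath X Y (s.P t) x y → OnPath X Y (s.P (t + 1)) x' y →
      x ≤ x' := by
    intro t ht x x' y h h'
    by_cases hm : Y (s.a t) ≤ y ∧ y ≤ Y (s.b t)
    · exact (fp t ht).path_le (midA t ht x y hm.1 hm.2 h) (midB t ht x' y hm.1 hm.2 h')
    · have hs0 := hY t ht.le
      have h0 := h
      rw [s.left t ht] at h0 hs0
      obtain ⟨p, q, i, h1, h2, e⟩ := h0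
      have hlt := lt_of_infix hs0 i
      have key : OnPath X Y (s.P (t + 1)) x y := by
        rcases infix_pair_append i with i1 | i1
        · exact ⟨p, q, i1.trans ⟨[], s.B t ++ s.b t :: s.y t, by rw [s.right t ht]; simp⟩, h1, h2,
            e⟩
        · rw [← List.cons_append] at i1
          rcases infix_pair_append i1 with i1 | i1
          · exfalso
            rw [List.cons_append] at i1
            have r1 := (fp t ht).range ((fp t ht).mem_left (mem_of_infix_left i1))
            have r2 := (fp t ht).range ((fp t ht).mem_left (mem_of_infix_right i1))
            exact hm ⟨r1.1.trans h1, h2.trans r2.2⟩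
          · exact ⟨p, q, i1.trans ⟨s.x t ++ s.a t :: s.B t, [], by rw [s.right t ht]; simp⟩, h1,
              h2, e⟩
      exact (key.unique (hY (t + 1) ht) h').le
  have mono : ∀ t t', t ≤ t' → t' ≤ s.n → ∀ x x' y, OnPath X Y (s.P t) x y →
      OnPath X Y (s.P t') x' y → x ≤ x' := by
    intro t t' htt'
    induction t', htt' using Nat.le_induction with
    | base => exact fun ht x x' y h h' => (h.unique (hY t ht) h').le
    | succ t' htt' ih => grind
  refine ⟨X, Y, hinj, hY, fun t ht v hv => OnPath.of_mem (hY t ht) hv (hlen t ht), ex, mono, ?_, ?_⟩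
  · intro t ht p q hc x y h1 h2
    obtain ⟨mp, mq⟩ := (fp t ht).ch_mem p q hc
    have r1 := (fp t ht).range mp
    have r2 := (fp t ht).range mq
    have hn := not_infix_of_chord (hs _) (hF _ (s.face_mem t ht)).1
      (hF _ (s.face_mem t ht)).2 hc
    exact ⟨fun h => (fp t ht).left_lt_chord hc hn.1 (midA t ht x y (by linarith) (by linarith) h) h1 h2,
      fun h => (fp t ht).chord_lt_right hc hn.2 (midB t ht x y (by linarith) (by linarith) h) h1 h2⟩
  · intro t ht v hv x h
    have r := (fp t ht).rangeA hv
    exact (fp t ht).dead_lt hv (midB t ht x (Y v) r.1.le r.2.le h)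

end Stretch

section Extreme
variable {N : Type*}

theorem lin_sub_left {X Y : N → ℝ} {p q : N} (h : Y p < Y q) (c y : ℝ) :
    (Y q - Y p) * (lin X Y p q y - c * y - (X q - c * Y q)) =
      (Y q - y) * (X p - c * Y p - (X q - c * Y q)) := by
  have : Y q - Y p ≠ 0 := by linarith
  unfold lin; field_simp; ring

theorem lin_sub_right {X Y : N → ℝ} {p q : N} (h : Y p < Y q) (c y : ℝ) :
    (Y q - Y p) * (lin X Y p q y - c * y - (X p - c * Y p)) =
      (y - Y p) * (X q - c * Y q - (X p - c * Y p)) := by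
  have : Y q - Y p ≠ 0 := by linarith
  unfold lin; field_simp; ring

open Classical in
/-- `S₀` with prescribed values, of size `K`, on the sides of the triangle `u`, `s`, `w`. -/
noncomputable def triangleWeight (M : N → Prop) (S₀ : N → N → ℝ) (u s w : N) (K : ℝ) (p q : N) : ℝ :=
  if M p ∨ M q then S₀ p q
  else if (p = u ∧ q = w) ∨ (p = w ∧ q = s) ∨ (p = s ∧ q = u) then K
  else if (q = u ∧ p = w) ∨ (q = w ∧ p = s) ∨ (q = s ∧ p = u) then -K
  else 0

theorem triangleWeight_anti {M : N → Prop} {S₀ : N → N → ℝ} (hS : ∀ u v, S₀ u v = - S₀ v u)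
    {u s w : N} (h1 : u ≠ s) (h2 : s ≠ w) (h3 : u ≠ w) (K : ℝ) (p q : N) :
    triangleWeight M S₀ u s w K p q = - triangleWeight M S₀ u s w K q p := by
  unfold triangleWeight
  by_cases hM : M p ∨ M q
  · rw [if_pos hM, if_pos hM.symm, hS]
  · grind

/-- The triangle with one marker on it is a face of positive area. -/
theorem chordOK_triangle {S base : N → N → ℝ} {ch : N → N → Prop} (hc : ∀ p q, ¬ ch p q)
    (a b c : N) (hab : a ≠ b) (hac : a ≠ c) (hbc : b ≠ c) (h : S a b + S b c + S c a < 0) :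
    ChordOK S base ch ((a :: b :: c :: [] : List N) : Cycle N) := by
  classical
  have hε : ∃ ε : ℝ, 0 < ε ∧ S a b + S b c + S c a + 3 * ε = 0 :=
    ⟨-(S a b + S b c + S c a) / 3, by linarith, by ring⟩
  obtain ⟨ε, hε, he⟩ := hε
  refine ⟨fun v => if v = b then S a b + ε else if v = c then S a b + S b c + 2 * ε else 0, ?_,
    fun p q h => absurd h (hc p q), Or.inl ⟨a, a, fun p q h => absurd h (hc p q)⟩⟩
  simp only [Cycle.chain_coe_cons, List.cons_append, List.nil_append, List.isChain_cons_cons,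
    List.isChain_singleton, and_true]
  refine ⟨?_, ?_, ?_⟩
  · simp [hab, hac]; linarith
  · simp [hbc.symm]; linarith
  · simp [hab, hac, hbc.symm]; linarith

set_option maxHeartbeats 2000000 in
/-- A placement of the vertices of a sweep in which a vertex next to the left boundary becomes
extreme. -/
theorem Steps.exists_extreme_placement {F : Multiset (Cycle N)} {T : Multiset N}
    {M Real : N → Prop} {u L s L' w R : N} (h : Steps [u, L, s, L', w] [u, R, w] F T) (hT : T.Nodup)
    (mL : M L) (mL' : M L') (mR : M R) (mu : ¬ M u) (ms : ¬ M s) (mw : ¬ M w)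
    (ru : ¬ Real u) (rw' : ¬ Real w) (rM : ∀ v, Real v → ¬ M v)
    (hFM : ∀ f ∈ F, f.Chain fun p q => M p ∨ M q)
    {S₀ base₀ : N → N → ℝ} (hS : ∀ u v, S₀ u v = - S₀ v u) (hb : ∀ u v, base₀ u v = - base₀ v u)
    {Ch : Cycle N → N → N → Prop} (hs : ∀ f p q, Ch f p q → Ch f q p)
    (hch : ∀ f p q, Ch f p q → p ∈ f ∧ q ∈ f ∧ p ≠ q ∧ Real p ∧ Real q)
    (hF : ∀ f ∈ F, ∀ S base : N → N → ℝ, (∀ u v, S u v = - S v u) → (∀ u v, base u v = - base v u) →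
      (∀ p q, M p ∨ M q → S p q = S₀ p q) → (∀ p q, Real p → Real q → base p q = base₀ p q) →
      ChordOK S base (Ch f) f) :
    ∃ X Y : N → ℝ, (∀ u ∈ T, ∀ v ∈ T, Y u = Y v → u = v) ∧
      (∀ f ∈ F, ∀ p q v, Ch f p q → v ∈ T → Y p < Y v → Y v < Y q → X v ≠ lin X Y p q (Y v)) ∧
      (∀ f ∈ F, ∀ f' ∈ F, f ≠ f' → ∀ p q p' q' y, Ch f p q → Ch f' p' q' → Y p < y → y < Y q →
        Y p' < y → y < Y q' → lin X Y p q y ≠ lin X Y p' q' y) ∧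
      ∃ c : ℝ, ∀ v ∈ T, v ≠ s → X s - c * Y s < X v - c * Y v := by
  classical
  have hl : [u, L, s, L', w].Nodup := h.nodup_left hT
  have hr : [u, R, w].Nodup := h.nodup_right hT
  simp only [List.nodup_cons, List.mem_cons, List.not_mem_nil, or_false, not_or, not_false_eq_true,
    List.nodup_nil, and_true] at hl hr
  obtain ⟨⟨uL, us, uL', uw⟩, ⟨Ls, LL', Lw⟩, ⟨sL', sw⟩, L'w⟩ := hl
  obtain ⟨⟨uR, -⟩, Rw⟩ := hr
  obtain ⟨K, hK⟩ : ∃ K : ℝ, -K + S₀ s L + S₀ L u < 0 ∧ -K + S₀ w L' + S₀ L' s < 0 ∧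
      S₀ u R + S₀ R w - K < 0 := by
    refine ⟨|S₀ s L + S₀ L u| + |S₀ w L' + S₀ L' s| + |S₀ u R + S₀ R w| + 1, ?_, ?_, ?_⟩ <;>
    linarith [le_abs_self (S₀ s L + S₀ L u), le_abs_self (S₀ w L' + S₀ L' s),
      le_abs_self (S₀ u R + S₀ R w), abs_nonneg (S₀ s L + S₀ L u),
      abs_nonneg (S₀ w L' + S₀ L' s), abs_nonneg (S₀ u R + S₀ R w)]
  obtain ⟨hK1, hK2, hK3⟩ := hK
  let S := triangleWeight M S₀ u s w K
  let base : N → N → ℝ := fun p q => if Real p ∧ Real q then base₀ p q else S p q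
  have S_anti : ∀ p q, S p q = - S q p := triangleWeight_anti hS us sw uw K
  have S_M : ∀ p q, M p ∨ M q → S p q = S₀ p q := fun p q hM => if_pos hM
  have S_us : S u s = -K := by grind [triangleWeight]
  have S_sw : S s w = -K := by grind [triangleWeight]
  have S_wu : S w u = -K := by grind [triangleWeight]
  have base_real : ∀ p q, Real p → Real q → base p q = base₀ p q := fun p q h1 h2 => if_pos ⟨h1, h2⟩
  have base_not : ∀ p q, ¬ (Real p ∧ Real q) → base p q = S p q := fun p q h => if_neg h
  have base_anti : ∀ p q, base p q = - base q p := by grind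
  -- the extended sweep
  have st1 := Steps.cons [u, L] s [] [L'] w [] _ _ _ h
  have st2 := Steps.cons [] u [] [L] s [w] _ _ _ st1
  have st3 := Steps.cons [] u [R] [] w [] _ _ _ (Steps.refl [u, w])
  simp only [List.nil_append, List.cons_append, List.reverse_cons, List.reverse_nil,
    Multiset.coe_nil, zero_add] at st2 st3
  have st := st2.trans st3 (T := T) (by
    congr 1
    exact Multiset.cons_swap u R {w})
  obtain ⟨sw'⟩ := @Steps.nonempty_sweep N ⟨u⟩ _ _ _ _ st hT
  have tri : ∀ a b c, a ≠ b → a ≠ c → b ≠ c → (∀ p, Real p → (p = a ∨ p = b ∨ p = c) → p = s) →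
      S a b + S b c + S c a < 0 → base a b = S a b → base b c = S b c → base c a = S c a →
      ChordOK S base (Ch ((a :: b :: c :: [] : List N) : Cycle N)) ((a :: b :: c :: [] : List N) : Cycle N) ∧
        ((a :: b :: c :: [] : List N) : Cycle N).Chain fun u v => base u v = S u v := by
    intro a b c h1 h2 h3 hreal hlt e1 e2 e3
    refine ⟨chordOK_triangle (fun p q hpq => ?_) a b c h1 h2 h3 hlt, ?_⟩
    · obtain ⟨k1, k2, k3, k4, k5⟩ := hch _ p q hpq
      simp only [Cycle.mem_coe_iff, List.mem_cons, List.not_mem_nil, or_false] at k1 k2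
      exact k3 ((hreal p k4 k1).trans (hreal q k5 k2).symm)
    · grind [Cycle.chain_coe_cons]
  have nR : ∀ p, M p → ¬ Real p := fun p h1 h2 => rM p h2 h1
  have hFall : ∀ f ∈ (((([u, s, L] : List N) : Cycle N) ::ₘ (([s, w,
      L'] : List N) : Cycle N) ::ₘ F) +
      (([u, R, w] : List N) : Cycle N) ::ₘ 0 : Multiset (Cycle N)), ChordOK S base (Ch f) f ∧ f.Chain fun u v => base u v = S u v := by
    intro f hf
    simp only [Multiset.mem_add, Multiset.mem_cons, Multiset.notMem_zero, or_false] at hf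
    rcases hf with (rfl | rfl | hf) | rfl
    · grind []
    · grind []
    · refine ⟨hF f hf S base S_anti base_anti S_M base_real, ?_⟩
      refine (hFM f hf).imp fun p q hpq => base_not p q ?_
      grind
    · refine tri u R w uR uw Rw ?_ ?_ (base_not _ _ ?_) (base_not _ _ ?_) (base_not _ _ ?_)
      · grind
      · grind
      · exact fun h => ru h.1
      · exact fun h => rw' h.2
      · exact fun h => ru h.2
  obtain ⟨X, Y, hinj, hsort, hon, hex, hmono, hchord, hdead⟩ :=
    sw'.exists_placement S_anti base_anti hs hFall (M := [s]) rfl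
  have hrange : ∀ t ≤ sw'.n, ∀ v ∈ sw'.P t, Y u ≤ Y v ∧ Y v ≤ Y w := by
    intro t ht v hv
    obtain ⟨M', e⟩ := sw'.path_form (M := [s]) rfl t ht
    grind [List.pairwise_cons]
  have hfaces : ∀ f ∈ F, ∃ t < sw'.n, f = sw'.face t := fun f hf =>
    sw'.face_surj f (by simp [hf])
  refine ⟨X, Y, hinj, ?_, ?_, ?_⟩
  · rintro f hf p q v hc hv h1 h2 e
    obtain ⟨t, ht, rfl⟩ := hfaces f hf
    obtain ⟨i, hi, hvi⟩ := sw'.total_mem v hv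
    have hvi' := hon i hi v hvi
    have hr := hrange i hi v hvi
    rcases Nat.lt_or_ge t i with hti | hti
    · obtain ⟨x, hx⟩ := hex (t + 1) ht _ hr.1 hr.2
      have k1 := (hchord t ht p q hc x (Y v) h1 h2).2 hx
      have k2 := hmono (t + 1) i hti hi _ _ _ hx hvi'
      linarith
    · obtain ⟨x, hx⟩ := hex t ht.le _ hr.1 hr.2
      have k1 := (hchord t ht p q hc x (Y v) h1 h2).1 hx
      have k2 := hmono i t hti ht.le _ _ _ hvi' hx
      linarith
  · have aux : ∀ t t', t < t' → t' < sw'.n → ∀ p q p' q' y, Ch (sw'.face t) p q →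
        Ch (sw'.face t') p' q' → Y p < y → y < Y q → Y p' < y → y < Y q' →
        lin X Y p q y < lin X Y p' q' y := by
      intro t t' htt' ht' p q p' q' y hc hc' h1 h2 h3 h4
      have rng : Y u ≤ y ∧ y ≤ Y w := by
        have mem : ∀ p, p ∈ sw'.face t → Y u ≤ Y p ∧ Y p ≤ Y w := by
          intro p hp
          have hl := sw'.left t (htt'.trans ht')
          have hr := sw'.right t (htt'.trans ht')
          simp only [Sweep.face, Cycle.mem_coe_iff, List.mem_cons, List.mem_append,
            List.mem_reverse] at hp
          have : p ∈ sw'.P t ∨ p ∈ sw'.P (t + 1) := by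
            rw [hl, hr]
            simp only [List.mem_append, List.mem_cons]
            tauto
          rcases this with h | h
          · exact hrange t (by omega) p h
          · exact hrange (t + 1) (by omega) p h
        obtain ⟨m1, m2, -⟩ := hch _ _ _ hc
        exact ⟨(mem p m1).1.trans h1.le, h2.le.trans (mem q m2).2⟩
      obtain ⟨x, hx⟩ := hex (t + 1) (by omega) y rng.1 rng.2
      obtain ⟨x', hx'⟩ := hex t' ht'.le y rng.1 rng.2
      have k1 := (hchord t (by omega) p q hc x y h1 h2).2 hx
      have k2 := (hchord t' ht' p' q' hc' x' y h3 h4).1 hx'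
      have k3 := hmono (t + 1) t' htt' ht'.le _ _ _ hx hx'
      linarith
    intro f hf f' hf' hne p q p' q' y hc hc' h1 h2 h3 h4
    obtain ⟨t, ht, rfl⟩ := hfaces f hf
    obtain ⟨t', ht', rfl⟩ := hfaces f' hf'
    rcases lt_trichotomy t t' with hlt | rfl | hlt
    · exact (aux t t' hlt ht' p q p' q' y hc hc' h1 h2 h3 h4).ne
    · exact absurd rfl hne
    · exact (aux t' t hlt ht p' q' p q y hc' hc h3 h4 h1 h2).ne'
  · have s0 : sw'.P 0 = [u, s, w] := sw'.start
    have sn : sw'.P sw'.n = [u, w] := sw'.final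
    have hsort0 := hsort 0 (Nat.zero_le _)
    rw [s0] at hsort0
    simp only [List.pairwise_cons, List.mem_cons, List.not_mem_nil, or_false] at hsort0
    have Yus : Y u < Y s := hsort0.1 s (Or.inl rfl)
    have Ysw : Y s < Y w := hsort0.2.1 w rfl
    have Xs : X s < lin X Y u w (Y s) := by
      obtain ⟨t, ht, m1, m2⟩ : ∃ t < sw'.n, s ∈ sw'.P t ∧ s ∉ sw'.P (t + 1) := by
        by_contra hcon
        push Not at hcon
        have : ∀ t ≤ sw'.n, s ∈ sw'.P t := by
          intro t
          induction t with
          | zero => intro _; rw [s0]; simp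
          | succ t ih => exact fun ht => hcon t ht (ih (by omega))
        have := this _ le_rfl
        rw [sn] at this
        simp [Ne.symm us, sw] at this
      have hA : s ∈ sw'.A t := by
        rw [sw'.left t ht] at m1
        rw [sw'.right t ht] at m2
        simp only [List.mem_append, List.mem_cons] at m1 m2
        tauto
      obtain ⟨x, hx⟩ := hex (t + 1) ht _ Yus.le Ysw.le
      have k1 := hdead t ht s hA x hx
      have k2 := hmono (t + 1) sw'.n ht le_rfl x (lin X Y u w (Y s)) (Y s) hx (by
        rw [sn]; exact ⟨u, w, List.infix_rfl, Yus.le, Ysw.le, rfl⟩)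
      linarith
    have Yuw := Yus.trans Ysw
    refine ⟨(X w - X u) / (Y w - Y u), fun v hv hvs => ?_⟩
    set c := (X w - X u) / (Y w - Y u) with hc
    have hcD : c * (Y w - Y u) = X w - X u := div_mul_cancel₀ _ (by linarith)
    have e1 := lin_sub_left (X := X) Yuw c (Y s)
    have ew : X u - c * Y u - (X w - c * Y w) = 0 := by linarith
    rw [ew, mul_zero] at e1
    have e2 : lin X Y u w (Y s) - c * Y s = X w - c * Y w := by grind
    have hsu : X s - c * Y s < X u - c * Y u := by linarith
    have hsw : X s - c * Y s < X w - c * Y w := by linarith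
    obtain ⟨i, hi, hvi⟩ := sw'.total_mem v hv
    have hr := hrange i hi v hvi
    have hne : Y v ≠ Y s := fun e =>
      hvs (hinj v hv s (sw'.mem_total 0 (Nat.zero_le _) s (by rw [s0]; simp)) e)
    rcases lt_or_gt_of_ne hne with hlt | hlt
    · have k := hmono 0 i (Nat.zero_le _) hi (lin X Y u s (Y v)) _ _ (by
        rw [s0]; exact ⟨u, s, infix_pair_iff.2 ⟨[], [w], rfl⟩, hr.1, hlt.le, rfl⟩) (hon i hi v hvi)
      have e3 := lin_sub_left (X := X) Yus c (Y v)
      have : 0 < (Y s - Y v) * (X u - c * Y u - (X s - c * Y s)) :=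
        mul_pos (by linarith) (by linarith)
      rw [← e3] at this
      have := pos_of_mul_pos_right this (by linarith)
      linarith
    · have k := hmono 0 i (Nat.zero_le _) hi (lin X Y s w (Y v)) _ _ (by
        rw [s0]; exact ⟨s, w, infix_pair_iff.2 ⟨[u], [], rfl⟩, hlt.le, hr.2, rfl⟩) (hon i hi v hvi)
      have e3 := lin_sub_right (X := X) Ysw c (Y v)
      have : 0 < (Y v - Y s) * (X w - c * Y w - (X s - c * Y s)) :=
        mul_pos (by linarith) (by linarith)
      rw [← e3] at this
      have := pos_of_mul_pos_right this (by linarith)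
      linarith

end Extreme

section Open
variable {N : Type*}

/-- Like `Steps`, but some flips `(b, A, B)`, recorded in a list, are not closed at the top yet. -/
inductive OpenSteps : List N → List N → List (N × List N × List N) → Multiset (Cycle N) →
    Multiset N → Prop
  | refl (l : List N) : OpenSteps l l [] 0 l
  | flip (x : List N) (a : N) (A B : List N) (b : N) (y r : List N) (C : List (N × List N × List N))
      (F : Multiset (Cycle N)) (T : Multiset N) : OpenSteps (x ++ a :: (B ++ b :: y)) r C F T →
      OpenSteps (x ++ a :: (A ++ b :: y)) r C
        (((a :: (A ++ b :: B.reverse) : List N) : Cycle N) ::ₘ F) (A + T)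
  | cell (x : List N) (b : N) (A B r : List N) (C : List (N × List N × List N))
      (F : Multiset (Cycle N)) (T : Multiset N) : OpenSteps (x ++ b :: B) r C F T →
      OpenSteps (x ++ b :: A) r ((b, A, B) :: C) F (A + T)

namespace OpenSteps

theorem toSteps {l r : List N} {F T} (h : OpenSteps l r [] F T) : Steps l r F T := by
  generalize hC : ([] : List (N × List N × List N)) = C at h
  induction h with
  | refl l => exact .refl l
  | flip x a A B b y r C F T _ ih => exact .cons x a A B b y r F T (ih hC)
  | cell => cases hC

theorem right_le {l r : List N} {C F T} (h : OpenSteps l r C F T) : (r : Multiset N) ≤ T := by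
  induction h with
  | refl l => exact le_rfl
  | flip x a A B b y r C F T _ ih => exact ih.trans (Multiset.le_add_left _ _)
  | cell x b A B r C F T _ ih => exact ih.trans (Multiset.le_add_left _ _)

theorem left_le {l r : List N} {C F T} (h : OpenSteps l r C F T) : (l : Multiset N) ≤ T := by
  induction h with
  | refl l => exact le_rfl
  | flip x a A B b y r C F T _ ih =>
    have : ((x ++ a :: (A ++ b :: y) : List N) : Multiset N) ≤
        (A : Multiset N) + (x ++ a :: (B ++ b :: y) : List N) := by
      simp only [← Multiset.coe_add, ← Multiset.cons_coe]
      rw [Multiset.le_iff_exists_add]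
      exact ⟨B, by simp only [← Multiset.singleton_add]; abel⟩
    exact this.trans (by gcongr)
  | cell x b A B r C F T _ ih =>
    have : ((x ++ b :: A : List N) : Multiset N) ≤ (A : Multiset N) + (x ++ b :: B : List N) := by
      simp only [← Multiset.coe_add, ← Multiset.cons_coe]
      rw [Multiset.le_iff_exists_add]
      exact ⟨B, by simp only [← Multiset.singleton_add]; abel⟩
    exact this.trans (by gcongr)

theorem trans {l m r : List N} {C₁ C₂ F₁ F₂ T₁ T₂ T} (h₁ : OpenSteps l m C₁ F₁ T₁)
    (h₂ : OpenSteps m r C₂ F₂ T₂) (hT : T + (m : Multiset N) = T₁ + T₂) :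
    OpenSteps l r (C₁ ++ C₂) (F₁ + F₂) T := by
  induction h₁ generalizing T with
  | refl l =>
    have : T = T₂ := by
      rw [add_comm] at hT
      exact add_left_cancel hT
    subst this
    simpa using h₂
  | flip x a A B b y m C F T' h ih =>
    obtain ⟨T'', hT''⟩ : ∃ T'', T'' + (m : Multiset N) = T' + T₂ := by
      obtain ⟨K, hK⟩ := Multiset.le_iff_exists_add.1 h.right_le
      exact ⟨K + T₂, by rw [hK]; abel⟩
    have : T = A + T'' := by
      apply add_right_cancel (b := (m : Multiset N))
      rw [hT, add_assoc, add_assoc, hT'']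
    rw [this, Multiset.cons_add]
    exact .flip x a A B b y r _ _ _ (ih h₂ hT'')
  | cell x b A B m C F T' h ih =>
    obtain ⟨T'', hT''⟩ : ∃ T'', T'' + (m : Multiset N) = T' + T₂ := by
      obtain ⟨K, hK⟩ := Multiset.le_iff_exists_add.1 h.right_le
      exact ⟨K + T₂, by rw [hK]; abel⟩
    have : T = A + T'' := by
      apply add_right_cancel (b := (m : Multiset N))
      rw [hT, add_assoc, add_assoc, hT'']
    rw [this]
    exact .cell x b A B r _ _ _ (ih h₂ hT'')

theorem split {l r : List N} {C₁ C₂ F T} (h : OpenSteps l r (C₁ ++ C₂) F T) :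
    ∃ m F₁ F₂ T₁ T₂, OpenSteps l m C₁ F₁ T₁ ∧ OpenSteps m r C₂ F₂ T₂ ∧ F = F₁ + F₂ ∧
      T + (m : Multiset N) = T₁ + T₂ := by
  generalize hC : C₁ ++ C₂ = C at h
  induction h generalizing C₁ with
  | refl l =>
    obtain ⟨rfl, rfl⟩ := List.append_eq_nil_iff.1 hC
    exact ⟨l, 0, 0, l, l, .refl l, .refl l, rfl, rfl⟩
  | flip x a A B b y r C F T h ih =>
    obtain ⟨m, F₁, F₂, T₁, T₂, h₁, h₂, rfl, hT⟩ := ih hC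
    exact ⟨m, _, F₂, _, T₂, .flip x a A B b y m _ _ _ h₁, h₂, by rw [Multiset.cons_add], by
      rw [add_assoc, hT, add_assoc]⟩
  | cell x b A B r C F T h ih =>
    rcases C₁ with _ | ⟨c, C₁⟩
    · rw [List.nil_append] at hC
      subst hC
      exact ⟨_, 0, F, _, _, .refl _, .cell x b A B r C F T h, by simp, by rw [add_comm]⟩
    · rw [List.cons_append, List.cons.injEq] at hC
      obtain ⟨rfl, hC⟩ := hC
      obtain ⟨m, F₁, F₂, T₁, T₂, h₁, h₂, rfl, hT⟩ := ih hC
      exact ⟨m, F₁, F₂, _, T₂, .cell x b A B m _ _ _ h₁, h₂, rfl, by rw [add_assoc, hT, add_assoc]⟩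

/-- The face obtained by closing a cell at the vertex `t`. -/
def closeCell (t : N) (c : N × List N × List N) : Cycle N :=
  ((c.1 :: (c.2.1 ++ t :: c.2.2.reverse) : List N) : Cycle N)

theorem close {l r : List N} {C F T} (h : OpenSteps l r C F T) (t : N) (ω : List N) :
    OpenSteps (l ++ t :: ω) (r ++ t :: ω) [] (F + (C.map (closeCell t) : List (Cycle N)))
      (T + (t :: ω : List N)) := by
  induction h with
  | refl l => exact .refl _
  | flip x a A B b y r C F T h ih =>
    rw [Multiset.cons_add, add_assoc]
    grind [OpenSteps.flip]
  | cell x b A B r C F T h ih =>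
    rw [List.map_cons, ← Multiset.cons_coe, Multiset.add_cons, add_assoc]
    grind [closeCell, OpenSteps.flip]

theorem append_closed {l r : List N} {F T} (h : OpenSteps l r [] F T) (z : List N) :
    OpenSteps (l ++ z) (r ++ z) [] F (T + z) := by
  generalize hC : ([] : List (N × List N × List N)) = C at h
  induction h with
  | refl l => exact .refl _
  | flip x a A B b y r C F T h ih => grind [add_assoc, OpenSteps.flip]
  | cell => cases hC

theorem append_last {l r : List N} {C : List (N × List N × List N)} {b : N} {A B : List N} {F T}
    (h : OpenSteps l r (C ++ [(b, A, B)]) F T) (z : List N) :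
    OpenSteps l (r ++ z) (C ++ [(b, A, B ++ z)]) F (T + z) := by
  generalize hC : C ++ [(b, A, B)] = C' at h
  induction h generalizing C with
  | refl l => simp at hC
  | flip x a A' B' b' y r C' F T h ih =>
    rw [add_assoc]
    exact .flip _ _ _ _ _ _ _ _ _ _ (ih hC)
  | cell x b' A' B' r C' F T h ih =>
    rw [add_assoc]
    rcases C with _ | ⟨c, C⟩
    · simp only [List.nil_append, List.cons.injEq] at hC
      obtain ⟨hc, rfl⟩ := hC
      cases hc
      refine .cell _ _ _ _ _ _ _ _ ?_
      simpa only [List.append_assoc, List.cons_append] using h.append_closed z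
    · rw [List.cons_append, List.cons.injEq] at hC
      obtain ⟨rfl, hC⟩ := hC
      exact .cell _ _ _ _ _ _ _ _ (ih hC)

theorem append_first {l r : List N} {C : List (N × List N × List N)} {b : N} {A B : List N} {F T}
    (h : OpenSteps l r ((b, A, B) :: C) F T) (z : List N) :
    OpenSteps (l ++ z) r ((b, A ++ z, B) :: C) F (T + z) := by
  generalize hC : (b, A, B) :: C = C' at h
  induction h with
  | refl l => simp at hC
  | flip x a A' B' b' y r C' F T h ih => grind [add_assoc, OpenSteps.flip]
  | cell x b' A' B' r C' F T h ih =>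
    simp only [List.cons.injEq] at hC
    obtain ⟨hc, rfl⟩ := hC
    cases hc
    have : (A : Multiset N) + T + z = (A ++ z : List N) + T := by
      rw [← Multiset.coe_add]; abel
    grind [OpenSteps.cell]

/-- The cells between consecutive strands `ν`, `N₁`, `N₂`, … springing from `b`. -/
def freshCells (b : N) : N → List N → List (N × List N × List N)
  | _, [] => []
  | ν, ν' :: L => (b, [ν], [ν']) :: freshCells b ν' L

theorem fresh (x : List N) (b ν : N) (L : List N) :
    OpenSteps (x ++ b :: [ν]) (x ++ b :: [L.getLastD ν]) (freshCells b ν L) 0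
      ((x ++ [b] : List N) + (ν :: L : List N)) := by
  induction L generalizing ν with
  | nil =>
    have := OpenSteps.refl (x ++ b :: [ν])
    have e : ((x ++ b :: [ν] : List N) : Multiset N) = (x ++ [b] : List N) + ([ν] : List N) := by
      rw [Multiset.coe_add]; simp
    rw [e] at this
    exact this
  | cons ν' L ih =>
    have := OpenSteps.cell x b [ν] [ν'] _ _ _ _ (ih ν')
    rw [List.getLastD_cons]
    have e : ((x ++ [b] : List N) : Multiset N) + (ν :: ν' :: L : List N) =
      ([ν] : List N) + ((x ++ [b] : List N) + (ν' :: L : List N)) := by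
      simp only [← Multiset.cons_coe, ← Multiset.singleton_add, Multiset.coe_nil]
      abel
    rw [e]
    exact this

/-- A block of strands is closed off by the word `ω₀ :: ω` and new strands spring from its last
letter. -/
theorem event {l' p q r : List N} {C' Cin C₂ : List (N × List N × List N)} {b : N}
    {A B : List N} {F₁ F₂ F₃ : Multiset (Cycle N)} {T₁ T₂ T₃ T T' : Multiset N}
    {L : List N} {ν t : N} {ω : List N} {e : N}
    (hω : ∃ x, t :: ω = x ++ [e])
    (h₁ : OpenSteps l' (p ++ (t :: ω ++ [ν])) C' F₁ (T₁ + T'))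
    (h₂ : OpenSteps p q Cin F₂ T₂) (h₃ : OpenSteps q r ((b, A, B) :: C₂) F₃ T₃)
    (hT : T + (p : Multiset N) + (q : Multiset N) = T₁ + T₂ + T₃)
    (hT' : T' = ((t :: ω ++ [ν] : List N) : Multiset N)) :
    OpenSteps l' r (C' ++ (freshCells e ν L ++ (b, A ++ (t :: ω ++ [L.getLastD ν]), B) :: C₂))
      (F₁ + (F₂ + (Cin.map (closeCell t) : List (Cycle N)) + F₃))
      (T + ((t :: ω ++ ν :: L : List N) : Multiset N)) := by
  subst hT'
  have k₃ := h₃.append_first (t :: ω ++ [L.getLastD ν])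
  have k₂ := (h₂.close t ω).append_closed [L.getLastD ν]
  obtain ⟨x, hx⟩ := hω
  have k₀ := fresh (p ++ x) e ν L
  have e₁ : p ++ x ++ e :: [ν] = p ++ (t :: ω ++ [ν]) := by rw [hx]; simp
  have e₂ : p ++ x ++ e :: [L.getLastD ν] = p ++ (t :: ω) ++ [L.getLastD ν] := by rw [hx]; simp
  have e₄ : q ++ t :: ω ++ [L.getLastD ν] = q ++ (t :: ω ++ [L.getLastD ν]) := by simp
  rw [e₁, e₂] at k₀
  rw [e₄] at k₂
  have hx' : ((t :: ω : List N) : Multiset N) = (x : Multiset N) + {e} := by aesop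
  obtain ⟨K, hK⟩ := Multiset.le_iff_exists_add.1 h₂.left_le
  obtain ⟨K', hK'⟩ := Multiset.le_iff_exists_add.1 h₃.left_le
  have hTT : T = T₁ + K + K' := by
    apply add_right_cancel (b := (p : Multiset N) + (q : Multiset N))
    rw [← add_assoc, hT, hK, hK']; abel
  have kk : OpenSteps (p ++ (t :: ω) ++ [L.getLastD ν]) r
      ([] ++ (b, A ++ (t :: ω ++ [L.getLastD ν]), B) :: C₂)
      (F₂ + (Cin.map (closeCell t) : List (Cycle N)) + F₃)
      (T₂ + K' + ((t :: ω : List N) + ([L.getLastD ν] : List N))) := by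
    refine k₂.trans k₃ ?_
    simp only [← Multiset.coe_add]
    rw [hK']; abel
  have kk' := k₀.trans kk (T := ((ν :: L : List N) : Multiset N) + (T₂ + K' + ((t :: ω : List N) : Multiset N))) (by
    grind [Multiset.coe_add])
  have := h₁.trans kk' (T := T + ((t :: ω ++ ν :: L : List N) : Multiset N)) (by
    grind [Multiset.coe_add])
  simpa using this

end OpenSteps
end Open

section Core
variable {N : Type*}

/-- Consecutive vertices on a path: born in this order, and one of them is a marker. -/
def Up (birth : N → ℕ) (M : N → Prop) (p q : N) : Prop := birth p < birth q ∧ (M p ∨ M q)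

/-- The total weight of a list of nodes. -/
def wsum (w : N → ℝ) (L : List N) : ℝ := (L.map w).sum

theorem wsum_append (w : N → ℝ) (L L' : List N) : wsum w (L ++ L') = wsum w L + wsum w L' := by
  simp [wsum]

theorem wsum_cons (w : N → ℝ) (a : N) (L : List N) : wsum w (a :: L) = w a + wsum w L := by
  simp [wsum]

theorem wsum_nil (w : N → ℝ) : wsum w [] = 0 := by simp [wsum]

theorem wsum_congr {w w' : N → ℝ} {L : List N} (h : ∀ v ∈ L, w' v = w v) :
    wsum w' L = wsum w L := by
  unfold wsum; rw [List.map_congr_left h]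

theorem wsum_eq_zero {w : N → ℝ} {L : List N} (h : ∀ v ∈ L, w v = 0) : wsum w L = 0 := by
  rw [wsum_congr (w := fun _ => 0) h]; simp [wsum]

/-- A cell which is not closed yet: it lies above `b`, between the paths `A ++ [lam]` and
`B ++ [rho]`. -/
theorem getLastD_mem {α : Type*} (a : α) (L : List α) : L.getLastD a ∈ a :: L := by grind

structure OpenCell (N : Type*) where
  b : N
  A : List N
  lam : N
  B : List N
  rho : N

namespace OpenCell

def toTriple (c : OpenCell N) : N × List N × List N := (c.b, c.A ++ [c.lam], c.B ++ [c.rho])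

/-- The left end strand of each cell is the right end strand of the previous one. -/
def Linked : N → List (OpenCell N) → Prop
  | _, [] => True
  | ρ, c :: cs => c.lam = ρ ∧ Linked c.rho cs

theorem linked_append {ρ : N} {C₁ C₂ : List (OpenCell N)} :
    Linked ρ (C₁ ++ C₂) ↔ Linked ρ C₁ ∧ Linked ((C₁.map rho).getLastD ρ) C₂ := by
  induction C₁ generalizing ρ with
  | nil => simp [Linked]
  | cons c C₁ ih => grind [Linked]

theorem Linked.lam_mem {ρ : N} {C : List (OpenCell N)} (h : Linked ρ C) {c : OpenCell N}
    (hc : c ∈ C) : c.lam ∈ ρ :: C.map rho := by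
  induction C generalizing ρ with
  | nil => simp at hc
  | cons d C ih =>
    rcases List.mem_cons.1 hc with rfl | hc
    · rw [h.1]; simp
    · exact List.mem_cons_of_mem _ (ih h.2 hc)

/-- The cells springing from `b` between consecutive strands. -/
def fresh (b : N) : N → List N → List (OpenCell N)
  | _, [] => []
  | ν, ν' :: L => ⟨b, [], ν, [], ν'⟩ :: fresh b ν' L

theorem fresh_toTriple (b ν : N) (L : List N) :
    (fresh b ν L).map toTriple = OpenSteps.freshCells b ν L := by
  induction L generalizing ν with
  | nil => rfl
  | cons ν' L ih => simp [fresh, OpenSteps.freshCells, toTriple, ih]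

theorem fresh_rho (b ν : N) (L : List N) : (fresh b ν L).map rho = L := by
  induction L generalizing ν with
  | nil => rfl
  | cons ν' L ih => simp [fresh, ih]

theorem fresh_linked (b ν : N) (L : List N) : Linked ν (fresh b ν L) := by
  induction L generalizing ν with
  | nil => trivial
  | cons ν' L ih => exact ⟨rfl, ih ν'⟩

theorem mem_fresh {b ν : N} {L : List N} {c : OpenCell N} (h : c ∈ fresh b ν L) :
    c.b = b ∧ c.A = [] ∧ c.B = [] ∧ c.lam ∈ ν :: L ∧ c.rho ∈ ν :: L := by
  induction L generalizing ν with
  | nil => simp [fresh] at h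
  | cons ν' L ih => grind [fresh]

/-- Prolong the right side of a cell. -/
def extR (c : OpenCell N) (ω : List N) (ν : N) : OpenCell N :=
  ⟨c.b, c.A, c.lam, c.B ++ c.rho :: ω, ν⟩

/-- Prolong the left side of a cell. -/
def extL (c : OpenCell N) (ω : List N) (ν : N) : OpenCell N :=
  ⟨c.b, c.A ++ c.lam :: ω, ν, c.B, c.rho⟩

/-- A cell whose left side has been lighter than its right side; `str` are the strands. -/
structure OK (birth : N → ℕ) (M : N → Prop) (lt : ℝ → ℝ → Prop) (n : ℕ) (w : N → ℝ)
    (str : List N) (c : OpenCell N) : Prop where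
  left : List.IsChain (Up birth M) (c.b :: (c.A ++ [c.lam]))
  right : List.IsChain (Up birth M) (c.b :: (c.B ++ [c.rho]))
  lt : lt (wsum w c.A + w c.lam) (wsum w c.B + w c.rho)
  dead : ∀ v ∈ c.b :: (c.A ++ c.B), v ∉ str ∧ birth v < n

end OpenCell

/-- A closed cell whose left side is lighter than its right side. -/
def LightFace (birth : N → ℕ) (M : N → Prop) (w : N → ℝ) (f : Cycle N) : Prop :=
  ∃ a A b B, f = ((a :: (A ++ b :: B.reverse) : List N) : Cycle N) ∧
    List.IsChain (Up birth M) (a :: (A ++ [b])) ∧ List.IsChain (Up birth M) (a :: (B ++ [b])) ∧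
    wsum w A < wsum w B

theorem LightFace.congr {birth : N → ℕ} {M : N → Prop} {w w' : N → ℝ} {f : Cycle N}
    (h : LightFace birth M w f) (hw : ∀ v ∈ f, w' v = w v) : LightFace birth M w' f := by
  obtain ⟨a, A, b, B, rfl, h1, h2, h3⟩ := h
  refine ⟨a, A, b, B, rfl, h1, h2, ?_⟩
  rwa [wsum_congr (w := w) (w' := w') (fun v hv => hw v (by simp [hv])),
    wsum_congr (w := w) (w' := w') (fun v hv => hw v (by simp [hv]))]

/-- A partial sweep, growing upwards. Its topmost nodes are the strands `ρ :: cells.map rho`, the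
only ones whose weight may still change. -/
structure PartialSweep (birth : N → ℕ) (M : N → Prop) (lt : ℝ → ℝ → Prop) (n : ℕ) (w : N → ℝ)
    (ρ : N) (l r : List N) (cells : List (OpenCell N)) (F : Multiset (Cycle N))
    (T : Multiset N) : Prop where
  steps : OpenSteps l r (cells.map OpenCell.toTriple) F T
  nodup : T.Nodup
  birth_lt : ∀ v ∈ T, birth v < n
  weight : ∀ v, n ≤ birth v → w v = 0
  linked : OpenCell.Linked ρ cells
  strands_nodup : (ρ :: cells.map OpenCell.rho).Nodup
  strands : ∀ v ∈ ρ :: cells.map OpenCell.rho, M v ∧ birth v < n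
  cells_ok : ∀ c ∈ cells, c.OK birth M lt n w (ρ :: cells.map OpenCell.rho)
  faces_ok : ∀ f ∈ F, LightFace birth M w f ∧
    ∀ v ∈ f, v ∉ ρ :: cells.map OpenCell.rho ∧ birth v < n

namespace PartialSweep
variable {birth : N → ℕ} {M : N → Prop} {n : ℕ} {w : N → ℝ} {ρ : N} {l r : List N}
  {F : Multiset (Cycle N)} {T : Multiset N}

theorem slab {cells : List (OpenCell N)} (h : PartialSweep birth M (· ≤ ·) n w ρ l r cells F T)
    {ξ : N → ℝ} (hξ : ∀ v ∉ ρ :: cells.map OpenCell.rho, ξ v = 0)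
    (hlt : ∀ c ∈ cells, ξ c.lam < ξ c.rho) {t : ℝ} (ht : 0 < t) :
    PartialSweep birth M (· < ·) n (fun v => w v + t * ξ v) ρ l r cells F T := by
  refine { h with weight := ?_, cells_ok := ?_, faces_ok := ?_ }
  · intro v hv
    rw [h.weight v hv, hξ v (fun hm => absurd (h.strands v hm).2 (by omega))]; simp
  · intro c hc
    have hok := h.cells_ok c hc
    refine ⟨hok.left, hok.right, ?_, hok.dead⟩
    have e : ∀ L : List N, (∀ v ∈ L, v ∈ c.b :: (c.A ++ c.B)) →
        wsum (fun v => w v + t * ξ v) L = wsum w L := fun L hL =>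
      wsum_congr fun v hv => by rw [hξ v (hok.dead v (hL v hv)).1]; simp
    rw [e _ (fun v hv => by simp [hv]), e _ (fun v hv => by simp [hv])]
    have := hok.lt
    have := mul_lt_mul_of_pos_left (hlt c hc) ht
    linarith
  · intro f hf
    obtain ⟨h1, h2⟩ := h.faces_ok f hf
    grind [h1.congr]

set_option maxHeartbeats 2000000 in
theorem event {C₁ Cin C₂ : List (OpenCell N)} {cL cR : OpenCell N}
    (h : PartialSweep birth M (· < ·) n w ρ l r (C₁ ++ cL :: (Cin ++ cR :: C₂)) F T)
    {t e ν : N} {ω x L : List N} {n' : ℕ} (hω : t :: ω = x ++ [e])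
    (hM : ∀ v ∈ ν :: L, M v) (hbω : ∀ v ∈ t :: ω, n ≤ birth v ∧ birth v < n')
    (hbν : ∀ v ∈ ν :: L, n ≤ birth v ∧ birth v < n' ∧ birth e < birth v)
    (hch : List.IsChain (Up birth M) (t :: ω)) (hnd : (t :: ω ++ ν :: L).Nodup) :
    PartialSweep birth M (· ≤ ·) n' w ρ l r
      (C₁ ++ cL.extR (t :: ω) ν ::
        (OpenCell.fresh e ν L ++ cR.extL (t :: ω) (L.getLastD ν) :: C₂))
      (F + (Cin.map (OpenSteps.closeCell t ∘ OpenCell.toTriple) : List (Cycle N)))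
      (T + ((t :: ω ++ ν :: L : List N) : Multiset N)) := by
  have hnn' : n ≤ n' := (hbω t (by simp)).1.trans (hbω t (by simp)).2.le
  have he : e ∈ t :: ω := by rw [hω]; simp
  have hlast : L.getLastD ν ∈ ν :: L := by
    exact getLastD_mem ν L
  have hnew : ∀ v ∈ t :: ω ++ ν :: L, n ≤ birth v ∧ birth v < n' := by aesop
  have hdisj : ∀ v ∈ t :: ω, v ∉ ν :: L := fun v hv hv' =>
    List.disjoint_of_nodup_append hnd hv hv'
  -- the strands before and after
  have hold : ρ :: (C₁ ++ cL :: (Cin ++ cR :: C₂)).map OpenCell.rho =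
      (ρ :: C₁.map OpenCell.rho) ++ ((cL.rho :: Cin.map OpenCell.rho) ++
        (cR.rho :: C₂.map OpenCell.rho)) := by simp
  have hstr : ρ :: (C₁ ++ cL.extR (t :: ω) ν :: (OpenCell.fresh e ν L ++
      cR.extL (t :: ω) (L.getLastD ν) :: C₂)).map OpenCell.rho =
      (ρ :: C₁.map OpenCell.rho) ++ ((ν :: L) ++ (cR.rho :: C₂.map OpenCell.rho)) := by
    simp [OpenCell.fresh_rho, OpenCell.extR, OpenCell.extL]
  have hsn := h.strands_nodup
  have hst := h.strands
  have hcells := h.cells_ok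
  have hfaces := h.faces_ok
  have hlink := h.linked
  have hsteps := h.steps
  rw [hold] at hsn hst hcells hfaces
  set P := ρ :: C₁.map OpenCell.rho
  set K := cL.rho :: Cin.map OpenCell.rho with hK
  set Q := cR.rho :: C₂.map OpenCell.rho
  rw [OpenCell.linked_append] at hlink
  obtain ⟨hl₁, hl₂, hl₃⟩ := hlink
  rw [OpenCell.linked_append] at hl₃
  obtain ⟨hl₃, hl₄, hl₅⟩ := hl₃
  have hRK : cR.lam ∈ K := by
    rw [hl₄]
    exact getLastD_mem _ _
  have hCK : ∀ c ∈ Cin, c.lam ∈ K ∧ c.rho ∈ K := fun c hc =>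
    ⟨hl₃.lam_mem hc, List.mem_cons_of_mem _ (List.mem_map_of_mem hc)⟩
  rw [List.nodup_append, List.nodup_append] at hsn
  obtain ⟨hP, ⟨hKn, hQ, hKQ⟩, hPKQ⟩ := hsn
  -- nodes born before and dead stay dead
  have dead_old : ∀ v, birth v < n → v ∉ P ++ (K ++ Q) → v ∉ P ++ ((ν :: L) ++ Q) := by grind
  have dead_K : ∀ v ∈ K, v ∉ P ++ ((ν :: L) ++ Q) := by grind
  have dead_ω : ∀ v ∈ t :: ω, v ∉ P ++ ((ν :: L) ++ Q) := by grind
  have wω : wsum w (t :: ω) = 0 := wsum_eq_zero fun v hv => h.weight v (hbω v hv).1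
  have wν : ∀ v ∈ ν :: L, w v = 0 := fun v hv => h.weight v (hbν v hv).1
  -- prolonging a side of a cell
  have chain_ext : ∀ (b : N) (A : List N) (lam v : N), List.IsChain (Up birth M) (b :: (A ++ [lam])) →
      lam ∈ K → v ∈ ν :: L →
      List.IsChain (Up birth M) (b :: (A ++ lam :: (t :: ω) ++ [v])) := by
    intro b A lam v hc hlam hv
    have e₁ : b :: (A ++ lam :: (t :: ω) ++ [v]) = (b :: (A ++ [lam])) ++ ((t :: ω) ++ [v]) := by simp
    rw [e₁]
    refine List.IsChain.append hc ?_ ?_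
    · refine List.IsChain.append hch (List.isChain_singleton _) ?_
      intro p hp q hq
      rw [hω, List.getLast?_append] at hp
      simp at hp hq
      subst hp hq
      exact ⟨(hbν _ hv).2.2, Or.inr (hM _ hv)⟩
    · intro p hp q hq
      have hp' : p = lam := by grind
      have hq' : q = t := by simpa using hq.symm
      subst hp' hq'
      have := hst p (by simp [hlam])
      exact ⟨this.2.trans_le (hbω q (by simp)).1, Or.inl this.1⟩
  refine ⟨?_, ?_, ?_, ?_, ?_, ?_, ?_, ?_, ?_⟩
  · have e₀ : (C₁ ++ cL :: (Cin ++ cR :: C₂)).map OpenCell.toTriple =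
        (C₁.map OpenCell.toTriple ++ [(cL.b, cL.A ++ [cL.lam], cL.B ++ [cL.rho])]) ++
        (Cin.map OpenCell.toTriple ++
          (cR.b, cR.A ++ [cR.lam], cR.B ++ [cR.rho]) :: C₂.map OpenCell.toTriple) := by
      simp [OpenCell.toTriple]
    rw [e₀] at hsteps
    obtain ⟨p, F₁, F', T₁, T', k₁, k', hF, hT⟩ := hsteps.split
    obtain ⟨q, F₂, F₃, T₂, T₃, k₂, k₃, hF', hT'⟩ := k'.split
    have := OpenSteps.event (L := L) (T := T) ⟨x, hω⟩ (k₁.append_last (t :: ω ++ [ν])) k₂ k₃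
      (by rw [hT, add_assoc, hT']; abel) rfl
    convert this using 1
    · simp [OpenCell.fresh_toTriple, OpenCell.toTriple, OpenCell.extR, OpenCell.extL]
    · rw [hF, hF', List.map_map]; abel
  · rw [Multiset.nodup_add]
    refine ⟨h.nodup, by simpa using hnd, ?_⟩
    rw [Multiset.disjoint_left]
    intro v hv hv'
    exact absurd (hnew v (by simpa using hv')).1 (by have := h.birth_lt v hv; omega)
  · intro v hv
    rcases Multiset.mem_add.1 hv with hv | hv
    · grind [h.birth_lt]
    · exact (hnew v (by simpa using hv)).2
  · grind [h.weight]
  · rw [OpenCell.linked_append]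
    refine ⟨hl₁, hl₂, ?_⟩
    rw [OpenCell.linked_append]
    refine ⟨OpenCell.fresh_linked e ν L, ?_, hl₅⟩
    rw [OpenCell.fresh_rho]
    rfl
  · rw [hstr, List.nodup_append, List.nodup_append]
    refine ⟨hP, ⟨(List.nodup_append.1 hnd).2.1, hQ, ?_⟩, ?_⟩
    · grind
    · grind []
  · rw [hstr]
    intro v hv
    simp only [List.mem_append] at hv
    rcases hv with hv | hv | hv
    · grind
    · exact ⟨hM v hv, (hbν v hv).2.1⟩
    · grind
  · rw [hstr]
    have old : ∀ c : OpenCell N, c.OK birth M (· < ·) n w (P ++ (K ++ Q)) →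
        c.OK birth M (· ≤ ·) n' w (P ++ ((ν :: L) ++ Q)) := fun c hc =>
      ⟨hc.left, hc.right, hc.lt.le, fun v hv =>
        ⟨dead_old v (hc.dead v hv).2 (hc.dead v hv).1, (hc.dead v hv).2.trans_le hnn'⟩⟩
    have aux : ∀ v, (birth v < n ∧ v ∉ P ++ (K ++ Q)) ∨ v ∈ K ∨ v ∈ t :: ω →
        v ∉ P ++ ((ν :: L) ++ Q) ∧ birth v < n' := by
      rintro v (⟨h1, h2⟩ | h1 | h1)
      · grind
      · grind
      · exact ⟨dead_ω v h1, (hbω v h1).2⟩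
    intro c hc
    simp only [List.mem_append, List.mem_cons] at hc
    rcases hc with hc | rfl | hc | rfl | hc
    · grind
    · have hok := hcells cL (by simp)
      refine ⟨hok.left, chain_ext _ _ _ _ hok.right (by simp [hK]) (by simp [OpenCell.extR]), ?_,
          ?_⟩
      · grind [hok.lt, OpenCell.extR, wsum_append, wsum_cons]
      · intro v hv
        apply aux
        simp only [OpenCell.extR, List.mem_cons, List.mem_append] at hv
        rcases hv with rfl | hv | hv | rfl | hv
        · exact Or.inl ⟨(hok.dead _ (by simp)).2, (hok.dead _ (by simp)).1⟩
        · exact Or.inl ⟨(hok.dead _ (by simp [hv])).2, (hok.dead _ (by simp [hv])).1⟩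
        · exact Or.inl ⟨(hok.dead _ (by simp [hv])).2, (hok.dead _ (by simp [hv])).1⟩
        · exact Or.inr (Or.inl (by simp [hK]))
        · exact Or.inr (Or.inr (by simpa using hv))
    · obtain ⟨h1, h2, h3, h4, h5⟩ := OpenCell.mem_fresh hc
      refine ⟨?_, ?_, ?_, ?_⟩
      · rw [h1, h2]
        simp only [List.nil_append, List.isChain_cons_cons, List.isChain_singleton, and_true]
        exact ⟨(hbν _ h4).2.2, Or.inr (hM _ h4)⟩
      · rw [h1, h3]
        simp only [List.nil_append, List.isChain_cons_cons, List.isChain_singleton, and_true]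
        exact ⟨(hbν _ h5).2.2, Or.inr (hM _ h5)⟩
      · rw [h2, h3, wν _ h4, wν _ h5]
      · intro v hv
        rw [h1, h2, h3] at hv
        simp only [List.nil_append, List.mem_singleton] at hv
        subst hv
        exact aux _ (Or.inr (Or.inr he))
    · have hok := hcells cR (by simp)
      refine ⟨chain_ext _ _ _ _ hok.left hRK hlast, hok.right, ?_, ?_⟩
      · have := hok.lt
        simp only [OpenCell.extL, wsum_append, wsum_cons w cR.lam, wω, wν _ hlast]
        linarith
      · intro v hv
        apply aux
        simp only [OpenCell.extL, List.mem_cons, List.mem_append] at hv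
        rcases hv with rfl | (hv | rfl | hv) | hv
        · exact Or.inl ⟨(hok.dead _ (by simp)).2, (hok.dead _ (by simp)).1⟩
        · exact Or.inl ⟨(hok.dead _ (by simp [hv])).2, (hok.dead _ (by simp [hv])).1⟩
        · exact Or.inr (Or.inl hRK)
        · exact Or.inr (Or.inr (by simpa using hv))
        · exact Or.inl ⟨(hok.dead _ (by simp [hv])).2, (hok.dead _ (by simp [hv])).1⟩
    · exact old c (hcells c (by simp [hc]))
  · rw [hstr]
    intro f hf
    rcases Multiset.mem_add.1 hf with hf | hf
    · obtain ⟨h1, h2⟩ := hfaces f hf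
      exact ⟨h1, fun v hv => ⟨dead_old v (h2 v hv).2 (h2 v hv).1, (h2 v hv).2.trans_le hnn'⟩⟩
    · rw [Multiset.mem_coe, List.mem_map] at hf
      obtain ⟨c, hc, rfl⟩ := hf
      have hok := hcells c (by simp [hc])
      obtain ⟨hc1, hc2⟩ := hCK c hc
      have up : ∀ v ∈ K, Up birth M v t := fun v hv =>
        ⟨(hst v (by simp [hv])).2.trans_le (hbω t (by simp)).1, Or.inl (hst v (by simp [hv])).1⟩
      have close : ∀ (A : List N) (v : N), v ∈ K → List.IsChain (Up birth M) (c.b :: (A ++ [v])) →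
          List.IsChain (Up birth M) (c.b :: (A ++ [v] ++ [t])) := by
        intro A v hv hc
        rw [← List.cons_append]
        refine List.IsChain.append hc (List.isChain_singleton _) ?_
        intro p hp q hq
        rw [← List.cons_append, List.getLast?_append] at hp
        simp at hp hq
        subst hp hq
        exact up _ hv
      refine ⟨⟨c.b, c.A ++ [c.lam], t, c.B ++ [c.rho], rfl, close _ _ hc1 hok.left,
        close _ _ hc2 hok.right, ?_⟩, ?_⟩
      · have := hok.lt
        simpa [wsum_append, wsum_cons, wsum_nil] using this
      · intro v hv
        simp only [Function.comp, OpenSteps.closeCell, OpenCell.toTriple, Cycle.mem_coe_iff,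
          List.mem_cons, List.mem_append, List.mem_reverse, List.not_mem_nil, or_false] at hv
        have hd := hok.dead v
        simp only [List.mem_cons, List.mem_append] at hd
        have kk : v ∈ K ∨ v = t ∨ (v = c.b ∨ v ∈ c.A ∨ v ∈ c.B) := by
          rcases hv with hv | (hv | rfl) | hv | hv | rfl
          exacts [by tauto, by tauto, Or.inl hc1, by tauto, by tauto, Or.inl hc2]
        rcases kk with kk | rfl | kk
        · exact ⟨dead_K v kk, (hst v (by simp [kk])).2.trans_le hnn'⟩
        · grind
        · grind

end PartialSweep
end Core

/-- The pieces swept over: uncrossed edges, and the four arms of each crossing. -/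
inductive Rod (U X : Type*)
  | e (i : U)
  | ra (x : X)
  | rb (x : X)
  | rc (x : X)
  | rd (x : X)

/-- The nodes created by the sweep. -/
inductive Node (V U X : Type*)
  | base | apex | lb | lb' | rb | gi
  | pt (v : V)
  | xB (x : X)
  | xT (x : X)
  | ml (r : Rod U X)
  | mr (r : Rod U X)
  | gl (q : V ⊕ X)
  | gr (r : Rod U X)

/-- The combinatorial record of a sweep over a geometric drawing with vertices `V`, uncrossed edges
`U` and crossings `X`. The edges crossing at `x` join `ca x` to `cb x` and `cc x` to `cd x`. -/
structure Frame (V U X : Type*) where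
  lo : U → V
  hi : U → V
  ca : X → V
  cb : X → V
  cc : X → V
  cd : X → V
  idx : V ⊕ X → ℕ
  n : ℕ
  s : V
  rods : ℕ → List (Rod U X)
  h : ℕ → ℝ
  xm : ℕ → Rod U X → ℝ
  area : Rod U X → ℕ → ℝ
  base₀ : V → V → ℝ

namespace Frame
variable {V U X : Type*} (Fr : Frame V U X)

def bot : Rod U X → V ⊕ X
  | .e i => .inl (Fr.lo i)
  | .ra x => .inl (Fr.ca x)
  | .rb x => .inr x
  | .rc x => .inl (Fr.cc x)
  | .rd x => .inr x

def top : Rod U X → V ⊕ X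
  | .e i => .inl (Fr.hi i)
  | .ra x => .inr x
  | .rb x => .inl (Fr.cb x)
  | .rc x => .inr x
  | .rd x => .inl (Fr.cd x)

/-- The area to the left of a rod. -/
def ar (r : Rod U X) : ℝ := Fr.area r (Fr.idx (Fr.top r) + 1)

structure Valid : Prop where
  idx_inj : Function.Injective Fr.idx
  idx_lt : ∀ q, Fr.idx q < Fr.n
  idx_surj : ∀ i < Fr.n, ∃ q, Fr.idx q = i
  mem_rods : ∀ r i, r ∈ Fr.rods i ↔ Fr.idx (Fr.bot r) < i ∧ i ≤ Fr.idx (Fr.top r)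
  bot_lt_top : ∀ r, Fr.idx (Fr.bot r) < Fr.idx (Fr.top r)
  sorted : ∀ i, (Fr.rods i).Pairwise fun r r' => Fr.xm i r < Fr.xm i r'
  h_pos : ∀ i, 0 < Fr.h i
  area_bot : ∀ r, Fr.area r (Fr.idx (Fr.bot r) + 1) = 0
  area_succ : ∀ i, ∀ r ∈ Fr.rods i, Fr.area r (i + 1) = Fr.area r i + Fr.h i * Fr.xm i r
  vertex_event : ∀ v, ∃ pre D E post, Fr.rods (Fr.idx (.inl v)) = pre ++ (D ++ post) ∧
    Fr.rods (Fr.idx (.inl v) + 1) = pre ++ (E ++ post) ∧ (∀ r ∈ D, Fr.top r = .inl v) ∧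
    (∀ r ∈ E, Fr.bot r = .inl v) ∧ (v = Fr.s → pre = [])
  cross_event : ∀ x, ∃ pre post, Fr.rods (Fr.idx (.inr x)) = pre ++ (.ra x :: .rc x :: post) ∧
    Fr.rods (Fr.idx (.inr x) + 1) = pre ++ (.rd x :: .rb x :: post)
  corners : ∀ x, Fr.ca x ≠ Fr.cb x ∧ Fr.ca x ≠ Fr.cc x ∧ Fr.cd x ≠ Fr.cb x ∧ Fr.cd x ≠ Fr.cc x
  base_anti : ∀ u v, Fr.base₀ u v = - Fr.base₀ v u
  base_e : ∀ i, Fr.base₀ (Fr.lo i) (Fr.hi i) = Fr.ar (.e i)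
  base_ab : ∀ x, Fr.base₀ (Fr.ca x) (Fr.cb x) = Fr.ar (.ra x) + Fr.ar (.rb x)
  base_cd : ∀ x, Fr.base₀ (Fr.cc x) (Fr.cd x) = Fr.ar (.rc x) + Fr.ar (.rd x)
  base_ac : ∀ x, - Fr.ar (.rc x) + Fr.ar (.ra x) ≤ Fr.base₀ (Fr.ca x) (Fr.cc x)
  base_da : ∀ x, - Fr.ar (.ra x) - Fr.ar (.rd x) ≤ Fr.base₀ (Fr.cd x) (Fr.ca x)
  base_bd : ∀ x, Fr.ar (.rd x) - Fr.ar (.rb x) ≤ Fr.base₀ (Fr.cb x) (Fr.cd x)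
  base_cb : ∀ x, Fr.ar (.rb x) + Fr.ar (.rc x) ≤ Fr.base₀ (Fr.cc x) (Fr.cb x)

def birth : Node V U X → ℕ
  | .base => 0
  | .lb => 1
  | .rb => 1
  | .gi => 1
  | .pt v => 3 * Fr.idx (.inl v) + 2
  | .xB x => 3 * Fr.idx (.inr x) + 2
  | .xT x => 3 * Fr.idx (.inr x) + 3
  | .ml r => 3 * Fr.idx (Fr.bot r) + 4
  | .mr r => 3 * Fr.idx (Fr.bot r) + 4
  | .gl q => 3 * Fr.idx q + 4
  | .gr r => 3 * Fr.idx (Fr.bot r) + 4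
  | .lb' => 3 * Fr.n + 2
  | .apex => 3 * Fr.n + 3

end Frame

/-- The markers: all nodes but the vertices and the two poles. -/
def Node.IsMarker {V U X : Type*} : Node V U X → Prop
  | .base => False
  | .apex => False
  | .pt _ => False
  | _ => True

namespace Frame
variable {V U X : Type*} (Fr : Frame V U X)

/-- The open cell around a rod. -/
def cell : Rod U X → OpenCell (Node V U X)
  | .e i => ⟨.pt (Fr.lo i), [], .ml (.e i), [], .mr (.e i)⟩
  | .ra x => ⟨.pt (Fr.ca x), [], .ml (.ra x), [], .mr (.ra x)⟩
  | .rc x => ⟨.pt (Fr.cc x), [], .ml (.rc x), [], .mr (.rc x)⟩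
  | .rd x => ⟨.pt (Fr.ca x), [], .ml (.ra x), [.mr (.ra x), .xB x, .xT x], .mr (.rd x)⟩
  | .rb x => ⟨.pt (Fr.cc x), [.ml (.rc x), .xB x, .xT x], .ml (.rb x), [], .mr (.rc x)⟩

def offL : Rod U X → ℝ
  | .rd x => Fr.ar (.ra x)
  | _ => 0

def offR : Rod U X → ℝ
  | .rb x => Fr.ar (.rc x)
  | _ => 0

def Side (w : Node V U X → ℝ) : Rod U X → Prop
  | .rd x => Fr.ar (.ra x) < w (.mr (.ra x))
  | .rb x => w (.ml (.rc x)) < Fr.ar (.rc x)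
  | _ => True

/-- The weights on the two sides of a rod enclose its area. -/
def Bound (lt : ℝ → ℝ → Prop) (w : Node V U X → ℝ) (k : ℕ) (r : Rod U X) : Prop :=
  lt (w (Fr.cell r).lam) (Fr.offL r + Fr.area r k) ∧
    lt (Fr.offR r + Fr.area r k) (w (Fr.cell r).rho) ∧ Fr.Side w r

/-- The kinds of open cells. -/
inductive Tag (U X : Type*)
  | start | gap
  | rod (r : Rod U X)

def Tag.pos (xm : Rod U X → ℝ) : Tag U X → Option ℝ
  | .rod r => some (xm r)
  | _ => none

def tags (R : List (Rod U X)) : List (Tag U X) :=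
  R.flatMap fun r => [.gap, .rod r, .gap]

def TagOK (lt : ℝ → ℝ → Prop) (w : Node V U X → ℝ) (k : ℕ) (sd : Prop) :
    Tag U X → OpenCell (Node V U X) → Prop
  | .start, c => c.b = .base ∧ c.A = [] ∧ c.lam = .lb ∧ (sd → .pt Fr.s ∈ c.B)
  | .gap, _ => True
  | .rod r, c => c = Fr.cell r ∧ Fr.Bound lt w k r

def rodFace (v : V) (r : Rod U X) : Cycle (Node V U X) :=
  OpenSteps.closeCell (.pt v) (Fr.cell r).toTriple

/-- The sweep before the event `i`; the bounds hold at level `k`. -/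
structure State (lt : ℝ → ℝ → Prop) (i k : ℕ) (w : Node V U X → ℝ)
    (cells : List (OpenCell (Node V U X))) (F : Multiset (Cycle (Node V U X)))
    (T : Multiset (Node V U X)) : Prop where
  sweep : PartialSweep Fr.birth Node.IsMarker lt (3 * i + 2) w .lb [.base, .lb] [.base, .rb]
    cells F T
  tagged : List.Forall₂ (Fr.TagOK lt w k (Fr.idx (.inl Fr.s) < i))
    (.start :: (tags (Fr.rods i) ++ [.gap])) cells
  weight : ∀ v, ¬ v.IsMarker → w v = 0
  done : ∀ r v, Fr.top r = .inl v → Fr.idx (.inl v) < i → Fr.rodFace v r ∈ F ∧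
    Fr.Bound (· < ·) w (Fr.idx (.inl v) + 1) r
  pts : ∀ v, Fr.idx (.inl v) < i → .pt v ∈ T

theorem exists_gt_forall_lt (y : ℝ) (L : List ℝ) (h : ∀ x ∈ L, y < x) :
    ∃ z, y < z ∧ ∀ x ∈ L, z < x := by
  induction L with
  | nil => exact ⟨y + 1, by linarith, by simp⟩
  | cons a L ih =>
    obtain ⟨z, h1, h2⟩ := ih fun x hx => h x (List.mem_cons_of_mem _ hx)
    refine ⟨min z ((y + a) / 2), lt_min h1 (by linarith [h a (by simp)]), ?_⟩
    grind

/-- Strands and rods can be placed along a line in the given order. -/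
theorem exists_levels {N : Type*} (xm : Rod U X → ℝ) {P : Tag U X → OpenCell N → Prop}
    {τ : List (Tag U X)} {cells : List (OpenCell N)} (h : List.Forall₂ P τ cells)
    (hs : (τ.filterMap (Tag.pos xm)).Pairwise (· < ·))
    {ρ : N} (z : ℝ)
    (hz : ∀ x ∈ τ.filterMap (Tag.pos xm), z < x)
    (hl : OpenCell.Linked ρ cells) (hn : (ρ :: cells.map OpenCell.rho).Nodup) :
    ∃ ξ : N → ℝ, ξ ρ = z ∧ (∀ v ∉ ρ :: cells.map OpenCell.rho, ξ v = 0) ∧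
      List.Forall₂ (fun t c => P t c ∧ ξ c.lam < ξ c.rho ∧
        ∀ r, t = .rod r → ξ c.lam < xm r ∧ xm r < ξ c.rho) τ cells := by
  classical
  induction h generalizing ρ z with
  | nil => exact ⟨fun v => if v = ρ then z else 0, by simp, by simp +contextual, .nil⟩
  | @cons t c τ cells hP hτ ih =>
    obtain ⟨y, hy, hys, hyr, hs'⟩ : ∃ y, z ≤ y ∧ (∀ x ∈ τ.filterMap (Tag.pos xm), y < x) ∧ (∀ r,
        t = .rod r → z < xm r ∧ y = xm r) ∧
        (τ.filterMap (Tag.pos xm)).Pairwise (· < ·) := by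
      cases t with
      | rod r =>
        rw [List.filterMap_cons_some (b := xm r) (by rfl)] at hs hz
        rw [List.pairwise_cons] at hs
        exact ⟨xm r, (hz _ (by simp)).le, hs.1, by rintro r' ⟨⟩; exact ⟨hz _ (by simp), rfl⟩, hs.2⟩
      | start =>
        rw [List.filterMap_cons_none (by rfl)] at hs hz
        exact ⟨z, le_rfl, hz, by simp, hs⟩
      | gap =>
        rw [List.filterMap_cons_none (by rfl)] at hs hz
        exact ⟨z, le_rfl, hz, by simp, hs⟩
    obtain ⟨z', h1, h2⟩ := exists_gt_forall_lt y _ hys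
    rw [List.map_cons] at hn
    obtain ⟨ξ, e1, e2, e3⟩ := ih hs' z' h2 hl.2 hn.of_cons
    have hρ : ∀ v ∈ c.rho :: cells.map OpenCell.rho, Function.update ξ ρ z v = ξ v :=
      fun v hv => Function.update_of_ne (by rintro rfl; exact (List.nodup_cons.1 hn).1 hv) _ _
    refine ⟨Function.update ξ ρ z, by simp, ?_, ?_⟩
    · grind
    · refine .cons ⟨hP, ?_, ?_⟩ ?_
      · rw [hl.1, Function.update_self, hρ c.rho (by simp), e1]; linarith
      · intro r hr
        obtain ⟨h3, h4⟩ := hyr r hr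
        rw [hl.1, Function.update_self, hρ c.rho (by simp), e1]; exact ⟨h3, by linarith⟩
      · refine (List.forall₂_iff_zip.2 ⟨e3.length_eq, fun {t c'} hm => ?_⟩)
        obtain ⟨h3, h4⟩ := (List.forall₂_iff_zip.1 e3).2 hm
        have hc' : c' ∈ cells := (List.of_mem_zip hm).2
        rw [hρ _ (hl.2.lam_mem hc'), hρ _ (List.mem_cons_of_mem _ (List.mem_map_of_mem hc'))]
        exact ⟨h3, h4⟩

theorem tags_filterMap (xm : Rod U X → ℝ) (R : List (Rod U X)) :
    ((.start : Tag U X) :: (tags R ++ [.gap])).filterMap (Tag.pos xm) = R.map xm := by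
  rw [List.filterMap_cons_none (by rfl), List.filterMap_append]
  induction R with
  | nil => rfl
  | cons r R ih => simpa [tags, Tag.pos, List.filterMap_cons] using ih

variable {Fr}

theorem State.slab (hV : Fr.Valid) {i : ℕ} {w cells F T} (h : Fr.State (· ≤ ·) i i w cells F T) :
    ∃ w', Fr.State (· < ·) i (i + 1) w' cells F T := by
  have hsw := h.sweep
  have hms := tags_filterMap (Fr.xm i) (Fr.rods i)
  obtain ⟨z, hz⟩ : ∃ z, ∀ x ∈ (Fr.rods i).map (Fr.xm i), z < x := by
    have : ∀ L : List ℝ, ∃ z, ∀ x ∈ L, z < x := fun L => by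
      induction L with
      | nil => exact ⟨0, by simp⟩
      | cons a L ih =>
        obtain ⟨z, hz⟩ := ih
        refine ⟨min z (a - 1), ?_⟩
        grind
    exact this _
  obtain ⟨ξ, -, h0, h2⟩ := exists_levels (Fr.xm i) h.tagged
    (by rw [hms, List.pairwise_map]; exact hV.sorted i) z (by rwa [hms]) hsw.linked
    hsw.strands_nodup
  have hz' := List.forall₂_iff_zip.1 h2
  have hlt : ∀ c ∈ cells, ξ c.lam < ξ c.rho := by
    intro c hc
    obtain ⟨j, hj, rfl⟩ := List.mem_iff_getElem.1 hc
    have hj' : j < ((.start : Tag U X) :: (tags (Fr.rods i) ++ [.gap])).length := by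
      rw [hz'.1]; exact hj
    exact (List.Forall₂.get h2 hj' hj).2.1
  have dead : ∀ v, v ∉ (.lb : Node V U X) :: cells.map OpenCell.rho →
      w v + Fr.h i * ξ v = w v := fun v hv => by rw [h0 v hv]; simp
  refine ⟨_, hsw.slab h0 hlt (hV.h_pos i), ?_, ?_, ?_, h.pts⟩
  · refine List.forall₂_iff_zip.2 ⟨hz'.1, fun {t c} hm => ?_⟩
    obtain ⟨h3, h4, h5⟩ := hz'.2 hm
    obtain ⟨ht, hc⟩ := List.of_mem_zip hm
    cases t with
    | start => exact h3
    | gap => trivial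
    | rod r =>
      obtain ⟨rfl, h6, h7, h8⟩ := h3
      obtain ⟨h9, h10⟩ := h5 r rfl
      have hr : r ∈ Fr.rods i := by grind [tags]
      have ha := hV.area_succ i r hr
      have hh := hV.h_pos i
      refine ⟨rfl, ?_, ?_, ?_⟩
      · rw [ha]; have := mul_lt_mul_of_pos_left h9 hh; linarith
      · rw [ha]; have := mul_lt_mul_of_pos_left h10 hh; linarith
      · have hd := (hsw.cells_ok _ hc).dead
        cases r with
        | rd x =>  grind [Side, cell]
        | rb x => grind [Side, cell]
        | _ => trivial
  · grind [hsw.strands, h.weight]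
  · intro r v hr hv
    obtain ⟨h3, h6, h7, h8⟩ := h.done r v hr hv
    have hf := fun u hu => dead u ((hsw.faces_ok _ h3).2 u hu).1
    have hlam : (Fr.cell r).lam ∈ Fr.rodFace v r := by
      simp [rodFace, OpenSteps.closeCell, OpenCell.toTriple]
    have hrho : (Fr.cell r).rho ∈ Fr.rodFace v r := by
      simp [rodFace, OpenSteps.closeCell, OpenCell.toTriple]
    refine ⟨h3, ?_, ?_, ?_⟩
    · simpa only [hf _ hlam] using h6
    · simpa only [hf _ hrho] using h7
    · cases r with
      | rd x =>
        simp only [Side] at h8 ⊢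
        rwa [hf _ (by simp [rodFace, OpenSteps.closeCell, OpenCell.toTriple, cell])]
      | rb x =>
        simp only [Side] at h8 ⊢
        rwa [hf _ (by simp [rodFace, OpenSteps.closeCell, OpenCell.toTriple, cell])]
      | _ => trivial

end Frame

namespace Frame
variable {V U X : Type*} {Fr : Frame V U X}

theorem forall₂_append_left {α β : Type*} {P : α → β → Prop} {a b : List α} {c : List β}
    (h : List.Forall₂ P (a ++ b) c) :
    ∃ c₁ c₂, List.Forall₂ P a c₁ ∧ List.Forall₂ P b c₂ ∧ c = c₁ ++ c₂ := by
  induction a generalizing c with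
  | nil => exact ⟨[], c, .nil, h, rfl⟩
  | cons x a ih => grind [List.forall₂_cons_left_iff]

theorem forall₂_exists_of_mem {α β : Type*} {P : α → β → Prop} {a : List α} {c : List β}
    (h : List.Forall₂ P a c) {x : α} (hx : x ∈ a) : ∃ y ∈ c, P x y := by
  induction h with
  | nil => simp at hx
  | cons h _ ih => grind

theorem forall₂_append {α β : Type*} {P : α → β → Prop} {a b : List α} {c d : List β}
    (h : List.Forall₂ P a c) (h' : List.Forall₂ P b d) : List.Forall₂ P (a ++ b) (c ++ d) := by
  induction h with
  | nil => exact h'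
  | cons h _ ih => exact .cons h ih

theorem Bound.le {w : Node V U X → ℝ} {k : ℕ} {r : Rod U X} (h : Fr.Bound (· < ·) w k r) :
    Fr.Bound (· ≤ ·) w k r := ⟨h.1.le, h.2.1.le, h.2.2⟩

theorem TagOK.le {w : Node V U X → ℝ} {k : ℕ} {sd sd' : Prop} {t : Tag U X}
    {c : OpenCell (Node V U X)} (h : Fr.TagOK (· < ·) w k sd t c)
    (hs : t = .start → sd' → sd) : Fr.TagOK (· ≤ ·) w k sd' t c := by
  cases t with
  | start => exact ⟨h.1, h.2.1, h.2.2.1, fun h' => h.2.2.2 (hs rfl h')⟩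
  | gap => trivial
  | rod r => exact ⟨h.1, h.2.le⟩

theorem forall₂_tagOK_le {w : Node V U X → ℝ} {k : ℕ} {sd sd' : Prop} {τ : List (Tag U X)}
    {C : List (OpenCell (Node V U X))} (h : List.Forall₂ (Fr.TagOK (· < ·) w k sd) τ C)
    (hs : .start ∈ τ → sd' → sd) : List.Forall₂ (Fr.TagOK (· ≤ ·) w k sd') τ C := by
  induction h with
  | nil => exact .nil
  | cons h _ ih =>
    exact .cons (h.le fun e => hs (by simp [e])) (ih fun e => hs (by simp [e]))

theorem tags_append (R R' : List (Rod U X)) : tags (R ++ R') = tags R ++ tags R' := by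
  simp [tags]

theorem Valid.nodup_rods (hV : Fr.Valid) (i : ℕ) : (Fr.rods i).Nodup :=
  (hV.sorted i).imp fun h e => by rw [e] at h; exact lt_irrefl _ h

theorem forall₂_fresh {w : Node V U X → ℝ} {k : ℕ} {sd : Prop} {v : V} (E : List (Rod U X))
    (hE : ∀ r ∈ E, Fr.bot r = .inl v ∧ Fr.area r k = 0 ∧ w (.ml r) = 0 ∧ w (.mr r) = 0)
    (ν : Node V U X) :
    List.Forall₂ (Fr.TagOK (· ≤ ·) w k sd) (tags E)
      (OpenCell.fresh (.pt v) ν (E.flatMap fun r => [.ml r, .mr r, .gr r])) := by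
  induction E generalizing ν with
  | nil => exact .nil
  | cons r E ih =>
    refine .cons trivial (.cons ?_ (.cons trivial (ih (fun r hr => hE r (by simp [hr])) _)))
    obtain ⟨h1, h2, h3, h4⟩ := hE r (by simp)
    cases r with
    | rb x => cases h1
    | rd x => cases h1
    | e i => cases h1; exact ⟨rfl, by simp [cell, h2, h3, offL], by simp [cell, h2, h4, offR],
        trivial⟩
    | ra i => cases h1; exact ⟨rfl, by simp [cell, h2, h3, offL], by simp [cell, h2, h4, offR],
        trivial⟩
    | rc i => cases h1; exact ⟨rfl, by simp [cell, h2, h3, offL], by simp [cell, h2, h4, offR],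
        trivial⟩

theorem State.vertex (hV : Fr.Valid) (v : V) {w cells F T}
    (h : Fr.State (· < ·) (Fr.idx (.inl v)) (Fr.idx (.inl v) + 1) w cells F T) :
    ∃ cells' F' T',
      Fr.State (· ≤ ·) (Fr.idx (.inl v) + 1) (Fr.idx (.inl v) + 1) w cells' F' T' := by
  obtain ⟨pre, D, E, post, e1, e2, hD, hE, hs⟩ := hV.vertex_event v
  set i := Fr.idx (.inl v) with hi
  obtain ⟨τ₁, τ, ht₁, hτ, hs'⟩ : ∃ τ₁ τ, (.start : Tag U X) :: tags pre = τ₁ ++ [τ] ∧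
      (τ = .start ∨ τ = .gap) ∧ (v = Fr.s → τ₁ = []) := by
    rcases pre.eq_nil_or_concat with rfl | ⟨p, r, rfl⟩
    · exact ⟨[], .start, rfl, Or.inl rfl, fun _ => rfl⟩
    · exact ⟨.start :: (tags p ++ [.gap, .rod r]), .gap, by simp [tags], Or.inr rfl,
        fun e => by simpa using hs e⟩
  obtain ⟨τ₂, ht₂, hτ₂⟩ : ∃ τ₂, tags post ++ [.gap] = (.gap : Tag U X) :: τ₂ ∧ .start ∉ τ₂ := by
    cases post with
    | nil => exact ⟨[], rfl, by simp⟩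
    | cons r p => exact ⟨.rod r :: .gap :: (tags p ++ [.gap]), by simp [tags], by simp [tags]⟩
  have key : ∀ Z : List (Rod U X), (.start : Tag U X) :: (tags (pre ++ (Z ++ post)) ++ [.gap]) =
      τ₁ ++ (τ :: (tags Z ++ .gap :: τ₂)) := fun Z => by
    rw [tags_append, tags_append, List.append_assoc, ← List.cons_append, ht₁, List.append_assoc,
      List.append_assoc, ht₂, List.singleton_append]
  have htag := h.tagged
  rw [e1, key] at htag
  obtain ⟨C₁, Ca, k1, k2, hc1⟩ := forall₂_append_left htag
  obtain ⟨cL, Cb, k3, k4, rfl⟩ := List.forall₂_cons_left_iff.1 k2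
  obtain ⟨Cin, Cc, k5, k6, rfl⟩ := forall₂_append_left k4
  obtain ⟨cR, C₂, k7, k8, rfl⟩ := List.forall₂_cons_left_iff.1 k6
  have hsw := h.sweep
  rw [hc1] at hsw
  have hbE : ∀ r ∈ E, Fr.idx (Fr.bot r) = i := fun r hr => by rw [hE r hr]
  have hEn : E.Nodup := by grind [hV.nodup_rods, List.nodup_append]
  have hmem : ∀ u ∈ (.gl (.inl v) : Node V U X) :: E.flatMap (fun r => [.ml r, .mr r, .gr r]),
      u = .gl (.inl v) ∨ ∃ r ∈ E, u = .ml r ∨ u = .mr r ∨ u = .gr r := fun u hu => by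
    simpa using hu
  have hnew := hsw.event (t := .pt v) (ω := []) (e := .pt v) (x := []) (ν := .gl (.inl v))
    (L := E.flatMap fun r => [.ml r, .mr r, .gr r]) (n' := 3 * (i + 1) + 2) rfl
    (by
      intro u hu
      rcases hmem u hu with rfl | ⟨r, -, rfl | rfl | rfl⟩ <;> trivial)
    (by simp [birth, ← hi])
    (by
      intro u hu
      rcases hmem u hu with rfl | ⟨r, hr, rfl | rfl | rfl⟩
      · simp only [birth, ← hi]; omega
      all_goals simp only [birth, ← hi, hbE r hr]; omega)
    (by simp)
    (by
      simp only [List.cons_append, List.nil_append, List.nodup_cons, List.mem_cons,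
        List.mem_flatMap, List.nodup_flatMap]
      refine ⟨by simp, by simp, by simp, ?_⟩
      exact hEn.imp fun {a b} hab => by simp [Function.onFun, List.Disjoint, hab])
  refine ⟨_, _, _, hnew, ?_, h.weight, ?_, ?_⟩
  · rw [e2, key]
    have hlt : v ≠ Fr.s → Fr.idx (.inl Fr.s) < i + 1 → Fr.idx (.inl Fr.s) < i := fun hne hlt => by
      grind [hV.idx_inj]
    refine forall₂_append (forall₂_tagOK_le k1 fun hm => hlt fun e => by simp [hs' e] at hm) ?_
    refine .cons ?_ (forall₂_append (forall₂_fresh E ?_ _) (.cons trivial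
      (forall₂_tagOK_le k8 fun hm => absurd hm hτ₂)))
    · rcases hτ with rfl | rfl
      · obtain ⟨a1, a2, a3, a4⟩ := k3
        refine ⟨a1, a2, a3, fun hlt' => ?_⟩
        grind [OpenCell.extR]
      · trivial
    · grind [hV.area_bot, h.sweep.weight, birth]
  · intro r u hr hu
    rcases Nat.lt_succ_iff_lt_or_eq.1 hu with hu | hu
    · grind [h.done]
    · obtain rfl := Sum.inl_injective (hV.idx_inj hu)
      have hrD : r ∈ D := by
        have h1 : r ∈ Fr.rods i := (hV.mem_rods r i).2 (by
          have := hV.bot_lt_top r; rw [hr] at this ⊢; exact ⟨this, le_rfl⟩)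
        have h2 : r ∉ Fr.rods (i + 1) := fun hm => by grind [hV.mem_rods]
        grind
      obtain ⟨c, hc, rfl, hb⟩ := forall₂_exists_of_mem k5 (x := .rod r) (by grind [tags])
      exact ⟨Multiset.mem_add.2 (Or.inr (by
        rw [Multiset.mem_coe, List.mem_map]; exact ⟨_, hc, rfl⟩)), hb⟩
  · intro u hu
    rcases Nat.lt_succ_iff_lt_or_eq.1 hu with hu | hu
    · grind [h.pts]
    · obtain rfl := Sum.inl_injective (hV.idx_inj hu)
      exact Multiset.mem_add.2 (Or.inr (by simp))

theorem State.cross (hV : Fr.Valid) (x : X) {w cells F T}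
    (h : Fr.State (· < ·) (Fr.idx (.inr x)) (Fr.idx (.inr x) + 1) w cells F T) :
    ∃ cells' F' T',
      Fr.State (· ≤ ·) (Fr.idx (.inr x) + 1) (Fr.idx (.inr x) + 1) w cells' F' T' := by
  obtain ⟨pre, post, e1, e2⟩ := hV.cross_event x
  set i := Fr.idx (.inr x) with hi
  have key : ∀ r r' : Rod U X, (.start : Tag U X) :: (tags (pre ++ (r :: r' :: post)) ++ [.gap]) =
      (.start :: (tags pre ++ [.gap])) ++ (.rod r :: ([.gap, .gap] ++
        .rod r' :: (.gap :: (tags post ++ [.gap])))) := by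
    simp [tags]
  have htag := h.tagged
  rw [e1, key] at htag
  obtain ⟨C₁, Ca, k1, k2, hc1⟩ := forall₂_append_left htag
  obtain ⟨cL, Cb, ⟨rfl, b1, b2, -⟩, k4, rfl⟩ := List.forall₂_cons_left_iff.1 k2
  obtain ⟨Cin, Cc, k5, k6, rfl⟩ := forall₂_append_left k4
  obtain ⟨cR, C₂, ⟨rfl, b3, b4, -⟩, k8, rfl⟩ := List.forall₂_cons_left_iff.1 k6
  have hsw := h.sweep
  rw [hc1] at hsw
  have hnew := hsw.event (t := .xB x) (ω := [.xT x]) (e := .xT x) (x := [.xB x]) (ν := .mr (.rd x))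
    (L := [.gl (.inr x), .ml (.rb x)]) (n' := 3 * (i + 1) + 2) rfl
    (by simp [Node.IsMarker])
    (by simp [birth, ← hi]; omega)
    (by simp [birth, bot, ← hi]; omega)
    (by simp [Up, birth, Node.IsMarker])
    (by simp)
  have hne : ∀ u, Fr.idx (.inl u) < i + 1 → Fr.idx (.inl u) < i := fun u hu => by grind [hV.idx_inj]
  have hw : ∀ r, Fr.bot r = .inr x → w (.ml r) = 0 ∧ w (.mr r) = 0 ∧ Fr.area r (i + 1) = 0 := by
    grind [hV.area_bot, h.sweep.weight, birth]
  refine ⟨_, _, _, hnew, ?_, h.weight, ?_, ?_⟩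
  · rw [e2, key]
    refine forall₂_append (forall₂_tagOK_le k1 fun _ => hne _) (.cons ⟨rfl, ?_⟩
      (.cons trivial (.cons trivial (.cons ⟨rfl, ?_⟩ (forall₂_tagOK_le k8 fun _ => hne _)))))
    · obtain ⟨h1, h2, h3⟩ := hw (.rd x) rfl
      simp only [cell, offL, offR, zero_add] at b1 b2
      refine ⟨?_, ?_, b2⟩
      · simp only [cell, offL, h3, ar, top, ← hi]; linarith
      · simp [cell, offR, h2, h3]
    · obtain ⟨h1, h2, h3⟩ := hw (.rb x) rfl
      simp only [cell, offL, offR, zero_add] at b3 b4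
      refine ⟨?_, ?_, b3⟩
      · simp [cell, offL, h1, h3]
      · simp only [cell, offR, h3, ar, top, ← hi]; linarith
  · grind [h.done]
  · grind [h.pts]

theorem State.start (hV : Fr.Valid) : ∃ w cells F T, Fr.State (· ≤ ·) 0 0 w cells F T := by
  have h0 : Fr.rods 0 = [] := List.eq_nil_iff_forall_not_mem.2 fun r hr =>
    absurd ((hV.mem_rods r 0).1 hr).1 (by omega)
  refine ⟨fun _ => 0, OpenCell.fresh .base .lb [.gi, .rb], 0,
    (([.base, .lb, .gi, .rb] : List (Node V U X)) : Multiset (Node V U X)),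
    ⟨?_, ?_, ?_, by simp, ⟨rfl, rfl, trivial⟩, ?_, ?_, ?_, by simp⟩, ?_,
    by simp, ?_, ?_⟩
  · rw [OpenCell.fresh_toTriple]
    exact OpenSteps.fresh [] Node.base Node.lb [Node.gi, Node.rb]
  · simp
  · intro v hv
    simp at hv
    rcases hv with rfl | rfl | rfl | rfl <;> simp [birth]
  · simp [OpenCell.fresh]
  · simp [OpenCell.fresh, Node.IsMarker, birth]
  · intro c hc
    simp [OpenCell.fresh] at hc
    rcases hc with rfl | rfl <;>
      exact ⟨by simp [Up, birth, Node.IsMarker], by simp [Up, birth, Node.IsMarker],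
        by simp [wsum_nil], by simp [birth, OpenCell.fresh]⟩
  · rw [h0]
    exact .cons ⟨rfl, rfl, rfl, by omega⟩ (.cons trivial .nil)
  · exact fun r v _ h => by omega
  · exact fun v h => by omega

theorem exists_state (hV : Fr.Valid) (i : ℕ) (hi : i ≤ Fr.n) :
    ∃ w cells F T, Fr.State (· < ·) i (i + 1) w cells F T := by
  suffices H : ∃ w cells F T, Fr.State (· ≤ ·) i i w cells F T by
    obtain ⟨w, cells, F, T, h⟩ := H
    obtain ⟨w', h'⟩ := h.slab hV
    exact ⟨w', cells, F, T, h'⟩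
  induction i with
  | zero => exact State.start hV
  | succ i ih =>
    obtain ⟨w, cells, F, T, h⟩ := ih (by omega)
    obtain ⟨w', h'⟩ := h.slab hV
    obtain ⟨q, rfl⟩ := hV.idx_surj i (by omega)
    cases q with
    | inl v => obtain ⟨c, F', T', h⟩ := h'.vertex hV v; exact ⟨_, c, F', T', h⟩
    | inr x => obtain ⟨c, F', T', h⟩ := h'.cross hV x; exact ⟨_, c, F', T', h⟩

end Frame

theorem OpenSteps.cell_of_pair {N : Type*} {a m : N} {B r : List N} {C F T}
    (h : OpenSteps [a, m] r ((a, [m], B) :: C) F T) (hm : ∀ f ∈ F, m ∉ f) :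
    ∃ T', OpenSteps (a :: B) r C F T' ∧ T = ([m] : List N) + T' := by
  generalize hl : [a, m] = l at h
  generalize hC : (a, [m], B) :: C = C' at h
  cases h with
  | refl => cases hC
  | flip x a' A B' b y r C F T h =>
    have := congrArg List.length hl
    simp only [List.length_append, List.length_cons, List.length_nil] at this
    obtain rfl : x = [] := List.length_eq_zero_iff.1 (by omega)
    obtain rfl : A = [] := List.length_eq_zero_iff.1 (by omega)
    simp_all
  | cell x b A B' r C F T h => simp_all

namespace Frame
variable {V U X : Type*} {Fr : Frame V U X}

/-- The outcome of a sweep, with `s` on the left side. -/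
structure Swept (Fr : Frame V U X) (w : Node V U X → ℝ) (F : Multiset (Cycle (Node V U X)))
    (T : Multiset (Node V U X)) : Prop where
  steps : Steps [.base, .lb, .pt Fr.s, .lb', .apex] [.base, .rb, .apex] F T
  nodup : T.Nodup
  weight : ∀ v, ¬ v.IsMarker → w v = 0
  light : ∀ f ∈ F, LightFace Fr.birth Node.IsMarker w f
  done : ∀ r v, Fr.top r = .inl v → Fr.rodFace v r ∈ F ∧
    Fr.Bound (· < ·) w (Fr.idx (.inl v) + 1) r
  pts : ∀ v, .pt v ∈ T

theorem exists_swept (hV : Fr.Valid) : ∃ w F T, Fr.Swept w F T := by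
  classical
  obtain ⟨w, cells, F, T, h⟩ := exists_state hV Fr.n le_rfl
  have hR : Fr.rods Fr.n = [] := List.eq_nil_iff_forall_not_mem.2 fun r hr => by
    have := ((hV.mem_rods r _).1 hr).2
    have := hV.idx_lt (Fr.top r)
    omega
  have htag := h.tagged
  rw [hR] at htag
  obtain ⟨c₀, c₁, rfl, hc₀⟩ : ∃ c₀ c₁, cells = [c₀, c₁] ∧
      Fr.TagOK (· < ·) w (Fr.n + 1) (Fr.idx (.inl Fr.s) < Fr.n) .start c₀ := by
    cases htag with
    | cons h0 h1 => cases h1 with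
      | cons _ h2 => cases h2 with
        | nil => exact ⟨_, _, rfl, h0⟩
  obtain ⟨b, A, lam, B, ρ⟩ := c₀
  obtain ⟨rfl, rfl, rfl, hs⟩ := hc₀
  have hsB : .pt Fr.s ∈ B := hs (hV.idx_lt _)
  obtain ⟨B₁, B₂, rfl⟩ := List.append_of_mem hsB
  have hsw := h.sweep
  have hok₀ := hsw.cells_ok _ (List.mem_cons_self)
  have hok₁ := hsw.cells_ok c₁ (by simp)
  have hlam : c₁.lam = ρ := hsw.linked.2.1
  have hst : ∀ v ∈ [Node.lb, ρ, c₁.rho], v.IsMarker ∧ Fr.birth v < 3 * Fr.n + 2 := hsw.strands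
  have hstn : ([Node.lb, ρ, c₁.rho] : List (Node V U X)).Nodup := hsw.strands_nodup
  have hnlb : ∀ f ∈ F, Node.lb ∉ f := fun f hf hm => ((hsw.faces_ok f hf).2 _ hm).1 (by simp)
  obtain ⟨T', hT', rfl⟩ := OpenSteps.cell_of_pair hsw.steps hnlb
  have hst' := (hT'.close .apex []).toSteps
  rw [show (Node.base :: (B₁ ++ Node.pt Fr.s :: B₂ ++ [ρ])) ++ [Node.apex] =
    [] ++ Node.base :: (B₁ ++ Node.pt Fr.s :: (B₂ ++ [ρ] ++ [.apex])) by simp] at hst'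
  have hst₁ := Steps.cons _ _ [.lb] _ _ _ _ _ _ hst'
  rw [show [] ++ Node.base :: ([Node.lb] ++ Node.pt Fr.s :: (B₂ ++ [ρ] ++ [.apex])) =
    [.base, .lb] ++ Node.pt Fr.s :: ((B₂ ++ [ρ]) ++ .apex :: []) by simp] at hst₁
  have hst₂ := Steps.cons _ _ [.lb'] _ _ _ _ _ _ hst₁
  obtain ⟨K, hK₁, hK₂⟩ : ∃ K, -K < wsum w B₁ ∧ -K < wsum w (B₂ ++ [ρ]) :=
    ⟨1 + |wsum w B₁| + |wsum w (B₂ ++ [ρ])|, by grind []⟩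
  set w' := Function.update (Function.update w .lb (-K)) .lb' (-K) with hw'
  have hw'v : ∀ v, v ≠ .lb → Fr.birth v < 3 * Fr.n + 2 → w' v = w v := by grind [birth]
  have hcongr : ∀ f, (∀ v ∈ f, v ≠ .lb ∧ Fr.birth v < 3 * Fr.n + 2) →
      LightFace Fr.birth Node.IsMarker w f → LightFace Fr.birth Node.IsMarker w' f :=
    fun f hf hl => hl.congr fun v hv => hw'v v (hf v hv).1 (hf v hv).2
  have hwl : w' .lb = -K ∧ w' .lb' = -K := by
    constructor <;> simp [hw']
  have hBd : ∀ v ∈ B₁ ++ Node.pt Fr.s :: (B₂ ++ [ρ]), w' v = w v := by grind [hok₀.dead]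
  have hright := hok₀.right
  have hapex : ∀ v, v.IsMarker → Fr.birth v < 3 * Fr.n + 2 →
      Up Fr.birth Node.IsMarker v .apex := fun v h1 h2 =>
    ⟨h2.trans (by simp [birth]), .inl h1⟩
  have hsn := hV.idx_lt (.inl Fr.s)
  refine ⟨w', _, _, hst₂, ?_, ?_, ?_, ?_, ?_⟩
  · have hnd := hsw.nodup
    have hb := hsw.birth_lt
    have h1 : ∀ v, 3 * Fr.n + 2 ≤ Fr.birth v → v ∉ T' ∧ v ≠ .lb := fun v hv =>
      ⟨fun hm => absurd (hb v (Multiset.mem_add.2 (.inr hm))) (by omega), by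
        rintro rfl; simp [birth] at hv⟩
    have h2 := h1 .lb' (by simp [birth])
    have h3 := h1 .apex (by simp [birth])
    rw [Multiset.coe_singleton, Multiset.singleton_add] at hnd
    simp only [Multiset.coe_singleton, Multiset.singleton_add]
    rw [add_comm T' _, Multiset.singleton_add]
    grind [Multiset.nodup_cons]
  · grind [Function.update_of_ne, Node.IsMarker, h.weight]
  · intro f hf
    rw [Multiset.mem_cons, Multiset.mem_cons, Multiset.mem_add] at hf
    rcases hf with rfl | rfl | hf | hf
    · refine ⟨_, _, _, _, rfl, ?_, ?_, ?_⟩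
      · simp [Up, Node.IsMarker, birth]; omega
      · rw [show Node.pt Fr.s :: (B₂ ++ [ρ] ++ [Node.apex]) = (.pt Fr.s :: B₂) ++ ρ :: .apex :: [] by
          simp, List.isChain_append_cons_cons]
        exact ⟨hright.infix ⟨.base :: B₁, [], by simp⟩,
          hapex ρ (hst ρ (by simp)).1 (hst ρ (by simp)).2, by simp⟩
      · rw [wsum_congr (w := w) (w' := w') (L := B₂ ++ [ρ]) (fun v hv => hBd v (by simp at hv ⊢; tauto)),
          wsum_cons, wsum_nil, hwl.2]; linarith
    · refine ⟨_, _, _, _, rfl, ?_, ?_, ?_⟩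
      · simp [Up, Node.IsMarker, birth]
      · exact hright.infix ⟨[], B₂ ++ [ρ], by simp⟩
      · grind [wsum_congr, wsum_cons, wsum_nil]
    · grind [hsw.faces_ok]
    · simp only [List.map_cons, List.map_nil, Multiset.coe_singleton, Multiset.mem_singleton] at hf
      obtain ⟨b, A, lam, B, rho⟩ := c₁
      obtain rfl : lam = ρ := hlam
      have hc : ∀ v ∈ b :: (A ++ lam :: (B ++ [rho])), w' v = w v := by
        intro v hv
        have : (v ∈ [Node.lb, lam, rho] ∧ v ≠ .lb) ∨ v ∈ b :: (A ++ B) := by grind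
        grind [hok₁.dead]
      have hl := hok₁.lt
      simp only at hl
      refine ⟨b, A ++ [lam], .apex, B ++ [rho], hf, ?_, ?_, ?_⟩
      · grind [List.isChain_append_cons_cons, hok₁.left]
      · grind [List.isChain_append_cons_cons, hok₁.right]
      · rw [wsum_congr (w := w) (fun v hv => hc v (by simp at hv ⊢; tauto)),
          wsum_congr (w := w) (fun v hv => hc v (by simp at hv ⊢; tauto)), wsum_append, wsum_append,
          wsum_cons, wsum_cons, wsum_nil]
        linarith
  · intro r v hr
    obtain ⟨h1, h2⟩ := h.done r v hr (hV.idx_lt _)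
    refine ⟨by simp [h1], ?_⟩
    cases r <;> simpa [Bound, cell, Side, hw'] using h2
  · intro v
    have := h.pts v (hV.idx_lt _)
    simp at this ⊢
    tauto

end Frame

section Faces
variable {N : Type*}

theorem Steps.nodup_of_mem {l r : List N} {F T} (h : Steps l r F T) (hT : T.Nodup) :
    ∀ f ∈ F, f.Nodup := by
  induction h with
  | refl l => simp
  | cons x a A B b y r F T h ih =>
    obtain ⟨h1, h2, h3⟩ := Multiset.nodup_add.1 hT
    intro f hf
    rcases Multiset.mem_cons.1 hf with rfl | hf
    · have h4 := h.nodup_left h2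
      have h5 : ∀ v ∈ x ++ a :: (B ++ b :: y), v ∉ A := fun v hv hv' =>
        Multiset.disjoint_left.1 h3 (Multiset.mem_coe.2 hv') (h.mem_of_mem_left hv)
      rw [Cycle.nodup_coe_iff]
      have h6 : (a :: (B ++ [b])).Nodup := h4.sublist (by simp_all)
      have h7 : (a :: b :: B.reverse).Nodup := by grind [List.reverse_perm]
      have h8 : (A ++ a :: b :: B.reverse).Nodup := by grind [Multiset.coe_nodup]
      exact (List.Perm.nodup_iff List.perm_middle).1 h8
    · exact ih h2 f hf

/-- The face condition for faces on which markers and vertices alternate suitably. -/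
def StrictOK (M : N → Prop) (S : N → N → ℝ) (f : Cycle N) : Prop :=
  ∃ ψ : N → ℝ, f.Chain fun u v => (M u ∨ M v) ∧ S u v < ψ v - ψ u

theorem exists_path_potential (S : N → N → ℝ) (a b : N) (A : List N) (hn : (a :: (A ++ [b])).Nodup)
    (α β : ℝ) (h : psum S (a :: (A ++ [b])) < β - α) : ∃ ψ : N → ℝ, ψ a = α ∧ ψ b = β ∧
      List.IsChain (fun u v => S u v < ψ v - ψ u) (a :: (A ++ [b])) := by
  classical
  induction A generalizing a α with
  | nil =>
    have hab : b ≠ a := by rintro rfl; simp at hn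
    refine ⟨Function.update (fun _ => β) a α, by simp, by simp [hab], ?_⟩
    simpa [hab, psum] using h
  | cons c A ih =>
    simp only [List.cons_append, psum] at h ⊢
    have hn' := (List.nodup_cons.1 hn)
    obtain ⟨ψ, h1, h2, h3⟩ := ih c hn'.2 (α + S a c +
      (β - α - S a c - psum S (c :: (A ++ [b]))) / 2) (by linarith)
    have hne : ∀ v ∈ c :: (A ++ [b]), Function.update ψ a α v = ψ v := fun v hv =>
      Function.update_of_ne (by rintro rfl; exact hn'.1 hv) _ _
    refine ⟨Function.update ψ a α, by simp, by rw [hne b (by simp), h2], ?_⟩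
    grind [List.IsChain.imp_of_mem_imp]

/-- The weight of an edge is that of its lower end. -/
noncomputable def edgeWeight (birth : N → ℕ) (w : N → ℝ) (p q : N) : ℝ :=
  if birth p < birth q then w p else if birth q < birth p then - w q else 0

theorem edgeWeight_anti (birth : N → ℕ) (w : N → ℝ) (p q : N) :
    edgeWeight birth w p q = - edgeWeight birth w q p := by
  unfold edgeWeight; split_ifs <;> first | omega | simp

theorem edgeWeight_up {birth : N → ℕ} {w : N → ℝ} {p q : N} (h : birth p < birth q) :
    edgeWeight birth w p q = w p := if_pos h

theorem edgeWeight_down {birth : N → ℕ} {w : N → ℝ} {p q : N} (h : birth q < birth p) :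
    edgeWeight birth w p q = - w q := by rw [edgeWeight_anti, edgeWeight_up h]

theorem psum_edgeWeight {birth : N → ℕ} {M : N → Prop} (w : N → ℝ) (a b : N) (A : List N)
    (h : List.IsChain (Up birth M) (a :: (A ++ [b]))) :
    psum (edgeWeight birth w) (a :: (A ++ [b])) = w a + wsum w A := by
  induction A generalizing a with
  | nil =>
    simp only [List.nil_append, List.isChain_cons_cons] at h
    simp [psum, wsum_nil, edgeWeight_up h.1.1]
  | cons c A ih =>
    simp only [List.cons_append, List.isChain_cons_cons] at h
    simp only [List.cons_append, psum]
    rw [ih c h.2, edgeWeight_up h.1.1, wsum_cons]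

theorem LightFace.strictOK {birth : N → ℕ} {M : N → Prop} {w : N → ℝ} {f : Cycle N}
    (h : LightFace birth M w f) (hn : f.Nodup) : StrictOK M (edgeWeight birth w) f := by
  classical
  obtain ⟨a, A, b, B, rfl, h1, h2, h3⟩ := h
  rw [Cycle.nodup_coe_iff] at hn
  set S := edgeWeight birth w
  obtain ⟨D, hD₁, hD₂⟩ := exists_between h3
  have hn1 : (a :: (A ++ [b])).Nodup := hn.sublist (by simp)
  have hn2 : (a :: (B ++ [b])).Nodup := by
    have : (a :: b :: B.reverse).Nodup := hn.sublist (by simp)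
    grind [List.reverse_perm]
  obtain ⟨ψ, e1, e2, e3⟩ := exists_path_potential S a b A hn1 0 (w a + D)
    (by rw [psum_edgeWeight w a b A h1]; linarith)
  have hneg : ∀ L, psum (fun u v => - S u v) L = - psum S L := fun L => by
    induction L with
    | nil => simp [psum]
    | cons x L ih => cases L with
      | nil => simp [psum]
      | cons y L => simp only [psum]; rw [ih]; ring
  obtain ⟨φ, f1, f2, f3⟩ := exists_path_potential (fun u v => - S u v) a b B hn2 0 (-(w a + D))
    (by rw [hneg, psum_edgeWeight w a b B h2]; linarith)
  have hA : ∀ v ∈ a :: (A ++ [b]), (if v ∈ B then - φ v else ψ v) = ψ v := by grind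
  have hB : ∀ v ∈ a :: (B ++ [b]), (if v ∈ B then - φ v else ψ v) = - φ v := by aesop
  refine ⟨fun v => if v ∈ B then - φ v else ψ v, ?_⟩
  rw [Cycle.chain_coe_cons, show a :: (A ++ b :: B.reverse ++ [a]) =
    (a :: A) ++ b :: (B.reverse ++ [a]) by simp, List.isChain_split]
  have hand : ∀ {R R' : N → N → Prop} {L : List N}, L.IsChain R → L.IsChain R' →
      L.IsChain fun u v => R u v ∧ R' u v := fun {R R' L} h h' => by
    induction L with
    | nil => simp
    | cons x L ih => cases L with
      | nil => simp
      | cons y L => grind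
  constructor
  · refine List.IsChain.imp_of_mem_imp (fun u v hu hv huv => ?_) (hand h1 e3)
    dsimp only
    rw [hA u hu, hA v hv]
    exact ⟨huv.1.2, huv.2⟩
  · rw [show b :: (B.reverse ++ [a]) = (a :: (B ++ [b])).reverse by simp, List.isChain_reverse]
    refine List.IsChain.imp_of_mem_imp (fun u v hu hv huv => ?_) (hand h2 f3)
    dsimp only
    rw [hB u hu, hB v hv]
    have h4 : S v u = - S u v := edgeWeight_anti birth w v u
    exact ⟨huv.1.2.symm, by have := huv.2; linarith⟩

end Faces

namespace Frame
variable {V U X : Type*} {Fr : Frame V U X}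

/-- The face around a crossing. -/
def ring (Fr : Frame V U X) (x : X) : Cycle (Node V U X) :=
  (.xB x :: ([.mr (.ra x), .pt (Fr.ca x), .ml (.ra x), .pt (Fr.cd x), .mr (.rd x)] ++
    .xT x :: [.ml (.rb x), .pt (Fr.cb x), .mr (.rc x), .pt (Fr.cc x), .ml (.rc x)]) :
    List (Node V U X))

theorem Valid.ne_of_idx (hV : Fr.Valid) (x : X) : Fr.ca x ≠ Fr.cd x ∧ Fr.cb x ≠ Fr.cc x := by
  have h1 := hV.bot_lt_top (.ra x)
  have h2 := hV.bot_lt_top (.rb x)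
  have h3 := hV.bot_lt_top (.rc x)
  have h4 := hV.bot_lt_top (.rd x)
  grind [bot, top]

theorem Swept.exists_ring_potential (hV : Fr.Valid) {w F T} (h : Fr.Swept w F T) (x : X) :
    ∃ ψ : Node V U X → ℝ, (Fr.ring x).Chain (fun u v => (u.IsMarker ∨ v.IsMarker) ∧
        edgeWeight Fr.birth w u v < ψ v - ψ u) ∧
      ψ (.pt (Fr.ca x)) = - Fr.ar (.ra x) ∧ ψ (.pt (Fr.cb x)) = Fr.ar (.rb x) ∧
      ψ (.pt (Fr.cc x)) = - Fr.ar (.rc x) ∧ ψ (.pt (Fr.cd x)) = Fr.ar (.rd x) := by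
  classical
  obtain ⟨n1, n2, n3, n4⟩ := hV.corners x
  obtain ⟨n5, n6⟩ := hV.ne_of_idx x
  have h1 := hV.bot_lt_top (.ra x)
  have h2 := hV.bot_lt_top (.rb x)
  have h3 := hV.bot_lt_top (.rc x)
  have h4 := hV.bot_lt_top (.rd x)
  have hd := (h.done (.rd x) _ rfl).2
  have hb := (h.done (.rb x) _ rfl).2
  have ed : Fr.area (.rd x) (Fr.idx (.inl (Fr.cd x)) + 1) = Fr.ar (.rd x) := rfl
  have eb : Fr.area (.rb x) (Fr.idx (.inl (Fr.cb x)) + 1) = Fr.ar (.rb x) := rfl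
  simp only [bot, top] at h1 h2 h3 h4
  simp only [Bound, cell, offL, offR, Side, ed, eb] at hd hb
  obtain ⟨d1, d2, d3⟩ := hd
  obtain ⟨b1, b2, b3⟩ := hb
  have hpt : ∀ v, w (.pt v) = 0 := fun v => h.weight _ (by simp [Node.IsMarker])
  set α := Fr.ar (.ra x)
  set β := Fr.ar (.rb x)
  set γ := Fr.ar (.rc x)
  set δ := Fr.ar (.rd x)
  let ψ : Node V U X → ℝ := fun
    | .pt v => if v = Fr.ca x then -α else if v = Fr.cd x then δ else if v = Fr.cb x then β else -γ
    | .xT _ => - w (.xT x)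
    | .mr (.ra _) => (-α - w (.mr (.ra x))) / 2
    | .ml (.ra _) => (δ - w (.ml (.ra x)) - α) / 2
    | .mr (.rd _) => (δ - w (.mr (.rd x))) / 2
    | .ml (.rb _) => (β - w (.ml (.rb x))) / 2
    | .mr (.rc _) => (β - w (.mr (.rc x)) - γ) / 2
    | .ml (.rc _) => (-γ - w (.ml (.rc x))) / 2
    | _ => 0
  have ha : ψ (.pt (Fr.ca x)) = -α := if_pos rfl
  have hd : ψ (.pt (Fr.cd x)) = δ := (if_neg n5.symm).trans (if_pos rfl)
  have hb : ψ (.pt (Fr.cb x)) = β :=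
    (if_neg n1.symm).trans ((if_neg n3.symm).trans (if_pos rfl))
  have hc : ψ (.pt (Fr.cc x)) = -γ :=
    (if_neg n2.symm).trans ((if_neg n4.symm).trans (if_neg n6.symm))
  refine ⟨ψ, ?_, ha, hb, hc, hd⟩
  have up : ∀ p q, Fr.birth p < Fr.birth q → edgeWeight Fr.birth w p q = w p :=
    fun p q => edgeWeight_up
  have dn : ∀ p q, Fr.birth q < Fr.birth p → edgeWeight Fr.birth w p q = - w q :=
    fun p q => edgeWeight_down
  simp only [ring, Cycle.chain_coe_cons, List.cons_append, List.nil_append, List.isChain_cons_cons,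
    List.isChain_singleton, and_true, Node.IsMarker, true_or, or_true, true_and, ha, hb, hc, hd]
  rw [dn (.xB x), dn (.mr (.ra x)), up (.pt (Fr.ca x)), up (.ml (.ra x)), dn (.pt (Fr.cd x)),
    dn (.mr (.rd x)), up (.xT x), up (.ml (.rb x)), dn (.pt (Fr.cb x)), dn (.mr (.rc x)),
    up (.pt (Fr.cc x)), up (.ml (.rc x)), hpt, hpt]
  · refine ⟨?_, ?_, ?_, ?_, ?_, ?_, ?_, ?_, ?_, ?_, ?_, ?_⟩ <;> simp only [ψ] <;> linarith
  all_goals simp only [birth, bot]; omega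

theorem Swept.exists_edge_potential (hV : Fr.Valid) {w F T} (h : Fr.Swept w F T) (i : U) :
    ∃ ψ : Node V U X → ℝ, (Fr.rodFace (Fr.hi i) (.e i)).Chain (fun u v =>
        (u.IsMarker ∨ v.IsMarker) ∧ edgeWeight Fr.birth w u v < ψ v - ψ u) ∧
      ψ (.pt (Fr.lo i)) = 0 ∧ ψ (.pt (Fr.hi i)) = Fr.ar (.e i) := by
  classical
  have h1 := hV.bot_lt_top (.e i)
  have he := (h.done (.e i) _ rfl).2
  have ee : Fr.area (.e i) (Fr.idx (.inl (Fr.hi i)) + 1) = Fr.ar (.e i) := rfl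
  simp only [bot, top] at h1
  simp only [Bound, cell, offL, offR, Side, ee, zero_add] at he
  obtain ⟨b1, b2, -⟩ := he
  have hpt : ∀ v, w (.pt v) = 0 := fun v => h.weight _ (by simp [Node.IsMarker])
  set α := Fr.ar (.e i)
  have hne : Fr.hi i ≠ Fr.lo i := fun h => by rw [h] at h1; omega
  let ψ : Node V U X → ℝ := fun
    | .pt v => if v = Fr.lo i then 0 else α
    | .mr _ => (α - w (.mr (.e i))) / 2
    | .ml _ => (α - w (.ml (.e i))) / 2
    | _ => 0
  have ha : ψ (.pt (Fr.lo i)) = 0 := if_pos rfl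
  have hb : ψ (.pt (Fr.hi i)) = α := if_neg hne
  refine ⟨ψ, ?_, ha, hb⟩
  simp only [rodFace, OpenSteps.closeCell, OpenCell.toTriple, cell, List.reverse_cons,
    List.reverse_nil, Cycle.chain_coe_cons, List.cons_append, List.nil_append,
    List.isChain_cons_cons, List.isChain_singleton, and_true, Node.IsMarker, true_or, or_true,
    true_and, ha, hb]
  rw [edgeWeight_up, edgeWeight_up, edgeWeight_down, edgeWeight_down, hpt]
  · grind
  all_goals simp only [birth, bot]; omega

/-- After merging, each piece of the drawing has a face of its own. -/
def face (Fr : Frame V U X) : U ⊕ X → Cycle (Node V U X)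
  | .inl i => Fr.rodFace (Fr.hi i) (.e i)
  | .inr x => Fr.ring x

theorem face_injective (Fr : Frame V U X) : Function.Injective Fr.face := by
  have h : ∀ π π', Fr.face π = Fr.face π' →
      (match π with | .inl i => Node.ml (.e i) | .inr x => .xB x) ∈ Fr.face π' := by
    rintro (i | x) π' h <;> rw [← h] <;>
      simp [face, ring, rodFace, OpenSteps.closeCell, OpenCell.toTriple, cell]
  rintro (i | x) (j | y) hh <;> have := h _ _ hh <;>
    simp [face, ring, rodFace, OpenSteps.closeCell, OpenCell.toTriple, cell] at this <;> simp [this]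

theorem Swept.exists_merged [Finite X] (hV : Fr.Valid) {w F T} (h : Fr.Swept w F T) :
    ∃ F', Steps [.base, .lb, .pt Fr.s, .lb', .apex] [.base, .rb, .apex] F' T ∧
      (∀ f ∈ F', StrictOK Node.IsMarker (edgeWeight Fr.birth w) f) ∧ ∀ π, Fr.face π ∈ F' := by
  classical
  have := Fintype.ofFinite X
  suffices H : ∀ xs : Finset X, ∃ F',
      Steps [.base, .lb, .pt Fr.s, .lb', .apex] [.base, .rb, .apex] F' T ∧
      (∀ f ∈ F', StrictOK Node.IsMarker (edgeWeight Fr.birth w) f) ∧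
      (∀ i, Fr.face (.inl i) ∈ F') ∧ (∀ x ∈ xs, Fr.face (.inr x) ∈ F') ∧
      (∀ x ∉ xs, Fr.rodFace (Fr.cd x) (.rd x) ∈ F' ∧ Fr.rodFace (Fr.cb x) (.rb x) ∈ F') by
    obtain ⟨F', h1, h2, h3, h4, -⟩ := H Finset.univ
    exact ⟨F', h1, h2, fun | .inl i => h3 i | .inr x => h4 x (Finset.mem_univ x)⟩
  intro xs
  induction xs using Finset.induction_on with
  | empty =>
    refine ⟨F, h.steps, fun f hf => (h.light f hf).strictOK (h.steps.nodup_of_mem h.nodup f hf),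
      fun i => (h.done _ _ rfl).1, by simp, fun x _ => ⟨(h.done _ _ rfl).1, (h.done _ _ rfl).1⟩⟩
  | insert x xs hx ih =>
    obtain ⟨F', h1, h2, h3, h4, h5⟩ := ih
    obtain ⟨hf, hg⟩ := h5 x hx
    set f := Fr.rodFace (Fr.cd x) (.rd x) with hfd
    set g := Fr.rodFace (Fr.cb x) (.rb x) with hgd
    have ef : f = ((.xT x :: .xB x :: [.mr (.ra x), .pt (Fr.ca x), .ml (.ra x), .pt (Fr.cd x),
        .mr (.rd x)] : List (Node V U X)) : Cycle (Node V U X)) :=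
      Cycle.coe_append_comm (N := Node V U X) [.pt (Fr.ca x), .ml (.ra x), .pt (Fr.cd x),
          .mr (.rd x)]
        [.xT x, .xB x, .mr (.ra x)]
    have eg : g = ((.xB x :: .xT x :: [.ml (.rb x), .pt (Fr.cb x), .mr (.rc x), .pt (Fr.cc x),
        .ml (.rc x)] : List (Node V U X)) : Cycle (Node V U X)) :=
      Cycle.coe_append_comm (N := Node V U X) [.pt (Fr.cc x), .ml (.rc x)] [.xB x, .xT x,
          .ml (.rb x),
        .pt (Fr.cb x), .mr (.rc x)]
    have hfg : g ≠ f := fun e => by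
      have : Node.ml (.rb x) ∈ g := by rw [eg]; simp
      rw [e, ef] at this; simp at this
    obtain ⟨F₁, rfl⟩ := Multiset.exists_cons_of_mem hf
    obtain ⟨F₂, rfl⟩ := Multiset.exists_cons_of_mem ((Multiset.mem_cons.1 hg).resolve_left hfg)
    have keep : ∀ k v, v ∈ k → v ∉ f → v ∉ g → k ∈ f ::ₘ g ::ₘ F₂ → k ∈ Fr.ring x ::ₘ F₂ := by grind
    have hxB : ∀ y, y ≠ x → Node.xB y ∉ f ∧ Node.xB y ∉ g := fun y hy => by
      rw [ef, eg]; simp [hy]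
    refine ⟨Fr.ring x ::ₘ F₂, ?_, ?_, ?_, ?_, ?_⟩
    · rw [ef, eg] at h1 h2
      refine h1.merge (edgeWeight_anti Fr.birth w) h.nodup (fun k hk => ?_) ?_
      · obtain ⟨ψ, hψ⟩ := h2 k hk
        exact ⟨ψ, hψ.imp fun u v huv => huv.2⟩
      · grind [hV.corners]
    · intro k hk
      rcases Multiset.mem_cons.1 hk with rfl | hk
      · obtain ⟨ψ, hψ, -⟩ := h.exists_ring_potential hV x
        exact ⟨ψ, hψ⟩
      · grind
    · refine fun i => keep _ (.ml (.e i)) ?_ ?_ ?_ (h3 i)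
      · simp [face, rodFace, OpenSteps.closeCell, OpenCell.toTriple, cell]
      · rw [ef]; simp
      · rw [eg]; simp
    · intro y hy
      rcases Finset.mem_insert.1 hy with rfl | hy'
      · exact Multiset.mem_cons_self _ _
      · have := hxB y fun e => hx (e ▸ hy')
        exact keep _ (.xB y) (by simp [face, ring]) this.1 this.2 (h4 y hy')
    · intro y hy
      rw [Finset.mem_insert, not_or] at hy
      have := hxB y hy.1
      obtain ⟨h6, h7⟩ := h5 y hy.2
      refine ⟨keep _ (.xB y) ?_ this.1 this.2 h6, keep _ (.xB y) ?_ this.1 this.2 h7⟩ <;>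
        simp [rodFace, OpenSteps.closeCell, OpenCell.toTriple, cell]

end Frame

namespace Frame
variable {V U X : Type*} {Fr : Frame V U X}

/-- The pairs of ends of the edges in a piece. -/
def chord (Fr : Frame V U X) : U ⊕ X → V → V → Prop
  | .inl i, v, w => (v = Fr.lo i ∧ w = Fr.hi i) ∨ (v = Fr.hi i ∧ w = Fr.lo i)
  | .inr x, v, w => (v = Fr.ca x ∧ w = Fr.cb x) ∨ (v = Fr.cb x ∧ w = Fr.ca x) ∨
      (v = Fr.cc x ∧ w = Fr.cd x) ∨ (v = Fr.cd x ∧ w = Fr.cc x)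

def faceChord (Fr : Frame V U X) (f : Cycle (Node V U X)) (p q : Node V U X) : Prop :=
  ∃ π v w, f = Fr.face π ∧ p = .pt v ∧ q = .pt w ∧ Fr.chord π v w

theorem faceChord_face {π : U ⊕ X} {p q : Node V U X} :
    Fr.faceChord (Fr.face π) p q ↔ ∃ v w, p = .pt v ∧ q = .pt w ∧ Fr.chord π v w := by
  constructor
  · rintro ⟨π', v, w, h, h1⟩
    obtain rfl := Fr.face_injective h
    exact ⟨v, w, h1⟩
  · rintro ⟨v, w, h⟩
    exact ⟨π, v, w, rfl, h⟩

theorem chord_symm {π : U ⊕ X} {v w : V} (h : Fr.chord π v w) : Fr.chord π w v := by grind [chord]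

theorem Valid.chord_mem (hV : Fr.Valid) {π : U ⊕ X} {v w : V} (h : Fr.chord π v w) :
    .pt v ∈ Fr.face π ∧ .pt w ∈ Fr.face π ∧ v ≠ w := by
  rcases π with i | x
  · have h1 := hV.bot_lt_top (.e i)
    simp only [bot, top] at h1
    have h2 : Fr.lo i ≠ Fr.hi i := fun h => by rw [h] at h1; omega
    rcases h with ⟨rfl, rfl⟩ | ⟨rfl, rfl⟩ <;>
      simp [face, rodFace, OpenSteps.closeCell, OpenCell.toTriple, cell, h2, h2.symm]
  · obtain ⟨n1, -, -, n4⟩ := hV.corners x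
    rcases h with ⟨rfl, rfl⟩ | ⟨rfl, rfl⟩ | ⟨rfl, rfl⟩ | ⟨rfl, rfl⟩ <;>
      simp [face, ring, n1, n4, n1.symm, n4.symm]

theorem Swept.chordOK (hV : Fr.Valid) {w F T} (h : Fr.Swept w F T)
    {S base : Node V U X → Node V U X → ℝ}
    (hS : ∀ p q, p.IsMarker ∨ q.IsMarker → S p q = edgeWeight Fr.birth w p q)
    (ha : ∀ p q, base p q = - base q p)
    (hb : ∀ u v, base (.pt u) (.pt v) = Fr.base₀ u v) (π : U ⊕ X) :
    ChordOK S base (Fr.faceChord (Fr.face π)) (Fr.face π) := by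
  have hmem : ∀ p q, Fr.faceChord (Fr.face π) p q → p ∈ Fr.face π ∧ q ∈ Fr.face π := by
    grind [faceChord_face, hV.chord_mem]
  rcases π with i | x
  · obtain ⟨ψ, h1, h2, h3⟩ := h.exists_edge_potential hV i
    refine ⟨ψ, h1.imp fun u v huv => by rw [hS u v huv.1]; exact huv.2, fun p q hpq => ?_,
      .inl ⟨.pt (Fr.lo i), .pt (Fr.hi i), fun p q hpq => ?_⟩⟩
    · refine ⟨(hmem p q hpq).1, (hmem p q hpq).2, ?_⟩
      obtain ⟨v, u, rfl, rfl, ⟨rfl, rfl⟩ | ⟨rfl, rfl⟩⟩ := faceChord_face.1 hpq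
      · rw [hb, hV.base_e, h2, h3]; ring
      · grind [hV.base_e]
    · obtain ⟨v, u, rfl, rfl, ⟨rfl, rfl⟩ | ⟨rfl, rfl⟩⟩ := faceChord_face.1 hpq <;> simp
  · obtain ⟨ψ, h1, ea, eb, ec, ed⟩ := h.exists_ring_potential hV x
    refine ⟨ψ, h1.imp fun u v huv => by rw [hS u v huv.1]; exact huv.2, fun p q hpq => ?_,
      .inr ⟨.pt (Fr.ca x), .pt (Fr.cd x), .pt (Fr.cb x), .pt (Fr.cc x), _, rfl, ?_,
        fun p q hpq => ?_, ?_, ?_, ?_, ?_⟩⟩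
    · refine ⟨(hmem p q hpq).1, (hmem p q hpq).2, ?_⟩
      obtain ⟨v, u, rfl, rfl, ⟨rfl, rfl⟩ | ⟨rfl, rfl⟩ | ⟨rfl, rfl⟩ | ⟨rfl, rfl⟩⟩ :=
        faceChord_face.1 hpq
      · rw [hb, hV.base_ab, ea, eb]; ring
      · grind [hV.base_ab]
      · rw [hb, hV.base_cd, ec, ed]; ring
      · grind [hV.base_cd]
    · refine .cons _ (.cons _ (.cons_cons _ (.cons _ (.cons_cons _ (.cons _ (.cons _ (.cons _
        (.cons_cons _ (.cons _ (.cons_cons _ (.cons _ .slnil)))))))))))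
    · obtain ⟨v, u, rfl, rfl, ⟨rfl, rfl⟩ | ⟨rfl, rfl⟩ | ⟨rfl, rfl⟩ | ⟨rfl, rfl⟩⟩ :=
        faceChord_face.1 hpq <;> simp
    · rw [hb, ea, ec]; linarith [hV.base_ac x]
    · grind [hV.base_da]
    · grind [hV.base_bd]
    · rw [hb, ec, eb]; linarith [hV.base_cb x]

/-- Drawings with the combinatorics of a frame can be chosen with `s` in extreme position. -/
theorem Valid.exists_extreme [Finite X] (hV : Fr.Valid) : ∃ Xc Yc : V → ℝ,
    Function.Injective Yc ∧
    (∀ π p q v, Fr.chord π p q → Yc p < Yc v → Yc v < Yc q → Xc v ≠ lin Xc Yc p q (Yc v)) ∧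
    (∀ π π', π ≠ π' → ∀ p q p' q' y, Fr.chord π p q → Fr.chord π' p' q' → Yc p < y → y < Yc q →
      Yc p' < y → y < Yc q' → lin Xc Yc p q y ≠ lin Xc Yc p' q' y) ∧
    ∃ c : ℝ, ∀ v, v ≠ Fr.s → Xc Fr.s - c * Yc Fr.s < Xc v - c * Yc v := by
  classical
  obtain ⟨w, F₀, T, h⟩ := exists_swept hV
  obtain ⟨F, h1, h2, h3⟩ := h.exists_merged hV
  let base : Node V U X → Node V U X → ℝ := fun
    | .pt u, .pt v => Fr.base₀ u v
    | _, _ => 0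
  have hbase : ∀ u v, base u v = - base v u := by grind [hV.base_anti]
  obtain ⟨Xn, Yn, e1, e2, e3, c, e4⟩ := h1.exists_extreme_placement h.nodup
    (M := Node.IsMarker) (Real := fun p => ∃ v, p = .pt v) (S₀ := edgeWeight Fr.birth w)
    (base₀ := base) (Ch := Fr.faceChord)
    trivial trivial trivial not_false not_false not_false (by simp) (by simp)
    (by rintro _ ⟨v, rfl⟩; exact not_false)
    (fun f hf => by obtain ⟨ψ, hψ⟩ := h2 f hf; exact hψ.imp fun u v huv => huv.1)
    (edgeWeight_anti _ _) hbase
    (fun f p q ⟨π, v, u, h4, h5, h6, h7⟩ => ⟨π, u, v, h4, h6, h5, chord_symm h7⟩)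
    (by
      rintro f p q ⟨π, v, u, rfl, rfl, rfl, h7⟩
      grind [hV.chord_mem])
    (by
      intro f hf S b _ hb hS hR
      by_cases hπ : ∃ π, f = Fr.face π
      · obtain ⟨π, rfl⟩ := hπ
        exact h.chordOK hV hS hb (fun u v => hR _ _ ⟨_, rfl⟩ ⟨_, rfl⟩) π
      · have hno : ∀ p q, ¬ Fr.faceChord f p q := fun p q ⟨π, _, _, h4, _⟩ => hπ ⟨π, h4⟩
        obtain ⟨ψ, hψ⟩ := h2 f hf
        exact ⟨ψ, hψ.imp fun u v huv => by rw [hS u v huv.1]; exact huv.2,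
          fun p q hpq => absurd hpq (hno p q),
          .inl ⟨.base, .base, fun p q hpq => absurd hpq (hno p q)⟩⟩)
  refine ⟨fun v => Xn (.pt v), fun v => Yn (.pt v), fun u v huv => ?_, ?_, ?_, c, ?_⟩
  · grind [h.pts]
  · exact fun π p q v hc h4 h5 =>
      e2 _ (h3 π) (.pt p) (.pt q) (.pt v) ⟨π, p, q, rfl, rfl, rfl, hc⟩ (h.pts v) h4 h5
  · exact fun π π' hne p q p' q' y hc hc' =>
      e3 _ (h3 π) _ (h3 π') (fun hh => hne (Fr.face_injective hh)) (.pt p) (.pt q) (.pt p') (.pt q') y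
        ⟨π, p, q, rfl, rfl, rfl, hc⟩ ⟨π', p', q', rfl, rfl, rfl, hc'⟩
  · grind [h.pts]

end Frame

theorem exists_sorted_list {R : Type*} [Finite R] (P : R → Prop) (f : R → ℝ)
    (hf : ∀ r r', P r → P r' → r ≠ r' → f r ≠ f r') :
    ∃ l : List R, (∀ r, r ∈ l ↔ P r) ∧ l.Pairwise fun r r' => f r < f r' := by
  classical
  have key : ∀ t : Finset R, (∀ r ∈ t, P r) →
      ∃ l : List R, (∀ r, r ∈ l ↔ r ∈ t) ∧ l.Pairwise fun r r' => f r < f r' := by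
    intro t
    induction t using Finset.induction_on_max_value f with
    | empty => exact fun _ => ⟨[], by simp⟩
    | insert a t ha hmax ih =>
      intro hP
      obtain ⟨l, h1, h2⟩ := ih fun r hr => hP r (Finset.mem_insert_of_mem hr)
      refine ⟨l ++ [a], fun r => by simp [h1, or_comm], ?_⟩
      grind
  have hfin : {r | P r}.Finite := Set.toFinite _
  obtain ⟨l, h1, h2⟩ := key hfin.toFinset (by simp)
  exact ⟨l, by simpa using h1, h2⟩

theorem eq_of_sorted {R : Type*} {f : R → ℝ} {l l' : List R}
    (h : l.Pairwise fun r r' => f r < f r') (h' : l'.Pairwise fun r r' => f r < f r')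
    (hm : ∀ r, r ∈ l ↔ r ∈ l') : l = l' := by
  have n1 : l.Nodup := h.imp fun hlt he => absurd hlt (by simp [he])
  have n2 : l'.Nodup := h'.imp fun hlt he => absurd hlt (by simp [he])
  exact ((List.perm_ext_iff_of_nodup n1 n2).2 hm).eq_of_pairwise
    (fun a b _ _ h1 h2 => absurd h1 (lt_asymm h2)) h h'

instance Rod.finite {U X : Type*} [Finite U] [Finite X] : Finite (Rod U X) :=
  Finite.of_surjective (α := U ⊕ X ⊕ X ⊕ X ⊕ X)
    (fun | .inl i => .e i | .inr (.inl x) => .ra x | .inr (.inr (.inl x)) => .rb x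
         | .inr (.inr (.inr (.inl x))) => .rc x | .inr (.inr (.inr (.inr x))) => .rd x)
    (by
      rintro (i | x | x | x | x)
      exacts [⟨.inl i, rfl⟩, ⟨.inr (.inl x), rfl⟩, ⟨.inr (.inr (.inl x)), rfl⟩,
        ⟨.inr (.inr (.inr (.inl x))), rfl⟩, ⟨.inr (.inr (.inr (.inr x))), rfl⟩])

/-- Straight segments in the plane meeting only at crossings: `U` indexes the uncrossed edges,
and `X` the crossings. -/
structure Arrangement (V U X : Type*) where
  lo : U → V
  hi : U → V
  ca : X → V
  cb : X → V
  cc : X → V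
  cd : X → V
  s : V
  Xp : V ⊕ X → ℝ
  Yp : V ⊕ X → ℝ

namespace Arrangement
variable {V U X : Type*} (A : Arrangement V U X)

def bot : Rod U X → V ⊕ X
  | .e i => .inl (A.lo i)
  | .ra x => .inl (A.ca x)
  | .rb x => .inr x
  | .rc x => .inl (A.cc x)
  | .rd x => .inr x

def top : Rod U X → V ⊕ X
  | .e i => .inl (A.hi i)
  | .ra x => .inr x
  | .rb x => .inl (A.cb x)
  | .rc x => .inr x
  | .rd x => .inl (A.cd x)

noncomputable def slope (r : Rod U X) : ℝ :=
  (A.Xp (A.top r) - A.Xp (A.bot r)) / (A.Yp (A.top r) - A.Yp (A.bot r))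

/-- The abscissa of a rod at a given height. -/
noncomputable def xr (r : Rod U X) (y : ℝ) : ℝ :=
  A.Xp (A.bot r) + A.slope r * (y - A.Yp (A.bot r))

structure Valid : Prop where
  y_inj : Function.Injective A.Yp
  lt : ∀ r, A.Yp (A.bot r) < A.Yp (A.top r)
  off : ∀ r q, A.Yp (A.bot r) < A.Yp q → A.Yp q < A.Yp (A.top r) → A.xr r (A.Yp q) ≠ A.Xp q
  disj : ∀ r r', r ≠ r' → ∀ y, A.Yp (A.bot r) < y → y < A.Yp (A.top r) →
    A.Yp (A.bot r') < y → y < A.Yp (A.top r') → A.xr r y ≠ A.xr r' y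
  left : ∀ r, A.Yp (A.bot r) < A.Yp (.inl A.s) → A.Yp (.inl A.s) < A.Yp (A.top r) →
    A.Xp (.inl A.s) < A.xr r (A.Yp (.inl A.s))
  slope_ab : ∀ x, A.slope (.ra x) = A.slope (.rb x)
  slope_cd : ∀ x, A.slope (.rc x) = A.slope (.rd x)
  slope_lt : ∀ x, A.slope (.rc x) < A.slope (.ra x)

noncomputable def idx (q : V ⊕ X) : ℕ := {q' | A.Yp q' < A.Yp q}.ncard

open Classical in
/-- The height of the `i`-th point. -/
noncomputable def lev (i : ℕ) : ℝ := if h : ∃ q, A.idx q = i then A.Yp h.choose else 0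

noncomputable def mid (i : ℕ) : ℝ := (A.lev (i - 1) + A.lev i) / 2

open Classical in
noncomputable def toFrame (rods : ℕ → List (Rod U X)) : Frame V U X where
  lo := A.lo
  hi := A.hi
  ca := A.ca
  cb := A.cb
  cc := A.cc
  cd := A.cd
  idx := A.idx
  n := Nat.card (V ⊕ X)
  s := A.s
  rods := rods
  h i := if A.lev (i - 1) < A.lev i then A.lev i - A.lev (i - 1) else 1
  xm i r := A.xr r (A.mid i)
  area r i := (A.lev (i - 1) - A.Yp (A.bot r)) * (A.Xp (A.bot r) + A.xr r (A.lev (i - 1))) / 2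
  base₀ u v := (A.Xp (.inl u) + A.Xp (.inl v)) / 2 * (A.Yp (.inl v) - A.Yp (.inl u))

variable {A}

theorem toFrame_bot {rods : ℕ → List (Rod U X)} (r : Rod U X) :
    (A.toFrame rods).bot r = A.bot r := by cases r <;> rfl
theorem toFrame_top {rods : ℕ → List (Rod U X)} (r : Rod U X) :
    (A.toFrame rods).top r = A.top r := by cases r <;> rfl

theorem xr_bot (r : Rod U X) : A.xr r (A.Yp (A.bot r)) = A.Xp (A.bot r) := by simp [xr]

theorem Valid.xr_eq (hA : A.Valid) (r : Rod U X) (y : ℝ) :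
    A.xr r y = A.Xp (A.top r) + A.slope r * (y - A.Yp (A.top r)) := by
  have h : A.Yp (A.top r) - A.Yp (A.bot r) ≠ 0 := sub_ne_zero.2 (hA.lt r).ne'
  have e : A.slope r * (A.Yp (A.top r) - A.Yp (A.bot r)) = A.Xp (A.top r) - A.Xp (A.bot r) :=
    div_mul_cancel₀ _ h
  unfold xr
  linear_combination e

theorem Valid.xr_top (hA : A.Valid) (r : Rod U X) :
    A.xr r (A.Yp (A.top r)) = A.Xp (A.top r) := by simp [hA.xr_eq]

theorem Valid.xr_lt (hA : A.Valid) {r r' : Rod U X} (hne : r ≠ r') {y y' : ℝ}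
    (h1 : A.Yp (A.bot r) ≤ y) (h2 : y ≤ A.Yp (A.top r))
    (h3 : A.Yp (A.bot r') ≤ y) (h4 : y ≤ A.Yp (A.top r'))
    (k1 : A.Yp (A.bot r) < y') (k2 : y' < A.Yp (A.top r))
    (k3 : A.Yp (A.bot r') < y') (k4 : y' < A.Yp (A.top r'))
    (hlt : A.xr r y < A.xr r' y) : A.xr r y' < A.xr r' y' := by
  by_contra hcon
  have hd : A.xr r' y' < A.xr r y' :=
    lt_of_le_of_ne (not_lt.1 hcon) (hA.disj _ _ hne.symm y' k3 k4 k1 k2)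
  have hc : Continuous fun z => A.xr r z - A.xr r' z := by unfold xr; fun_prop
  obtain ⟨z, hz, h0⟩ := intermediate_value_uIcc (a := y) (b := y') hc.continuousOn
    (Set.mem_uIcc.2 (.inl ⟨by linarith, by linarith⟩) : (0 : ℝ) ∈ _)
  have := hA.disj r r' hne z
  grind [Set.mem_uIcc]

theorem Valid.idx_lt_iff [Finite V] [Finite X] {q q' : V ⊕ X} :
    A.idx q < A.idx q' ↔ A.Yp q < A.Yp q' := by
  have key : ∀ {q q' : V ⊕ X}, A.Yp q < A.Yp q' → A.idx q < A.idx q' := fun h =>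
    Set.ncard_lt_ncard ⟨fun z hz => lt_trans hz h, fun hs => lt_irrefl (A.Yp _) (hs h)⟩
  refine ⟨fun h => ?_, key⟩
  by_contra hcon
  rcases (not_lt.1 hcon).lt_or_eq with h' | h'
  · exact lt_asymm h (key h')
  · simp [idx, h'] at h

theorem Valid.idx_inj [Finite V] [Finite X] (hA : A.Valid) : Function.Injective A.idx := by
  intro q q' h
  by_contra hne
  rcases lt_or_gt_of_ne (fun e => hne (hA.y_inj e)) with h' | h'
  · exact absurd h (idx_lt_iff.2 h').ne
  · exact absurd h (idx_lt_iff.2 h').ne'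

theorem idx_lt_card [Finite V] [Finite X] (q : V ⊕ X) : A.idx q < Nat.card (V ⊕ X) := by
  rw [← Set.ncard_univ]
  exact Set.ncard_lt_ncard ⟨Set.subset_univ _, fun hs => lt_irrefl (A.Yp q) (hs (Set.mem_univ q))⟩

theorem Valid.idx_surj [Finite V] [Finite X] (hA : A.Valid) {i : ℕ}
    (hi : i < Nat.card (V ⊕ X)) : ∃ q, A.idx q = i := by
  have hinj : Function.Injective fun q => (⟨A.idx q, idx_lt_card q⟩ : Fin (Nat.card (V ⊕ X))) :=
    fun q q' h => hA.idx_inj (by simpa using h)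
  have := (Nat.bijective_iff_injective_and_card _).2 ⟨hinj, by simp⟩
  obtain ⟨q, hq⟩ := this.2 ⟨i, hi⟩
  exact ⟨q, by simpa using hq⟩

theorem Valid.lev_idx [Finite V] [Finite X] (hA : A.Valid) (q : V ⊕ X) :
    A.lev (A.idx q) = A.Yp q := by
  have h : ∃ q', A.idx q' = A.idx q := ⟨q, rfl⟩
  rw [lev, dif_pos h, hA.idx_inj h.choose_spec]

variable (A) in
def Alive (i : ℕ) (r : Rod U X) : Prop := A.idx (A.bot r) < i ∧ i ≤ A.idx (A.top r)

theorem Valid.alive [Finite V] [Finite X] (hA : A.Valid) {i : ℕ} {r : Rod U X}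
    (h : A.Alive i r) : A.Yp (A.bot r) ≤ A.lev (i - 1) ∧ A.lev (i - 1) < A.lev i ∧
      A.lev i ≤ A.Yp (A.top r) := by
  obtain ⟨h1, h2⟩ := h
  have hc := idx_lt_card (A := A) (A.top r)
  obtain ⟨q, hq⟩ := hA.idx_surj (i := i) (by omega)
  obtain ⟨q', hq'⟩ := hA.idx_surj (i := i - 1) (by omega)
  rw [← hq', ← hq]
  simp only [hA.lev_idx, ← not_lt, ← idx_lt_iff]
  omega

theorem Valid.alive_mid [Finite V] [Finite X] (hA : A.Valid) {i : ℕ} {r : Rod U X}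
    (h : A.Alive i r) : A.Yp (A.bot r) < A.mid i ∧ A.mid i < A.Yp (A.top r) := by
  obtain ⟨h1, h2, h3⟩ := hA.alive h
  constructor <;> unfold mid <;> linarith

theorem Valid.event [Finite V] [Finite X] (hA : A.Valid) {rods : ℕ → List (Rod U X)}
    (hm : ∀ i r, r ∈ rods i ↔ A.Alive i r)
    (hs : ∀ i, (rods i).Pairwise fun r r' => A.xr r (A.mid i) < A.xr r' (A.mid i))
    (q : V ⊕ X) {D E : List (Rod U X)} (hD : ∀ r, r ∈ D ↔ A.top r = q)
    (hE : ∀ r, r ∈ E ↔ A.bot r = q)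
    (sD : D.Pairwise fun r r' => A.xr r (A.mid (A.idx q)) < A.xr r' (A.mid (A.idx q)))
    (sE : E.Pairwise fun r r' => A.xr r (A.mid (A.idx q + 1)) < A.xr r' (A.mid (A.idx q + 1))) :
    ∃ pre post, rods (A.idx q) = pre ++ (D ++ post) ∧ rods (A.idx q + 1) = pre ++ (E ++ post) ∧
      ∀ r ∈ pre, A.Yp (A.bot r) < A.Yp q ∧ A.Yp q < A.Yp (A.top r) ∧ A.xr r (A.Yp q) < A.Xp q := by
  classical
  set i := A.idx q with hi
  set L := (rods i).filter fun r => A.top r ≠ q ∧ A.xr r (A.Yp q) < A.Xp q with hL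
  set R := (rods i).filter fun r => A.top r ≠ q ∧ A.Xp q < A.xr r (A.Yp q) with hR
  have thr : ∀ {r}, r ∈ rods i → A.top r ≠ q → A.Yp (A.bot r) < A.Yp q ∧ A.Yp q < A.Yp (A.top r) := by
    intro r hr hq
    obtain ⟨h1, h2⟩ := (hm i r).1 hr
    refine ⟨idx_lt_iff.1 h1, idx_lt_iff.1 (lt_of_le_of_ne h2 fun h => hq (hA.idx_inj ?_))⟩
    rw [← h]
  have alv : ∀ {r}, A.Yp (A.bot r) < A.Yp q → A.Yp q < A.Yp (A.top r) →
      A.Alive i r ∧ A.Alive (i + 1) r := fun h1 h2 => by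
    have h1 := idx_lt_iff.2 h1
    have h2 := idx_lt_iff.2 h2
    exact ⟨⟨h1, h2.le⟩, ⟨by omega, h2⟩⟩
  have mL : ∀ r, r ∈ L ↔ A.Yp (A.bot r) < A.Yp q ∧ A.Yp q < A.Yp (A.top r) ∧
      A.xr r (A.Yp q) < A.Xp q := by grind
  have mR : ∀ r, r ∈ R ↔ A.Yp (A.bot r) < A.Yp q ∧ A.Yp q < A.Yp (A.top r) ∧
      A.Xp q < A.xr r (A.Yp q) := by grind
  have sort : ∀ (j : ℕ) (M : List (Rod U X)),
      (∀ r ∈ M, A.Alive j r ∧ A.Yp (A.bot r) ≤ A.Yp q ∧ A.Yp q ≤ A.Yp (A.top r) ∧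
        A.xr r (A.Yp q) = A.Xp q) →
      (∀ r, A.Yp (A.bot r) < A.Yp q → A.Yp q < A.Yp (A.top r) → A.Alive j r) →
      (M.Pairwise fun r r' => A.xr r (A.mid j) < A.xr r' (A.mid j)) →
      (L ++ (M ++ R)).Pairwise fun r r' => A.xr r (A.mid j) < A.xr r' (A.mid j) := by
    intro j M hM hj hp
    have cmp : ∀ {r r'}, A.Alive j r → A.Alive j r' → A.Yp (A.bot r) ≤ A.Yp q →
        A.Yp q ≤ A.Yp (A.top r) → A.Yp (A.bot r') ≤ A.Yp q → A.Yp q ≤ A.Yp (A.top r') →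
        A.xr r (A.Yp q) < A.xr r' (A.Yp q) → A.xr r (A.mid j) < A.xr r' (A.mid j) := by
      intro r r' ha ha' h1 h2 h3 h4 hlt
      exact hA.xr_lt (fun e => by simp [e] at hlt) h1 h2 h3 h4 (hA.alive_mid ha).1
        (hA.alive_mid ha).2 (hA.alive_mid ha').1 (hA.alive_mid ha').2 hlt
    have self : ∀ N : List (Rod U X), N.Sublist (rods i) →
        (∀ r ∈ N, A.Yp (A.bot r) < A.Yp q ∧ A.Yp q < A.Yp (A.top r)) →
        N.Pairwise fun r r' => A.xr r (A.mid j) < A.xr r' (A.mid j) := by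
      intro N hN hthr
      refine ((hs i).sublist hN).imp_of_mem fun {r r'} hr hr' hlt => ?_
      have a := hthr r hr
      have b := hthr r' hr'
      have := hA.alive_mid (i := i) (r := r)
      have := hA.alive_mid (i := i) (r := r')
      have := hA.xr_lt (r := r) (r' := r') (y := A.mid i) (y' := A.Yp q)
      grind
    rw [List.pairwise_append, List.pairwise_append]
    refine ⟨self L List.filter_sublist fun r hr => ⟨((mL r).1 hr).1, ((mL r).1 hr).2.1⟩,
      ⟨hp, self R List.filter_sublist fun r hr => ⟨((mR r).1 hr).1, ((mR r).1 hr).2.1⟩, ?_⟩, ?_⟩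
    · grind
    · grind
  refine ⟨L, R, eq_of_sorted (hs i) (sort i D ?_ (fun r h1 h2 => (alv h1 h2).1) sD) ?_,
    eq_of_sorted (hs (i + 1)) (sort (i + 1) E ?_ (fun r h1 h2 => (alv h1 h2).2) sE) ?_,
    fun r hr => (mL r).1 hr⟩
  · intro r hr
    obtain rfl := (hD r).1 hr
    exact ⟨⟨idx_lt_iff.2 (hA.lt r), le_rfl⟩, (hA.lt r).le, le_rfl, hA.xr_top r⟩
  · grind [hA.off, hA.lt, Alive, idx_lt_iff]
  · intro r hr
    obtain rfl := (hE r).1 hr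
    exact ⟨⟨Nat.lt_succ_self _, idx_lt_iff.2 (hA.lt r)⟩, le_rfl, (hA.lt r).le, xr_bot r⟩
  · grind [hA.off, hA.lt, hA.idx_inj, Alive, idx_lt_iff]

theorem Valid.exists_frame [Finite V] [Finite U] [Finite X] (hA : A.Valid) :
    ∃ rods, (A.toFrame rods).Valid := by
  classical
  have hex : ∀ i, ∃ l : List (Rod U X), (∀ r, r ∈ l ↔ A.Alive i r) ∧
      l.Pairwise fun r r' => A.xr r (A.mid i) < A.xr r' (A.mid i) := fun i =>
    exists_sorted_list _ _ fun r r' h h' hne => hA.disj r r' hne _ (hA.alive_mid h).1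
      (hA.alive_mid h).2 (hA.alive_mid h').1 (hA.alive_mid h').2
  choose rods hm hs using hex
  have har : ∀ r, (A.toFrame rods).ar r = (A.Yp (A.top r) - A.Yp (A.bot r)) *
      (A.Xp (A.bot r) + A.Xp (A.top r)) / 2 := by
    intro r
    rw [Frame.ar, toFrame_top]
    simp only [toFrame, Nat.add_sub_cancel, hA.lev_idx, hA.xr_top]
  have hx : ∀ x, ∃ cx cy m₁ m₂ t₁ t₂ t₃ t₄ : ℝ, 0 < t₁ ∧ 0 < t₂ ∧ 0 < t₃ ∧ 0 < t₄ ∧ m₂ < m₁ ∧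
      A.Xp (.inr x) = cx ∧ A.Yp (.inr x) = cy ∧
      A.Xp (.inl (A.ca x)) = cx - m₁ * t₁ ∧ A.Yp (.inl (A.ca x)) = cy - t₁ ∧
      A.Xp (.inl (A.cc x)) = cx - m₂ * t₂ ∧ A.Yp (.inl (A.cc x)) = cy - t₂ ∧
      A.Xp (.inl (A.cb x)) = cx + m₁ * t₃ ∧ A.Yp (.inl (A.cb x)) = cy + t₃ ∧
      A.Xp (.inl (A.cd x)) = cx + m₂ * t₄ ∧ A.Yp (.inl (A.cd x)) = cy + t₄ := by
    intro x
    have ea := hA.xr_top (.ra x)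
    have eb := hA.xr_top (.rb x)
    have ec := hA.xr_top (.rc x)
    have ed := hA.xr_top (.rd x)
    simp only [xr, bot, top, ← hA.slope_ab, ← hA.slope_cd] at ea eb ec ed
    refine ⟨_, _, A.slope (.ra x), A.slope (.rc x), _, _, _, _, sub_pos.2 (hA.lt (.ra x)),
      sub_pos.2 (hA.lt (.rc x)), sub_pos.2 (hA.lt (.rb x)), sub_pos.2 (hA.lt (.rd x)),
      hA.slope_lt x, rfl, rfl, ?_⟩
    simp only [bot, top]
    grind
  refine ⟨rods, ?_⟩
  constructor
  · exact hA.idx_inj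
  · exact idx_lt_card
  · exact fun i hi => hA.idx_surj hi
  · intro r i
    rw [toFrame_bot, toFrame_top]
    exact hm i r
  · intro r
    rw [toFrame_bot, toFrame_top]
    exact idx_lt_iff.2 (hA.lt r)
  · exact hs
  · intro i
    grind [toFrame]
  · intro r
    rw [toFrame_bot]
    simp [toFrame, hA.lev_idx]
  · intro i r hr
    have := hA.alive ((hm i r).1 hr)
    simp only [toFrame, if_pos this.2.1, Nat.add_sub_cancel, mid, xr]
    ring
  · intro v
    obtain ⟨pre, post, h1, h2, h3⟩ := hA.event hm hs (.inl v)
      (D := (rods (A.idx (.inl v))).filter fun r => A.top r = .inl v)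
      (E := (rods (A.idx (.inl v) + 1)).filter fun r => A.bot r = .inl v)
      (fun r => by grind [idx_lt_iff, hA.lt, Alive])
      (fun r => by grind [idx_lt_iff, hA.lt, Alive])
      ((hs _).sublist List.filter_sublist) ((hs _).sublist List.filter_sublist)
    refine ⟨pre, _, _, post, h1, h2, fun r hr => ?_, fun r hr => ?_, ?_⟩
    · grind [toFrame_top]
    · grind [toFrame_bot]
    · intro hv
      have hv : v = A.s := hv
      have := hA.left
      exact List.eq_nil_iff_forall_not_mem.2 (by grind)
  · intro x
    obtain ⟨pre, post, h1, h2, -⟩ := hA.event hm hs (.inr x)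
      (D := [.ra x, .rc x]) (E := [.rd x, .rb x])
      (fun r => by cases r <;> simp [top, eq_comm]) (fun r => by cases r <;> simp [bot, eq_comm])
      (by
        have h := hA.alive_mid (i := A.idx (.inr x)) (r := .ra x)
          ⟨idx_lt_iff.2 (hA.lt (.ra x)), le_rfl⟩
        have h' := hA.slope_lt x
        simp only [top] at h
        simp only [List.pairwise_cons, List.mem_singleton, forall_eq, List.not_mem_nil,
          IsEmpty.forall_iff, implies_true, List.Pairwise.nil, and_true, hA.xr_eq, top]
        nlinarith)
      (by
        have h := hA.alive_mid (i := A.idx (.inr x) + 1) (r := .rb x)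
          ⟨Nat.lt_succ_self _, idx_lt_iff.2 (hA.lt (.rb x))⟩
        have h' := hA.slope_lt x
        simp only [bot] at h
        simp only [List.pairwise_cons, List.mem_singleton, forall_eq, List.not_mem_nil,
          IsEmpty.forall_iff, implies_true, List.Pairwise.nil, and_true, xr, bot,
          ← hA.slope_ab, ← hA.slope_cd]
        nlinarith)
    exact ⟨pre, post, h1, h2⟩
  · intro x
    obtain ⟨cx, cy, m₁, m₂, t₁, t₂, t₃, t₄, h1, h2, h3, h4, hlt, -, -, xa, ya, xc, yc, xb, yb, xd,
      yd⟩ := hx x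
    have := mul_pos h1 (sub_pos.2 hlt)
    have := mul_pos h3 (sub_pos.2 hlt)
    grind [toFrame]
  · intro u v
    simp only [toFrame]
    ring
  · grind [toFrame, bot, top]
  all_goals
    intro x
    obtain ⟨cx, cy, m₁, m₂, t₁, t₂, t₃, t₄, h1, h2, h3, h4, hlt, ex, ey, xa, ya, xc, yc, xb, yb, xd,
      yd⟩ := hx x
    simp only [har]
    simp only [toFrame, bot, top, ex, ey, xa, ya, xc, yc, xb, yb, xd, yd]
  · ring
  · ring
  · nlinarith [mul_pos (mul_pos h1 h2) (sub_pos.2 hlt)]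
  · nlinarith [mul_pos (mul_pos h1 h4) (sub_pos.2 hlt)]
  · nlinarith [mul_pos (mul_pos h3 h4) (sub_pos.2 hlt)]
  · nlinarith [mul_pos (mul_pos h3 h2) (sub_pos.2 hlt)]

end Arrangement

theorem mem_segment_iff_lin {N : Type*} {X Y : N → ℝ} {u v : N} (h : Y u < Y v) {z : ℝ × ℝ} :
    z ∈ segment ℝ (X u, Y u) (X v, Y v) ↔ Y u ≤ z.2 ∧ z.2 ≤ Y v ∧ z.1 = lin X Y u v z.2 := by
  have h' : Y v - Y u ≠ 0 := (sub_pos.2 h).ne'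
  constructor
  · rintro ⟨a, b, ha, hb, hab, rfl⟩
    obtain rfl : a = 1 - b := by linarith
    simp only [Prod.smul_mk, Prod.mk_add_mk, smul_eq_mul, lin]
    refine ⟨by nlinarith, by nlinarith, ?_⟩
    rw [eq_div_iff h']
    ring
  · rintro ⟨h1, h2, h3⟩
    refine ⟨(Y v - z.2) / (Y v - Y u), (z.2 - Y u) / (Y v - Y u),
      div_nonneg (by linarith) (by linarith), div_nonneg (by linarith) (by linarith),
      by field_simp; ring, ?_⟩
    ext
    · rw [h3]
      simp only [Prod.smul_mk, Prod.mk_add_mk, smul_eq_mul, lin]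
      field_simp
    · simp only [Prod.smul_mk, Prod.mk_add_mk, smul_eq_mul]
      field_simp
      ring

section Placement
variable {V : Type*} (G : SimpleGraph V) (p : V → ℝ × ℝ)

/-- The straight edges `ab` and `cd` cross. -/
def Cr (a b c d : V) : Prop :=
  G.Adj a b ∧ G.Adj c d ∧ s(a, b) ≠ s(c, d) ∧
    ∃ z ∈ segment ℝ (p a) (p b), z ∈ segment ℝ (p c) (p d) ∧ z ∉ Set.range p

/-- The positions define a straight-line drawing. -/
structure Plain : Prop where
  inj : Function.Injective p
  off : ∀ u v w, G.Adj u v → p w ∈ segment ℝ (p u) (p v) → w = u ∨ w = v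

/-- The positions define a straight-line 1-planar drawing. -/
structure Good : Prop extends Plain G p where
  one : ∀ a b c d c' d', Cr G p a b c d → Cr G p a b c' d' → s(c, d) = s(c', d')
  adj : ∀ a b c d, Cr G p a b c d → a ≠ c ∧ a ≠ d ∧ b ≠ c ∧ b ≠ d

/-- There is a straight-line drawing without new crossings in which `s` is strictly extreme. -/
def Extremal (s : V) : Prop :=
  ∃ p' : V → ℝ × ℝ, Plain G p' ∧ (∀ a b c d, Cr G p' a b c d → Cr G p a b c d) ∧
    ∃ φ : ℝ × ℝ →ₗ[ℝ] ℝ, ∀ v, v ≠ s → φ (p' s) < φ (p' v)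

variable {G p}

theorem Cr.swap {a b c d : V} (h : Cr G p a b c d) : Cr G p c d a b := by
  obtain ⟨h1, h2, h3, z, h4, h5, h6⟩ := h
  exact ⟨h2, h1, h3.symm, z, h5, h4, h6⟩

theorem Cr.left {a b c d : V} (h : Cr G p a b c d) : Cr G p b a c d := by
  obtain ⟨h1, h2, h3, z, h4, h5, h6⟩ := h
  exact ⟨h1.symm, h2, by rwa [Sym2.eq_swap], z, by rwa [segment_symm], h5, h6⟩

theorem Cr.right {a b c d : V} (h : Cr G p a b c d) : Cr G p a b d c := h.swap.left.swap

theorem Good.of_plain {p' : V → ℝ × ℝ} (hp : Good G p) (h : Plain G p')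
    (hc : ∀ a b c d, Cr G p' a b c d → Cr G p a b c d) : Good G p' :=
  ⟨h, fun a b c d c' d' h1 h2 => hp.one a b c d c' d' (hc _ _ _ _ h1) (hc _ _ _ _ h2),
    fun a b c d h1 => hp.adj a b c d (hc _ _ _ _ h1)⟩

variable (G p)

/-- Uncrossed edges, directed upwards. -/
abbrev UpEdge : Type _ :=
  {e : V × V // G.Adj e.1 e.2 ∧ (p e.1).2 < (p e.2).2 ∧ ∀ c d, ¬ Cr G p e.1 e.2 c d}

/-- The change of abscissa with height along a line. -/
noncomputable def sl (u v : V) : ℝ := ((p v).1 - (p u).1) / ((p v).2 - (p u).2)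

/-- Pairs of crossing edges, directed upwards. -/
abbrev UpCross : Type _ :=
  {q : (V × V) × (V × V) // Cr G p q.1.1 q.1.2 q.2.1 q.2.2 ∧ (p q.1.1).2 < (p q.1.2).2 ∧
    (p q.2.1).2 < (p q.2.2).2 ∧ sl p q.2.1 q.2.2 < sl p q.1.1 q.1.2}

variable {G p}

noncomputable def UpCross.pt (x : UpCross G p) : ℝ × ℝ := x.2.1.2.2.2.choose

theorem UpCross.pt_spec (x : UpCross G p) : x.pt ∈ segment ℝ (p x.1.1.1) (p x.1.1.2) ∧
    x.pt ∈ segment ℝ (p x.1.2.1) (p x.1.2.2) ∧ x.pt ∉ Set.range p := x.2.1.2.2.2.choose_spec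

def rodEdge : Rod (UpEdge G p) (UpCross G p) → V × V
  | .e i => i.1
  | .ra x => x.1.1
  | .rb x => x.1.1
  | .rc x => x.1.2
  | .rd x => x.1.2

variable (G p) in
noncomputable def arrangement (s : V) : Arrangement V (UpEdge G p) (UpCross G p) where
  lo i := i.1.1
  hi i := i.1.2
  ca x := x.1.1.1
  cb x := x.1.1.2
  cc x := x.1.2.1
  cd x := x.1.2.2
  s := s
  Xp := Sum.elim (fun v => (p v).1) fun x => x.pt.1
  Yp := Sum.elim (fun v => (p v).2) fun x => x.pt.2

/-- The abscissa of a line at a given height. -/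
noncomputable abbrev ln (p : V → ℝ × ℝ) (u v : V) (y : ℝ) : ℝ :=
  lin (fun v => (p v).1) (fun v => (p v).2) u v y

theorem ln_eq {u v : V} (h : (p u).2 < (p v).2) (y : ℝ) :
    ln p u v y = (p u).1 + sl p u v * (y - (p u).2) := by
  have h' : (p v).2 - (p u).2 ≠ 0 := (sub_pos.2 h).ne'
  simp only [ln, lin, sl]
  field_simp
  ring

theorem mem_seg_iff {u v : V} (h : (p u).2 < (p v).2) {z : ℝ × ℝ} :
    z ∈ segment ℝ (p u) (p v) ↔ (p u).2 ≤ z.2 ∧ z.2 ≤ (p v).2 ∧ z.1 = ln p u v z.2 :=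
  mem_segment_iff_lin (X := fun v => (p v).1) (Y := fun v => (p v).2) h

theorem mem_seg_lt {u v : V} (h : (p u).2 < (p v).2) {z : ℝ × ℝ}
    (hz : z ∈ segment ℝ (p u) (p v)) (hn : z ∉ Set.range p) :
    (p u).2 < z.2 ∧ z.2 < (p v).2 := by
  obtain ⟨h1, h2, h3⟩ := (mem_seg_iff h).1 hz
  grind [lin_left (X := fun v => (p v).1) (Y := fun v => (p v).2) h,
    lin_right (X := fun v => (p v).1) (Y := fun v => (p v).2) h, Prod.ext_iff]

theorem Good.sl_ne (hp : Good G p) {a b c d : V} (h : Cr G p a b c d) (h1 : (p a).2 < (p b).2)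
    (h2 : (p c).2 < (p d).2) : sl p a b ≠ sl p c d := by
  have key : ∀ {a b c d : V}, Cr G p a b c d → (p a).2 < (p b).2 → (p c).2 < (p d).2 →
      sl p a b = sl p c d → (p a).2 ≤ (p c).2 → False := by
    intro a b c d h h1 h2 he hle
    obtain ⟨hab, -, -, z, hz, hz', -⟩ := id h
    obtain ⟨a1, a2, a3⟩ := (mem_seg_iff h1).1 hz
    obtain ⟨b1, b2, b3⟩ := (mem_seg_iff h2).1 hz'
    rw [ln_eq h1] at a3
    rw [ln_eq h2, ← he] at b3
    have : p c ∈ segment ℝ (p a) (p b) := by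
      rw [mem_seg_iff h1, ln_eq h1]
      exact ⟨hle, b1.trans a2, by linarith⟩
    grind [hp.adj _ _ _ _ h, hp.off _ _ _ hab this]
  grind [Cr.swap]

theorem edge_ext {e e' : V × V} (h : (p e.1).2 < (p e.2).2) (h' : (p e'.1).2 < (p e'.2).2)
    (he : s(e.1, e.2) = s(e'.1, e'.2)) : e = e' := by
  grind [Sym2.eq_iff]

theorem Good.upCross_ext (hp : Good G p) {x x' : UpCross G p} {e : V × V}
    (h : e = x.1.1 ∨ e = x.1.2) (h' : e = x'.1.1 ∨ e = x'.1.2) : x = x' := by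
  obtain ⟨⟨e₁, e₂⟩, c, y1, y2, hs⟩ := x
  obtain ⟨⟨e₃, e₄⟩, c', y3, y4, hs'⟩ := x'
  simp only at h h' c c' y1 y2 y3 y4 hs hs'
  rcases h with rfl | rfl <;> rcases h' with rfl | rfl
  · obtain rfl := edge_ext y2 y4 (hp.one _ _ _ _ _ _ c c'); rfl
  · obtain rfl := edge_ext y2 y3 (hp.one _ _ _ _ _ _ c c'.swap)
    exact absurd hs (lt_asymm hs')
  · obtain rfl := edge_ext y1 y4 (hp.one _ _ _ _ _ _ c.swap c')
    exact absurd hs (lt_asymm hs')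
  · obtain rfl := edge_ext y1 y3 (hp.one _ _ _ _ _ _ c.swap c'.swap); rfl

/-- An edge through a crossing is one of the two crossing edges. -/
theorem Good.edge_of_pt (hp : Good G p) {x : UpCross G p} {e : V × V} (he : G.Adj e.1 e.2)
    (hy : (p e.1).2 < (p e.2).2) (hz : x.pt ∈ segment ℝ (p e.1) (p e.2)) :
    e = x.1.1 ∨ e = x.1.2 := by
  obtain ⟨z1, z2, z3⟩ := x.pt_spec
  by_contra hcon
  rw [not_or] at hcon
  have c1 : Cr G p e.1 e.2 x.1.1.1 x.1.1.2 :=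
    ⟨he, x.2.1.1, fun h => hcon.1 (edge_ext hy x.2.2.1 h), _, hz, z1, z3⟩
  have c2 : Cr G p e.1 e.2 x.1.2.1 x.1.2.2 :=
    ⟨he, x.2.1.2.1, fun h => hcon.2 (edge_ext hy x.2.2.2.1 h), _, hz, z2, z3⟩
  exact x.2.1.2.2.1 (hp.one _ _ _ _ _ _ c1 c2)

theorem rodEdge_spec (r : Rod (UpEdge G p) (UpCross G p)) :
    G.Adj (rodEdge r).1 (rodEdge r).2 ∧ (p (rodEdge r).1).2 < (p (rodEdge r).2).2 := by
  rcases r with i | x | x | x | x <;> grind [rodEdge, Cr]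

theorem arrangement_rod {s : V} (r : Rod (UpEdge G p) (UpCross G p)) :
    let A := arrangement G p s
    A.slope r = sl p (rodEdge r).1 (rodEdge r).2 ∧
    (∀ y, A.xr r y = ln p (rodEdge r).1 (rodEdge r).2 y) ∧
    (p (rodEdge r).1).2 ≤ A.Yp (A.bot r) ∧ A.Yp (A.bot r) < A.Yp (A.top r) ∧
    A.Yp (A.top r) ≤ (p (rodEdge r).2).2 := by
  intro A
  obtain ⟨hadj, hlt⟩ := rodEdge_spec r
  have on : ∀ {x : UpCross G p}, x.pt.1 = (p x.1.1.1).1 + sl p x.1.1.1 x.1.1.2 *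
      (x.pt.2 - (p x.1.1.1).2) ∧ x.pt.1 = (p x.1.2.1).1 + sl p x.1.2.1 x.1.2.2 *
      (x.pt.2 - (p x.1.2.1).2) := fun {x} => by
    rw [← ln_eq x.2.2.1, ← ln_eq x.2.2.2.1]
    exact ⟨((mem_seg_iff x.2.2.1).1 x.pt_spec.1).2.2,
      ((mem_seg_iff x.2.2.2.1).1 x.pt_spec.2.1).2.2⟩
  have end' : ∀ {u v}, (p u).2 < (p v).2 →
      (p v).1 = (p u).1 + sl p u v * ((p v).2 - (p u).2) := fun h => by
    rw [← ln_eq h]; exact (lin_right (X := fun v => (p v).1) (Y := fun v => (p v).2) h).symm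
  have lt1 : ∀ x : UpCross G p, _ := fun x => mem_seg_lt x.2.2.1 x.pt_spec.1 x.pt_spec.2.2
  have lt2 : ∀ x : UpCross G p, _ := fun x => mem_seg_lt x.2.2.2.1 x.pt_spec.2.1 x.pt_spec.2.2
  have main : (A.Xp (A.bot r) = (p (rodEdge r).1).1 + sl p (rodEdge r).1 (rodEdge r).2 *
      (A.Yp (A.bot r) - (p (rodEdge r).1).2)) ∧ (A.Xp (A.top r) = (p (rodEdge r).1).1 +
      sl p (rodEdge r).1 (rodEdge r).2 * (A.Yp (A.top r) - (p (rodEdge r).1).2)) ∧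
      (p (rodEdge r).1).2 ≤ A.Yp (A.bot r) ∧ A.Yp (A.bot r) < A.Yp (A.top r) ∧
      A.Yp (A.top r) ≤ (p (rodEdge r).2).2 := by
    rcases r with i | x | x | x | x <;>
      simp only [A, arrangement, Arrangement.bot, Arrangement.top, rodEdge, Sum.elim_inl,
        Sum.elim_inr] at hlt ⊢
    all_goals grind
  obtain ⟨h1, h2, h3, h4, h5⟩ := main
  have hs : A.slope r = sl p (rodEdge r).1 (rodEdge r).2 := by grind [Arrangement.slope]
  refine ⟨hs, fun y => ?_, h3, h4, h5⟩
  rw [ln_eq hlt, Arrangement.xr, hs, h1]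
  ring

variable (G p) in
/-- Vertices and crossings. -/
def special : Set (ℝ × ℝ) :=
  Set.range p ∪ {z | z ∉ Set.range p ∧ ∃ a b c d, G.Adj a b ∧ G.Adj c d ∧ s(a, b) ≠ s(c, d) ∧
    z ∈ segment ℝ (p a) (p b) ∧ z ∈ segment ℝ (p c) (p d)}

theorem Good.arrangement_valid (hp : Good G p)
    (hgen : ∀ z ∈ special G p, ∀ z' ∈ special G p, z.2 = z'.2 → z = z') {s : V}
    (hray : ∀ u v, G.Adj u v → ∀ z ∈ segment ℝ (p u) (p v), z.2 = (p s).2 → (p s).1 ≤ z.1) :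
    (arrangement G p s).Valid := by
  set A := arrangement G p s with hA
  have hrod := fun r => arrangement_rod (G := G) (p := p) (s := s) r
  simp only [← hA] at hrod
  have hseg : ∀ r y, A.Yp (A.bot r) < y → y < A.Yp (A.top r) →
      ((A.xr r y, y) : ℝ × ℝ) ∈ segment ℝ (p (rodEdge r).1) (p (rodEdge r).2) ∧
      (p (rodEdge r).1).2 < y ∧ y < (p (rodEdge r).2).2 := by
    intro r y h1 h2
    obtain ⟨-, k2, k3, -, k5⟩ := hrod r
    rw [mem_seg_iff (rodEdge_spec r).2]
    exact ⟨⟨(k3.trans_lt h1).le, (h2.trans_le k5).le, k2 y⟩, k3.trans_lt h1, h2.trans_le k5⟩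
  have hnv : ∀ r y, A.Yp (A.bot r) < y → y < A.Yp (A.top r) →
      ((A.xr r y, y) : ℝ × ℝ) ∉ Set.range p := by
    rintro r y h1 h2 ⟨v, hv⟩
    grind [hp.off _ _ v (rodEdge_spec r).1]
  have hsp : ∀ x : UpCross G p, x.pt ∈ special G p := fun x =>
    .inr ⟨x.pt_spec.2.2, _, _, _, _, x.2.1.1, x.2.1.2.1, x.2.1.2.2.1, x.pt_spec.1, x.pt_spec.2.1⟩
  have hoff : ∀ r q, A.Yp (A.bot r) < A.Yp q → A.Yp q < A.Yp (A.top r) →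
      A.xr r (A.Yp q) ≠ A.Xp q := by
    intro r q h1 h2 he
    have hz := (hseg r _ h1 h2).1
    have hn := hnv r _ h1 h2
    rw [he] at hz hn
    rcases q with v | x
    · exact hn ⟨v, rfl⟩
    · have hx := hp.edge_of_pt (x := x) (rodEdge_spec r).1 (rodEdge_spec r).2 hz
      rcases r with i | x' | x' | x' | x'
      · rcases hx with hx | hx
        · have := x.2.1
          rw [← hx] at this
          exact i.2.2.2 _ _ this
        · have := x.2.1.swap
          rw [← hx] at this
          exact i.2.2.2 _ _ this
      · obtain rfl := hp.upCross_ext hx (.inl rfl)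
        exact lt_irrefl _ h2
      · obtain rfl := hp.upCross_ext hx (.inl rfl)
        exact lt_irrefl _ h1
      · obtain rfl := hp.upCross_ext hx (.inr rfl)
        exact lt_irrefl _ h2
      · obtain rfl := hp.upCross_ext hx (.inr rfl)
        exact lt_irrefl _ h1
  have hcr : ∀ r : Rod (UpEdge G p) (UpCross G p),
      (∃ c d, Cr G p (rodEdge r).1 (rodEdge r).2 c d) →
      ∃ x : UpCross G p, (rodEdge r = x.1.1 ∨ rodEdge r = x.1.2) ∧
        ∀ y, A.Yp (A.bot r) < y → y < A.Yp (A.top r) → y ≠ x.pt.2 := by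
    rintro (i | x | x | x | x) ⟨c, d, h⟩
    · exact absurd h (i.2.2.2 c d)
    · exact ⟨x, .inl rfl, fun y _ h2 => h2.ne⟩
    · exact ⟨x, .inl rfl, fun y h1 _ => h1.ne'⟩
    · exact ⟨x, .inr rfl, fun y _ h2 => h2.ne⟩
    · exact ⟨x, .inr rfl, fun y h1 _ => h1.ne'⟩
  constructor
  · rintro (v | x) (v' | x') h
    · exact congrArg _ (hp.inj (hgen _ (.inl ⟨v, rfl⟩) _ (.inl ⟨v', rfl⟩) h))
    · exact absurd ⟨v, hgen _ (.inl ⟨v, rfl⟩) _ (hsp x') h⟩ x'.pt_spec.2.2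
    · exact absurd ⟨v', (hgen _ (hsp x) _ (.inl ⟨v', rfl⟩) h).symm⟩ x.pt_spec.2.2
    · have hpt : x.pt = x'.pt := hgen _ (hsp x) _ (hsp x') h
      refine congrArg _ (hp.upCross_ext (hp.edge_of_pt x'.2.1.1 x'.2.2.1 ?_) (.inl rfl))
      rw [hpt]
      exact x'.pt_spec.1
  · exact fun r => (hrod r).2.2.2.1
  · exact hoff
  · intro r r' hne y h1 h2 h3 h4 he
    have hz := (hseg r y h1 h2).1
    have hz' := (hseg r' y h3 h4).1
    rw [← he] at hz'
    by_cases hee : rodEdge r = rodEdge r'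
    · have hx : ∀ x x' : UpCross G p, rodEdge r = x.1.1 ∨ rodEdge r = x.1.2 →
          rodEdge r' = x'.1.1 ∨ rodEdge r' = x'.1.2 → x = x' := fun x x' k k' =>
        hp.upCross_ext (e := rodEdge r) k (by rwa [hee])
      have hd : ∀ x : UpCross G p, x.1.1 ≠ x.1.2 := fun x h => x.2.1.2.2.1 (by rw [h])
      rcases r with i | x | x | x | x <;> rcases r' with i' | x' | x' | x' | x' <;>
        simp only [rodEdge] at hee hx
      · grind
      all_goals first
        | (exact i.2.2.2 _ _ (by rw [hee]; exact x'.2.1))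
        | (exact i.2.2.2 _ _ (by rw [hee]; exact x'.2.1.swap))
        | (exact i'.2.2.2 _ _ (by rw [← hee]; exact x.2.1))
        | (exact i'.2.2.2 _ _ (by rw [← hee]; exact x.2.1.swap))
        | (obtain rfl := hx x x' (by simp) (by simp)
           first
            | exact hne rfl
            | exact hd _ hee
            | exact hd _ hee.symm
            | (simp only [Arrangement.bot, Arrangement.top] at h1 h2 h3 h4; linarith))
    · have hc : Cr G p (rodEdge r).1 (rodEdge r).2 (rodEdge r').1 (rodEdge r').2 :=
        ⟨(rodEdge_spec r).1, (rodEdge_spec r').1, fun h =>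
          hee (edge_ext (rodEdge_spec r).2 (rodEdge_spec r').2 h), _, hz, hz', hnv r y h1 h2⟩
      obtain ⟨x, hx, hxy⟩ := hcr r ⟨_, _, hc⟩
      refine hxy y h1 h2 ?_
      have hx' : x.pt ∈ segment ℝ (p (rodEdge r).1) (p (rodEdge r).2) ∧
          x.pt ∈ segment ℝ (p (rodEdge r').1) (p (rodEdge r').2) := by
        rcases hx with hx | hx <;> rw [hx] at hc ⊢
        · rw [edge_ext (rodEdge_spec r').2 x.2.2.2.1 (hp.one _ _ _ _ _ _ hc x.2.1)]
          exact ⟨x.pt_spec.1, x.pt_spec.2.1⟩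
        · rw [edge_ext (rodEdge_spec r').2 x.2.2.1 (hp.one _ _ _ _ _ _ hc x.2.1.swap)]
          exact ⟨x.pt_spec.2.1, x.pt_spec.1⟩
      have l1 := (rodEdge_spec r).2
      have l2 := (rodEdge_spec r').2
      have := hp.sl_ne hc l1 l2
      simp only [mem_seg_iff l1, mem_seg_iff l2, ln_eq l1, ln_eq l2] at hz hz' hx'
      grind
  · intro r h1 h2
    have h3 := hray _ _ (rodEdge_spec r).1 _ (hseg r _ h1 h2).1 rfl
    exact lt_of_le_of_ne h3 (hoff r _ h1 h2).symm
  · intro x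
    rw [(hrod _).1, (hrod _).1]; rfl
  · intro x
    rw [(hrod _).1, (hrod _).1]; rfl
  · intro x
    rw [(hrod _).1, (hrod _).1]
    exact x.2.2.2.2

theorem Good.extremal_of_generic [Finite V] (hp : Good G p)
    (hgen : ∀ z ∈ special G p, ∀ z' ∈ special G p, z.2 = z'.2 → z = z') {s : V}
    (hray : ∀ u v, G.Adj u v → ∀ z ∈ segment ℝ (p u) (p v), z.2 = (p s).2 → (p s).1 ≤ z.1) :
    Extremal G p s := by
  obtain ⟨rods, hF⟩ := (hp.arrangement_valid hgen hray).exists_frame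
  obtain ⟨X, Y, hY, hoff, hdis, c, hc⟩ := hF.exists_extreme
  set Fr := (arrangement G p s).toFrame rods with hFr
  have hinj : ∀ {u v}, (p u).2 = (p v).2 → u = v := fun {u v} h =>
    hp.inj (hgen _ (.inl ⟨u, rfl⟩) _ (.inl ⟨v, rfl⟩) h)
  have hch' : ∀ u v, G.Adj u v → (p u).2 < (p v).2 → ∃ π, Fr.chord π u v ∧ Fr.chord π v u := by
    intro u v huv hlt
    by_cases h : ∀ c d, ¬ Cr G p u v c d
    · exact ⟨.inl ⟨(u, v), huv, hlt, h⟩, .inl ⟨rfl, rfl⟩, .inr ⟨rfl, rfl⟩⟩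
    · push Not at h
      obtain ⟨c, d, h, hlt'⟩ : ∃ c d, Cr G p u v c d ∧ (p c).2 < (p d).2 := by
        obtain ⟨c, d, h⟩ := h
        grind [h.right, h.2.1.ne]
      rcases lt_or_gt_of_ne (hp.sl_ne h hlt hlt') with hs | hs
      · exact ⟨.inr ⟨((c, d), (u, v)), h.swap, hlt', hlt, hs⟩, .inr (.inr (.inl ⟨rfl, rfl⟩)),
          .inr (.inr (.inr ⟨rfl, rfl⟩))⟩
      · exact ⟨.inr ⟨((u, v), (c, d)), h, hlt, hlt', hs⟩, .inl ⟨rfl, rfl⟩, .inr (.inl ⟨rfl, rfl⟩)⟩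
  have hch : ∀ u v, G.Adj u v → ∃ π, Fr.chord π u v := by
    intro u v huv
    grind [huv.ne, huv.symm]
  set p' : V → ℝ × ℝ := fun v => (X v, Y v) with hp'
  have hpl : Plain G p' := by
    refine ⟨fun u v h => hY (congrArg Prod.snd h), ?_⟩
    have key : ∀ u v w, G.Adj u v → Y u < Y v → p' w ∈ segment ℝ (p' u) (p' v) →
        w = u ∨ w = v := by
      intro u v w huv hlt hw
      obtain ⟨h1, h2, h3⟩ := (mem_segment_iff_lin (X := X) hlt).1 hw
      obtain ⟨π, hπ⟩ := hch u v huv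
      have := hoff π u v w hπ
      have := @hY w u
      have := @hY w v
      grind
    intro u v w huv hw
    rcases lt_or_gt_of_ne (fun h => huv.ne (hY h)) with h | h
    · exact key u v w huv h hw
    · exact (key v u w huv.symm h (by rwa [segment_symm])).symm
  refine ⟨p', hpl, ?_, LinearMap.fst ℝ ℝ ℝ - c • LinearMap.snd ℝ ℝ ℝ, fun v hv => ?_⟩
  · have key : ∀ a b c d, Cr G p' a b c d → Y a < Y b → Y c < Y d → Cr G p a b c d := by
      rintro a b c d ⟨hab, hcd, hne, z, hz, hz', hnr⟩ h1 h2
      obtain ⟨a1, a2⟩ := mem_seg_lt (p := p') h1 hz hnr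
      obtain ⟨b1, b2⟩ := mem_seg_lt (p := p') h2 hz' hnr
      have a3 := ((mem_segment_iff_lin (X := X) h1).1 hz).2.2
      have b3 := ((mem_segment_iff_lin (X := X) h2).1 hz').2.2
      obtain ⟨π, hπ⟩ := hch a b hab
      obtain ⟨π', hπ'⟩ := hch c d hcd
      by_cases hππ : π = π'
      · subst hππ
        rcases π with i | x
        · exfalso
          rcases hπ with ⟨rfl, rfl⟩ | ⟨rfl, rfl⟩ <;> rcases hπ' with ⟨rfl, rfl⟩ | ⟨rfl, rfl⟩ <;>
            grind [Sym2.eq_swap]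
        · have hx := x.2.1
          rcases hπ with ⟨rfl, rfl⟩ | ⟨rfl, rfl⟩ | ⟨rfl, rfl⟩ | ⟨rfl, rfl⟩ <;>
            rcases hπ' with ⟨rfl, rfl⟩ | ⟨rfl, rfl⟩ | ⟨rfl, rfl⟩ | ⟨rfl, rfl⟩ <;>
            first
            | exact absurd rfl hne
            | exact absurd Sym2.eq_swap hne
            | exact hx
            | exact hx.left
            | exact hx.right
            | exact hx.left.right
            | exact hx.swap
            | exact hx.swap.left
            | exact hx.swap.right
            | exact hx.swap.left.right
      · grind
    intro a b c d h
    rcases lt_or_gt_of_ne (fun e => h.1.ne (hY e)) with h1 | h1 <;>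
      rcases lt_or_gt_of_ne (fun e => h.2.1.ne (hY e)) with h2 | h2 <;> grind [Cr.left, Cr.right]
  · have h : X s - c * Y s < X v - c * Y v := hc v hv
    simpa [hp'] using h

end Placement

theorem isCompact_seg (a b : ℝ × ℝ) : IsCompact (segment ℝ a b) := by
  rw [segment_eq_image]
  exact isCompact_Icc.image (by fun_prop)

theorem mem_seg_smul {a b z : ℝ × ℝ} :
    z ∈ segment ℝ a b ↔ ∃ t : ℝ, 0 ≤ t ∧ t ≤ 1 ∧ z = a + t • (b - a) := by
  rw [segment_eq_image']
  constructor
  · grind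
  · aesop

theorem exists_lineMap_of_mem {a b z z' : ℝ × ℝ} (hz : z ∈ segment ℝ a b)
    (hz' : z' ∈ segment ℝ a b) (hne : z ≠ z') : ∃ α β : ℝ,
      a = AffineMap.lineMap z z' α ∧ b = AffineMap.lineMap z z' β ∧ 0 ∈ Set.uIcc α β := by
  obtain ⟨t, h0, h1, rfl⟩ := mem_seg_smul.1 hz
  obtain ⟨t', -, -, rfl⟩ := mem_seg_smul.1 hz'
  have htt : t' - t ≠ 0 := by
    intro h
    rw [sub_eq_zero.1 h] at hne
    exact hne rfl
  refine ⟨-t / (t' - t), (1 - t) / (t' - t), ?_, ?_, ?_⟩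
  · rw [AffineMap.lineMap_apply, vsub_eq_sub, vadd_eq_add, add_sub_add_left_eq_sub, ← sub_smul,
      smul_smul, div_mul_cancel₀ _ htt]
    module
  · rw [AffineMap.lineMap_apply, vsub_eq_sub, vadd_eq_add, add_sub_add_left_eq_sub, ← sub_smul,
      smul_smul, div_mul_cancel₀ _ htt]
    module
  · rw [Set.mem_uIcc]
    rcases lt_or_gt_of_ne htt with h | h
    · exact .inr ⟨div_nonpos_of_nonneg_of_nonpos (by linarith) h.le,
        div_nonneg_of_nonpos (by linarith) h.le⟩
    · exact .inl ⟨div_nonpos_of_nonpos_of_nonneg (by linarith) h.le,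
        div_nonneg (by linarith) h.le⟩

/-- Two segments with two common points overlap. -/
theorem endpoint_mem_of_two {a b c d z z' : ℝ × ℝ} (h1 : z ∈ segment ℝ a b)
    (h1' : z' ∈ segment ℝ a b) (h2 : z ∈ segment ℝ c d) (h2' : z' ∈ segment ℝ c d)
    (hne : z ≠ z') : c ∈ segment ℝ a b ∨ d ∈ segment ℝ a b ∨ a ∈ segment ℝ c d ∨
      b ∈ segment ℝ c d := by
  obtain ⟨α, β, rfl, rfl, h⟩ := exists_lineMap_of_mem h1 h1' hne
  obtain ⟨γ, δ, rfl, rfl, h'⟩ := exists_lineMap_of_mem h2 h2' hne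
  have hinj : Function.Injective (AffineMap.lineMap z z' : ℝ →ᵃ[ℝ] ℝ × ℝ) :=
    AffineMap.lineMap_injective ℝ hne
  simp only [← image_segment, hinj.mem_set_image, segment_eq_uIcc, Set.mem_uIcc] at *
  grind

section Placement
variable {V : Type*} {G : SimpleGraph V} {p : V → ℝ × ℝ}

theorem Good.cross_unique (hp : Good G p) {a b c d : V} {z z' : ℝ × ℝ} (hab : G.Adj a b)
    (hcd : G.Adj c d) (hne : s(a, b) ≠ s(c, d)) (h1 : z ∈ segment ℝ (p a) (p b))
    (h2 : z ∈ segment ℝ (p c) (p d)) (hr : z ∉ Set.range p) (h1' : z' ∈ segment ℝ (p a) (p b))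
    (h2' : z' ∈ segment ℝ (p c) (p d)) : z = z' := by
  by_contra hzz
  obtain ⟨n1, n2, n3, n4⟩ := hp.adj a b c d ⟨hab, hcd, hne, z, h1, h2, hr⟩
  rcases endpoint_mem_of_two h1 h1' h2 h2' hzz with h | h | h | h
  · grind [hp.off]
  · grind [hp.off]
  · grind [hp.off]
  · grind [hp.off]

theorem Good.special_finite [Finite V] (hp : Good G p) : (special G p).Finite := by
  refine (Set.finite_range p).union ?_
  have : {z | z ∉ Set.range p ∧ ∃ a b c d, G.Adj a b ∧ G.Adj c d ∧ s(a, b) ≠ s(c, d) ∧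
      z ∈ segment ℝ (p a) (p b) ∧ z ∈ segment ℝ (p c) (p d)} ⊆
      ⋃ q : (V × V) × (V × V), {z | z ∉ Set.range p ∧ G.Adj q.1.1 q.1.2 ∧ G.Adj q.2.1 q.2.2 ∧
        s(q.1.1, q.1.2) ≠ s(q.2.1, q.2.2) ∧ z ∈ segment ℝ (p q.1.1) (p q.1.2) ∧
        z ∈ segment ℝ (p q.2.1) (p q.2.2)} := by
    rintro z ⟨h, a, b, c, d, h'⟩
    exact Set.mem_iUnion.2 ⟨((a, b), (c, d)), h, h'⟩
  refine (Set.finite_iUnion fun q => Set.Subsingleton.finite ?_).subset this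
  rintro z ⟨h0, h1, h2, h3, h4, h5⟩ z' ⟨-, -, -, -, h4', h5'⟩
  exact hp.cross_unique h1 h2 h3 h4 h5 h0 h4' h5'

theorem Good.affine {p : V → ℝ × ℝ} (hp : Good G p) {E : ℝ × ℝ →ᵃ[ℝ] ℝ × ℝ}
    (hE : Function.Injective E) : Good G (E ∘ p) ∧
      ∀ a b c d, Cr G (E ∘ p) a b c d → Cr G p a b c d := by
  have hcr : ∀ a b c d, Cr G (E ∘ p) a b c d → Cr G p a b c d := by
    rintro a b c d ⟨h1, h2, h3, y, h4, h5, h6⟩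
    simp only [Function.comp_apply, ← image_segment] at h4 h5
    obtain ⟨z, hz, rfl⟩ := h4
    exact ⟨h1, h2, h3, z, hz, hE.mem_set_image.1 h5, fun ⟨v, hv⟩ => h6 ⟨v, congrArg E hv⟩⟩
  refine ⟨hp.of_plain ⟨hE.comp hp.inj, fun u v w h hw => hp.off u v w h ?_⟩ hcr, hcr⟩
  simp only [Function.comp_apply, ← image_segment] at hw
  exact hE.mem_set_image.1 hw

theorem Good.extremal_of_linear [Finite V] (hp : Good G p) {s : V} {L : ℝ × ℝ →ₗ[ℝ] ℝ × ℝ}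
    (hL : Function.Injective L)
    (hgen : ∀ z ∈ special G p, ∀ z' ∈ special G p, (L z).2 = (L z').2 → z = z')
    (hray : ∀ u v, G.Adj u v → ∀ z ∈ segment ℝ (p u) (p v), (L z).2 = (L (p s)).2 →
      (L (p s)).1 ≤ (L z).1) : Extremal G p s := by
  obtain ⟨hG, hcr⟩ := hp.affine (E := L.toAffineMap) hL
  have hseg : ∀ a b, segment ℝ ((L.toAffineMap ∘ p) a) ((L.toAffineMap ∘ p) b) =
      L '' segment ℝ (p a) (p b) := fun a b => (image_segment ℝ L.toAffineMap _ _).symm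
  have hsp : ∀ z ∈ special G (L.toAffineMap ∘ p), ∃ z' ∈ special G p, z = L z' := by
    rintro z (⟨v, rfl⟩ | ⟨h, a, b, c, d, h1, h2, h3, h4, h5⟩)
    · exact ⟨p v, .inl ⟨v, rfl⟩, rfl⟩
    · rw [hseg] at h4 h5
      obtain ⟨z, h4, rfl⟩ := h4
      exact ⟨z, .inr ⟨fun ⟨v, hv⟩ => h ⟨v, congrArg L hv⟩, a, b, c, d, h1, h2, h3, h4,
        hL.mem_set_image.1 h5⟩, rfl⟩
  obtain ⟨p', h1, h2, h3⟩ := hG.extremal_of_generic (s := s) (by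
    intro z hz z' hz' he
    obtain ⟨z, k, rfl⟩ := hsp z hz
    obtain ⟨z', k', rfl⟩ := hsp z' hz'
    rw [hgen z k z' k' he]) (by
    intro u v huv z hz he
    rw [hseg] at hz
    obtain ⟨z, hz', rfl⟩ := hz
    exact hray u v huv z hz' he)
  exact ⟨p', h1, fun a b c d h => hcr _ _ _ _ (h2 _ _ _ _ h), h3⟩

variable (G p) in
/-- The point set of a straight-line drawing. -/
def pic : Set (ℝ × ℝ) := Set.range p ∪ {z | ∃ u v, G.Adj u v ∧ z ∈ segment ℝ (p u) (p v)}

theorem isCompact_edges [Finite V] (P : V → V → Prop) :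
    IsCompact {z | ∃ u v, P u v ∧ z ∈ segment ℝ (p u) (p v)} := by
  have : {z | ∃ u v, P u v ∧ z ∈ segment ℝ (p u) (p v)} =
      ⋃ q ∈ {q : V × V | P q.1 q.2}, segment ℝ (p q.1) (p q.2) := by
    ext z
    simp only [Set.mem_ofPred_eq, Set.mem_iUnion, exists_prop, Prod.exists]
  rw [this]
  exact (Set.toFinite _).isCompact_biUnion fun q _ => isCompact_seg _ _

theorem isCompact_pic [Finite V] : IsCompact (pic G p) :=
  (Set.finite_range p).isCompact.union (isCompact_edges _)

theorem Good.extremal_of_ray [Finite V] (hp : Good G p) {s : V} {d : ℝ × ℝ} (hd : d ≠ 0)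
    (hray : ∀ t : ℝ, 0 < t → p s + t • d ∉ pic G p) : Extremal G p s := by
  set N := d.1 * d.1 + d.2 * d.2 with hN
  have hN0 : 0 < N := by
    rcases (mul_self_nonneg d.1).lt_or_eq with h | h
    · nlinarith [mul_self_nonneg d.2]
    · aesop
  set ξ : ℝ × ℝ →ₗ[ℝ] ℝ := d.1 • LinearMap.fst ℝ ℝ ℝ + d.2 • LinearMap.snd ℝ ℝ ℝ with hξ
  set η : ℝ × ℝ →ₗ[ℝ] ℝ := d.1 • LinearMap.snd ℝ ℝ ℝ - d.2 • LinearMap.fst ℝ ℝ ℝ with hη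
  have eξ : ∀ k : ℝ × ℝ, ξ k = d.1 * k.1 + d.2 * k.2 := fun k => by simp [hξ]
  have eη : ∀ k : ℝ × ℝ, η k = d.1 * k.2 - d.2 * k.1 := fun k => by simp [hη]
  have cξ : Continuous ξ := by
    have : (ξ : ℝ × ℝ → ℝ) = fun k => d.1 * k.1 + d.2 * k.2 := funext eξ
    rw [this]; fun_prop
  have cη : Continuous η := by
    have : (η : ℝ × ℝ → ℝ) = fun k => d.1 * k.2 - d.2 * k.1 := funext eη
    rw [this]; fun_prop
  have hsolve : ∀ k : ℝ × ℝ, η k = 0 → k = (ξ k / N) • d := by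
    intro k hk
    rw [eη] at hk
    ext
    · simp only [Prod.smul_fst, smul_eq_mul, eξ]
      field_simp
      linear_combination (-d.2) * hk
    · simp only [Prod.smul_snd, smul_eq_mul, eξ]
      field_simp
      linear_combination d.1 * hk
  have hzero : ∀ k : ℝ × ℝ, η k = 0 → ξ k = 0 → k = 0 := fun k h1 h2 => by
    rw [hsolve k h1, h2, zero_div, zero_smul]
  obtain ⟨ε₀, hε₀, hcone⟩ : ∃ ε₀ : ℝ, 0 < ε₀ ∧ ∀ ε, 0 < ε → ε < ε₀ → ∀ u v, G.Adj u v →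
      u ≠ s → v ≠ s → ∀ z ∈ segment ℝ (p u) (p v), η (z - p s) = ε * ξ (z - p s) →
      ξ (z - p s) ≤ 0 := by
    set K := {z | ∃ u v, (G.Adj u v ∧ u ≠ s ∧ v ≠ s) ∧ z ∈ segment ℝ (p u) (p v)} with hK
    have hC : IsCompact (K ∩ {z | 0 ≤ ξ (z - p s)}) :=
      (isCompact_edges _).inter_right (isClosed_le continuous_const (by fun_prop))
    have hne : ∀ z ∈ K ∩ {z | 0 ≤ ξ (z - p s)}, η (z - p s) ≠ 0 := by
      rintro z ⟨⟨u, v, ⟨h1, h2, h3⟩, hz⟩, h0⟩ he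
      have h0 : 0 ≤ ξ (z - p s) := h0
      rcases h0.lt_or_eq with h0 | h0
      · refine hray _ (div_pos h0 hN0) (.inr ⟨u, v, h1, ?_⟩)
        rwa [← hsolve _ he, add_sub_cancel]
      · rw [sub_eq_zero.1 (hzero _ he h0.symm)] at hz
        grind [hp.off]
    obtain ⟨B, hB⟩ := hC.exists_bound_of_continuousOn (f := fun z => ξ (z - p s) / η (z - p s))
      (ContinuousOn.div (by fun_prop) (by fun_prop) hne)
    refine ⟨1 / (|B| + 1), by positivity, fun ε h0 hε u v huv hu hv z hz he => ?_⟩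
    by_contra hcon
    rw [not_le] at hcon
    have := hB z ⟨⟨u, v, ⟨huv, hu, hv⟩, hz⟩, hcon.le⟩
    rw [he, Real.norm_eq_abs, abs_of_pos (div_pos hcon (mul_pos h0 hcon)),
      div_le_iff₀ (mul_pos h0 hcon)] at this
    rw [lt_div_iff₀ (by positivity)] at hε
    nlinarith [le_abs_self B, mul_pos h0 hcon]
  obtain ⟨ε, ⟨⟨hε1, hε2⟩, hε3⟩⟩ : ∃ ε, ε ∈ Set.Ioo 0 ε₀ ∧ ∀ z ∈ special G p, ∀ z' ∈ special G p,
      η (z - z') = ε * ξ (z - z') → z = z' := by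
    have hfin : (⋃ q ∈ special G p ×ˢ special G p,
        {ε : ℝ | η (q.1 - q.2) = ε * ξ (q.1 - q.2) ∧ q.1 ≠ q.2}).Finite := by
      refine (hp.special_finite.prod hp.special_finite).biUnion fun q _ => ?_
      refine Set.Subsingleton.finite ?_
      rintro ε ⟨h1, h2⟩ ε' ⟨h1', -⟩
      refine mul_right_cancel₀ (fun h => h2 ?_) (h1.symm.trans h1')
      rw [h, mul_zero] at h1
      exact sub_eq_zero.1 (hzero _ h1 h)
    obtain ⟨ε, h1, h2⟩ := ((Set.Ioo_infinite hε₀).sdiff hfin).nonempty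
    refine ⟨ε, h1, fun z hz z' hz' he => ?_⟩
    by_contra hne
    exact h2 (Set.mem_biUnion (x := (z, z')) ⟨hz, hz'⟩ ⟨he, hne⟩)
  set L : ℝ × ℝ →ₗ[ℝ] ℝ × ℝ := (-(ξ + ε • η)).prod (η - ε • ξ) with hL
  have eL1 : ∀ k, (L k).1 = -(ξ k + ε * η k) := fun k => by simp [hL]
  have eL2 : ∀ k, (L k).2 = η k - ε * ξ k := fun k => by simp [hL]
  have hdiff : ∀ z z', (L z).2 = (L z').2 ↔ η (z - z') = ε * ξ (z - z') := fun z z' => by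
    rw [eL2, eL2, map_sub, map_sub]
    constructor <;> intro h <;> linarith
  refine hp.extremal_of_linear (L := L) ?_ ?_ ?_
  · rw [← LinearMap.ker_eq_bot, LinearMap.ker_eq_bot']
    intro k hk
    have h1 := eL1 k
    have h2 := eL2 k
    rw [hk] at h1 h2
    simp only [Prod.fst_zero, Prod.snd_zero] at h1 h2
    have h3 : ξ k * (1 + ε * ε) = 0 := by linear_combination h1 + ε * h2
    have h4 : ξ k = 0 := (mul_eq_zero.1 h3).resolve_right (by positivity)
    exact hzero k (by rw [h4] at h2; linarith) h4
  · grind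
  · have inc : ∀ w, G.Adj s w → ∀ z ∈ segment ℝ (p s) (p w), (L z).2 = (L (p s)).2 →
        z = p s := by
      intro w hw z hz he
      obtain ⟨t, -, -, rfl⟩ := mem_seg_smul.1 hz
      rw [hdiff, add_sub_cancel_left, map_smul, map_smul, smul_eq_mul, smul_eq_mul,
        mul_left_comm] at he
      rcases eq_or_ne t 0 with rfl | ht
      · simp
      · exact absurd (hp.inj (hε3 _ (.inl ⟨w, rfl⟩) _ (.inl ⟨s, rfl⟩)
          (mul_left_cancel₀ ht he))) hw.ne'
    intro u v huv z hz he
    by_cases hu : u = s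
    · subst hu
      rw [inc v huv z hz he]
    by_cases hv : v = s
    · subst hv
      rw [inc u huv.symm z (by rwa [segment_symm]) he]
    · have h := hcone ε hε1 hε2 u v huv hu hv z hz ((hdiff _ _).1 he)
      have h2 := (hdiff _ _).1 he
      rw [eL1, eL1]
      rw [map_sub] at h
      rw [map_sub, map_sub] at h2
      nlinarith [mul_nonneg (mul_nonneg hε1.le hε1.le) (sub_nonneg.2 h)]

end Placement

section Reach
open Set

/-- Points from which one escapes `A` along a broken line with `k` bends. -/
def Reach (A : Set (ℝ × ℝ)) : ℕ → Set (ℝ × ℝ)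
  | 0 => {q | ∃ d ≠ 0, ∀ t : ℝ, 0 ≤ t → q + t • d ∉ A}
  | k + 1 => {q | ∃ q' ∈ Reach A k, Disjoint (segment ℝ q q') A}

theorem exists_reach {A : Set (ℝ × ℝ)} (hA : IsCompact A) {x : ℝ × ℝ} (hx : x ∉ A)
    (hu : ¬Bornology.IsBounded (connectedComponentIn Aᶜ x)) : ∃ k, x ∈ Reach A k := by
  have hloc : ∀ q ∉ A, ∃ U, IsOpen U ∧ q ∈ U ∧ U ⊆ Aᶜ ∧
      ∀ y ∈ U, ∀ y' ∈ U, (∃ k, y' ∈ Reach A k) → ∃ k, y ∈ Reach A k := by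
    intro q hq
    obtain ⟨ε, h0, h⟩ := Metric.isOpen_iff.1 hA.isClosed.isOpen_compl q hq
    refine ⟨_, Metric.isOpen_ball, Metric.mem_ball_self h0, h, fun y hy y' hy' ⟨k, hk⟩ =>
      ⟨k + 1, y', hk, ?_⟩⟩
    exact Set.disjoint_left.2 fun w hw => h ((convex_ball q ε).segment_subset hy hy' hw)
  let R := {q | ∃ k, q ∈ Reach A k}
  have h1 : IsOpen (Aᶜ ∩ R) := isOpen_iff_forall_mem_open.2 fun q ⟨hq, hk⟩ => by
    obtain ⟨U, hU, hqU, hUA, h⟩ := hloc q hq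
    exact ⟨U, fun y hy => ⟨hUA hy, h y hy q hqU hk⟩, hU, hqU⟩
  have h2 : IsOpen (Aᶜ \ R) := isOpen_iff_forall_mem_open.2 fun q ⟨hq, hk⟩ => by
    obtain ⟨U, hU, hqU, hUA, h⟩ := hloc q hq
    exact ⟨U, fun y hy => ⟨hUA hy, fun hy' => hk (h q hqU y hy hy')⟩, hU, hqU⟩
  rcases isPreconnected_connectedComponentIn.subset_or_subset h1 h2
    (Set.disjoint_left.2 fun y hy hy' => hy'.2 hy.2)
    ((connectedComponentIn_subset Aᶜ x).trans fun y hy => by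
      by_cases h : y ∈ R
      exacts [.inl ⟨hy, h⟩, .inr ⟨hy, h⟩]) with h | h
  · exact (h (mem_connectedComponentIn hx)).2
  · refine (hu ?_).elim
    obtain ⟨M, hM⟩ := hA.isBounded.exists_norm_le
    refine Metric.isBounded_closedBall (x := (0 : ℝ × ℝ)) (r := |M|) |>.subset fun y hy => ?_
    by_contra hn
    rw [mem_closedBall_zero_iff, not_le] at hn
    have hM' := abs_nonneg M
    refine (h hy).2 ⟨0, y, norm_pos_iff.1 (by linarith), fun t ht hA => ?_⟩
    have h3 := hM _ hA
    rw [show y + t • y = (1 + t) • y by module, norm_smul, Real.norm_of_nonneg (by linarith)] at h3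
    nlinarith [le_abs_self M]

theorem reach_union {A B : Set (ℝ × ℝ)} {n : ℕ} (h : ∀ m < n, ∀ y ∈ Reach A m, y ∉ B) :
    ∀ m < n, Reach A m ⊆ Reach (A ∪ B) m
  | 0, hm => fun q ⟨d, hd, hq⟩ => ⟨d, hd, fun t ht => by
      rintro (h' | h')
      · exact hq t ht h'
      · refine h 0 hm _ ⟨d, hd, fun t' ht' => ?_⟩ h'
        rw [add_assoc, ← add_smul]
        exact hq _ (add_nonneg ht ht')⟩
  | m + 1, hm => fun q ⟨q', hq', hq⟩ => ⟨q', reach_union h m (by omega) hq',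
      Set.disjoint_union_right.2 ⟨hq, Set.disjoint_left.2 fun y hy =>
        h (m + 1) hm y ⟨q', hq', hq.mono_left
          ((convex_segment q q').segment_subset hy (right_mem_segment ℝ q q'))⟩⟩⟩

variable {V : Type*} {G : SimpleGraph V} {p : V → ℝ × ℝ}

/-- The half-open segment from the position of `s` to `z` misses the drawing. -/
def Sees (G : SimpleGraph V) (p : V → ℝ × ℝ) (s : V) (z : ℝ × ℝ) : Prop :=
  ∀ t : ℝ, 0 < t → t ≤ 1 → p s + t • (z - p s) ∉ pic G p

theorem Sees.notMem {s : V} {z : ℝ × ℝ} (h : Sees G p s z) : z ∉ pic G p := by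
  simpa using h 1 one_pos le_rfl

theorem exists_ball_disjoint [Finite V] (hp : Plain G p) (s : V) : ∃ r > 0,
    (∀ v ≠ s, p v ∉ Metric.ball (p s) r) ∧ ∀ u v, G.Adj u v → u ≠ s → v ≠ s →
      ∀ z ∈ segment ℝ (p u) (p v), z ∉ Metric.ball (p s) r := by
  have hK : IsCompact (p '' {v | v ≠ s} ∪
      {z | ∃ u v, (G.Adj u v ∧ u ≠ s ∧ v ≠ s) ∧ z ∈ segment ℝ (p u) (p v)}) :=
    (Set.toFinite _).isCompact.union (isCompact_edges _)
  obtain ⟨r, hr, h⟩ := Metric.isOpen_iff.1 hK.isClosed.isOpen_compl (p s) (by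
    rintro (⟨v, hv, he⟩ | ⟨u, v, ⟨h1, h2, h3⟩, h⟩)
    · exact hv (hp.inj he)
    · rcases hp.off _ _ _ h1 h with h | h
      exacts [h2 h.symm, h3 h.symm])
  exact ⟨r, hr, fun v hv hb => h hb (.inl ⟨v, hv, rfl⟩), fun u v h1 h2 h3 z hz hb =>
    h hb (.inr ⟨u, v, ⟨h1, h2, h3⟩, hz⟩)⟩

theorem exists_sees_of_closure [Finite V] (hp : Plain G p) {s : V} {R : Set (ℝ × ℝ)}
    (hR : ∀ x ∈ R, x ∉ pic G p) (h : p s ∈ closure R) : ∃ z ∈ R, Sees G p s z := by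
  obtain ⟨r, hr, hv, he⟩ := exists_ball_disjoint hp s
  obtain ⟨z, hzR, hz⟩ := Metric.mem_closure_iff.1 h r hr
  rw [dist_comm, ← Metric.mem_ball] at hz
  refine ⟨z, hzR, fun t h0 h1 hy => ?_⟩
  have hball : ∀ c : ℝ, 0 ≤ c → c ≤ 1 → p s + c • (z - p s) ∈ Metric.ball (p s) r :=
    fun c h0 h1 => (convex_ball _ r).segment_subset (Metric.mem_ball_self hr) hz
      (mem_seg_smul.2 ⟨c, h0, h1, rfl⟩)
  have key : ∀ v, G.Adj s v → p s + t • (z - p s) ∉ segment ℝ (p s) (p v) := by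
    intro v hsv hm
    obtain ⟨τ, h2, h3, h4⟩ := mem_seg_smul.1 hm
    have h5 : t • (z - p s) = τ • (p v - p s) := add_left_cancel h4
    rcases le_or_gt τ t with h | h
    · refine hR z hzR (.inr ⟨s, v, hsv, mem_seg_smul.2 ⟨τ / t, by positivity,
        (div_le_one h0).2 h, ?_⟩⟩)
      rw [div_eq_inv_mul, mul_smul, ← h5, smul_smul, inv_mul_cancel₀ h0.ne', one_smul]
      abel
    · have h6 : 0 < τ := h0.trans h
      refine hv v hsv.ne' ?_
      have := hball (t / τ) (by positivity) ((div_le_one h6).2 h.le)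
      rwa [div_eq_inv_mul, mul_smul, h5, smul_smul, inv_mul_cancel₀ h6.ne', one_smul,
        add_sub_cancel] at this
  rcases hy with ⟨v, hy⟩ | ⟨u, v, hadj, hy⟩
  · by_cases hvs : v = s
    · subst hvs
      have : t • (z - p v) = 0 := by simpa using hy.symm
      rcases smul_eq_zero.1 this with h | h
      · exact h0.ne' h
      · exact hR z hzR (.inl ⟨v, (sub_eq_zero.1 h).symm⟩)
    · exact hv v hvs (hy ▸ hball t h0.le h1)
  · by_cases hu : u = s
    · exact key v (hu ▸ hadj) (hu ▸ hy)
    by_cases hv : v = s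
    · subst hv
      exact key u hadj.symm (segment_symm ℝ (p u) (p v) ▸ hy)
    exact he u v hadj hu hv _ hy (hball t h0.le h1)

/-- `G` with a pendant vertex attached to `s`. -/
def pend (G : SimpleGraph V) (s : V) : SimpleGraph (Option V) where
  Adj a b := (∃ u v, a = some u ∧ b = some v ∧ G.Adj u v) ∨ (a = some s ∧ b = none) ∨
    (a = none ∧ b = some s)
  symm := ⟨by
    rintro a b (⟨u, v, h1, h2, h⟩ | h | h)
    exacts [.inl ⟨v, u, h2, h1, h.symm⟩, .inr (.inr h.symm), .inr (.inl h.symm)]⟩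
  loopless := ⟨by rintro a (⟨u, v, h1, h2, h⟩ | ⟨h, h'⟩ | ⟨h, h'⟩) <;> simp_all⟩

theorem pend_some {s u v : V} : (pend G s).Adj (some u) (some v) ↔ G.Adj u v := by simp [pend]

section
variable {s : V} {z : ℝ × ℝ}

theorem pic_pend : pic (pend G s) (fun o : Option V => o.elim z p) = pic G p ∪ segment ℝ (p s) z := by
  ext y
  constructor
  · rintro (⟨_ | v, rfl⟩ | ⟨a, b, ⟨u, v, rfl, rfl, h⟩ | ⟨rfl, rfl⟩ | ⟨rfl, rfl⟩, hy⟩)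
    · exact .inr (right_mem_segment ℝ _ _)
    · exact .inl (.inl ⟨v, rfl⟩)
    · exact .inl (.inr ⟨u, v, h, hy⟩)
    · exact .inr hy
    · exact .inr (segment_symm ℝ z (p s) ▸ hy)
  · rintro ((⟨v, rfl⟩ | ⟨u, v, h, hy⟩) | hy)
    · exact .inl ⟨some v, rfl⟩
    · exact .inr ⟨some u, some v, pend_some.2 h, hy⟩
    · exact .inr ⟨some s, none, .inr (.inl ⟨rfl, rfl⟩), hy⟩

theorem Sees.notMem_seg (h : Sees G p s z) {y : ℝ × ℝ} (hy : y ∈ segment ℝ (p s) z)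
    (hs : y ≠ p s) : y ∉ pic G p := by
  obtain ⟨t, h0, h1, rfl⟩ := mem_seg_smul.1 hy
  refine h t (h0.lt_of_ne ?_) h1
  rintro rfl
  simp at hs

theorem pend_cr (hz : Sees G p s z) {a b c d : Option V}
    (h : Cr (pend G s) (fun o => o.elim z p) a b c d) :
    ∃ a' b' c' d', a = some a' ∧ b = some b' ∧ c = some c' ∧ d = some d' ∧ Cr G p a' b' c' d' := by
  have key : ∀ c d y, (pend G s).Adj c d → s(some s, none) ≠ s(c, d) → y ∈ segment ℝ (p s) z →
      y ∈ segment ℝ ((c.elim z p : ℝ × ℝ)) (d.elim z p) →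
      y ∈ Set.range (fun o : Option V => o.elim z p) := by
    rintro c d y (⟨u, v, rfl, rfl, h⟩ | ⟨rfl, rfl⟩ | ⟨rfl, rfl⟩) hne hy hy'
    · by_contra hn
      exact hz.notMem_seg hy (fun h => hn ⟨some s, h.symm⟩) (.inr ⟨u, v, h, hy'⟩)
    · exact (hne rfl).elim
    · exact (hne Sym2.eq_swap).elim
  obtain ⟨h1, h2, hne, y, h3, h4, h5⟩ := h
  rcases h1 with ⟨u, v, rfl, rfl, h⟩ | ⟨rfl, rfl⟩ | ⟨rfl, rfl⟩
  · rcases h2 with ⟨u', v', rfl, rfl, h'⟩ | ⟨rfl, rfl⟩ | ⟨rfl, rfl⟩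
    · exact ⟨u, v, u', v', rfl, rfl, rfl, rfl, h, h', fun he => hne (congrArg (Sym2.map some) he),
        y, h3, h4, fun ⟨v, hv⟩ => h5 ⟨some v, hv⟩⟩
    · exact (h5 (key _ _ y (pend_some.2 h) hne.symm h4 h3)).elim
    · exact (h5 (key _ _ y (pend_some.2 h) (Sym2.eq_swap.trans_ne hne.symm)
        (segment_symm ℝ z (p s) ▸ h4) h3)).elim
  · exact (h5 (key _ _ y h2 hne h3 h4)).elim
  · exact (h5 (key _ _ y h2 (Sym2.eq_swap.trans_ne hne) (segment_symm ℝ z (p s) ▸ h3) h4)).elim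

theorem Good.pend (hp : Good G p) (hz : Sees G p s z) :
    Good (pend G s) (fun o : Option V => o.elim z p) where
  inj := by
    have : ∀ v, p v ≠ z := fun v hv => hz.notMem (.inl ⟨v, hv⟩)
    rintro (_ | a) (_ | b) h
    exacts [rfl, (this b h.symm).elim, (this a h).elim, congrArg some (hp.inj h)]
  off := by
    have key : ∀ w : Option V, (w.elim z p : ℝ × ℝ) ∈ segment ℝ (p s) z → w = some s ∨ w = none := by
      rintro (_ | w) h
      · exact .inr rfl
      · by_contra hn
        exact hz.notMem_seg h (fun h => hn (.inl (congrArg some (hp.inj h)))) (.inl ⟨w, rfl⟩)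
    rintro a b w (⟨u, v, rfl, rfl, h⟩ | ⟨rfl, rfl⟩ | ⟨rfl, rfl⟩) hw
    · rcases w with _ | w
      · exact (hz.notMem (.inr ⟨u, v, h, hw⟩)).elim
      · exact (hp.off u v w h hw).imp (congrArg some) (congrArg some)
    · exact key w hw
    · exact (key w (segment_symm ℝ z (p s) ▸ hw)).symm
  one a b c d c' d' h h' := by
    obtain ⟨a, b, c, d, rfl, rfl, rfl, rfl, k⟩ := pend_cr hz h
    obtain ⟨a', b', c', d', e1, e2, rfl, rfl, k'⟩ := pend_cr hz h'
    obtain rfl := Option.some.inj e1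
    obtain rfl := Option.some.inj e2
    exact congrArg (Sym2.map some) (hp.one _ _ _ _ _ _ k k')
  adj a b c d h := by
    obtain ⟨a, b, c, d, rfl, rfl, rfl, rfl, k⟩ := pend_cr hz h
    simpa using hp.adj _ _ _ _ k

theorem Extremal.of_pend [Finite V] (hp : Good G p) (hz : Sees G p s z)
    (h : Extremal (pend G s) (fun o : Option V => o.elim z p) none) : Extremal G p s := by
  obtain ⟨q, hq, hc, φ, hφ⟩ := h
  have hsn : (OnePlanarity.pend G s).Adj (some s) none := .inr (.inl ⟨rfl, rfl⟩)
  have hc' : ∀ a b c d, Cr G (q ∘ some) a b c d → Cr G p a b c d := by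
    rintro a b c d ⟨h1, h2, hne, y, h3, h4, h5⟩
    have : Cr (OnePlanarity.pend G s) q (some a) (some b) (some c) (some d) := by
      refine ⟨pend_some.2 h1, pend_some.2 h2, fun he =>
        hne (Sym2.map.injective (Option.some_injective V) he), y, h3, h4, ?_⟩
      rintro ⟨_ | v, rfl⟩
      · simpa using hq.off _ _ _ (pend_some.2 h1) h3
      · exact h5 ⟨v, rfl⟩
    obtain ⟨a', b', c', d', e1, e2, e3, e4, h⟩ := pend_cr hz (hc _ _ _ _ this)
    simp only [Option.some.injEq] at e1 e2 e3 e4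
    exact e1 ▸ e2 ▸ e3 ▸ e4 ▸ h
  have hpl : Plain G (q ∘ some) := ⟨hq.inj.comp (Option.some_injective V), fun u v w h hw => by
    simpa using hq.off _ _ _ (pend_some.2 h) hw⟩
  have hd : q none - q (some s) ≠ 0 := sub_ne_zero.2 fun h => by simpa using hq.inj h
  obtain ⟨p', h1, h2, h3⟩ := (hp.of_plain hpl hc').extremal_of_ray (s := s) hd (by
    intro t ht hy
    have hlow : ∀ y ∈ pic G (q ∘ some), φ (q none) < φ y := by
      rintro y (⟨v, rfl⟩ | ⟨u, v, -, hy⟩)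
      · exact hφ _ (by simp)
      · exact (convex_halfSpace_gt φ.isLinear (φ (q none))).segment_subset
          (hφ (some u) (by simp)) (hφ (some v) (by simp)) hy
    have h4 := hlow _ hy
    have h5 := hφ (some s) (by simp)
    have ht1 : t < 1 := by
      simp only [Function.comp_apply, map_add, map_smul, map_sub, smul_eq_mul] at h4
      nlinarith
    set y := (q ∘ some) s + t • (q none - q (some s)) with hyd
    have hys : y ∈ segment ℝ (q (some s)) (q none) := mem_seg_smul.2 ⟨t, ht.le, ht1.le, rfl⟩
    have hyn : y ∉ Set.range q := by
      rintro ⟨w, hw⟩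
      rcases hq.off _ _ w hsn (hw ▸ hys) with rfl | rfl
      · rw [hyd, Function.comp_apply, left_eq_add, smul_eq_zero] at hw
        exact hw.elim ht.ne' hd
      · rw [← hw] at h4
        exact lt_irrefl _ h4
    rcases hy with ⟨v, hv⟩ | ⟨u, v, hu, hy⟩
    · exact hyn ⟨some v, hv⟩
    · obtain ⟨a, b, -, -, -, e, -⟩ := pend_cr hz (hc (some s) none (some u) (some v)
        ⟨hsn, pend_some.2 hu, by simp, y, hys, hy, hyn⟩)
      simp at e)
  exact ⟨p', h1, fun _ _ _ _ h => hc' _ _ _ _ (h2 _ _ _ _ h), h3⟩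

end

theorem Good.extremal_of_sees (n : ℕ) : ∀ {V : Type*} [Finite V] {G : SimpleGraph V}
    {p : V → ℝ × ℝ} (_ : Good G p) {s : V} {z : ℝ × ℝ}, Sees G p s z →
    z ∈ Reach (pic G p) n → Extremal G p s := by
  induction n using Nat.strong_induction_on with | _ n ih
  intro V _ G p hp s z hz hn
  by_cases hex : ∃ m < n, ∃ y, Sees G p s y ∧ y ∈ Reach (pic G p) m
  · obtain ⟨m, hm, y, hy, h⟩ := hex
    exact ih m hm hp hy h
  push Not at hex
  have hs : p s ∈ pic G p := .inl ⟨s, rfl⟩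
  have hscale : ∀ c : ℝ, 0 < c → c ≤ 1 → Sees G p s (p s + c • (z - p s)) := fun c h0 h1 t h2 h3 => by
    rw [add_sub_cancel_left, smul_smul]
    exact hz _ (by positivity) (mul_le_one₀ h3 h0.le h1)
  have hne : ∀ m < n, ∀ y ∈ Reach (pic G p) m, y ∉ segment ℝ (p s) z := by
    intro m hm y hy hys
    obtain ⟨c, h0, h1, rfl⟩ := mem_seg_smul.1 hys
    rcases h0.eq_or_lt with rfl | h0
    · rw [zero_smul, add_zero] at hy
      cases m with
      | zero =>
        obtain ⟨d, -, h⟩ := hy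
        exact h 0 le_rfl (by simpa using hs)
      | succ m =>
        obtain ⟨q, -, h⟩ := hy
        exact Set.disjoint_left.1 h (left_mem_segment ℝ _ _) hs
    · exact hex m hm _ (hscale c h0 h1) hy
  have hline : ∀ {t : ℝ} {d : ℝ × ℝ}, 0 < t → d ≠ 0 → z + t • d ∈ segment ℝ (p s) z →
      ∃ c : ℝ, 0 < c ∧ p s = z + c • d := by
    intro t d ht hd h
    obtain ⟨τ, -, h1, h2⟩ := mem_seg_smul.1 h
    have h3 : (1 - τ) • (p s - z) = t • d := by
      rw [eq_sub_of_add_eq' h2]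
      module
    have h4 : 0 < 1 - τ := by
      refine (sub_nonneg.2 h1).lt_of_ne fun h => ?_
      rw [← h, zero_smul] at h3
      exact (smul_ne_zero ht.ne' hd) h3.symm
    refine ⟨t / (1 - τ), by positivity, ?_⟩
    rw [div_eq_inv_mul, mul_smul, ← h3, smul_smul, inv_mul_cancel₀ h4.ne', one_smul,
      add_sub_cancel]
  refine Extremal.of_pend hp hz ?_
  have hP := hp.pend hz
  cases n with
  | zero =>
    obtain ⟨d, hd, h⟩ := hn
    refine hP.extremal_of_ray hd fun t ht => ?_
    rw [pic_pend]
    rintro (h' | h')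
    · exact h t ht.le h'
    · obtain ⟨c, hc, h3⟩ := hline ht hd h'
      exact h c hc.le (h3 ▸ hs)
  | succ k =>
    obtain ⟨g, hg, h⟩ := hn
    have hgz : g - z ≠ 0 := sub_ne_zero.2 fun he => hex k k.lt_succ_self z hz (he ▸ hg)
    refine ih k k.lt_succ_self hP (z := g) (fun t h0 h1 => ?_) ?_
    · rw [pic_pend]
      change z + t • (g - z) ∉ _
      rintro (h' | h')
      · exact Set.disjoint_left.1 h (mem_seg_smul.2 ⟨t, h0.le, h1, rfl⟩) h'
      · obtain ⟨c, hc, h3⟩ := hline h0 hgz h'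
        rcases le_or_gt c 1 with h4 | h4
        · exact Set.disjoint_left.1 h (mem_seg_smul.2 ⟨c, hc.le, h4, h3⟩) hs
        · refine hex k k.lt_succ_self g ?_ hg
          have h5 : c⁻¹ < 1 := inv_lt_one_of_one_lt₀ h4
          have := hscale (1 - c⁻¹) (by linarith) (by linarith [inv_pos.2 hc])
          have e : c⁻¹ • (p s - z) = g - z := by
            rw [h3, add_sub_cancel_left, smul_smul, inv_mul_cancel₀ hc.ne', one_smul]
          convert this using 1
          rw [sub_eq_iff_eq_add.1 e.symm]
          module
    · rw [pic_pend]
      exact reach_union hne k k.lt_succ_self hg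

theorem Good.extremal_of_outer [Finite V] (hp : Good G p) {s : V} (h : p s ∈ closure
    {x | x ∉ pic G p ∧ ¬Bornology.IsBounded (connectedComponentIn (pic G p)ᶜ x)}) :
    Extremal G p s := by
  obtain ⟨z, hz, hs⟩ := exists_sees_of_closure hp.toPlain (fun _ h => h.1) h
  obtain ⟨k, hk⟩ := exists_reach isCompact_pic hz.1 hz.2
  exact hp.extremal_of_sees k hs hk

end Reach

open Set Filter Topology

section Regions

theorem subset_outerRegion {A C : Set (ℝ × ℝ)} (hC : IsPreconnected C) (hA : Disjoint C A)
    (hu : ¬Bornology.IsBounded C) : C ⊆ outerRegion A := fun _ hx =>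
  ⟨Set.disjoint_left.1 hA hx, fun h => hu (h.subset
    (hC.subset_connectedComponentIn hx (Set.subset_compl_iff_disjoint_right.2 hA)))⟩

theorem subset_outerRegion_of_mem {A C : Set (ℝ × ℝ)} {x : ℝ × ℝ} (hC : IsPreconnected C)
    (hA : Disjoint C A) (hx : x ∈ C) (hxA : x ∈ outerRegion A) : C ⊆ outerRegion A := fun _ hy =>
  ⟨Set.disjoint_left.1 hA hy, connectedComponentIn_eq (hC.subset_connectedComponentIn hx
    (Set.subset_compl_iff_disjoint_right.2 hA) hy) ▸ hxA.2⟩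

theorem outerRegion_anti {A B : Set (ℝ × ℝ)} (h : A ⊆ B) : outerRegion B ⊆ outerRegion A :=
  fun x hx => ⟨fun hA => hx.1 (h hA), fun hb => hx.2 (hb.subset
    (connectedComponentIn_mono x (Set.compl_subset_compl.2 h)))⟩

/-- The segment from `x` to `z` without `x`. -/
def tail (x z : ℝ × ℝ) : Set (ℝ × ℝ) := (fun t : ℝ => x + t • (z - x)) '' Set.Ioc 0 1

theorem right_mem_tail (x z : ℝ × ℝ) : z ∈ tail x z := ⟨1, by simp, by simp⟩

theorem tail_subset (x z : ℝ × ℝ) : tail x z ⊆ segment ℝ x z := by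
  rintro _ ⟨t, ht, rfl⟩
  exact mem_seg_smul.2 ⟨t, ht.1.le, ht.2, rfl⟩

theorem isPreconnected_tail (x z : ℝ × ℝ) : IsPreconnected (tail x z) :=
  isPreconnected_Ioc.image _ (by fun_prop)

theorem mem_closure_tail (x z : ℝ × ℝ) : x ∈ closure (tail x z) := by
  refine image_closure_subset_closure_image (by fun_prop) ⟨0, ?_, by simp⟩
  rw [closure_Ioc zero_ne_one]
  simp

theorem exists_escape {A : Set (ℝ × ℝ)} : ∀ {k : ℕ} {q : ℝ × ℝ}, q ∈ Reach A k →
    ∃ Γ, IsClosed Γ ∧ IsPreconnected Γ ∧ ¬Bornology.IsBounded Γ ∧ q ∈ Γ ∧ Disjoint Γ A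
  | 0, q, ⟨d, hd, h⟩ => by
    have hf : IsClosedEmbedding fun t : ℝ => q + t • d :=
      (Homeomorph.addLeft q).isClosedEmbedding.comp (isClosedEmbedding_smul_left hd)
    refine ⟨_, hf.isClosedMap _ (isClosed_Ici (a := (0 : ℝ))),
      isPreconnected_Ici.image _ hf.continuous.continuousOn, fun hb => ?_, ⟨0, by simp⟩, ?_⟩
    · have := (Metric.isCompact_of_isClosed_isBounded
        (hf.isClosedMap _ (isClosed_Ici (a := (0 : ℝ)))) hb)
      rw [← hf.isInducing.isCompact_iff] at this
      exact not_bddAbove_Ici 0 this.bddAbove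
    · grind
  | k + 1, q, ⟨q', hq', h⟩ => by
    obtain ⟨Γ, h1, h2, h3, h4, h5⟩ := exists_escape hq'
    exact ⟨segment ℝ q q' ∪ Γ, (isCompact_seg q q').isClosed.union h1,
      (convex_segment q q').isPreconnected.union q' (right_mem_segment ℝ _ _) h4 h2,
      fun hb => h3 (hb.subset Set.subset_union_right), .inl (left_mem_segment ℝ _ _),
      Set.disjoint_union_left.2 ⟨h, h5⟩⟩

theorem mem_closure_outerRegion {A Γ : Set (ℝ × ℝ)} {x z : ℝ × ℝ} (hz : Disjoint (tail x z) A)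
    (h1 : IsPreconnected Γ) (h2 : ¬Bornology.IsBounded Γ) (h3 : z ∈ Γ) (h4 : Disjoint Γ A) :
    x ∈ closure (outerRegion A) :=
  closure_mono (Set.subset_union_left.trans (subset_outerRegion
    ((isPreconnected_tail x z).union z (right_mem_tail x z) h3 h1)
    (Set.disjoint_union_left.2 ⟨hz, h4⟩)
    fun hb => h2 (hb.subset Set.subset_union_right))) (mem_closure_tail x z)

end Regions

section Drawings
variable {V : Type*} {G : SimpleGraph V}

theorem Drawing.image_eq {D : Drawing G} (hg : D.IsGeometric) : D.image = pic G D.pos := by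
  refine congrArg (Set.range D.pos ∪ ·) (Set.ext fun z => ?_)
  simp only [Set.mem_iUnion, Set.mem_ofPred_eq, exists_prop]
  constructor
  · rintro ⟨⟨u, v⟩, h, hz⟩
    exact ⟨u, v, h, hg u v h ▸ hz⟩
  · rintro ⟨u, v, h, hz⟩
    exact ⟨s(u, v), h, hg u v h ▸ hz⟩

theorem Drawing.cr_iff {D : Drawing G} (hg : D.IsGeometric) {a b c d : V} :
    Cr G D.pos a b c d ↔ ∃ z, D.Crosses s(a, b) s(c, d) z := by
  constructor
  · rintro ⟨h1, h2, h3, z, h4, h5, h6⟩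
    exact ⟨z, h1, h2, h3, hg a b h1 ▸ h4, hg c d h2 ▸ h5, h6⟩
  · rintro ⟨z, h1, h2, h3, h4, h5, h6⟩
    exact ⟨h1, h2, h3, z, hg a b h1 ▸ h4, hg c d h2 ▸ h5, h6⟩

theorem Drawing.good {D : Drawing G} (hg : D.IsGeometric) (h : D.IsOnePlanar) : Good G D.pos where
  inj := D.pos_inj
  off u v w huv hw := Sym2.mem_iff.1 (D.arc_avoid s(u, v) huv w (hg u v huv ▸ hw))
  one a b c d c' d' h1 h2 := by
    obtain ⟨z, hz⟩ := (Drawing.cr_iff hg).1 h1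
    obtain ⟨z', hz'⟩ := (Drawing.cr_iff hg).1 h2
    exact (h.1 _ _ _ _ _ hz hz').1
  adj a b c d h1 := by
    obtain ⟨z, hz⟩ := (Drawing.cr_iff hg).1 h1
    have ha := h.2 _ _ _ hz a (by simp)
    have hb := h.2 _ _ _ hz b (by simp)
    grind

theorem isArc_segment {x y : ℝ × ℝ} (h : x ≠ y) : IsArc (segment ℝ x y) x y := by
  refine ⟨fun t => AffineMap.lineMap x y (t : ℝ), by fun_prop,
    (AffineMap.lineMap_injective ℝ h).comp Subtype.val_injective, by simp, by simp, ?_⟩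
  rw [segment_eq_image_lineMap]
  aesop

theorem Good.exists_drawing [Finite V] {p : V → ℝ × ℝ} (hp : Good G p) :
    ∃ D : Drawing G, D.pos = p ∧ D.IsGeometric ∧ D.IsOnePlanar := by
  let D : Drawing G :=
    { pos := p
      pos_inj := hp.inj
      arc := Sym2.lift ⟨fun u v => segment ℝ (p u) (p v), fun u v => segment_symm ℝ _ _⟩
      arc_curve := by
        rintro _ he u v rfl
        exact isArc_segment (hp.inj.ne (SimpleGraph.Adj.ne he))
      arc_avoid := by
        rintro ⟨u, v⟩ he w hw
        exact Sym2.mem_iff.2 (hp.off u v w he hw)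
      arc_finite_inter := by
        rintro ⟨a, b⟩ h1 ⟨c, d⟩ h2 hne
        refine ((Set.finite_range p).union (Set.Subsingleton.finite (s :=
          (segment ℝ (p a) (p b) ∩ segment ℝ (p c) (p d)) \ Set.range p) ?_)).subset
          fun z hz => or_iff_not_imp_left.2 fun hn => ⟨hz, hn⟩
        exact fun z hz z' hz' => hp.cross_unique h1 h2 hne hz.1.1 hz.1.2 hz.2 hz'.1.1 hz'.1.2 }
  have hg : D.IsGeometric := fun u v _ => rfl
  refine ⟨D, rfl, hg, ?_, ?_⟩
  · rintro ⟨a, b⟩ ⟨c, d⟩ ⟨c', d'⟩ z z' h h'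
    have he := hp.one a b c d c' d' ((Drawing.cr_iff hg).2 ⟨z, h⟩) ((Drawing.cr_iff hg).2 ⟨z', h'⟩)
    refine ⟨he, ?_⟩
    change D.Crosses s(a, b) s(c', d') z' at h'
    rw [← he] at h'
    exact hp.cross_unique h.1 h.2.1 h.2.2.1 h.2.2.2.1 h.2.2.2.2.1 h.2.2.2.2.2 h'.2.2.2.1
      h'.2.2.2.2.1
  · rintro ⟨a, b⟩ ⟨c, d⟩ z h v hv hv'
    obtain ⟨h1, h2, h3, h4⟩ := hp.adj a b c d ((Drawing.cr_iff hg).2 ⟨z, h⟩)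
    grind

/-- All crossings have a type in `S`. -/
def Typed (G : SimpleGraph V) (S : Set CrossingType) (p : V → ℝ × ℝ) : Prop :=
  ∀ a b c d, Cr G p a b c d → ∃ t ∈ S, HasCrossingType G a b c d t

theorem oGeoSRestricted_iff [Finite V] {S : Set CrossingType} {O : Set V} :
    OGeoSRestricted G S O ↔ ∃ p, Good G p ∧ Typed G S p ∧
      ∀ v ∈ O, p v ∈ closure (outerRegion (pic G p)) := by
  constructor
  · rintro ⟨D, hg, ⟨h1, h2⟩, h3⟩
    refine ⟨D.pos, Drawing.good hg h1, fun a b c d h => ?_, fun v hv =>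
      Drawing.image_eq hg ▸ h3 v hv⟩
    grind [Drawing.cr_iff]
  · rintro ⟨p, h1, h2, h3⟩
    obtain ⟨D, rfl, hg, h⟩ := h1.exists_drawing
    refine ⟨D, hg, ⟨h, fun a b c d z hz => h2 a b c d ((Drawing.cr_iff hg).2 ⟨z, hz⟩)⟩,
      fun v hv => ?_⟩
    grind [Drawing.OnOuterFace, Drawing.image_eq]

theorem HasCrossingType.cycle {a b c d : V} {t : CrossingType} (h : HasCrossingType G a b c d t)
    (ht : t ∈ goodTypes) : (G.Adj a c ∧ G.Adj b d) ∨ (G.Adj a d ∧ G.Adj b c) := by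
  rcases ht with rfl | rfl | rfl <;> simp only [HasCrossingType] at h <;> tauto

theorem exists_outer [Finite V] [Nonempty V] (p : V → ℝ × ℝ) :
    ∃ v, p v ∈ closure (outerRegion (pic G p)) := by
  obtain ⟨v, hv⟩ := Finite.exists_max fun v => (p v).1
  have hle : ∀ y ∈ pic G p, y.1 ≤ (p v).1 := by
    rintro y (⟨w, rfl⟩ | ⟨u, w, -, hy⟩)
    · exact hv w
    · exact (convex_halfSpace_le (LinearMap.fst ℝ ℝ ℝ).isLinear (p v).1).segment_subset
        (hv u) (hv w) hy
  have hesc : p v + (1, 0) ∈ Reach (pic G p) 0 := ⟨(1, 0), by simp, fun t ht hy => by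
    have := hle _ hy
    simp at this
    linarith⟩
  obtain ⟨Γ, -, h1, h2, h3, h4⟩ := exists_escape hesc
  refine ⟨v, mem_closure_outerRegion (Set.disjoint_left.2 ?_) h1 h2 h3 h4⟩
  rintro _ ⟨t, ht, rfl⟩ hy
  have := hle _ hy
  simp at this
  linarith [ht.1]

end Drawings

section Split
variable {V : Type*} {G : SimpleGraph V} {s : V} {X₁ X₂ : Set V}

/-- Two sides covering all vertices and edges and sharing only `s`. -/
structure Split (G : SimpleGraph V) (s : V) (X₁ X₂ : Set V) : Prop where
  left : s ∈ X₁
  right : s ∈ X₂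
  cover : ∀ v, v ∈ X₁ ∨ v ∈ X₂
  eq : ∀ v, v ∈ X₁ → v ∈ X₂ → v = s
  edge : ∀ u v, G.Adj u v → (u ∈ X₁ ∧ v ∈ X₁) ∨ (u ∈ X₂ ∧ v ∈ X₂)

theorem Split.symm (h : Split G s X₁ X₂) : Split G s X₂ X₁ :=
  ⟨h.right, h.left, fun v => (h.cover v).symm, fun v h1 h2 => h.eq v h2 h1,
    fun u v huv => (h.edge u v huv).symm⟩

theorem Split.not_both (h : Split G s X₁ X₂) {u v : V} (huv : G.Adj u v) (hu : u ∈ X₁)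
    (hv : v ∈ X₁) (hu' : u ∈ X₂) (hv' : v ∈ X₂) : False :=
  huv.ne ((h.eq u hu hu').trans (h.eq v hv hv').symm)

theorem IsSeparation.split (h : IsSeparation G {s} X₁ X₂) : Split G s X₁ X₂ := by
  obtain ⟨h1, h2, -, -, h3⟩ := h
  have hs : s ∈ X₁ ∩ X₂ := h2 ▸ rfl
  have hc : ∀ v, v ∈ X₁ ∨ v ∈ X₂ := fun v => (h1 ▸ Set.mem_univ v : v ∈ X₁ ∪ X₂)
  have heq : ∀ v, v ∈ X₁ → v ∈ X₂ → v = s := fun v hv hv' => (h2 ▸ ⟨hv, hv'⟩ : v ∈ ({s} : Set V))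
  have hno : ∀ u v, u ∈ X₁ \ {s} → v ∈ X₂ \ {s} → ¬G.Adj u v := by
    intro u v hu hv huv
    obtain ⟨w, rfl, hw⟩ := h3 u hu v hv huv.toWalk
    aesop
  refine ⟨hs.1, hs.2, hc, heq, fun u v huv => ?_⟩
  have h4 := hno u v
  have h5 := hno v u
  have h6 := huv.symm
  grind

theorem Plain.comap {p : V → ℝ × ℝ} (hp : Plain G p) (X : Set V) :
    Plain (G.induce X) (fun v => p v) :=
  ⟨fun _ _ h => Subtype.ext (hp.inj h), fun u v w h hw =>
    (hp.off u v w h hw).imp Subtype.ext Subtype.ext⟩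

theorem Plain.cr_induce {p : V → ℝ × ℝ} (hp : Plain G p) {X : Set V} {a b c d : X}
    (h : Cr (G.induce X) (fun v => p v) a b c d) : Cr G p a b c d := by
  obtain ⟨h1, h2, h3, z, h4, h5, h6⟩ := h
  refine ⟨h1, h2, fun he => h3 (Sym2.map.injective Subtype.val_injective he), z, h4, h5, ?_⟩
  rintro ⟨w, rfl⟩
  rcases hp.off _ _ _ h1 h4 with rfl | rfl
  exacts [h6 ⟨a, rfl⟩, h6 ⟨b, rfl⟩]

theorem Good.comap {p : V → ℝ × ℝ} (hp : Good G p) (X : Set V) :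
    Good (G.induce X) (fun v => p v) where
  toPlain := hp.toPlain.comap X
  one _ _ _ _ _ _ h h' := Sym2.map.injective Subtype.val_injective
    (hp.one _ _ _ _ _ _ (hp.cr_induce h) (hp.cr_induce h'))
  adj a b c d h := by simpa [Subtype.ext_iff] using hp.adj _ _ _ _ (hp.cr_induce h)

theorem Typed.comap {p : V → ℝ × ℝ} {S : Set CrossingType} (h : Typed G S p) (hp : Plain G p)
    (X : Set V) : Typed (G.induce X) S (fun v => p v) := fun _ _ _ _ hc => by
  obtain ⟨t, ht, h'⟩ := h _ _ _ _ (hp.cr_induce hc)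
  exact ⟨t, ht, by cases t <;> exact h'⟩

theorem pic_induce_subset (p : V → ℝ × ℝ) (X : Set V) :
    pic (G.induce X) (fun v => p v) ⊆ pic G p := by
  rintro z (⟨v, rfl⟩ | ⟨u, v, h, hz⟩)
  exacts [.inl ⟨v, rfl⟩, .inr ⟨u, v, h, hz⟩]

variable {S : Set CrossingType}

theorem Split.side_of_cr (sp : Split G s X₁ X₂) (hS : S ⊆ goodTypes) {p : V → ℝ × ℝ}
    (hp : Good G p) (ht : Typed G S p) {a b c d : V} (h : Cr G p a b c d) :
    (a ∈ X₁ ∧ b ∈ X₁ ∧ c ∈ X₁ ∧ d ∈ X₁) ∨ (a ∈ X₂ ∧ b ∈ X₂ ∧ c ∈ X₂ ∧ d ∈ X₂) := by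
  obtain ⟨t, htS, h'⟩ := ht _ _ _ _ h
  have h1 := h'.cycle (hS htS)
  have h2 := hp.adj _ _ _ _ h
  have h3 := h.1
  have h4 := h.2.1
  have h5 := h3.ne
  have h6 := h4.ne
  have h7 := sp.edge
  have h8 := sp.eq
  clear h h' htS hp ht
  grind

theorem Split.disjoint_pic (sp : Split G s X₁ X₂) (hS : S ⊆ goodTypes) {p : V → ℝ × ℝ}
    (hp : Good G p) (ht : Typed G S p) {u v : V} (huv : G.Adj u v) (hu : u ∈ X₁) (hv : v ∈ X₁)
    {y : ℝ × ℝ} (hy : y ∈ segment ℝ (p u) (p v)) (hys : y ≠ p s) :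
    y ∉ pic (G.induce X₂) (fun v => p v) := by
  have hvert : ∀ w ∈ X₂, y ≠ p w := by grind [hp.off, sp.eq]
  rintro (⟨w, rfl⟩ | ⟨c, d, hcd, hz⟩)
  · exact hvert w w.2 rfl
  · by_cases hr : y ∈ Set.range p
    · obtain ⟨w, rfl⟩ := hr
      rcases hp.off _ _ _ hcd hz with rfl | rfl
      exacts [hvert _ c.2 rfl, hvert _ d.2 rfl]
    have hne : s(u, v) ≠ s((c : V), (d : V)) := fun he => by
      rcases Sym2.eq_iff.1 he with ⟨rfl, rfl⟩ | ⟨rfl, rfl⟩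
      exacts [sp.not_both huv hu hv c.2 d.2, sp.not_both huv hu hv d.2 c.2]
    rcases sp.side_of_cr hS hp ht ⟨huv, hcd, hne, y, hy, hz, hr⟩ with ⟨-, -, h1, h2⟩ | ⟨h1, h2, -⟩
    exacts [sp.not_both hcd h1 h2 c.2 d.2, sp.not_both huv hu hv h1 h2]

theorem Split.outer_of_walk (sp : Split G s X₁ X₂) (hS : S ⊆ goodTypes) {p : V → ℝ × ℝ}
    (hp : Good G p) (ht : Typed G S p) {u w : V} (W : G.Walk u w) (hw : w = s) (hu : u ∈ X₁)
    (hus : u ≠ s) (ho : p u ∈ outerRegion (pic (G.induce X₂) (fun v => p v))) :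
    p s ∈ closure (outerRegion (pic (G.induce X₂) (fun v => p v))) := by
  induction W with
  | nil => exact (hus hw).elim
  | @cons u v w huv W ih =>
    have hv : v ∈ X₁ := (sp.edge u v huv).elim (·.2) fun h => (hus (sp.eq u hu h.1)).elim
    by_cases hvs : v = s
    · subst hvs
      refine closure_mono (subset_outerRegion_of_mem (isPreconnected_tail (p v) (p u))
        (Set.disjoint_left.2 ?_) (right_mem_tail _ _) ho) (mem_closure_tail (p v) (p u))
      intro y hy
      refine sp.disjoint_pic hS hp ht huv.symm hv hu (tail_subset _ _ hy) ?_
      rintro rfl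
      obtain ⟨t, h0, h1⟩ := hy
      simp only [add_eq_left, smul_eq_zero, sub_eq_zero] at h1
      exact h1.elim h0.1.ne' fun h => hus (hp.inj h)
    · refine ih hw hv hvs (subset_outerRegion_of_mem (convex_segment (p u) (p v)).isPreconnected
        (Set.disjoint_left.2 fun y hy => sp.disjoint_pic hS hp ht huv hu hv hy ?_)
        (left_mem_segment ℝ _ _) ho (right_mem_segment ℝ _ _))
      grind [hp.off]

theorem Split.forward [Finite V] (sp : Split G s X₁ X₂) (hS : S ⊆ goodTypes) (hconn : G.Connected)
    {p : V → ℝ × ℝ} (hp : Good G p) (ht : Typed G S p) {v : V} (hv : v ∈ X₁)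
    (ho : p v ∈ closure (outerRegion (pic G p))) {O : Set V} (hO : O ⊆ {v}) :
    OGeoSRestricted (G.induce X₁) S {v : X₁ | (v : V) ∈ O} ∧
      OGeoSRestricted (G.induce X₂) S {v : X₂ | (v : V) = s} := by
  have hsub : ∀ X, p v ∈ closure (outerRegion (pic (G.induce X) (fun v => p v))) := fun X =>
    closure_mono (outerRegion_anti (pic_induce_subset p X)) ho
  refine ⟨oGeoSRestricted_iff.2 ⟨_, hp.comap X₁, ht.comap hp.toPlain X₁, ?_⟩,
    oGeoSRestricted_iff.2 ⟨_, hp.comap X₂, ht.comap hp.toPlain X₂, ?_⟩⟩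
  · rintro ⟨w, hw⟩ hwO
    obtain rfl := hO hwO
    exact hsub X₁
  · rintro ⟨w, hw⟩ rfl
    by_cases hvw : v = w
    · exact hvw ▸ hsub X₂
    have hn : p v ∉ pic (G.induce X₂) (fun v => p v) := by
      rintro (⟨u, hu⟩ | ⟨c, d, hcd, hz⟩)
      · grind [sp.eq, hp.inj]
      · rcases hp.off _ _ _ hcd hz with rfl | rfl
        exacts [hvw (sp.eq _ hv c.2), hvw (sp.eq _ hv d.2)]
    refine sp.outer_of_walk hS hp ht (hconn.preconnected v w).some rfl hv hvw ?_
    obtain ⟨r, hr, hb⟩ := Metric.isOpen_iff.1 (isCompact_pic (G := G.induce X₂)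
      (p := fun v => p v)).isClosed.isOpen_compl _ hn
    obtain ⟨y, hy, hyr⟩ := Metric.mem_closure_iff.1 (hsub X₂) r hr
    exact subset_outerRegion_of_mem (convex_ball _ r).isPreconnected
      (Set.subset_compl_iff_disjoint_right.1 hb) (Metric.mem_ball'.2 hyr) hy
      (Metric.mem_ball_self hr)

end Split

open Set Filter Topology

section Glue
variable {V : Type*} {G : SimpleGraph V} {s : V} {X₁ X₂ : Set V} {S : Set CrossingType}

theorem Split.cr_glue (sp : Split G s X₁ X₂) {P : V → ℝ × ℝ}
    (hd : ∀ z ∈ pic (G.induce X₁) (fun v => P v), z ∈ pic (G.induce X₂) (fun v => P v) → z = P s)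
    {a b c d : V} (h : Cr G P a b c d) :
    (∃ a' b' c' d' : X₁, a = a' ∧ b = b' ∧ c = c' ∧ d = d' ∧
      Cr (G.induce X₁) (fun v => P v) a' b' c' d') ∨
    ∃ a' b' c' d' : X₂, a = a' ∧ b = b' ∧ c = c' ∧ d = d' ∧
      Cr (G.induce X₂) (fun v => P v) a' b' c' d' := by
  obtain ⟨h1, h2, h3, z, h4, h5, h6⟩ := h
  have same : ∀ X : Set V, ∀ ha : a ∈ X, ∀ hb : b ∈ X, ∀ hc : c ∈ X, ∀ hd : d ∈ X,
      Cr (G.induce X) (fun v => P v) ⟨a, ha⟩ ⟨b, hb⟩ ⟨c, hc⟩ ⟨d, hd⟩ := fun X ha hb hc hd =>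
    ⟨h1, h2, fun he => h3 (congrArg (Sym2.map Subtype.val) he), z, h4, h5,
      fun ⟨v, hv⟩ => h6 ⟨v, hv⟩⟩
  have mixed : ∀ {a b c d : V}, G.Adj a b → G.Adj c d → z ∈ segment ℝ (P a) (P b) →
      z ∈ segment ℝ (P c) (P d) → a ∈ X₁ → b ∈ X₁ → c ∈ X₂ → d ∈ X₂ → False :=
    fun {a b c d} h1 h2 h4 h5 ha hb hc hd' => h6 ⟨s, (hd z (.inr ⟨⟨a, ha⟩, ⟨b, hb⟩, h1, h4⟩)
      (.inr ⟨⟨c, hc⟩, ⟨d, hd'⟩, h2, h5⟩)).symm⟩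
  rcases sp.edge a b h1 with ⟨ha, hb⟩ | ⟨ha, hb⟩ <;> rcases sp.edge c d h2 with ⟨hc, hd⟩ | ⟨hc, hd⟩
  · grind
  · grind
  · grind
  · grind

theorem Split.good_glue (sp : Split G s X₁ X₂) {P : V → ℝ × ℝ}
    (h1 : Good (G.induce X₁) (fun v => P v)) (h2 : Good (G.induce X₂) (fun v => P v))
    (hd : ∀ z ∈ pic (G.induce X₁) (fun v => P v), z ∈ pic (G.induce X₂) (fun v => P v) → z = P s) :
    Good G P := by
  have hs : ∀ {v}, P v = P s → v = s := fun {v} hv => by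
    rcases sp.cover v with h | h
    · exact congrArg Subtype.val (@h1.inj ⟨v, h⟩ ⟨s, sp.left⟩ hv)
    · exact congrArg Subtype.val (@h2.inj ⟨v, h⟩ ⟨s, sp.right⟩ hv)
  have hoff : ∀ {X : Set V}, Good (G.induce X) (fun v => P v) → s ∈ X →
      (∀ w z, w ∉ X → z ∈ pic (G.induce X) (fun v => P v) → z = P w → z = P s) →
      ∀ u v w, u ∈ X → v ∈ X → G.Adj u v → P w ∈ segment ℝ (P u) (P v) → w = u ∨ w = v := by
    intro X hX hsX hz u v w hu hv huv hw
    have hwX : w ∈ X := by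
      by_contra hwX
      exact hwX (hs (hz w _ hwX (.inr ⟨⟨u, hu⟩, ⟨v, hv⟩, huv, hw⟩) rfl) ▸ hsX)
    exact (hX.off ⟨u, hu⟩ ⟨v, hv⟩ ⟨w, hwX⟩ huv hw).imp (congrArg Subtype.val)
      (congrArg Subtype.val)
  refine ⟨⟨fun u v huv => ?_, fun u v w huv hw => ?_⟩, fun a b c d c' d' h h' => ?_,
    fun a b c d h => ?_⟩
  · have key : ∀ u v, P u = P v → u ∈ X₁ → v ∈ X₂ → u = v := fun u v huv hu hv => by
      have := hd (P u) (.inl ⟨⟨u, hu⟩, rfl⟩) (.inl ⟨⟨v, hv⟩, huv.symm⟩)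
      exact (hs this).trans (hs (huv ▸ this)).symm
    rcases sp.cover u with hu | hu <;> rcases sp.cover v with hv | hv
    · exact congrArg Subtype.val (@h1.inj ⟨u, hu⟩ ⟨v, hv⟩ huv)
    · exact key u v huv hu hv
    · exact (key v u huv.symm hv hu).symm
    · exact congrArg Subtype.val (@h2.inj ⟨u, hu⟩ ⟨v, hv⟩ huv)
  · rcases sp.edge u v huv with ⟨hu, hv⟩ | ⟨hu, hv⟩
    · exact hoff h1 sp.left (fun w z hwX hz hzw => hd z hz (.inl
        ⟨⟨w, (sp.cover w).resolve_left hwX⟩, hzw.symm⟩)) u v w hu hv huv hw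
    · exact hoff h2 sp.right (fun w z hwX hz hzw => hd z (.inl
        ⟨⟨w, (sp.cover w).resolve_right hwX⟩, hzw.symm⟩) hz) u v w hu hv huv hw
  · have hab := h.1
    rcases sp.cr_glue hd h with ⟨a, b, c, d, rfl, rfl, rfl, rfl, k⟩ | ⟨a, b, c, d, rfl, rfl, rfl,
        rfl, k⟩ <;>
    rcases sp.cr_glue hd h' with ⟨a', b', c', d', e1, e2, rfl, rfl, k'⟩ |
      ⟨a', b', c', d', e1, e2, rfl, rfl, k'⟩
    · obtain rfl := Subtype.ext e1
      obtain rfl := Subtype.ext e2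
      exact congrArg (Sym2.map Subtype.val) (h1.one _ _ _ _ _ _ k k')
    · grind [sp.not_both]
    · grind [sp.symm.not_both]
    · obtain rfl := Subtype.ext e1
      obtain rfl := Subtype.ext e2
      exact congrArg (Sym2.map Subtype.val) (h2.one _ _ _ _ _ _ k k')
  · grind [sp.cr_glue, h1.adj, h2.adj]

/-- A placement with a strictly extreme point can be squeezed at that point into a convex set
close to `x` that avoids finitely many lines through `x`. -/
theorem exists_squeeze {W : Type*} [Finite W] {q : W → ℝ × ℝ} {s : W} {φ : ℝ × ℝ →ₗ[ℝ] ℝ}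
    (hφ : ∀ w, w ≠ s → φ (q s) < φ (q w)) (hW : ∃ w, w ≠ s) (x : ℝ × ℝ) {D : Set (ℝ × ℝ)}
    (hD : D.Finite) {r : ℝ} (hr : 0 < r) : ∃ E : ℝ × ℝ →ᵃ[ℝ] ℝ × ℝ, Function.Injective E ∧
      E (q s) = x ∧ ∃ T, Convex ℝ T ∧ (∀ w, E (q w) ∈ T) ∧ T ⊆ Metric.ball x r ∧
        ∀ y ∈ T, y ≠ x → ∀ d ∈ D, ∀ t : ℝ, y ≠ x + t • d := by
  obtain ⟨a, ha⟩ : ∃ a, a ∉ (fun d : ℝ × ℝ => d.2 / d.1) '' D := (hD.image _).exists_notMem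
  obtain ⟨δ, hδ, hb⟩ := Metric.isOpen_iff.1 (hD.image _).isClosed.isOpen_compl a ha
  set α := φ (1, 0) with hα
  set β := φ (0, 1) with hβ
  have hφe : ∀ z, φ z = α * z.1 + β * z.2 := fun z => by
    have : z = z.1 • ((1, 0) : ℝ × ℝ) + z.2 • ((0, 1) : ℝ × ℝ) := by ext <;> simp
    grind [map_smul, smul_eq_mul]
  have hαβ : 0 < α ^ 2 + β ^ 2 := by
    obtain ⟨w, hw⟩ := hW
    have := hφ w hw
    rw [hφe, hφe] at this
    by_contra hn
    have h1 : α = 0 := by nlinarith [sq_nonneg α, sq_nonneg β]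
    have h2 : β = 0 := by nlinarith [sq_nonneg α, sq_nonneg β]
    simp [h1, h2] at this
  let ψ : ℝ × ℝ → ℝ := fun z => α * z.2 - β * z.1
  have small : ∀ f : W → ℝ, ∀ g : W → ℝ, (∀ w, w = s ∧ f w = 0 ∧ 0 ≤ g w ∨ 0 < g w) →
      ∃ ε > 0, ∀ w, |ε * f w| ≤ g w := by
    intro f g h
    have : ∀ᶠ ε : ℝ in 𝓝[>] 0, ∀ w, |ε * f w| ≤ g w := by
      refine eventually_all.2 fun w => ?_
      rcases h w with ⟨-, h1, h2⟩ | h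
      · simp [h1, h2]
      · have ht : Tendsto (fun ε : ℝ => |ε * f w|) (𝓝[>] 0) (𝓝 0) :=
          ((by fun_prop : Continuous fun ε : ℝ => |ε * f w|).tendsto' 0 0 (by simp)).mono_left
            nhdsWithin_le_nhds
        exact (ht.eventually_lt_const h).mono fun _ h => h.le
    obtain ⟨ε, h1, h2⟩ := (this.and self_mem_nhdsWithin).exists
    exact ⟨ε, h2, h1⟩
  obtain ⟨ε, hε, hε'⟩ := small (fun w => ψ (q w - q s)) (fun w => δ / 2 * φ (q w - q s)) fun w => by
    by_cases hw : w = s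
    · simp [hw, ψ]
    · right
      have := hφ w hw
      rw [map_sub]
      nlinarith
  let M : ℝ × ℝ → ℝ × ℝ := fun z => (φ z, a * φ z + ε * ψ z)
  obtain ⟨μ, hμ, hμ'⟩ := small (fun w => ‖M (q w - q s)‖) (fun _ => r / 2) fun _ => .inr (by positivity)
  let L : ℝ × ℝ →ₗ[ℝ] ℝ × ℝ :=
    { toFun := fun z => μ • M z
      map_add' := fun z z' => by
        ext <;> simp [M, ψ] <;> ring
      map_smul' := fun c z => by
        ext <;> simp [M, ψ] <;> ring }
  have hL : ∀ z, L z = μ • M z := fun z => rfl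
  have hLinj : Function.Injective L := (injective_iff_map_eq_zero L).2 fun z hz => by
    rw [hL, smul_eq_zero, or_iff_right hμ.ne', Prod.ext_iff] at hz
    grind [Prod.fst_zero, Prod.snd_zero, Prod.ext, hαβ.ne']
  refine ⟨L.toAffineMap + AffineMap.const ℝ _ (x - L (q s)), fun z z' h => hLinj (by simpa using h),
    by simp, {y | |y.2 - x.2 - a * (y.1 - x.1)| ≤ δ / 2 * (y.1 - x.1)} ∩ Metric.ball x r,
    ?_, fun w => ⟨?_, ?_⟩, Set.inter_subset_right, ?_⟩
  · refine Convex.inter ?_ (convex_ball x r)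
    intro y hy z hz c d hc hd hcd
    simp only [Set.mem_ofPred_eq, Prod.snd_add, Prod.smul_snd, Prod.fst_add, Prod.smul_fst,
      smul_eq_mul, abs_le] at hy hz ⊢
    obtain rfl : d = 1 - c := by linarith
    constructor <;> nlinarith
  · have h1 : μ * |ε * ψ (q w - q s)| ≤ μ * _ := mul_le_mul_of_nonneg_left (hε' w) hμ.le
    have h2 : L (q w) + (x - L (q s)) - x = μ • M (q w - q s) := by
      rw [← hL, map_sub]
      abel
    simp only [Prod.ext_iff, Prod.fst_sub, Prod.snd_sub, Prod.smul_fst, Prod.smul_snd,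
      smul_eq_mul, M] at h2
    simp only [Set.mem_ofPred_eq, AffineMap.coe_add, AffineMap.coe_const, Pi.add_apply,
      LinearMap.coe_toAffineMap, Function.const_apply]
    rw [h2.1, h2.2, show μ * (a * φ (q w - q s) + ε * ψ (q w - q s)) - a * (μ * φ (q w - q s)) =
      μ * (ε * ψ (q w - q s)) by ring, abs_mul, abs_of_pos hμ]
    linarith
  · have h1 := hμ' w
    have h2 : L (q w) + (x - L (q s)) - x = μ • M (q w - q s) := by
      rw [← hL, map_sub]
      abel
    rw [Metric.mem_ball, dist_eq_norm]
    simp only [AffineMap.coe_add, AffineMap.coe_const, Pi.add_apply,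
      LinearMap.coe_toAffineMap, Function.const_apply]
    rw [h2, norm_smul, Real.norm_of_nonneg hμ.le]
    linarith [le_abs_self (μ * ‖M (q w - q s)‖)]
  · rintro y ⟨hy, -⟩ hyx d hd t rfl
    simp only [Set.mem_ofPred_eq, Prod.fst_add, Prod.snd_add, Prod.smul_fst, Prod.smul_snd,
      smul_eq_mul, add_sub_cancel_left] at hy
    have h0 : 0 ≤ t * d.1 := by nlinarith [abs_nonneg (t * d.2 - a * (t * d.1))]
    rcases h0.eq_or_lt with h0 | h0
    · rw [← h0, mul_zero, sub_zero, mul_zero] at hy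
      refine hyx ?_
      rw [add_eq_left]
      exact Prod.ext h0.symm (abs_nonpos_iff.1 hy)
    · have hd1 : d.1 ≠ 0 := by
        rintro h
        simp [h] at h0
      refine hb (a := d.2 / d.1) ?_ ⟨d, hd, rfl⟩
      have h1 : t * d.2 - a * (t * d.1) = (d.2 / d.1 - a) * (t * d.1) := by field_simp
      rw [h1, abs_mul, abs_of_pos h0, mul_le_mul_iff_of_pos_right h0] at hy
      rw [Metric.mem_ball, Real.dist_eq]
      linarith

theorem Split.backward [Finite V] (sp : Split G s X₁ X₂) (hX : (X₂ \ {s}).Nonempty) {O : Set V}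
    (hO : O.Subsingleton) (hO₁ : O ⊆ X₁)
    (h₁ : OGeoSRestricted (G.induce X₁) S {v : X₁ | (v : V) ∈ O})
    (h₂ : OGeoSRestricted (G.induce X₂) S {v : X₂ | (v : V) = s}) : OGeoSRestricted G S O := by
  obtain ⟨p, hp, tp, op⟩ := oGeoSRestricted_iff.1 h₁
  obtain ⟨p₂, hp₂, tp₂, op₂⟩ := oGeoSRestricted_iff.1 h₂
  obtain ⟨q, hq, hqc, φ, hφ⟩ := hp₂.extremal_of_outer (op₂ ⟨s, sp.right⟩ rfl)
  replace hq := hp₂.of_plain hq hqc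
  set A := pic (G.induce X₁) p with hA
  let s₁ : X₁ := ⟨s, sp.left⟩
  let s₂ : X₂ := ⟨s, sp.right⟩
  have hsA : p s₁ ∈ A := .inl ⟨s₁, rfl⟩
  obtain ⟨d, Γ, hΓ, hsΓ, hout⟩ : ∃ (d : ℝ × ℝ) (Γ : Set (ℝ × ℝ)), IsClosed Γ ∧ p s₁ ∉ Γ ∧
      ∀ T, Disjoint T Γ → (∀ y ∈ T, y ≠ p s₁ → ∀ t : ℝ, y ≠ p s₁ + t • d) →
        ∀ v : X₁, (v : V) ∈ O → p v ∈ closure (outerRegion (A ∪ T)) := by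
    by_cases hOe : ∃ v : X₁, (v : V) ∈ O
    · obtain ⟨v, hv⟩ := hOe
      obtain ⟨z, hz, hsee⟩ := exists_sees_of_closure hp.toPlain (fun _ h => h.1) (op v hv)
      obtain ⟨k, hk⟩ := exists_reach isCompact_pic hz.1 hz.2
      obtain ⟨Γ, g1, g2, g3, g4, g5⟩ := exists_escape hk
      have htail : Disjoint (tail (p v) z) A := by
        rw [Set.disjoint_left]
        rintro _ ⟨t, ht, rfl⟩
        exact hsee t ht.1 ht.2
      have fin : ∀ T, Disjoint T Γ → Disjoint (tail (p v) z) T → ∀ w : X₁, (w : V) ∈ O →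
          p w ∈ closure (outerRegion (A ∪ T)) := fun T h1 h2 w hw => by
        obtain rfl : w = v := Subtype.ext (hO hw hv)
        exact mem_closure_outerRegion (Set.disjoint_union_right.2 ⟨htail, h2⟩) g2 g3 g4
          (Set.disjoint_union_right.2 ⟨g5, h1.symm⟩)
      by_cases hvs : v = s₁
      · refine ⟨z - p v, Γ, g1, fun h => Set.disjoint_left.1 g5 h hsA, fun T h1 h2 =>
          fin T h1 (Set.disjoint_left.2 ?_)⟩
        rintro _ ⟨t, ht, rfl⟩ hy
        refine h2 _ hy ?_ t (hvs ▸ rfl)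
        exact fun h => hsee t ht.1 ht.2 ((congrArg (· ∈ A) h).mpr hsA)
      · refine ⟨0, segment ℝ (p v) z ∪ Γ, (isCompact_seg _ _).isClosed.union g1, ?_,
          fun T h1 _ => ?_⟩
        · grind [hsee.notMem_seg, hp.inj]
        · rw [Set.disjoint_union_right] at h1
          exact fin T h1.2 (h1.1.symm.mono_left (tail_subset _ _))
    · exact ⟨0, ∅, isClosed_empty, fun h => h, fun T _ _ v hv => (hOe ⟨v, hv⟩).elim⟩
  obtain ⟨r, hr, hrv, hre⟩ := exists_ball_disjoint hp.toPlain s₁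
  obtain ⟨r', hr', hrΓ⟩ := Metric.isOpen_iff.1 hΓ.isOpen_compl _ hsΓ
  obtain ⟨E, hE, hEs, T, hT, hET, hTb, hTd⟩ := exists_squeeze (s := s₂) hφ
    (by obtain ⟨w, hw, hws⟩ := hX; exact ⟨⟨w, hw⟩, fun h => hws (congrArg Subtype.val h)⟩) (p s₁)
    ((Set.finite_range fun v => p v - p s₁).insert d) (lt_min hr hr')
  classical
  let P : V → ℝ × ℝ := fun v => if h : v ∈ X₁ then p ⟨v, h⟩ else
    E (q ⟨v, (sp.cover v).resolve_left h⟩)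
  have hP₁ : (fun v : X₁ => P v) = p := funext fun v => dif_pos v.2
  have hP₂ : (fun v : X₂ => P v) = E ∘ q := funext fun v => by grind [sp.eq]
  have hPT : pic (G.induce X₂) (E ∘ q) ⊆ T := by
    rintro y (⟨v, rfl⟩ | ⟨u, v, -, hy⟩)
    exacts [hET v, hT.segment_subset (hET u) (hET v) hy]
  have hAT : ∀ z ∈ A, z ∈ T → z = p s₁ := by
    intro z hz hzT
    by_contra hne
    have hb : z ∈ Metric.ball (p s₁) r := Metric.ball_subset_ball (min_le_left _ _) (hTb hzT)
    have key : ∀ v, z ∉ segment ℝ (p s₁) (p v) := fun v hv => by grind [mem_seg_smul]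
    rcases hz with ⟨v, rfl⟩ | ⟨u, v, huv, hy⟩
    · grind
    · by_cases hu : u = s₁
      · exact key v (hu ▸ hy)
      grind [segment_symm]
  have hPs : P s = p s₁ := dif_pos sp.left
  have hd : ∀ z ∈ pic (G.induce X₁) (fun v => P v), z ∈ pic (G.induce X₂) (fun v => P v) →
      z = P s := by
    rw [hP₁, hP₂, hPs]
    exact fun z h1 h2 => hAT z h1 (hPT h2)
  obtain ⟨hEq, hEc⟩ := hq.affine hE
  have hgood := sp.good_glue (hP₁ ▸ hp) (hP₂ ▸ hEq) hd
  refine oGeoSRestricted_iff.2 ⟨P, hgood, fun a b c d h => ?_, fun v hv => ?_⟩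
  · rcases sp.cr_glue hd h with ⟨a, b, c, d, rfl, rfl, rfl, rfl, k⟩ |
      ⟨a, b, c, d, rfl, rfl, rfl, rfl, k⟩
    · obtain ⟨t, ht, h⟩ := tp _ _ _ _ (hP₁ ▸ k)
      exact ⟨t, ht, by cases t <;> exact h⟩
    · obtain ⟨t, ht, h⟩ := tp₂ _ _ _ _ (hqc _ _ _ _ (hEc _ _ _ _ (hP₂ ▸ k)))
      exact ⟨t, ht, by cases t <;> exact h⟩
  · rw [show P v = p ⟨v, hO₁ hv⟩ from dif_pos _]
    refine closure_mono (outerRegion_anti ?_) (hout T (Set.disjoint_left.2 fun y hy hyΓ =>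
      hrΓ (Metric.ball_subset_ball (min_le_right _ _) (hTb hy)) hyΓ)
      (fun y hy hne => hTd y hy hne d (Set.mem_insert _ _)) ⟨v, hO₁ hv⟩ hv)
    have e1 : pic (G.induce X₁) (fun v => P v) ⊆ A := by rw [hP₁]
    have e2 : pic (G.induce X₂) (fun v => P v) ⊆ T := by rwa [hP₂]
    rintro y (⟨v, rfl⟩ | ⟨u, v, huv, hy⟩)
    · rcases sp.cover v with h | h
      exacts [.inl (e1 (.inl ⟨⟨v, h⟩, rfl⟩)), .inr (e2 (.inl ⟨⟨v, h⟩, rfl⟩))]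
    · rcases sp.edge u v huv with ⟨hu, hv⟩ | ⟨hu, hv⟩
      exacts [.inl (e1 (.inr ⟨⟨u, hu⟩, ⟨v, hv⟩, huv, hy⟩)),
        .inr (e2 (.inr ⟨⟨u, hu⟩, ⟨v, hv⟩, huv, hy⟩))]

end Glue

/-- **Splitting at a cutvertex (geometric setting).** Assume
`S ⊆ {full, almost-full, bowtie}`.  Let `G` be connected, `O ⊆ V(G)` with `|O| ≤ 1`, `s` a
cutvertex of `G`, `(X₁, X₂)` a separation induced by `s`, and `Gᵢ := G[Xᵢ]`.  Then `G` is
`O`-geometric-`S`-restricted iff (i) `O ⊆ X₁`, `G₁` is `O`-geometric-`S`-restricted and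
`G₂` is `{s}`-geometric-`S`-restricted, or (ii) symmetrically with the roles of `X₁` and
`X₂` exchanged. -/
theorem ogeo_srestricted_iff_cutvertex_parts {V : Type*} [Fintype V] (G : SimpleGraph V)
    (S : Set CrossingType) (hS : S ⊆ goodTypes)
    (hconn : G.Connected) (O : Set V) (hO : O.Subsingleton) (s : V) (X₁ X₂ : Set V)
    (hsep : IsSeparation G {s} X₁ X₂) :
    OGeoSRestricted G S O ↔
      ((O ⊆ X₁ ∧ OGeoSRestricted (G.induce X₁) S {v : X₁ | (v : V) ∈ O} ∧
          OGeoSRestricted (G.induce X₂) S {v : X₂ | (v : V) = s}) ∨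
       (O ⊆ X₂ ∧ OGeoSRestricted (G.induce X₁) S {v : X₁ | (v : V) = s} ∧
          OGeoSRestricted (G.induce X₂) S {v : X₂ | (v : V) ∈ O})) := by
  have sp := hsep.split
  constructor
  · intro h
    obtain ⟨p, hp, ht, ho⟩ := oGeoSRestricted_iff.1 h
    obtain ⟨v, hv, hOv⟩ : ∃ v, p v ∈ closure (outerRegion (pic G p)) ∧ O ⊆ {v} := by
      rcases hO.eq_empty_or_singleton with rfl | ⟨v, rfl⟩
      · have := hconn.nonempty
        obtain ⟨v, hv⟩ := exists_outer (G := G) p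
        exact ⟨v, hv, Set.empty_subset _⟩
      · exact ⟨v, ho v rfl, subset_rfl⟩
    grind [sp.cover, sp.forward, sp.symm.forward]
  · rintro (⟨h, h₁, h₂⟩ | ⟨h, h₁, h₂⟩)
    · exact sp.backward hsep.2.2.2.1 hO h h₁ h₂
    · exact sp.symm.backward hsep.2.2.1 hO h h₂ h₁

end OnePlanarity
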